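/- Let n ≥ 2. There exists a unique continuous, translation invariant, SU(n)-invariant valuation φ₂ on ℂⁿ which is homogeneous of degree n and satisfies: for every real-linear subspace W ⊆ ℂⁿ of real dimension n, every basis w₁,…,wₙ of W orthonormal with respect to Re⟨·,·⟩, and every convex body K ⊆ W, one has φ₂(K) = (det(w₁,…,wₙ))² · Hⁿ(K). Moreover φ₂(gK) = (det g)² φ₂(K) for all g ∈ U(n) and all convex bodies K. -/

import Mathlib

open MeasureTheory
open scoped ENNReal

noncomputable section

/-- `ℂⁿ`, regarded as a real inner product space via `Re⟨z,w⟫`. -/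
abbrev Cn (n : ℕ) := EuclideanSpace ℂ (Fin n)

/-- `μ` is a valuation: it is finitely additive on convex bodies of `ℂⁿ`. -/
def IsValuation {n : ℕ} (μ : ConvexBody (Cn n) → ℂ) : Prop :=
  ∀ K L U I : ConvexBody (Cn n),
    (U : Set (Cn n)) = (K : Set (Cn n)) ∪ (L : Set (Cn n)) →
    (I : Set (Cn n)) = (K : Set (Cn n)) ∩ (L : Set (Cn n)) →
    μ U + μ I = μ K + μ L

/-- `μ` is translation invariant. -/
def TranslationInvariant {n : ℕ} (μ : ConvexBody (Cn n) → ℂ) : Prop :=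
  ∀ (x : Cn n) (K L : ConvexBody (Cn n)),
    (L : Set (Cn n)) = (fun y => x + y) '' (K : Set (Cn n)) → μ L = μ K

/-- `μ` is invariant under the special unitary group `SU(n)` acting on `ℂⁿ`. -/
def SUInvariant {n : ℕ} (μ : ConvexBody (Cn n) → ℂ) : Prop :=
  ∀ g ∈ Matrix.specialUnitaryGroup (Fin n) ℂ, ∀ K L : ConvexBody (Cn n),
    (L : Set (Cn n)) = (Matrix.toEuclideanLin g) '' (K : Set (Cn n)) → μ L = μ K

/-- `μ` has weight `l` : `μ (g K) = (det g)^l • μ K` for all `g ∈ U(n)`. -/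
def HasWeight {n : ℕ} (l : ℤ) (μ : ConvexBody (Cn n) → ℂ) : Prop :=
  ∀ g ∈ Matrix.unitaryGroup (Fin n) ℂ, ∀ K L : ConvexBody (Cn n),
    (L : Set (Cn n)) = (Matrix.toEuclideanLin g) '' (K : Set (Cn n)) →
    μ L = (Matrix.det g) ^ l * μ K

/-- `μ` is homogeneous of degree `k` : `μ (t K) = t ^ k * μ K` for `t > 0`. -/
def Homogeneous {n : ℕ} (k : ℕ) (μ : ConvexBody (Cn n) → ℂ) : Prop :=
  ∀ (t : ℝ), 0 < t → ∀ K L : ConvexBody (Cn n),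
    (L : Set (Cn n)) = (fun y => t • y) '' (K : Set (Cn n)) → μ L = (t : ℂ) ^ k * μ K

instance (n : ℕ) : MeasurableSpace (Cn n) := borel _
instance (n : ℕ) : BorelSpace (Cn n) := ⟨rfl⟩

/-- The determinant of the complex `n × n` matrix whose columns are `w 0, …, w (n-1)`. -/
def detC {n : ℕ} (w : Fin n → Cn n) : ℂ := Matrix.det (Matrix.of fun i j => w j i)

/-- `w` is a basis of the real subspace `W` which is orthonormal for the real inner
product `Re⟨·,·⟩` on `ℂⁿ`. -/
def IsONBasisOf {n : ℕ} (w : Fin n → Cn n) (W : Submodule ℝ (Cn n)) : Prop :=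
  (∀ i, w i ∈ W) ∧ Submodule.span ℝ (Set.range w) = W ∧ Orthonormal ℝ w

/-- The Klain-type property of `φ₂` : on every convex body `K` inside an `n`-dimensional
real subspace `W` with orthonormal basis `w`, `φ₂ K = (det(w₁,…,wₙ))² · Hⁿ(K)`. -/
def KlainTheta2 {n : ℕ} (μ : ConvexBody (Cn n) → ℂ) : Prop :=
  ∀ W : Submodule ℝ (Cn n), Module.finrank ℝ W = n →
    ∀ w : Fin n → Cn n, IsONBasisOf w W →
      ∀ K : ConvexBody (Cn n), (K : Set (Cn n)) ⊆ (W : Set (Cn n)) →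
        μ K = (detC w) ^ 2 * ((μH[(n : ℝ)] (K : Set (Cn n))).toReal : ℂ)

section development
open scoped Pointwise

/-- Compact convex sets, possibly empty. -/
structure CC {E : Type*} [NormedAddCommGroup E] [NormedSpace ℝ E] (A : Set E) : Prop where
  conv : Convex ℝ A
  comp : IsCompact A

/-- `A` and `B` are within Hausdorff distance `δ`. -/
def Near {E : Type*} [NormedAddCommGroup E] (δ : ℝ) (A B : Set E) : Prop :=
  (∀ x ∈ A, ∃ y ∈ B, ‖x - y‖ ≤ δ) ∧ (∀ y ∈ B, ∃ x ∈ A, ‖x - y‖ ≤ δ)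

/-- Continuous translation invariant valuations, as functionals on all sets. -/
structure Val {E : Type*} [NormedAddCommGroup E] [NormedSpace ℝ E] (m : Set E → ℂ) : Prop where
  empty : m ∅ = 0
  union : ∀ A B : Set E, CC A → CC B → Convex ℝ (A ∪ B) → m (A ∪ B) + m (A ∩ B) = m A + m B
  trans : ∀ (x : E) (A : Set E), CC A → m ({x} + A) = m A
  cont : ∀ A : Set E, CC A → A.Nonempty → ∀ ε : ℝ, 0 < ε → ∃ δ : ℝ, 0 < δ ∧
    ∀ B : Set E, CC B → B.Nonempty → Near δ B A → ‖m B - m A‖ ≤ ε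

section basic
variable {E : Type*} [NormedAddCommGroup E] [NormedSpace ℝ E]
variable {F : Type*} [NormedAddCommGroup F] [NormedSpace ℝ F]

namespace CC

theorem singleton (x : E) : CC ({x} : Set E) := ⟨convex_singleton x, isCompact_singleton⟩

theorem add {A B : Set E} (hA : CC A) (hB : CC B) : CC (A + B) :=
  ⟨hA.conv.add hB.conv, hA.comp.add hB.comp⟩

theorem inter {A B : Set E} (hA : CC A) (hB : CC B) : CC (A ∩ B) :=
  ⟨hA.conv.inter hB.conv, hA.comp.inter hB.comp⟩

theorem inter_closed {A B : Set E} (hA : CC A) (hB : Convex ℝ B) (hc : IsClosed B) :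
    CC (A ∩ B) :=
  ⟨hA.conv.inter hB, hA.comp.inter_right hc⟩

theorem smul {A : Set E} (hA : CC A) (t : ℝ) : CC (t • A) :=
  ⟨hA.conv.smul t, hA.comp.smul t⟩

theorem segment (x y : E) : CC (segment ℝ x y) := by
  refine ⟨convex_segment x y, ?_⟩
  rw [segment_eq_image]
  exact isCompact_Icc.image (by fun_prop)

theorem image [FiniteDimensional ℝ E] {A : Set E} (hA : CC A) (φ : E →ₗ[ℝ] F) : CC (φ '' A) :=
  ⟨hA.conv.linear_image φ, hA.comp.image φ.continuous_of_finiteDimensional⟩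

/-- A segment between two closed sets whose union is convex meets their intersection. -/
theorem crossing {A B : Set E} (hA : CC A) (hB : CC B) (hU : Convex ℝ (A ∪ B)) {a b : E}
    (ha : a ∈ A) (hb : b ∈ B) :
    ∃ s t : ℝ, 0 ≤ s ∧ 0 ≤ t ∧ s + t = 1 ∧ s • a + t • b ∈ A ∩ B := by
  have h1 : IsPreconnected (_root_.segment ℝ a b) := (convex_segment a b).isPreconnected
  rw [isPreconnected_closed_iff] at h1
  obtain ⟨x, hx, hx'⟩ := h1 A B hA.comp.isClosed hB.comp.isClosed
    (hU.segment_subset (Or.inl ha) (Or.inr hb))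
    ⟨a, left_mem_segment _ _ _, ha⟩ ⟨b, right_mem_segment _ _ _, hb⟩
  obtain ⟨s, t, hs, ht, hst, rfl⟩ := hx
  exact ⟨s, t, hs, ht, hst, hx'⟩

theorem image_inter [FiniteDimensional ℝ E] {A B : Set E} (hA : CC A) (hB : CC B)
    (hU : Convex ℝ (A ∪ B)) (φ : E →ₗ[ℝ] F) : φ '' (A ∩ B) = φ '' A ∩ φ '' B := by
  refine (Set.image_inter_subset _ _ _).antisymm ?_
  rintro _ ⟨⟨a, ha, rfl⟩, ⟨b, hb, hab⟩⟩
  obtain ⟨s, t, -, -, hst, h⟩ := crossing hA hB hU ha hb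
  refine ⟨_, h, ?_⟩
  rw [map_add, map_smul, map_smul, hab, ← add_smul, hst, one_smul]

theorem inter_add {A B : Set E} (hA : CC A) (hB : CC B)
    (hU : Convex ℝ (A ∪ B)) {M : Set E} (hM : CC M) : (A ∩ B) + M = (A + M) ∩ (B + M) := by
  refine (Set.inter_add_subset).antisymm ?_
  rintro _ ⟨⟨a, ha, x, hx, rfl⟩, ⟨b, hb, y, hy, hab⟩⟩
  obtain ⟨s, t, hs, ht, hst, h⟩ := crossing hA hB hU ha hb
  refine ⟨_, h, s • x + t • y, hM.conv hx hy hs ht hst, ?_⟩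
  simp only at hab ⊢
  have : s • a + t • b + (s • x + t • y) = s • (a + x) + t • (b + y) := by
    simp only [smul_add]; abel
  rw [this, hab, ← add_smul, hst, one_smul]

end CC

namespace Val

theorem zero : Val (fun _ : Set E => (0 : ℂ)) :=
  ⟨rfl, by simp, by simp, fun A _ _ ε hε => ⟨1, one_pos, by simp [hε.le]⟩⟩

theorem smul {m : Set E → ℂ} (hm : Val m) (c : ℂ) : Val (fun A => c * m A) where
  empty := by simp [hm.empty]
  union A B hA hB h := by rw [← mul_add, ← mul_add, hm.union A B hA hB h]
  trans x A hA := by simp only [hm.trans x A hA]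
  cont A hA hne ε hε := by
    obtain ⟨δ, hδ, h⟩ := hm.cont A hA hne (ε / (‖c‖ + 1)) (by positivity)
    refine ⟨δ, hδ, fun B hB hB' hn => ?_⟩
    rw [← mul_sub, norm_mul]
    have := h B hB hB' hn
    calc ‖c‖ * ‖m B - m A‖ ≤ (‖c‖ + 1) * (ε / (‖c‖ + 1)) := by gcongr; linarith
      _ = ε := by field_simp

theorem add {m m' : Set E → ℂ} (hm : Val m) (hm' : Val m') : Val (fun A => m A + m' A) where
  empty := by simp [hm.empty, hm'.empty]
  union A B hA hB h := by linear_combination hm.union A B hA hB h + hm'.union A B hA hB h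
  trans x A hA := by simp only [hm.trans x A hA, hm'.trans x A hA]
  cont A hA hne ε hε := by
    obtain ⟨δ, hδ, h⟩ := hm.cont A hA hne (ε / 2) (by positivity)
    obtain ⟨δ', hδ', h'⟩ := hm'.cont A hA hne (ε / 2) (by positivity)
    refine ⟨min δ δ', lt_min hδ hδ', fun B hB hB' hn => ?_⟩
    have h1 := h B hB hB' ⟨fun x hx => (hn.1 x hx).imp fun y hy => ⟨hy.1, hy.2.trans (min_le_left _ _)⟩,
      fun x hx => (hn.2 x hx).imp fun y hy => ⟨hy.1, hy.2.trans (min_le_left _ _)⟩⟩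
    have h2 := h' B hB hB' ⟨fun x hx => (hn.1 x hx).imp fun y hy => ⟨hy.1, hy.2.trans (min_le_right _ _)⟩,
      fun x hx => (hn.2 x hx).imp fun y hy => ⟨hy.1, hy.2.trans (min_le_right _ _)⟩⟩
    calc ‖m B + m' B - (m A + m' A)‖ = ‖(m B - m A) + (m' B - m' A)‖ := by congr 1; ring
      _ ≤ _ := norm_add_le _ _
      _ ≤ ε := by linarith

theorem sub {m m' : Set E → ℂ} (hm : Val m) (hm' : Val m') : Val (fun A => m A - m' A) := by
  have := hm.add (hm'.smul (-1))
  simpa [sub_eq_add_neg] using this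

theorem comp_add {m : Set E → ℂ} (hm : Val m) {M : Set E} (hM : CC M) :
    Val (fun A => m (A + M)) := by
  rcases M.eq_empty_or_nonempty with rfl | hMne
  · simpa [hm.empty] using zero
  refine ⟨by simp [hm.empty], fun A B hA hB h => ?_, fun x A hA => ?_, fun A hA hne ε hε => ?_⟩
  · rw [Set.union_add, CC.inter_add hA hB h hM]
    refine hm.union _ _ (hA.add hM) (hB.add hM) ?_
    rw [← Set.union_add]; exact h.add hM.conv
  · rw [add_assoc, hm.trans x _ (hA.add hM)]
  · obtain ⟨δ, hδ, h⟩ := hm.cont (A + M) (hA.add hM) (hne.add hMne) ε hε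
    refine ⟨δ, hδ, fun B hB hB' hn => h _ (hB.add hM) (hB'.add hMne) ⟨?_, ?_⟩⟩
    · rintro _ ⟨b, hb, x, hx, rfl⟩
      obtain ⟨a, ha, h⟩ := hn.1 b hb
      exact ⟨_, Set.add_mem_add ha hx, by simpa using h⟩
    · rintro _ ⟨b, hb, x, hx, rfl⟩
      obtain ⟨a, ha, h⟩ := hn.2 b hb
      exact ⟨_, Set.add_mem_add ha hx, by simpa using h⟩

theorem comp_linear [FiniteDimensional ℝ E] {m : Set F → ℂ} (hm : Val m) (φ : E →ₗ[ℝ] F) :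
    Val (fun A => m (φ '' A)) := by
  refine ⟨by simp [hm.empty], fun A B hA hB h => ?_, fun x A hA => ?_, fun A hA hne ε hε => ?_⟩
  · rw [Set.image_union, CC.image_inter hA hB h]
    refine hm.union _ _ (hA.image φ) (hB.image φ) ?_
    rw [← Set.image_union]; exact h.linear_image φ
  · rw [Set.image_add, Set.image_singleton, hm.trans _ _ (hA.image φ)]
  · obtain ⟨δ, hδ, h⟩ := hm.cont (φ '' A) (hA.image φ) (hne.image φ) ε hε
    obtain ⟨C, hC, hφ⟩ := (LinearMap.toContinuousLinearMap φ).bound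
    have key : ∀ x y : E, ‖x - y‖ ≤ δ / C → ‖φ x - φ y‖ ≤ δ := fun x y hxy => by
      have := hφ (x - y)
      simp only [LinearMap.coe_toContinuousLinearMap', map_sub] at this
      calc _ ≤ _ := this
        _ ≤ C * (δ / C) := by gcongr
        _ = δ := by field_simp
    refine ⟨δ / C, by positivity, fun B hB hB' hn => h _ (hB.image φ) (hB'.image φ) ⟨?_, ?_⟩⟩
    · rintro _ ⟨b, hb, rfl⟩
      obtain ⟨a, ha, h⟩ := hn.1 b hb
      exact ⟨_, ⟨a, ha, rfl⟩, key _ _ h⟩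
    · rintro _ ⟨b, hb, rfl⟩
      obtain ⟨a, ha, h⟩ := hn.2 b hb
      exact ⟨_, ⟨a, ha, rfl⟩, key _ _ h⟩

/-- The Euler characteristic, times a constant. -/
theorem euler (c : ℂ) : Val (fun A : Set E => by classical exact if A.Nonempty then c else 0) := by
  classical
  refine ⟨by simp, fun A B hA hB h => ?_, fun x A hA => ?_, fun A hA hne ε hε => ?_⟩
  · by_cases ha : A.Nonempty
    · by_cases hb : B.Nonempty
      · obtain ⟨a, ha'⟩ := ha
        obtain ⟨b, hb'⟩ := hb
        obtain ⟨s, t, -, -, -, h⟩ := CC.crossing hA hB h ha' hb'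
        have h1 : A.Nonempty := ⟨a, ha'⟩
        have h2 : B.Nonempty := ⟨b, hb'⟩
        have h3 : (A ∩ B).Nonempty := ⟨_, h⟩
        simp [h1, h2, h3]
      · rw [Set.not_nonempty_iff_eq_empty] at hb
        subst hb; simp
    · rw [Set.not_nonempty_iff_eq_empty] at ha
      subst ha; simp
  · have : ({x} + A).Nonempty ↔ A.Nonempty := by
      rw [Set.add_nonempty]; simp
    simp only [this]
  · exact ⟨1, one_pos, fun B hB hB' _ => by simp [hne, hB', hε.le]⟩

theorem cut {m : Set E → ℂ} [FiniteDimensional ℝ E] (hm : Val m) {A : Set E} (hA : CC A)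
    (l : E →ₗ[ℝ] ℝ) (c : ℝ) :
    m A + m (A ∩ {x | l x = c}) = m (A ∩ {x | l x ≤ c}) + m (A ∩ {x | c ≤ l x}) := by
  have hl : Continuous l := l.continuous_of_finiteDimensional
  have h := hm.union (A ∩ {x | l x ≤ c}) (A ∩ {x | c ≤ l x})
    (hA.inter_closed (convex_halfSpace_le l.isLinear c) (isClosed_le hl continuous_const))
    (hA.inter_closed (convex_halfSpace_ge l.isLinear c) (isClosed_le continuous_const hl))
  have e1 : A ∩ {x | l x ≤ c} ∪ A ∩ {x | c ≤ l x} = A := by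
    ext x; simp only [Set.mem_union, Set.mem_inter_iff, Set.mem_ofPred_eq]
    have := le_total (l x) c
    tauto
  have e2 : A ∩ {x | l x ≤ c} ∩ (A ∩ {x | c ≤ l x}) = A ∩ {x | l x = c} := by
    ext x; simp only [Set.mem_inter_iff, Set.mem_ofPred_eq, le_antisymm_iff]
    tauto
  rw [e1, e2] at h
  exact h hA.conv

end Val

/-- The difference of a functional along a segment. -/
def Nv (v : E) (m : Set E → ℂ) : Set E → ℂ := fun A => m (A + segment ℝ 0 v) - m A

theorem Val.nv {m : Set E → ℂ} (hm : Val m) (v : E) : Val (Nv v m) :=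
  (hm.comp_add (CC.segment 0 v)).sub hm

theorem nv_comm (v w : E) (m : Set E → ℂ) : Nv v (Nv w m) = Nv w (Nv v m) := by
  funext A
  simp only [Nv]
  rw [add_right_comm]
  ring

theorem segment_zero_smul (v : E) {t : ℝ} (ht : 0 ≤ t) :
    segment ℝ 0 (t • v) = {x | ∃ s, 0 ≤ s ∧ s ≤ t ∧ x = s • v} := by
  ext x
  rw [segment_eq_image]
  simp only [smul_zero, zero_add, Set.mem_image, Set.mem_Icc, Set.mem_ofPred_eq]
  constructor
  · rintro ⟨s, hs, rfl⟩
    exact ⟨s * t, mul_nonneg hs.1 ht, by nlinarith, by rw [smul_smul]⟩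
  · rintro ⟨s, h0, h1, rfl⟩
    rcases ht.eq_or_lt with rfl | ht
    · exact ⟨0, by simp, by simp [le_antisymm h1 h0]⟩
    · exact ⟨s / t, ⟨by positivity, by rw [div_le_one ht]; exact h1⟩, by
        rw [smul_smul]; congr 1; field_simp⟩

/-- Additivity of differences along a fixed direction. -/
theorem Val.nv_add_smul {m : Set E → ℂ} (hm : Val m) (v : E) {s t : ℝ} (hs : 0 ≤ s) (ht : 0 ≤ t)
    {A : Set E} (hA : CC A) :
    Nv ((s + t) • v) m A = Nv (s • v) m A + Nv (t • v) m A := by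
  have h := (hm.comp_add hA).union (segment ℝ 0 (s • v)) ({s • v} + segment ℝ 0 (t • v))
    (CC.segment _ _) ((CC.singleton _).add (CC.segment _ _))
  have e1 : segment ℝ 0 (s • v) ∪ ({s • v} + segment ℝ 0 (t • v)) = segment ℝ 0 ((s + t) • v) := by
    rw [segment_zero_smul v hs, segment_zero_smul v ht, segment_zero_smul v (add_nonneg hs ht)]
    ext x
    simp only [Set.singleton_add, Set.image_add_left, Set.mem_union, Set.mem_ofPred_eq,
      Set.mem_preimage]
    constructor
    · rintro (⟨r, h0, h1, rfl⟩ | ⟨r, h0, h1, h2⟩)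
      · exact ⟨r, h0, by linarith, rfl⟩
      · refine ⟨s + r, by linarith, by linarith, ?_⟩
        rw [add_smul, ← h2]; abel
    · rintro ⟨r, h0, h1, rfl⟩
      rcases le_total r s with h | h
      · exact Or.inl ⟨r, h0, h, rfl⟩
      · exact Or.inr ⟨r - s, by linarith, by linarith, by rw [sub_smul]; abel⟩
  have hv : v = 0 ∨ v ≠ 0 := em _
  have e2 : segment ℝ 0 (s • v) ∩ ({s • v} + segment ℝ 0 (t • v)) = {s • v} := by
    rw [segment_zero_smul v hs, segment_zero_smul v ht]
    ext x
    simp only [Set.singleton_add, Set.image_add_left, Set.mem_inter_iff, Set.mem_ofPred_eq,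
      Set.mem_preimage, Set.mem_singleton_iff]
    constructor
    · rintro ⟨⟨r, h0, h1, rfl⟩, ⟨r', h0', h1', h2⟩⟩
      rcases hv with rfl | hv
      · simp
      have h3 : (r - s - r') • v = 0 := by
        rw [sub_smul, sub_smul, ← h2]; abel
      rcases smul_eq_zero.mp h3 with h | h
      · have : r = s := by linarith
        rw [this]
      · exact absurd h hv
    · rintro rfl
      exact ⟨⟨s, hs, le_rfl, rfl⟩, ⟨0, le_rfl, ht, by simp⟩⟩
  rw [e1, e2] at h
  have h := h (convex_segment _ _)
  simp only [Nv]
  rw [hm.trans _ _ hA, add_assoc, hm.trans _ _ ((CC.segment _ _).add hA)] at h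
  rw [add_comm A, add_comm A, add_comm A]
  linear_combination h

theorem nv_zero (m : Set E → ℂ) (A : Set E) : Nv 0 m A = 0 := by simp [Nv]

theorem Val.nv_neg {m : Set E → ℂ} (hm : Val m) (v : E) {A : Set E} (hA : CC A) :
    Nv (-v) m A = Nv v m A := by
  have h : segment ℝ 0 (-v) = {-v} + segment ℝ 0 v := by
    rw [Set.singleton_add, segment_symm]
    have := (segment_translate_image ℝ (-v) 0 v)
    simpa using this.symm
  simp only [Nv]
  rw [h, add_left_comm, hm.trans _ _ (hA.add (CC.segment _ _))]

theorem Val.tendsto {m : Set E → ℂ} (hm : Val m) {A : Set E} (hA : CC A) (hne : A.Nonempty)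
    {ι : Type*} {l : Filter ι} {B : ι → Set E} (hB : ∀ i, CC (B i)) {δ : ι → ℝ}
    (hδ : Filter.Tendsto δ l (nhds 0)) (hn : ∀ i, Near (δ i) (B i) A) :
    Filter.Tendsto (fun i => m (B i)) l (nhds (m A)) := by
  rw [Metric.tendsto_nhds]
  intro ε hε
  obtain ⟨d, hd, h⟩ := hm.cont A hA hne (ε / 2) (by positivity)
  filter_upwards [hδ.eventually (gt_mem_nhds hd)] with i hi
  obtain ⟨x, hx⟩ := hne
  obtain ⟨y, hy, -⟩ := (hn i).2 x hx
  have := h (B i) (hB i) ⟨y, hy⟩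
    ⟨fun x hx => ((hn i).1 x hx).imp fun y hy => ⟨hy.1, hy.2.trans hi.le⟩,
     fun x hx => ((hn i).2 x hx).imp fun y hy => ⟨hy.1, hy.2.trans hi.le⟩⟩
  rw [dist_eq_norm]
  linarith

theorem near_segment {A : Set E} (v w : E) :
    Near (‖v - w‖) (A + segment ℝ 0 v) (A + segment ℝ 0 w) := by
  constructor
  · rintro _ ⟨a, ha, _, ⟨s, t, hs, ht, hst, rfl⟩, rfl⟩
    refine ⟨_, Set.add_mem_add ha ⟨s, t, hs, ht, hst, rfl⟩, ?_⟩
    simp only [smul_zero, zero_add, add_sub_add_left_eq_sub, ← smul_sub, norm_smul,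
      Real.norm_of_nonneg ht]
    nlinarith [norm_nonneg (v - w)]
  · rintro _ ⟨a, ha, _, ⟨s, t, hs, ht, hst, rfl⟩, rfl⟩
    refine ⟨_, Set.add_mem_add ha ⟨s, t, hs, ht, hst, rfl⟩, ?_⟩
    simp only [smul_zero, zero_add, add_sub_add_left_eq_sub, ← smul_sub, norm_smul,
      Real.norm_of_nonneg ht]
    nlinarith [norm_nonneg (v - w)]

theorem Val.nv_nat_mul_smul {m : Set E → ℂ} (hm : Val m) (v : E) {s : ℝ} (hs : 0 ≤ s) (k : ℕ)
    {A : Set E} (hA : CC A) : Nv ((k * s) • v) m A = k * Nv (s • v) m A := by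
  induction k with
  | zero => simp [nv_zero]
  | succ k ih =>
    have : ((k + 1 : ℕ) : ℝ) * s = k * s + s := by push_cast; ring
    rw [this, hm.nv_add_smul v (by positivity) hs hA, ih]
    push_cast; ring

theorem Val.nv_smul_of_nonneg {m : Set E → ℂ} (hm : Val m) (v : E) {t : ℝ} (ht : 0 ≤ t)
    {A : Set E} (hA : CC A) : Nv (t • v) m A = t * Nv v m A := by
  rcases A.eq_empty_or_nonempty with rfl | hne
  · simp [Nv, hm.empty]
  have h1 : Filter.Tendsto (fun k : ℕ => (⌊t * k⌋₊ / k : ℝ)) Filter.atTop (nhds t) :=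
    (tendsto_nat_floor_mul_div_atTop ht).comp tendsto_natCast_atTop_atTop
  have h2 : Filter.Tendsto (fun k : ℕ => Nv ((⌊t * k⌋₊ / k : ℝ) • v) m A) Filter.atTop
      (nhds (Nv (t • v) m A)) := by
    refine Filter.Tendsto.sub_const ?_ _
    refine hm.tendsto (hA.add (CC.segment _ _)) (hne.add ⟨0, left_mem_segment _ _ _⟩)
      (fun i => hA.add (CC.segment _ _)) (δ := fun k : ℕ => ‖(⌊t * k⌋₊ / k : ℝ) • v - t • v‖) ?_
      (fun i => near_segment _ _)
    have := ((h1.smul_const v).sub_const (t • v)).norm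
    simpa using this
  have h3 : Filter.Tendsto (fun k : ℕ => ((⌊t * k⌋₊ / k : ℝ) : ℂ) * Nv v m A) Filter.atTop
      (nhds (t * Nv v m A)) :=
    ((Complex.continuous_ofReal.tendsto t).comp h1).mul_const _
  refine tendsto_nhds_unique_of_eventuallyEq h2 h3 ?_
  filter_upwards [Filter.eventually_gt_atTop 0] with k hk
  have hk' : (k : ℝ) ≠ 0 := by positivity
  have e1 := hm.nv_nat_mul_smul v (s := (1 : ℝ) / k) (by positivity) k hA
  have e2 := hm.nv_nat_mul_smul v (s := (1 : ℝ) / k) (by positivity) ⌊t * k⌋₊ hA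
  rw [mul_one_div_cancel hk', one_smul] at e1
  rw [mul_one_div] at e2
  have hk'' : (k : ℂ) ≠ 0 := by exact_mod_cast hk'
  rw [e2, e1]
  push_cast
  field_simp

theorem Val.nv_smul {m : Set E → ℂ} (hm : Val m) (v : E) (t : ℝ)
    {A : Set E} (hA : CC A) : Nv (t • v) m A = |t| * Nv v m A := by
  rcases le_total 0 t with ht | ht
  · rw [hm.nv_smul_of_nonneg v ht hA, abs_of_nonneg ht]
  · rw [← hm.nv_neg _ hA, ← neg_smul, hm.nv_smul_of_nonneg v (by linarith) hA, abs_of_nonpos ht]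

end basic

section modv
variable {E : Type*} [NormedAddCommGroup E] [NormedSpace ℝ E]

/-- Projection along `v` onto the kernel of `l`, when `l v = 1`. -/
def projAlong (l : E →ₗ[ℝ] ℝ) (v : E) : E →ₗ[ℝ] E := LinearMap.id - l.smulRight v

theorem projAlong_apply (l : E →ₗ[ℝ] ℝ) (v x : E) : projAlong l v x = x - l x • v := rfl

theorem mem_add_segment_iff {l : E →ₗ[ℝ] ℝ} {v : E} (hl : l v = 1) {A : Set E} {t : ℝ}
    (ht : 0 ≤ t) {x : E} : x ∈ A + segment ℝ 0 (t • v) ↔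
      ∃ a ∈ A, projAlong l v a = projAlong l v x ∧ l a ≤ l x ∧ l x ≤ l a + t := by
  rw [segment_zero_smul v ht]
  constructor
  · rintro ⟨a, ha, _, ⟨s, h0, h1, rfl⟩, rfl⟩
    refine ⟨a, ha, ?_, ?_, ?_⟩
    · simp only [projAlong_apply, map_add, map_smul, hl]
      simp
    · simp [hl, h0]
    · simp [hl, h1]
  · rintro ⟨a, ha, h, h1, h2⟩
    refine ⟨a, ha, (l x - l a) • v, ⟨_, by linarith, by linarith, rfl⟩, ?_⟩
    simp only [projAlong_apply] at h
    have : x = (a - l a • v) + l x • v := by rw [h]; abel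
    conv_rhs => rw [this]
    simp only [sub_smul]; abel

theorem mem_singleton_add_iff {E : Type*} [AddCommGroup E] {x y : E} {A : Set E} : x ∈ {y} + A ↔ x - y ∈ A := by
  simp [Set.singleton_add, neg_add_eq_sub]

theorem Val.nv_proj [FiniteDimensional ℝ E] {m : Set E → ℂ} (hm : Val m) {v : E} {l : E →ₗ[ℝ] ℝ} (hl : l v = 1)
    {A : Set E} (hA : CC A) : Nv v m A = Nv v m (projAlong l v '' A) := by
  have hlc : Continuous l := l.continuous_of_finiteDimensional
  obtain ⟨R, hR⟩ := (hA.comp.image hlc).isBounded.subset_closedBall (0 : ℝ)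
  have hR' : ∀ a ∈ A, -R ≤ l a ∧ l a ≤ R := fun a ha => by
    have := hR ⟨a, ha, rfl⟩
    rw [mem_closedBall_zero_iff, Real.norm_eq_abs] at this
    exact abs_le.mp this
  obtain ⟨j, hj⟩ := exists_nat_ge (2 * R)
  set P := projAlong l v with hP
  have hPv : ∀ t : ℝ, P (t • v) = 0 := fun t => by simp [hP, projAlong_apply, hl]
  set D := P '' A with hD
  have hDcc : CC D := hA.image P
  have hPP : ∀ x, P (P x) = P x := fun x => by
    simp [hP, projAlong_apply, hl]
  have hlP : ∀ x, l (P x) = 0 := fun x => by simp [hP, projAlong_apply, hl]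
  have hsplit : ∀ x, P x + l x • v = x := fun x => by simp [hP, projAlong_apply]
  have memD : ∀ (c : ℝ) (x : E), x ∈ {c • v} + D ↔ l x = c ∧ ∃ a ∈ A, P a = P x := by
    intro c x
    rw [mem_singleton_add_iff]
    constructor
    · rintro ⟨a, ha, h⟩
      have hx : x = P a + c • v := by rw [h]; abel
      refine ⟨by rw [hx]; simp [hlP, hl], a, ha, by rw [hx, map_add, hPv, hPP, add_zero]⟩
    · rintro ⟨rfl, a, ha, h⟩
      exact ⟨a, ha, by rw [h]; rfl⟩
  set c := R with hc
  have hm1 : ∀ k : ℕ, CC (A + segment ℝ 0 ((k : ℝ) • v)) := fun k => hA.add (CC.segment _ _)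
  set K : ℕ → Set E := fun k => A + segment ℝ 0 ((k : ℝ) • v) with hK
  have memK : ∀ (k : ℕ) (x : E), x ∈ K k ↔ ∃ a ∈ A, P a = P x ∧ l a ≤ l x ∧ l x ≤ l a + k :=
    fun k x => mem_add_segment_iff hl (Nat.cast_nonneg k)
  have up1 : ∀ k : ℕ, j ≤ k → K k ∩ {x | l x = c} = {c • v} + D := by
    intro k hk
    have hk' : (j : ℝ) ≤ k := by exact_mod_cast hk
    ext x
    rw [memD, Set.mem_inter_iff, memK]
    constructor
    · rintro ⟨⟨a, ha, h, -, -⟩, hx⟩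
      exact ⟨hx, a, ha, h⟩
    · rintro ⟨hx, a, ha, h⟩
      have := hR' a ha
      exact ⟨⟨a, ha, h, by linarith, by linarith⟩, hx⟩
  have low : K (j + 1) ∩ {x | l x ≤ c} = K j ∩ {x | l x ≤ c} := by
    ext x
    simp only [Set.mem_inter_iff, memK, Set.mem_ofPred_eq]
    refine and_congr_left fun hx => ?_
    refine exists_congr fun a => and_congr_right fun ha => ?_
    have := hR' a ha
    push_cast
    constructor
    · rintro ⟨h1, h2, h3⟩; exact ⟨h1, h2, by linarith⟩
    · rintro ⟨h1, h2, h3⟩; exact ⟨h1, h2, by linarith⟩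
  have q1 := hm.cut (hm1 j) l c
  have q2 := hm.cut (hm1 (j + 1)) l c
  change m (K j) + m (K j ∩ _) = m (K j ∩ _) + m (K j ∩ _) at q1
  change m (K (j + 1)) + m (K (j + 1) ∩ _) = m (K (j + 1) ∩ _) + m (K (j + 1) ∩ _) at q2
  rw [up1 _ le_rfl] at q1
  rw [up1 _ (Nat.le_succ j), low] at q2
  have hU : CC (K (j + 1) ∩ {x | c ≤ l x}) := (hm1 (j + 1)).inter_closed
    (convex_halfSpace_ge l.isLinear c) (isClosed_le continuous_const hlc)
  have hU' : CC (K j ∩ {x | c ≤ l x}) := (hm1 j).inter_closed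
    (convex_halfSpace_ge l.isLinear c) (isClosed_le continuous_const hlc)
  have q3 := hm.cut hU l (c + 1)
  have e1 : K (j + 1) ∩ {x | c ≤ l x} ∩ {x | l x = c + 1} = {(c + 1) • v} + D := by
    ext x
    simp only [Set.mem_inter_iff, memK, Set.mem_ofPred_eq, memD]
    constructor
    · rintro ⟨⟨⟨a, ha, h, -, -⟩, -⟩, hx⟩; exact ⟨hx, a, ha, h⟩
    · rintro ⟨hx, a, ha, h⟩
      have := hR' a ha
      push_cast
      exact ⟨⟨⟨a, ha, h, by linarith, by linarith⟩, by linarith⟩, hx⟩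
  have e2 : K (j + 1) ∩ {x | c ≤ l x} ∩ {x | l x ≤ c + 1}
      = ({c • v} + D) + segment ℝ 0 ((1 : ℝ) • v) := by
    ext x
    rw [mem_add_segment_iff hl zero_le_one]
    simp only [Set.mem_inter_iff, memK, Set.mem_ofPred_eq, memD]
    constructor
    · rintro ⟨⟨⟨a, ha, h, -, -⟩, h1⟩, h2⟩
      refine ⟨P x + c • v, ⟨by simp [hlP, hl], a, ha, by rw [map_add, hPP, hPv, add_zero, h]⟩,
        ?_, ?_, ?_⟩
      · change P _ = P _
        rw [map_add, hPP, hPv, add_zero]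
      · simpa [hlP, hl] using h1
      · simpa [hlP, hl] using h2
    · rintro ⟨y, ⟨hy, a, ha, h⟩, h1, h2, h3⟩
      have := hR' a ha
      push_cast
      exact ⟨⟨⟨a, ha, h.trans h1, by linarith, by linarith⟩, by linarith⟩, by linarith⟩
  have e3 : K (j + 1) ∩ {x | c ≤ l x} ∩ {x | c + 1 ≤ l x}
      = {v} + K j ∩ {x | c ≤ l x} := by
    ext x
    rw [mem_singleton_add_iff]
    have hPx : P (x - v) = P x := by
      have := hPv 1
      rw [one_smul] at this
      rw [map_sub, this, sub_zero]
    simp only [Set.mem_inter_iff, memK, Set.mem_ofPred_eq, hPx, map_sub, hl]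
    constructor
    · rintro ⟨⟨⟨a, ha, h, h1, h2⟩, -⟩, h3⟩
      have := hR' a ha
      push_cast at h2
      exact ⟨⟨a, ha, h, by linarith, by linarith⟩, by linarith⟩
    · rintro ⟨⟨a, ha, h, h1, h2⟩, h3⟩
      push_cast
      exact ⟨⟨⟨a, ha, h, by linarith, by linarith⟩, by linarith⟩, by linarith⟩
  rw [e1, e2, e3, hm.trans _ _ hU', hm.trans _ _ hDcc, add_assoc,
    hm.trans _ _ (hDcc.add (CC.segment _ _)), one_smul] at q3
  have r1 := hm.nv_nat_mul_smul v zero_le_one j hA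
  have r2 := hm.nv_nat_mul_smul v zero_le_one (j + 1) hA
  rw [mul_one, one_smul] at r1 r2
  have r1' : m (K j) - m A = j * Nv v m A := r1
  have r2' : m (K (j + 1)) - m A = (j + 1 : ℕ) * Nv v m A := r2
  push_cast at r2'
  have : Nv v m D = m (D + segment ℝ 0 v) - m D := rfl
  rw [this]
  linear_combination -r2' + r1' + q2 - q1 + q3

theorem Val.nv_congr [FiniteDimensional ℝ E] {m : Set E → ℂ} (hm : Val m) {v : E}
    {l : E →ₗ[ℝ] ℝ} (hl : l v = 1) {A B : Set E} (hA : CC A) (hB : CC B)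
    (h : projAlong l v '' A = projAlong l v '' B) : Nv v m A = Nv v m B := by
  rw [hm.nv_proj hl hA, hm.nv_proj hl hB, h]

end modv

section tet
variable {E : Type*} [NormedAddCommGroup E] [NormedSpace ℝ E]

/-- Functionals vanishing on sets contained in a hyperplane. -/
def Simple (m : Set E → ℂ) : Prop :=
  ∀ S : Set E, CC S → ∀ l : E →ₗ[ℝ] ℝ, l ≠ 0 → ∀ c : ℝ, (∀ x ∈ S, l x = c) → m S = 0

/-- Coordinates of the orthoscheme. -/
def orth (d : ℕ) (r : ℝ) : Set (Fin d → ℝ) := {x | Antitone x ∧ ∀ i, 0 ≤ x i ∧ x i ≤ r}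

theorem orth_cc (d : ℕ) (r : ℝ) : CC (orth d r) := by
  constructor
  · intro x hx y hy s t hs ht hst
    refine ⟨fun i j hij => ?_, fun i => ⟨?_, ?_⟩⟩
    · have h1 := hx.1 hij
      have h2 := hy.1 hij
      simp only [Pi.add_apply, Pi.smul_apply, smul_eq_mul]
      gcongr
    · have h1 := (hx.2 i).1
      have h2 := (hy.2 i).1
      simp only [Pi.add_apply, Pi.smul_apply, smul_eq_mul]
      positivity
    · have h1 := (hx.2 i).2
      have h2 := (hy.2 i).2
      simp only [Pi.add_apply, Pi.smul_apply, smul_eq_mul]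
      calc s * x i + t * y i ≤ s * r + t * r := by gcongr
        _ = r := by rw [← add_mul, hst, one_mul]
  · have h : IsCompact (Set.Icc (0 : Fin d → ℝ) (fun _ => r)) := isCompact_Icc
    refine h.of_isClosed_subset ?_ (fun x hx => ⟨fun i => (hx.2 i).1, fun i => (hx.2 i).2⟩)
    have : orth d r = (⋂ i, ⋂ j, {x : Fin d → ℝ | i ≤ j → x j ≤ x i}) ∩
        ⋂ i, {x | 0 ≤ x i ∧ x i ≤ r} := by
      ext x
      simp only [orth, Set.mem_ofPred_eq, Set.mem_inter_iff, Set.mem_iInter, Antitone]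
    rw [this]
    refine (isClosed_iInter fun i => isClosed_iInter fun j => ?_).inter
      (isClosed_iInter fun i => ?_)
    · by_cases hij : i ≤ j
      · simp only [hij, true_imp_iff]
        exact isClosed_le (continuous_apply j) (continuous_apply i)
      · simp [hij]
    · exact (isClosed_le continuous_const (continuous_apply i)).inter
        (isClosed_le (continuous_apply i) continuous_const)

/-- The path simplex with edge vectors `v`. -/
def tet {d : ℕ} (v : Fin d → E) : Set E := Fintype.linearCombination ℝ v '' orth d 1

theorem tet_cc {d : ℕ} (v : Fin d → E) : CC (tet v) := (orth_cc d 1).image _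

theorem tet_nonempty {d : ℕ} (v : Fin d → E) : (tet v).Nonempty :=
  ⟨_, 0, ⟨fun _ _ _ => le_rfl, fun _ => ⟨le_rfl, zero_le_one⟩⟩, rfl⟩

/-- The initial part of a family, extended by zero. -/
def lowPart {d : ℕ} (v : Fin d → E) (j : ℕ) : Fin d → E := fun i => if (i : ℕ) < j then v i else 0
/-- The final part of a family, extended by zero. -/
def highPart {d : ℕ} (v : Fin d → E) (j : ℕ) : Fin d → E := fun i => if (i : ℕ) < j then 0 else v i

/-- Pieces of the doubled orthoscheme. -/
def orthMid (d : ℕ) (j : ℕ) : Set (Fin d → ℝ) :=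
  {x | x ∈ orth d 2 ∧ (∀ i : Fin d, (i : ℕ) < j → 1 ≤ x i) ∧ ∀ i : Fin d, j ≤ (i : ℕ) → x i ≤ 1}

theorem orthMid_image {d : ℕ} (v : Fin d → E) (j : ℕ) :
    Fintype.linearCombination ℝ v '' orthMid d j =
      {∑ i, lowPart v j i} + (tet (lowPart v j) + tet (highPart v j)) := by
  ext p
  constructor
  · rintro ⟨x, ⟨⟨hx1, hx2⟩, hx3, hx4⟩, rfl⟩
    refine ⟨_, rfl, _, ⟨_, ⟨fun i => if (i : ℕ) < j then x i - 1 else 0, ⟨?_, ?_⟩, rfl⟩,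
      _, ⟨fun i => if (i : ℕ) < j then 1 else x i, ⟨?_, ?_⟩, rfl⟩, rfl⟩, ?_⟩
    · intro a b hab
      have h1 := hx1 hab
      have hab' : (a : ℕ) ≤ b := hab
      dsimp only
      split_ifs with h2 h3 h3
      · linarith
      · omega
      · linarith [hx3 a h3]
      · exact le_rfl
    · intro i
      dsimp only
      split_ifs with h
      · constructor
        · linarith [hx3 i h]
        · linarith [(hx2 i).2]
      · simp
    · intro a b hab
      have h1 := hx1 hab
      have hab' : (a : ℕ) ≤ b := hab
      dsimp only
      split_ifs with h2 h3 h3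
      · exact le_rfl
      · omega
      · exact hx4 b (by omega)
      · exact h1
    · intro i
      dsimp only
      split_ifs with h
      · simp
      · exact ⟨(hx2 i).1, hx4 i (by omega)⟩
    · simp only [Fintype.linearCombination_apply, lowPart, highPart]
      rw [← Finset.sum_add_distrib, ← Finset.sum_add_distrib]
      refine Finset.sum_congr rfl fun i _ => ?_
      split_ifs <;> simp [sub_smul]
  · rintro ⟨_, rfl, _, ⟨_, ⟨y, ⟨hy1, hy2⟩, rfl⟩, _, ⟨z, ⟨hz1, hz2⟩, rfl⟩, rfl⟩, rfl⟩
    refine ⟨fun i => if (i : ℕ) < j then 1 + y i else z i, ⟨⟨?_, ?_⟩, ?_, ?_⟩, ?_⟩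
    · intro a b hab
      have h1 := hy1 hab
      have h2 := hz1 hab
      have hab' : (a : ℕ) ≤ b := hab
      dsimp only
      split_ifs with h2 h3 h3
      · linarith
      · omega
      · linarith [(hy2 a).1, (hz2 b).2]
      · assumption
    · intro i
      have h1 := hy2 i
      have h2 := hz2 i
      dsimp only
      split_ifs with h
      · constructor <;> linarith
      · constructor <;> linarith
    · intro i hi
      simp only [hi, if_true]
      linarith [(hy2 i).1]
    · intro i hi
      have : ¬ ((i : ℕ) < j) := by omega
      simp only [this, if_false]
      exact (hz2 i).2
    · simp only [Fintype.linearCombination_apply, lowPart, highPart]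
      rw [← Finset.sum_add_distrib, ← Finset.sum_add_distrib]
      refine Finset.sum_congr rfl fun i _ => ?_
      split_ifs <;> simp [add_smul]

/-- Subdivision of the doubled orthoscheme. -/
theorem Val.double_orth {d : ℕ} {m : Set (Fin d → ℝ) → ℂ} (hm : Val m) (hs : Simple m) :
    m (orth d 2) = m (orthMid d d) + ∑ j : Fin d, m (orthMid d j) := by
  set B : ℕ → Set (Fin d → ℝ) := fun j => orth d 2 ∩ {x | ∀ i : Fin d, (i : ℕ) < j → 1 ≤ x i}
    with hB
  have hproj : ∀ i : Fin d, Continuous fun x : Fin d → ℝ => x i := fun i => continuous_apply i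
  have hBcc : ∀ j, CC (B j) := fun j => by
    refine (orth_cc d 2).inter_closed ?_ ?_
    · intro x hx y hy s t h1 h2 hst i hi
      have := hx i hi
      have := hy i hi
      simp only [Pi.add_apply, Pi.smul_apply, smul_eq_mul]
      nlinarith
    · simp only [Set.ofPred_forall]
      exact isClosed_iInter fun i => isClosed_iInter fun _ => isClosed_le continuous_const (hproj i)
  have step : ∀ j : Fin d, m (B j) = m (orthMid d j) + m (B (j + 1)) := by
    intro j
    have h := hm.cut (hBcc j) (LinearMap.proj j) 1
    rw [hs (B j ∩ {x | LinearMap.proj (R := ℝ) j x = 1}) ((hBcc j).inter_closed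
      (convex_hyperplane (LinearMap.isLinear _) 1) (isClosed_eq (hproj j) continuous_const))
      (LinearMap.proj (R := ℝ) (φ := fun _ => ℝ) j)
      (fun h => by simpa using LinearMap.congr_fun h (fun _ => 1)) 1 (fun x hx => hx.2),
      add_zero] at h
    rw [h]
    congr 2
    · ext x
      simp only [hB, Set.mem_inter_iff, Set.mem_ofPred_eq, orthMid, LinearMap.proj_apply]
      constructor
      · rintro ⟨⟨h1, h2⟩, h3⟩
        exact ⟨h1, h2, fun i hi => (h1.1 (show j ≤ i from hi)).trans h3⟩
      · rintro ⟨h1, h2, h3⟩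
        exact ⟨⟨h1, h2⟩, h3 j le_rfl⟩
    · ext x
      simp only [hB, Set.mem_inter_iff, Set.mem_ofPred_eq, LinearMap.proj_apply]
      constructor
      · rintro ⟨⟨h1, h2⟩, h3⟩
        refine ⟨h1, fun i hi => ?_⟩
        rcases Nat.lt_succ_iff_lt_or_eq.mp hi with h | h
        · exact h2 i h
        · rw [Fin.ext h]; exact h3
      · rintro ⟨h1, h2⟩
        exact ⟨⟨h1, fun i hi => h2 i (by omega)⟩, h2 j (by omega)⟩
  have tot : ∀ k : ℕ, ∀ hk : k ≤ d, m (B 0) = m (B k) + ∑ j : Fin k, m (orthMid d j) := by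
    intro k
    induction k with
    | zero => simp
    | succ k ih =>
      intro hk
      rw [ih (by omega), Fin.sum_univ_castSucc, step ⟨k, hk⟩]
      simp only [Fin.val_castSucc, Fin.val_last]
      ring
  have h0 : B 0 = orth d 2 := by simp [hB]
  have hd : B d = orthMid d d := by
    ext x
    simp only [hB, Set.mem_inter_iff, Set.mem_ofPred_eq, orthMid]
    refine and_congr_right fun _ => ⟨fun h => ⟨h, fun i hi => absurd i.2 (by omega)⟩, fun h => h.1⟩
  rw [← h0, tot d le_rfl, hd]

theorem smul_tet {d : ℕ} (v : Fin d → E) :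
    (2 : ℝ) • tet v = Fintype.linearCombination ℝ v '' orth d 2 := by
  ext p
  rw [Set.mem_smul_set]
  constructor
  · rintro ⟨_, ⟨x, hx, rfl⟩, rfl⟩
    refine ⟨(2 : ℝ) • x, ⟨fun a b hab => ?_, fun i => ?_⟩, by rw [map_smul]⟩
    · have := hx.1 hab
      simp only [Pi.smul_apply, smul_eq_mul]; linarith
    · have := hx.2 i
      simp only [Pi.smul_apply, smul_eq_mul]
      constructor <;> linarith
  · rintro ⟨x, hx, rfl⟩
    refine ⟨_, ⟨(1 / 2 : ℝ) • x, ⟨fun a b hab => ?_, fun i => ?_⟩, rfl⟩, ?_⟩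
    · have := hx.1 hab
      simp only [Pi.smul_apply, smul_eq_mul]; linarith
    · have := hx.2 i
      simp only [Pi.smul_apply, smul_eq_mul]
      constructor <;> linarith
    · rw [map_smul, smul_smul]; norm_num

theorem Val.double_tet {d : ℕ} {m : Set E → ℂ} (hm : Val m) (v : Fin d → E)
    (hs : Simple fun A : Set (Fin d → ℝ) => m (Fintype.linearCombination ℝ v '' A)) :
    m ((2 : ℝ) • tet v) = m (tet v) +
      ∑ j : Fin d, m (tet (lowPart v j) + tet (highPart v j)) := by
  have h := (hm.comp_linear (Fintype.linearCombination ℝ v)).double_orth hs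
  simp only [orthMid_image] at h
  rw [smul_tet, h, hm.trans _ _ ((tet_cc _).add (tet_cc _))]
  congr 1
  · have h1 : lowPart v d = v := by funext i; simp [lowPart]
    have h2 : tet (highPart v d) = {0} := by
      have : highPart v d = 0 := by funext i; simp [highPart]
      rw [this]
      refine Set.eq_singleton_iff_nonempty_unique_mem.mpr ⟨tet_nonempty _, ?_⟩
      rintro _ ⟨x, -, rfl⟩
      simp [Fintype.linearCombination_apply]
    rw [h1, h2, Set.add_singleton]
    simp
  · refine Finset.sum_congr rfl fun j _ => ?_
    rw [hm.trans _ _ ((tet_cc _).add (tet_cc _))]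

end tet

section simplex
variable {E : Type*} [NormedAddCommGroup E] [NormedSpace ℝ E]

theorem convexHull_range_eq_tet {d : ℕ} (p : Fin (d + 1) → E) :
    convexHull ℝ (Set.range p) = {p 0} + tet fun i : Fin d => p i.succ - p i.castSucc := by
  apply Set.Subset.antisymm
  · refine convexHull_min ?_ ((convex_singleton _).add (tet_cc _).conv)
    rintro _ ⟨k, rfl⟩
    refine ⟨_, rfl, _, ⟨fun i => if (i : ℕ) < k then 1 else 0, ⟨fun a b hab => ?_, fun i => ?_⟩,
      rfl⟩, ?_⟩
    · have : (a : ℕ) ≤ b := hab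
      dsimp only
      split_ifs <;> first | omega | simp
    · dsimp only
      split_ifs <;> simp
    · simp only [Fintype.linearCombination_apply]
      induction k using Fin.induction with
      | zero => simp
      | succ k ih =>
        have : ∑ i : Fin d, (if (i : ℕ) < (k.succ : Fin (d + 1)) then (1 : ℝ) else 0) •
            (p i.succ - p i.castSucc) = ∑ i : Fin d, ((if (i : ℕ) < (k.castSucc : Fin (d + 1))
            then (1 : ℝ) else 0) • (p i.succ - p i.castSucc)
            + if i = k then p i.succ - p i.castSucc else 0) := by
          refine Finset.sum_congr rfl fun i _ => ?_
          simp only [Fin.val_succ, Fin.val_castSucc, Fin.ext_iff]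
          split_ifs <;> first | omega | simp
        rw [this, Finset.sum_add_distrib, ← add_assoc, ih]
        simp
  · rintro _ ⟨_, rfl, _, ⟨x, ⟨hx1, hx2⟩, rfl⟩, rfl⟩
    set w : Fin (d + 1) → ℝ := fun k => Fin.cons (α := fun _ => ℝ) 1 x k -
      Fin.snoc (α := fun _ => ℝ) x 0 k with hw
    have hsnoc : ∀ k, Fin.snoc (α := fun _ => ℝ) x 0 k ≤ 1 := by
      intro k
      refine Fin.lastCases ?_ (fun i => ?_) k
      · simp
      · simpa using (hx2 i).2
    have hw0 : ∀ k, 0 ≤ w k := by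
      intro k
      simp only [hw, sub_nonneg]
      refine Fin.cases ?_ (fun i => ?_) k
      · simpa using hsnoc 0
      · simp only [Fin.cons_succ, Fin.snoc]
        split_ifs with h
        · refine hx1 ?_
          rw [Fin.le_def]; simp
        · exact (hx2 i).1
    have hw1 : ∑ k, w k = 1 := by
      simp only [hw, Finset.sum_sub_distrib]
      rw [Fin.sum_univ_succ, Fin.sum_univ_castSucc (fun k => Fin.snoc (α := fun _ => ℝ) x 0 k)]
      simp
    have hws : p 0 + Fintype.linearCombination ℝ (fun i : Fin d => p i.succ - p i.castSucc) x
        = ∑ k, w k • p k := by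
      simp only [hw, sub_smul, Finset.sum_sub_distrib]
      rw [Fin.sum_univ_succ,
        Fin.sum_univ_castSucc (fun k => Fin.snoc (α := fun _ => ℝ) x 0 k • p k)]
      simp [Fintype.linearCombination_apply, smul_sub, Finset.sum_sub_distrib, add_sub_assoc]
    simp only
    rw [hws]
    exact (convex_convexHull ℝ _).sum_mem (fun k _ => hw0 k) hw1
      (fun k _ => subset_convexHull ℝ _ ⟨k, rfl⟩)

theorem convexHull_range_cc {ι : Type*} [Finite ι] (p : ι → E) : CC (convexHull ℝ (Set.range p)) :=
  ⟨convex_convexHull _ _, (Set.finite_range p).isCompact_convexHull ℝ⟩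

theorem Simple.tet_eq_zero [FiniteDimensional ℝ E] {m : Set E → ℂ} (hs : Simple m) {d : ℕ}
    (hd : Module.finrank ℝ E = d) (v : Fin d → E) (hv : ¬ LinearIndependent ℝ v) :
    m (tet v) = 0 := by
  have hlt : Submodule.span ℝ (Set.range v) < ⊤ := by
    rw [lt_top_iff_ne_top]
    intro h
    exact hv (linearIndependent_of_top_le_span_of_card_eq_finrank h.ge (by simp [hd]))
  obtain ⟨l, hl, hle⟩ := Submodule.exists_le_ker_of_lt_top _ hlt
  refine hs _ (tet_cc v) l hl 0 ?_
  rintro _ ⟨x, -, rfl⟩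
  have : Fintype.linearCombination ℝ v x ∈ Submodule.span ℝ (Set.range v) := by
    rw [Fintype.linearCombination_apply]
    exact Submodule.sum_mem _ fun i _ => Submodule.smul_mem _ _ (Submodule.subset_span ⟨i, rfl⟩)
  exact hle this

theorem Simple.hull_eq_zero [FiniteDimensional ℝ E] {m : Set E → ℂ} (hs : Simple m) {d : ℕ}
    (hd : Module.finrank ℝ E = d) (p : Fin (d + 1) → E) (hp : ¬ AffineIndependent ℝ p)
    {S : Set E} (hS : CC S) (hSp : S ⊆ convexHull ℝ (Set.range p)) : m S = 0 := by
  have hlt : vectorSpan ℝ (Set.range p) < ⊤ := by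
    rw [lt_top_iff_ne_top]
    intro h
    apply hp
    rw [affineIndependent_iff_finrank_vectorSpan_eq ℝ p (n := d) (by simp), h, finrank_top, hd]
  obtain ⟨l, hl, hle⟩ := Submodule.exists_le_ker_of_lt_top _ hlt
  refine hs _ hS l hl (l (p 0)) fun x hx => ?_
  have : convexHull ℝ (Set.range p) ⊆ {x | l x = l (p 0)} := by
    refine convexHull_min ?_ (convex_hyperplane l.isLinear _)
    rintro _ ⟨k, rfl⟩
    have := hle (vsub_mem_vectorSpan ℝ (Set.mem_range_self k) (Set.mem_range_self (f := p) 0))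
    simpa [sub_eq_zero] using this
  exact this (hSp hx)

/-- Cutting a simplex along a hyperplane through a point of an edge. -/
theorem AffineBasis.hull_inter {ι : Type*} [Fintype ι] [DecidableEq ι] (b : AffineBasis ι ℝ E)
    {i j : ι} (hij : i ≠ j) {α β : ℝ} (hα : 0 < α) (hβ : 0 < β) (hab : α + β = 1) :
    convexHull ℝ (Set.range b) ∩ {x | α * b.coord j x ≤ β * b.coord i x} =
      convexHull ℝ (Set.range (Function.update b j (α • b i + β • b j))) := by
  apply Set.Subset.antisymm
  · rintro x ⟨hx, hx'⟩
    rw [b.convexHull_eq_nonneg_coord] at hx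
    simp only [Set.mem_ofPred_eq] at hx hx'
    set w : ι → ℝ := fun k => b.coord k x with hw
    set w' : ι → ℝ := Function.update (Function.update w i (w i - α / β * w j)) j (w j / β) with hw'
    have wi : w' i = w i - α / β * w j := by simp [hw', hij]
    have wj : w' j = w j / β := by simp [hw']
    have wk : ∀ k, k ≠ i ∧ k ≠ j → w' k = w k := fun k hk => by simp [hw', hk.1, hk.2]
    have hsum : ∑ k, (w' k - w k) = 0 := by
      rw [Fintype.sum_eq_add i j hij (fun k hk => by rw [wk k hk, sub_self]), wi, wj]
      field_simp
      linear_combination (w j) * (-hab)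
    have hsum2 : ∑ k, (w' k • Function.update b j (α • b i + β • b j) k - w k • b k) = 0 := by
      rw [Fintype.sum_eq_add i j hij
        (fun k hk => by rw [wk k hk, Function.update_of_ne hk.2, sub_self]), wi, wj,
        Function.update_self, Function.update_of_ne hij]
      have h1 : w j / β * α = α / β * w j := by ring
      have h2 : w j / β * β = w j := by field_simp
      rw [smul_add, smul_smul, smul_smul, h1, h2, sub_smul]
      abel
    have hx2 : x = ∑ k, w' k • Function.update b j (α • b i + β • b j) k := by
      rw [Finset.sum_sub_distrib, sub_eq_zero] at hsum2
      rw [hsum2]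
      exact (b.linear_combination_coord_eq_self x).symm
    rw [hx2]
    refine (convex_convexHull ℝ _).sum_mem (fun k _ => ?_) ?_
      (fun k _ => subset_convexHull ℝ _ ⟨k, rfl⟩)
    · by_cases hki : k = i
      · subst hki
        rw [wi, sub_nonneg, div_mul_eq_mul_div, div_le_iff₀ hβ]
        linarith
      · by_cases hkj : k = j
        · subst hkj
          rw [wj]; exact div_nonneg (hx _) hβ.le
        · rw [wk k ⟨hki, hkj⟩]; exact hx k
    · rw [Finset.sum_sub_distrib, sub_eq_zero] at hsum
      rw [hsum]; exact b.sum_coord_apply_eq_one x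
  · have hconv : Convex ℝ (convexHull ℝ (Set.range b) ∩
        {x | α * b.coord j x ≤ β * b.coord i x}) := by
      refine (convex_convexHull ℝ _).inter ?_
      intro x hx y hy s t hs ht hst
      simp only [Set.mem_ofPred_eq] at hx hy ⊢
      rw [Convex.combo_affine_apply hst, Convex.combo_affine_apply hst]
      simp only [smul_eq_mul]
      nlinarith
    refine convexHull_min ?_ hconv
    have hmem : ∀ k, b k ∈ convexHull ℝ (Set.range b) := fun k => subset_convexHull ℝ _ ⟨k, rfl⟩
    rintro _ ⟨k, rfl⟩
    by_cases hkj : k = j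
    · subst hkj
      rw [Function.update_self]
      refine ⟨convex_convexHull ℝ _ (hmem i) (hmem k) hα.le hβ.le hab, ?_⟩
      simp only [Set.mem_ofPred_eq]
      rw [Convex.combo_affine_apply hab, Convex.combo_affine_apply hab]
      simp [hij, hij.symm, mul_comm]
    · rw [Function.update_of_ne hkj]
      refine ⟨hmem k, ?_⟩
      simp only [Set.mem_ofPred_eq]
      by_cases hki : k = i
      · subst hki
        simp [hij.symm, hβ.le]
      · simp [Ne.symm hkj, Ne.symm hki]

end simplex

section simplex
variable {E : Type*} [NormedAddCommGroup E] [NormedSpace ℝ E]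

/-- The polyhedron given by a list of inequalities. -/
def polyh (L : List ((E →ₗ[ℝ] ℝ) × ℝ)) : Set E := {x | ∀ q ∈ L, q.1 x ≤ q.2}

theorem polyh_convex (L : List ((E →ₗ[ℝ] ℝ) × ℝ)) : Convex ℝ (polyh L) := by
  have : polyh L = ⋂ q ∈ L, {x | q.1 x ≤ q.2} := by ext x; simp [polyh]
  rw [this]
  exact convex_iInter fun q => convex_iInter fun _ => convex_halfSpace_le q.1.isLinear _

theorem polyh_closed [FiniteDimensional ℝ E] (L : List ((E →ₗ[ℝ] ℝ) × ℝ)) :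
    IsClosed (polyh L) := by
  have : polyh L = ⋂ q ∈ L, {x | q.1 x ≤ q.2} := by ext x; simp [polyh]
  rw [this]
  exact isClosed_iInter fun q => isClosed_iInter fun _ =>
    isClosed_le q.1.continuous_of_finiteDimensional continuous_const

theorem polyh_cons (q : (E →ₗ[ℝ] ℝ) × ℝ) (L : List ((E →ₗ[ℝ] ℝ) × ℝ)) :
    polyh (q :: L) = {x | q.1 x ≤ q.2} ∩ polyh L := by
  ext x; simp [polyh]

theorem Val.hull_inter_polyh [FiniteDimensional ℝ E] {m : Set E → ℂ} (hm : Val m) (hs : Simple m)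
    {d : ℕ} (hd : Module.finrank ℝ E = d)
    (h : ∀ v : Fin d → E, LinearIndependent ℝ v → m (tet v) = 0)
    (L : List ((E →ₗ[ℝ] ℝ) × ℝ)) :
    ∀ p : Fin (d + 1) → E, m (convexHull ℝ (Set.range p) ∩ polyh L) = 0 := by
  classical
  have hcc : ∀ (p : Fin (d + 1) → E) (L : List ((E →ₗ[ℝ] ℝ) × ℝ)),
      CC (convexHull ℝ (Set.range p) ∩ polyh L) := fun p L =>
    (convexHull_range_cc p).inter_closed (polyh_convex L) (polyh_closed L)
  induction L with
  | nil =>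
    intro p
    have : polyh ([] : List ((E →ₗ[ℝ] ℝ) × ℝ)) = Set.univ := by ext; simp [polyh]
    rw [this, Set.inter_univ, convexHull_range_eq_tet, hm.trans _ _ (tet_cc _)]
    by_cases hv : LinearIndependent ℝ fun i : Fin d => p i.succ - p i.castSucc
    · exact h _ hv
    · exact hs.tet_eq_zero hd _ hv
  | cons q L ih =>
    obtain ⟨l, c⟩ := q
    suffices H : ∀ N : ℕ, ∀ p : Fin (d + 1) → E, (Finset.univ.filter fun k => l (p k) ≠ c).card = N →
        m (convexHull ℝ (Set.range p) ∩ polyh ((l, c) :: L)) = 0 from fun p => H _ p rfl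
    intro N
    induction N using Nat.strong_induction_on with
    | _ N ihN =>
    intro p hN
    by_cases hp : AffineIndependent ℝ p
    swap
    · exact hs.hull_eq_zero hd p hp (hcc p _) Set.inter_subset_left
    by_cases h1 : ∀ k, l (p k) ≤ c
    · have : convexHull ℝ (Set.range p) ⊆ {x | l x ≤ c} := by
        refine convexHull_min ?_ (convex_halfSpace_le l.isLinear _)
        rintro _ ⟨k, rfl⟩; exact h1 k
      rw [polyh_cons, ← Set.inter_assoc, Set.inter_eq_left.mpr this]
      exact ih p
    by_cases h2 : ∀ k, c ≤ l (p k)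
    · have hsub : convexHull ℝ (Set.range p) ⊆ {x | c ≤ l x} := by
        refine convexHull_min ?_ (convex_halfSpace_ge l.isLinear _)
        rintro _ ⟨k, rfl⟩; exact h2 k
      by_cases hl : l = 0
      · subst hl
        push Not at h1
        obtain ⟨k, hk⟩ := h1
        have : convexHull ℝ (Set.range p) ∩ polyh (((0 : E →ₗ[ℝ] ℝ), c) :: L) = ∅ := by
          rw [Set.eq_empty_iff_forall_notMem]
          rintro x ⟨-, hx⟩
          have := hx _ List.mem_cons_self
          simp only [LinearMap.zero_apply] at this hk
          linarith
        rw [this, hm.empty]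
      · refine hs _ (hcc p _) l hl c fun x hx => ?_
        exact le_antisymm (hx.2 _ List.mem_cons_self) (hsub hx.1)
    push Not at h1 h2
    obtain ⟨i, hi⟩ := h1
    obtain ⟨j, hj⟩ := h2
    have hij : i ≠ j := by rintro rfl; linarith
    let b : AffineBasis (Fin (d + 1)) ℝ E := ⟨p, hp, by
      rw [hp.affineSpan_eq_top_iff_card_eq_finrank_add_one, hd]; simp⟩
    have hb : (b : Fin (d + 1) → E) = p := rfl
    have hD : 0 < l (p i) - l (p j) := by linarith
    set α := (c - l (p j)) / (l (p i) - l (p j)) with hα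
    set β := (l (p i) - c) / (l (p i) - l (p j)) with hβ
    have hα0 : 0 < α := div_pos (by linarith) hD
    have hβ0 : 0 < β := div_pos (by linarith) hD
    have hab : α + β = 1 := by rw [hα, hβ]; field_simp; ring
    have hlq : l (α • p i + β • p j) = c := by
      simp only [map_add, map_smul, smul_eq_mul, hα, hβ]; field_simp; ring
    set f : E →ᵃ[ℝ] ℝ := β • b.coord i - α • b.coord j with hf
    have hfx : ∀ x, f x = f.linear x + f 0 := fun x => by
      have := f.decomp; exact congrFun this x
    have hfv : ∀ x, f x = β * b.coord i x - α * b.coord j x := fun x => by simp [hf]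
    have hfl : f.linear ≠ 0 := by
      intro h0
      have e1 := hfx (b i)
      have e2 := hfx (b j)
      rw [h0, hfv] at e1 e2
      simp [hij, hij.symm] at e1 e2
      linarith
    have hcut := hm.cut (hcc p ((l, c) :: L)) f.linear (-f 0)
    rw [hs (convexHull ℝ (Set.range p) ∩ polyh ((l, c) :: L) ∩ {x | f.linear x = -f 0})
      ((hcc p _).inter_closed (convex_hyperplane f.linear.isLinear _)
        (isClosed_eq f.linear.continuous_of_finiteDimensional continuous_const))
      f.linear hfl (-f 0) (fun x hx => hx.2), add_zero] at hcut
    have s1 : {x | f.linear x ≤ -f 0} = {x | β * b.coord i x ≤ α * b.coord j x} := by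
      ext x
      have h1 := hfx x
      have h2 := hfv x
      simp only [Set.mem_ofPred_eq]
      constructor <;> intro <;> linarith
    have s2 : {x | -f 0 ≤ f.linear x} = {x | α * b.coord j x ≤ β * b.coord i x} := by
      ext x
      have h1 := hfx x
      have h2 := hfv x
      simp only [Set.mem_ofPred_eq]
      constructor <;> intro <;> linarith
    rw [hcut, s1, s2, Set.inter_right_comm _ _ {x | β * b.coord i x ≤ α * b.coord j x},
      Set.inter_right_comm _ _ {x | α * b.coord j x ≤ β * b.coord i x}, ← hb,
      AffineBasis.hull_inter b hij hα0 hβ0 hab,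
      AffineBasis.hull_inter b hij.symm hβ0 hα0 (by linarith), hb]
    have hcard : ∀ k : Fin (d + 1), l (p k) ≠ c → ∀ y, l y = c →
        (Finset.univ.filter fun a => l (Function.update p k y a) ≠ c).card < N := by
      intro k hk y hy
      rw [← hN]
      refine Finset.card_lt_card ?_
      rw [Finset.ssubset_iff_of_subset]
      · exact ⟨k, by simpa using hk, by simpa using hy⟩
      · intro a ha
        simp only [Finset.mem_filter, Finset.mem_univ, true_and] at ha ⊢
        by_cases hak : a = k
        · subst hak; exact hk
        · rwa [Function.update_of_ne hak] at ha
    rw [ihN _ (hcard j hj.ne _ hlq) _ rfl,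
      ihN _ (hcard i hi.ne' _ (by rw [add_comm]; exact hlq)) _ rfl, add_zero]

theorem exists_simplex_supset [FiniteDimensional ℝ E] (R : ℝ) :
    ∃ p : Fin (Module.finrank ℝ E + 1) → E, Metric.closedBall 0 R ⊆ convexHull ℝ (Set.range p) := by
  obtain ⟨⟨b⟩⟩ : Nonempty (AffineBasis (Fin (Module.finrank ℝ E + 1)) ℝ E) ∧ True :=
    ⟨AffineBasis.exists_affineBasis_of_finiteDimensional (by simp), trivial⟩
  have hne : (interior (convexHull ℝ (Set.range b))).Nonempty :=
    interior_convexHull_nonempty_iff_affineSpan_eq_top.mpr b.tot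
  obtain ⟨x, hx⟩ := hne
  obtain ⟨r, hr, hr'⟩ := Metric.isOpen_iff.mp isOpen_interior x hx
  have hball : Metric.ball x r ⊆ convexHull ℝ (Set.range b) := hr'.trans interior_subset
  set t : ℝ := (|R| + 1) / r with ht
  have ht0 : 0 < t := by positivity
  refine ⟨fun k => t • (b k - x), fun y hy => ?_⟩
  rw [mem_closedBall_zero_iff] at hy
  have hy' : x + t⁻¹ • y ∈ convexHull ℝ (Set.range b) := by
    apply hball
    rw [mem_ball_iff_norm, add_sub_cancel_left, norm_smul, norm_inv, Real.norm_of_nonneg ht0.le,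
      inv_mul_lt_iff₀ ht0, ht]
    have : (|R| + 1) / r * r = |R| + 1 := by field_simp
    rw [this]
    linarith [le_abs_self R]
  set φ : E →ᵃ[ℝ] E := t • (AffineMap.id ℝ E - AffineMap.const ℝ E x) with hφ
  have hφx : ∀ z, φ z = t • (z - x) := fun z => by simp [hφ]
  have : Set.range (fun k => t • (b k - x)) = φ '' Set.range b := by
    rw [← Set.range_comp]; simp [hφx, Function.comp_def]
  rw [this, ← AffineMap.image_convexHull]
  refine ⟨_, hy', ?_⟩
  rw [hφx, add_sub_cancel_left, smul_smul, mul_inv_cancel₀ ht0.ne', one_smul]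

/-- A simple continuous valuation vanishing on simplices vanishes. -/
theorem Val.eq_zero_of_tet [FiniteDimensional ℝ E] {m : Set E → ℂ} (hm : Val m) (hs : Simple m)
    {d : ℕ} (hd : Module.finrank ℝ E = d)
    (h : ∀ v : Fin d → E, LinearIndependent ℝ v → m (tet v) = 0) {A : Set E} (hA : CC A) :
    m A = 0 := by
  subst hd
  rcases A.eq_empty_or_nonempty with rfl | hne
  · exact hm.empty
  obtain ⟨R, hR⟩ := hA.comp.isBounded.subset_closedBall (0 : E)
  obtain ⟨p, hp⟩ := exists_simplex_supset (E := E) R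
  rw [← norm_le_zero_iff]
  refine le_of_forall_pos_le_add fun ε hε => ?_
  rw [zero_add]
  obtain ⟨δ, hδ, hδ'⟩ := hm.cont A hA hne ε hε
  set Q := convexHull ℝ (Set.range p) with hQ
  have hcomp : IsCompact (Q \ Metric.thickening δ A) :=
    (convexHull_range_cc p).comp.diff Metric.isOpen_thickening
  have hsep : ∀ x ∈ Q \ Metric.thickening δ A, ∃ q : (E →ₗ[ℝ] ℝ) × ℝ,
      (∀ a ∈ A, q.1 a ≤ q.2) ∧ q.2 < q.1 x := by
    rintro x ⟨-, hx⟩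
    have hxA : x ∉ A := fun h => hx (Metric.self_subset_thickening hδ A h)
    obtain ⟨f, u, h1, h2⟩ := geometric_hahn_banach_closed_point hA.conv hA.comp.isClosed hxA
    exact ⟨(f.toLinearMap, u), fun a ha => (h1 a ha).le, h2⟩
  choose! q hq1 hq2 using hsep
  obtain ⟨t, htc⟩ := hcomp.elim_nhds_subcover' (fun x hx => {y | (q x).2 < (q x).1 y})
    (fun x hx => (isOpen_lt continuous_const
      (q x).1.continuous_of_finiteDimensional).mem_nhds (hq2 x hx))
  set L : List ((E →ₗ[ℝ] ℝ) × ℝ) :=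
    t.toList.map (fun x : ↥(Q \ Metric.thickening δ A) => q (x : E)) with hL
  have hAL : A ⊆ Q ∩ polyh L := fun a ha => ⟨hp (hR ha), fun r hr => by
    obtain ⟨x, -, rfl⟩ := List.mem_map.mp hr
    exact hq1 x x.2 a ha⟩
  have hLA : Q ∩ polyh L ⊆ Metric.thickening δ A := by
    rintro y ⟨hy, hyL⟩
    by_contra hcon
    obtain ⟨x, hx, hxy⟩ := Set.mem_iUnion₂.mp (htc ⟨hy, hcon⟩)
    have := hyL (q x) (List.mem_map.mpr ⟨x, Finset.mem_toList.mpr hx, rfl⟩)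
    exact absurd hxy (not_lt.mpr this)
  have := hδ' (Q ∩ polyh L) ((convexHull_range_cc p).inter_closed (polyh_convex L)
    (polyh_closed L)) (hne.mono hAL) ⟨fun x hx => ?_, fun y hy => ⟨y, hAL hy, by simpa using hδ.le⟩⟩
  · rw [hm.hull_inter_polyh hs rfl h L p, zero_sub, norm_neg] at this
    exact this
  · obtain ⟨y, hy, hxy⟩ := Metric.mem_thickening_iff.mp (hLA hx)
    exact ⟨y, hy, by rw [← dist_eq_norm]; exact hxy.le⟩

end simplex

section add
variable {E : Type*} [NormedAddCommGroup E] [NormedSpace ℝ E]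

theorem CC.preimage {F : Type*} [NormedAddCommGroup F] [NormedSpace ℝ F] [FiniteDimensional ℝ F]
    {A : Set E} (hA : CC A) (φ : F →ₗ[ℝ] E) (hφ : Function.Injective φ) : CC (φ ⁻¹' A) :=
  ⟨hA.conv.linear_preimage φ, (LinearMap.isClosedEmbedding_of_injective
    (LinearMap.ker_eq_bot.mpr hφ)).isCompact_preimage hA.comp⟩

theorem image_tet {F : Type*} [NormedAddCommGroup F] [NormedSpace ℝ F] {d : ℕ} (v : Fin d → F)
    (φ : F →ₗ[ℝ] E) : φ '' tet v = tet (φ ∘ v) := by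
  rw [tet, tet, ← Set.image_comp]
  congr 1
  funext x
  simp [Fintype.linearCombination_apply]

theorem range_linearCombination {d : ℕ} (v : Fin d → E) :
    LinearMap.range (Fintype.linearCombination ℝ v) = Submodule.span ℝ (Set.range v) :=
  Fintype.range_linearCombination ℝ v

theorem linearCombination_injective {d : ℕ} {v : Fin d → E} (hv : LinearIndependent ℝ v) :
    Function.Injective (Fintype.linearCombination ℝ v) :=
  linearIndependent_iff_injective_fintypeLinearCombination.mp hv

theorem Val.simple_of_lower {R : Set E → ℂ} (hR : Val R) {d : ℕ} {v : Fin d → E}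
    (hv : LinearIndependent ℝ v)
    (h : ∀ W : Submodule ℝ E, W < Submodule.span ℝ (Set.range v) → ∀ K : Set E, CC K →
      K ⊆ W → R K = 0) :
    Simple fun A : Set (Fin d → ℝ) => R (Fintype.linearCombination ℝ v '' A) := by
  intro S hS l hl c hlc
  dsimp only
  set φ := Fintype.linearCombination ℝ v with hφ
  rcases S.eq_empty_or_nonempty with rfl | ⟨s, hs⟩
  · simp [hR.empty]
  rw [← hR.trans (-φ s) _ (hS.image φ)]
  refine h ((LinearMap.ker l).map φ) ?_ _ ((CC.singleton _).add (hS.image φ)) ?_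
  · rw [← range_linearCombination, ← hφ, lt_iff_le_and_ne]
    refine ⟨LinearMap.map_le_range, fun heq => hl ?_⟩
    rw [← Submodule.map_top] at heq
    have := Submodule.map_injective_of_injective (linearCombination_injective hv) heq
    exact LinearMap.ker_eq_top.mp this
  · rintro _ ⟨_, rfl, _, ⟨x, hx, rfl⟩, rfl⟩
    refine ⟨x - s, ?_, by simp; abel⟩
    simp [hlc x hx, hlc s hs]

/-- Induction on dimension for families of valuations. -/
theorem vanish_induction [FiniteDimensional ℝ E] {ι : Type*} (R : ι → Set E → ℂ)
    (hR : ∀ i, Val (R i))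
    (h : ∀ (d : ℕ) (v : Fin d → E), LinearIndependent ℝ v →
      (∀ i, ∀ W : Submodule ℝ E, W < Submodule.span ℝ (Set.range v) → ∀ K : Set E, CC K →
        K ⊆ W → R i K = 0) → ∀ i, R i (tet v) = 0) (i : ι) {K : Set E} (hK : CC K) :
    R i K = 0 := by
  suffices H : ∀ W : Submodule ℝ E, ∀ i, ∀ K : Set E, CC K → K ⊆ W → R i K = 0 from
    H ⊤ i K hK (by simp)
  intro W
  induction W using WellFoundedLT.induction with
  | _ W ih =>
  intro i K hK hKW
  let b := Module.finBasis ℝ W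
  set v : Fin (Module.finrank ℝ W) → E := fun i => (b i : E) with hv
  have hvi : LinearIndependent ℝ v :=
    b.linearIndependent.map' W.subtype (Submodule.ker_subtype W)
  have hspan : Submodule.span ℝ (Set.range v) = W := by
    have : Set.range v = W.subtype '' Set.range b := by
      rw [← Set.range_comp]; rfl
    rw [this, ← Submodule.map_span, b.span_eq, Submodule.map_top, Submodule.range_subtype]
  set φ := Fintype.linearCombination ℝ v with hφ
  have hinj : Function.Injective φ := linearCombination_injective hvi
  have hrange : LinearMap.range φ = W := by rw [hφ, range_linearCombination, hspan]
  have hKφ : φ '' (φ ⁻¹' K) = K := by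
    rw [Set.image_preimage_eq_iff]
    intro x hx
    have := hKW hx
    rw [← hrange] at this
    exact this
  have hlow : ∀ i, ∀ W' : Submodule ℝ E, W' < Submodule.span ℝ (Set.range v) → ∀ K : Set E, CC K →
      K ⊆ W' → R i K = 0 := fun i W' hW' K hK hKW' => ih W' (hspan ▸ hW') i K hK hKW'
  rw [← hKφ]
  refine ((hR i).comp_linear φ).eq_zero_of_tet ((hR i).simple_of_lower hvi (hlow i))
    (d := Module.finrank ℝ W) (by simp) (fun w hw => ?_) (hK.preimage φ hinj)
  rw [image_tet]
  have hw' : LinearIndependent ℝ (φ ∘ w) := hw.map' φ (LinearMap.ker_eq_bot.mpr hinj)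
  refine h _ _ hw' (fun i W' hW' => ih W' (lt_of_lt_of_le hW' ?_) i) i
  refine le_trans (Submodule.span_le.mpr ?_) hrange.le
  rintro _ ⟨k, rfl⟩
  exact ⟨w k, rfl⟩

theorem tet_subset_span {d : ℕ} (v : Fin d → E) : tet v ⊆ Submodule.span ℝ (Set.range v) := by
  rintro _ ⟨x, -, rfl⟩
  rw [← range_linearCombination]
  exact ⟨x, rfl⟩

theorem span_lowPart_lt {d : ℕ} {v : Fin d → E} (hv : LinearIndependent ℝ v) (j : Fin d) :
    Submodule.span ℝ (Set.range (lowPart v j)) < Submodule.span ℝ (Set.range v) := by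
  refine lt_of_le_of_ne ?_ ?_
  · rw [Submodule.span_le]
    rintro _ ⟨i, rfl⟩
    simp only [lowPart]
    split_ifs
    · exact Submodule.subset_span ⟨i, rfl⟩
    · exact Submodule.zero_mem _
  · intro h
    have h1 : v j ∈ Submodule.span ℝ (v '' (Set.univ \ {j})) := by
      have h2 : v j ∈ Submodule.span ℝ (Set.range (lowPart v j)) := by
        rw [h]; exact Submodule.subset_span ⟨j, rfl⟩
      refine Submodule.span_le.mpr ?_ h2
      rintro _ ⟨i, rfl⟩
      simp only [lowPart]
      split_ifs with hi
      · exact Submodule.subset_span ⟨i, ⟨trivial, by rintro rfl; simp at hi⟩, rfl⟩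
      · exact Submodule.zero_mem _
    exact (linearIndependent_iff_notMem_span.mp hv j) h1

theorem span_highPart_lt {d : ℕ} {v : Fin d → E} (hv : LinearIndependent ℝ v) (j : Fin d)
    (hj : 0 < (j : ℕ)) :
    Submodule.span ℝ (Set.range (highPart v j)) < Submodule.span ℝ (Set.range v) := by
  refine lt_of_le_of_ne ?_ ?_
  · rw [Submodule.span_le]
    rintro _ ⟨i, rfl⟩
    simp only [highPart]
    split_ifs
    · exact Submodule.zero_mem _
    · exact Submodule.subset_span ⟨i, rfl⟩
  · intro h
    set z : Fin d := ⟨0, by omega⟩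
    have h1 : v z ∈ Submodule.span ℝ (v '' (Set.univ \ {z})) := by
      have h2 : v z ∈ Submodule.span ℝ (Set.range (highPart v j)) := by
        rw [h]; exact Submodule.subset_span ⟨z, rfl⟩
      refine Submodule.span_le.mpr ?_ h2
      rintro _ ⟨i, rfl⟩
      simp only [highPart]
      split_ifs with hi
      · exact Submodule.zero_mem _
      · exact Submodule.subset_span ⟨i, ⟨trivial, by rintro rfl; exact hi hj⟩, rfl⟩
    exact (linearIndependent_iff_notMem_span.mp hv z) h1

theorem smul_tet_eq {d : ℕ} (v : Fin d → E) (t : ℝ) : t • tet v = tet fun i => t • v i := by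
  have := image_tet v (t • (LinearMap.id : E →ₗ[ℝ] E))
  exact this

theorem tet_zero_part {d : ℕ} {v : Fin d → E} (hv : ∀ i, v i = 0) : tet v = {0} := by
  refine Set.eq_singleton_iff_nonempty_unique_mem.mpr ⟨tet_nonempty _, ?_⟩
  rintro _ ⟨x, -, rfl⟩
  simp [Fintype.linearCombination_apply, hv]

theorem Val.pow_two_smul {T : Set E → ℂ}
    (h2 : ∀ A, CC A → T ((2 : ℝ) • A) = 2 * T A) (n : ℕ) {A : Set E} (hA : CC A) :
    T (((2 : ℝ) ^ n) • A) = 2 ^ n * T A := by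
  induction n with
  | zero => simp
  | succ n ih => rw [pow_succ', ← smul_smul, h2 _ (hA.smul _), ih]; ring

theorem near_add_smul {A L : Set E} {M : ℝ} (hM : ∀ x ∈ L, ‖x‖ ≤ M) (hL : L.Nonempty) {t : ℝ}
    (ht : 0 ≤ t) : Near (t * M) (A + t • L) A := by
  constructor
  · rintro _ ⟨a, ha, _, ⟨x, hx, rfl⟩, rfl⟩
    refine ⟨a, ha, ?_⟩
    simp only [add_sub_cancel_left, norm_smul, Real.norm_of_nonneg ht]
    exact mul_le_mul_of_nonneg_left (hM x hx) ht
  · intro a ha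
    obtain ⟨x, hx⟩ := hL
    refine ⟨_, Set.add_mem_add ha (Set.smul_mem_smul_set hx), ?_⟩
    simp only [add_sub_cancel_left, norm_smul, Real.norm_of_nonneg ht]
    exact mul_le_mul_of_nonneg_left (hM x hx) ht

open Classical in
/-- A continuous valuation with `T (2 • A) = 2 * T A` is Minkowski additive. -/
theorem Val.minkowski_add [FiniteDimensional ℝ E] {T : Set E → ℂ} (hT : Val T)
    (h2 : ∀ A, CC A → T ((2 : ℝ) • A) = 2 * T A) {K L : Set E} (hK : CC K) (hL : CC L)
    (hKn : K.Nonempty) (hLn : L.Nonempty) : T (K + L) = T K + T L := by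
  let R : {L : Set E // CC L ∧ L.Nonempty} → Set E → ℂ := fun L K =>
    T (K + L.1) - (T K + if K.Nonempty then T L.1 else 0)
  have hR : ∀ L, Val (R L) := fun L => (hT.comp_add L.2.1).sub (hT.add (Val.euler (T L.1)))
  have key := vanish_induction R hR ?_ ⟨L, hL, hLn⟩ hK
  · simp only [R, hKn, if_true] at key
    linear_combination key
  intro d v hv ih L
  have hdouble : ∀ w : Fin d → E, LinearIndependent ℝ w →
      Submodule.span ℝ (Set.range w) = Submodule.span ℝ (Set.range v) →
      R L ((2 : ℝ) • tet w) = 2 * R L (tet w) := by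
    intro w hw hspan
    rw [(hR L).double_tet w ((hR L).simple_of_lower hw fun W hW => ih L W (hspan ▸ hW))]
    rcases d with _ | d
    · have : tet w = {0} := tet_zero_part fun i => i.elim0
      have h0 : T ({0} : Set E) = 0 := by
        have := h2 {0} (CC.singleton 0)
        simp only [Set.smul_set_singleton, smul_zero] at this
        linear_combination -this
      simp [this, R, h0]
    · rw [Fin.sum_univ_succ, Finset.sum_eq_zero, add_zero, two_mul]
      · congr 2
        have e1 : tet (lowPart w (0 : Fin (d + 1))) = {0} := tet_zero_part fun i => by simp [lowPart]
        have e2 : highPart w (0 : Fin (d + 1)) = w := by funext i; simp [highPart]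
        simp only [Fin.val_zero] at e1 e2
        simp [e1, e2]
      · intro j _
        set E' := tet (lowPart w (j.succ : Fin (d+1)))
        set F' := tet (highPart w (j.succ : Fin (d+1)))
        have hEs := tet_subset_span (lowPart w (j.succ : Fin (d+1)))
        have hFs := tet_subset_span (highPart w (j.succ : Fin (d+1)))
        have hE := span_lowPart_lt hw j.succ
        have hF := span_highPart_lt hw j.succ (by simp)
        rw [hspan] at hE hF
        have hEn : E'.Nonempty := tet_nonempty _
        have hFn : F'.Nonempty := tet_nonempty _
        have hEc : CC E' := tet_cc _
        have hFc : CC F' := tet_cc _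
        have r1 := ih ⟨F' + L.1, hFc.add L.2.1, hFn.add L.2.2⟩ _ hE E' hEc hEs
        have r2 := ih ⟨F', hFc, hFn⟩ _ hE E' hEc hEs
        have r3 := ih L _ hF F' hFc hFs
        simp only [R, hEn, hFn, hEn.add hFn, if_true, ← add_assoc] at r1 r2 r3 ⊢
        linear_combination r1 - r2 + r3
  have hpow : ∀ k : ℕ, R L ((2 : ℝ) ^ k • tet v) = 2 ^ k * R L (tet v) := by
    intro k
    induction k with
    | zero => simp
    | succ k ihk =>
      have h2k : (2 : ℝ) ^ k ≠ 0 := by positivity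
      have hw : LinearIndependent ℝ fun i => (2 : ℝ) ^ k • v i :=
        hv.units_smul fun _ => Units.mk0 _ h2k
      rw [pow_succ', ← smul_smul, smul_tet_eq v, hdouble _ hw, ← smul_tet_eq, ihk, pow_succ']
      · ring
      · apply le_antisymm <;> rw [Submodule.span_le] <;> rintro _ ⟨i, rfl⟩
        · exact Submodule.smul_mem _ _ (Submodule.subset_span ⟨i, rfl⟩)
        · have := Submodule.smul_mem (Submodule.span ℝ (Set.range fun i => (2 : ℝ) ^ k • v i))
            ((2 : ℝ) ^ k)⁻¹ (Submodule.subset_span ⟨i, rfl⟩)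
          simpa [smul_smul, inv_mul_cancel₀ h2k] using this
  have hconst : ∀ k : ℕ, T (tet v + ((1 / 2 : ℝ) ^ k) • L.1) - T (tet v) -
      (1 / 2 : ℂ) ^ k * T L.1 = R L (tet v) := by
    intro k
    have h2k : (2 : ℂ) ^ k ≠ 0 := pow_ne_zero _ two_ne_zero
    have h3 : (2 : ℝ) ^ k • (tet v + ((1 / 2 : ℝ) ^ k) • L.1) = (2 : ℝ) ^ k • tet v + L.1 := by
      rw [smul_add, smul_smul, ← mul_pow]; norm_num
    have h4 := Val.pow_two_smul h2 k ((tet_cc v).add (L.2.1.smul ((1 / 2 : ℝ) ^ k)))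
    have h5 := Val.pow_two_smul h2 k (tet_cc v)
    have h6 := hpow k
    have hne : ((2 : ℝ) ^ k • tet v).Nonempty := (tet_nonempty v).smul_set
    simp only [R, hne, if_true, ← h3, h4, h5] at h6
    have h7 : R L (tet v) = T (tet v + ((1 / 2 : ℝ) ^ k) • L.1) - T (tet v) - T L.1 / 2 ^ k := by
      simp only [R]
      field_simp
      linear_combination -h6
    rw [h7, one_div_pow (2 : ℂ)]
    ring
  obtain ⟨M, hM⟩ := L.2.1.comp.isBounded.exists_norm_le
  have hlim : Filter.Tendsto (fun k : ℕ => T (tet v + ((1 / 2 : ℝ) ^ k) • L.1) - T (tet v) -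
      (1 / 2 : ℂ) ^ k * T L.1) Filter.atTop (nhds (T (tet v) - T (tet v) - 0 * T L.1)) := by
    refine Filter.Tendsto.sub (Filter.Tendsto.sub_const ?_ _) (Filter.Tendsto.mul_const _ ?_)
    · refine hT.tendsto (tet_cc v) (tet_nonempty v)
        (fun k => (tet_cc v).add (L.2.1.smul ((1 / 2 : ℝ) ^ k)))
        (δ := fun k => (1 / 2 : ℝ) ^ k * M) ?_ (fun k => near_add_smul hM L.2.2 (by positivity))
      have := (tendsto_pow_atTop_nhds_zero_of_lt_one (r := (1 / 2 : ℝ)) (by norm_num)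
        (by norm_num)).mul_const M
      simpa using this
    · exact tendsto_pow_atTop_nhds_zero_of_norm_lt_one (by norm_num)
  simp only [hconst] at hlim
  simpa using tendsto_nhds_unique tendsto_const_nhds hlim

theorem Val.smul_of_double [FiniteDimensional ℝ E] {T : Set E → ℂ} (hT : Val T)
    (h2 : ∀ A, CC A → T ((2 : ℝ) • A) = 2 * T A) {K : Set E} (hK : CC K)
    (hne : K.Nonempty) {t : ℝ} (ht : 0 ≤ t) : T (t • K) = t * T K := by
  have h0 : T ({0} : Set E) = 0 := by
    have := h2 {0} (CC.singleton 0)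
    simp only [Set.smul_set_singleton, smul_zero] at this
    linear_combination -this
  have hadd : ∀ s t : ℝ, 0 ≤ s → 0 ≤ t → T ((s + t) • K) = T (s • K) + T (t • K) := by
    intro s t hs ht
    rw [hK.conv.add_smul hs ht]
    exact hT.minkowski_add h2 (hK.smul _) (hK.smul _) hne.smul_set hne.smul_set
  have hnat : ∀ (s : ℝ) (k : ℕ), 0 ≤ s → T ((k * s) • K) = k * T (s • K) := by
    intro s k hs
    induction k with
    | zero => simp [Set.zero_smul_set hne, ← Set.singleton_zero, h0]
    | succ k ih =>
      have : ((k + 1 : ℕ) : ℝ) * s = k * s + s := by push_cast; ring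
      rw [this, hadd _ _ (by positivity) hs, ih]
      push_cast; ring
  obtain ⟨M, hM⟩ := hK.comp.isBounded.exists_norm_le
  have h1 : Filter.Tendsto (fun k : ℕ => (⌊t * k⌋₊ / k : ℝ)) Filter.atTop (nhds t) :=
    (tendsto_nat_floor_mul_div_atTop ht).comp tendsto_natCast_atTop_atTop
  have hnear : ∀ s t : ℝ, Near (|s - t| * M) (s • K) (t • K) := by
    intro s t
    constructor
    · rintro _ ⟨x, hx, rfl⟩
      refine ⟨_, Set.smul_mem_smul_set hx, ?_⟩
      simp only [← sub_smul, norm_smul, Real.norm_eq_abs]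
      exact mul_le_mul_of_nonneg_left (hM x hx) (abs_nonneg _)
    · rintro _ ⟨x, hx, rfl⟩
      refine ⟨_, Set.smul_mem_smul_set hx, ?_⟩
      simp only [← sub_smul, norm_smul, Real.norm_eq_abs]
      exact mul_le_mul_of_nonneg_left (hM x hx) (abs_nonneg _)
  have h2' : Filter.Tendsto (fun k : ℕ => T ((⌊t * k⌋₊ / k : ℝ) • K)) Filter.atTop
      (nhds (T (t • K))) := by
    refine hT.tendsto (hK.smul _) hne.smul_set (fun k => hK.smul _)
      (δ := fun k : ℕ => |(⌊t * k⌋₊ / k : ℝ) - t| * M) ?_ (fun k => hnear _ _)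
    have := ((h1.sub_const t).abs).mul_const M
    simpa using this
  have h3 : Filter.Tendsto (fun k : ℕ => ((⌊t * k⌋₊ / k : ℝ) : ℂ) * T K) Filter.atTop
      (nhds (t * T K)) :=
    ((Complex.continuous_ofReal.tendsto t).comp h1).mul_const _
  refine tendsto_nhds_unique_of_eventuallyEq h2' h3 ?_
  filter_upwards [Filter.eventually_gt_atTop 0] with k hk
  have hk' : (k : ℝ) ≠ 0 := by positivity
  have e1 := hnat (1 / k) k (by positivity)
  have e2 := hnat (1 / k) ⌊t * k⌋₊ (by positivity)
  rw [mul_one_div_cancel hk', one_smul] at e1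
  rw [mul_one_div] at e2
  have hkc : (k : ℂ) ≠ 0 := by exact_mod_cast hk.ne'
  rw [e2, e1]
  push_cast
  field_simp

end add

section sublinear
variable {V : Type*} [NormedAddCommGroup V] [InnerProductSpace ℝ V]

/-- Sublinear functions. -/
structure Sublin {V : Type*} [NormedAddCommGroup V] [InnerProductSpace ℝ V] (f : V → ℝ) : Prop where
  add : ∀ x y, f (x + y) ≤ f x + f y
  smul : ∀ t : ℝ, 0 ≤ t → ∀ x, f (t • x) = t * f x

/-- The convex body with support function `f`. -/
def body (f : V → ℝ) : Set V := {y | ∀ x, inner ℝ x y ≤ f x}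

/-- The support function of `A`. -/
def supp (A : Set V) (x : V) : ℝ := sSup ((fun y => inner ℝ x y) '' A)

theorem Sublin.zero {f : V → ℝ} (hf : Sublin f) : f 0 = 0 := by
  simpa using hf.smul 0 le_rfl 0

theorem Sublin.neg_le {f : V → ℝ} (hf : Sublin f) (x : V) : - f (-x) ≤ f x := by
  have := hf.add x (-x)
  rw [add_neg_cancel, hf.zero] at this
  linarith

theorem Sublin.sum {f g : V → ℝ} (hf : Sublin f) (hg : Sublin g) : Sublin fun x => f x + g x :=
  ⟨fun x y => by linarith [hf.add x y, hg.add x y], fun t ht x => by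
    rw [hf.smul t ht, hg.smul t ht]; ring⟩

theorem Sublin.mul {f : V → ℝ} (hf : Sublin f) {c : ℝ} (hc : 0 ≤ c) : Sublin fun x => c * f x :=
  ⟨fun x y => by nlinarith [hf.add x y], fun t ht x => by rw [hf.smul t ht]; ring⟩

theorem Sublin.sup {f g : V → ℝ} (hf : Sublin f) (hg : Sublin g) :
    Sublin fun x => max (f x) (g x) :=
  ⟨fun x y => max_le ((hf.add x y).trans (add_le_add (le_max_left _ _) (le_max_left _ _)))
    ((hg.add x y).trans (add_le_add (le_max_right _ _) (le_max_right _ _))), fun t ht x => by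
    rw [hf.smul t ht, hg.smul t ht, mul_max_of_nonneg _ _ ht]⟩

theorem Sublin.comp {W : Type*} [NormedAddCommGroup W] [InnerProductSpace ℝ W] {f : V → ℝ}
    (hf : Sublin f) (φ : W →ₗ[ℝ] V) : Sublin fun x => f (φ x) :=
  ⟨fun x y => by rw [map_add]; exact hf.add _ _, fun t ht x => by rw [map_smul, hf.smul t ht]⟩

theorem Sublin.linear (φ : V →ₗ[ℝ] ℝ) : Sublin fun x => φ x :=
  ⟨fun x y => by rw [map_add], fun t _ x => by rw [map_smul, smul_eq_mul]⟩

theorem Sublin.norm : Sublin fun x : V => ‖x‖ :=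
  ⟨norm_add_le, fun t ht x => by rw [norm_smul, Real.norm_of_nonneg ht]⟩

theorem Sublin.norm_smul_unit {f : V → ℝ} (hf : Sublin f) (x : V) :
    f x = ‖x‖ * f (‖x‖⁻¹ • x) := by
  rcases eq_or_ne x 0 with rfl | hx
  · simp [hf.zero]
  · rw [← hf.smul _ (norm_nonneg x), smul_smul, mul_inv_cancel₀ (norm_ne_zero_iff.mpr hx), one_smul]

theorem norm_unit_le (x : V) : ‖‖x‖⁻¹ • x‖ ≤ 1 := by
  rcases eq_or_ne x 0 with rfl | hx
  · simp
  · rw [norm_smul, norm_inv, norm_norm, inv_mul_cancel₀ (norm_ne_zero_iff.mpr hx)]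

theorem Sublin.convexOn {f : V → ℝ} (hf : Sublin f) : ConvexOn ℝ Set.univ f :=
  ⟨convex_univ, fun x _ y _ a b ha hb _ => by
    have := hf.add (a • x) (b • y)
    rwa [hf.smul a ha, hf.smul b hb] at this⟩

theorem body_norm {δ : ℝ} (hδ : 0 ≤ δ) :
    body (fun x : V => δ * ‖x‖) = Metric.closedBall 0 δ := by
  ext y
  rw [mem_closedBall_zero_iff]
  constructor
  · intro h
    have h1 := h y
    rw [real_inner_self_eq_norm_mul_norm] at h1
    rcases eq_or_lt_of_le (norm_nonneg y) with h0 | h0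
    · rw [← h0]; exact hδ
    · exact le_of_mul_le_mul_right h1 h0
  · intro h x
    calc inner ℝ x y ≤ ‖x‖ * ‖y‖ := real_inner_le_norm _ _
      _ ≤ δ * ‖x‖ := by nlinarith [norm_nonneg x]

theorem le_supp {A : Set V} (hA : CC A) (x : V) {y : V} (hy : y ∈ A) : inner ℝ x y ≤ supp A x :=
  le_csSup (hA.comp.image (by fun_prop)).bddAbove ⟨y, hy, rfl⟩

theorem exists_eq_supp {A : Set V} (hA : CC A) (hne : A.Nonempty) (x : V) :
    ∃ y ∈ A, inner ℝ x y = supp A x :=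
  (hA.comp.image (f := fun y => inner ℝ x y) (by fun_prop)).sSup_mem (hne.image _)

theorem supp_sublin {A : Set V} (hA : CC A) (hne : A.Nonempty) : Sublin (supp A) := by
  constructor
  · intro x y
    obtain ⟨a, ha, h⟩ := exists_eq_supp hA hne (x + y)
    rw [← h, inner_add_left]
    exact add_le_add (le_supp hA x ha) (le_supp hA y ha)
  · intro t ht x
    obtain ⟨a, ha, h⟩ := exists_eq_supp hA hne (t • x)
    obtain ⟨b, hb, h'⟩ := exists_eq_supp hA hne x
    apply le_antisymm
    · rw [← h, real_inner_smul_left]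
      exact mul_le_mul_of_nonneg_left (le_supp hA x ha) ht
    · rw [← h', ← real_inner_smul_left]
      exact le_supp hA _ hb

variable [FiniteDimensional ℝ V]

theorem Sublin.continuous {f : V → ℝ} (hf : Sublin f) : Continuous f :=
  hf.convexOn.locallyLipschitz.continuous

theorem Sublin.bound {f : V → ℝ} (hf : Sublin f) : ∃ M : ℝ, 0 ≤ M ∧ ∀ x, |f x| ≤ M * ‖x‖ := by
  obtain ⟨M, hM⟩ := ((isCompact_closedBall (0 : V) 1).image hf.continuous).isBounded.exists_norm_le
  refine ⟨max M 0, le_max_right _ _, fun x => ?_⟩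
  rw [hf.norm_smul_unit x, abs_mul, abs_norm, mul_comm]
  refine mul_le_mul_of_nonneg_right ((hM _ ⟨_, ?_, rfl⟩).trans (le_max_left _ _)) (norm_nonneg _)
  simpa using norm_unit_le x

theorem body_cc {f : V → ℝ} (hf : Sublin f) : CC (body f) := by
  have e : body f = ⋂ x, {y | inner ℝ x y ≤ f x} := by ext; simp [body]
  refine ⟨?_, ?_⟩
  · rw [e]
    exact convex_iInter fun x => convex_halfSpace_le (innerₛₗ ℝ x).isLinear _
  · obtain ⟨M, hM0, hM⟩ := hf.bound
    refine (isCompact_closedBall (0 : V) M).of_isClosed_subset ?_ fun y hy => ?_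
    · rw [e]
      exact isClosed_iInter fun x => isClosed_le (by fun_prop) continuous_const
    · rw [← body_norm hM0]
      exact fun x => (hy x).trans ((le_abs_self _).trans (hM x))

theorem Sublin.exists_mem_body {f : V → ℝ} (hf : Sublin f) (x : V) :
    ∃ y ∈ body f, inner ℝ x y = f x := by
  obtain ⟨g, hg1, hg2⟩ : ∃ g : V →ₗ[ℝ] ℝ, g x = f x ∧ ∀ z, g z ≤ f z := by
    rcases eq_or_ne x 0 with rfl | hx
    · obtain ⟨g, -, hg2⟩ := exists_extension_of_le_sublinear ⟨⊥, 0⟩ f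
        (fun c hc x => hf.smul c hc.le x) hf.add (fun z => by
          have : (z : V) = 0 := (Submodule.mem_bot ℝ).mp z.2
          simp [this, hf.zero])
      exact ⟨g, by simp [hf.zero], hg2⟩
    · obtain ⟨g, hg1, hg2⟩ := exists_extension_of_le_sublinear
        (LinearPMap.mkSpanSingleton x (f x) hx) f
        (fun c hc x => hf.smul c hc.le x) hf.add (fun z => by
          obtain ⟨z, hz⟩ := z
          obtain ⟨t, rfl⟩ := Submodule.mem_span_singleton.mp hz
          rw [LinearPMap.mkSpanSingleton'_apply, RingHom.id_apply, smul_eq_mul]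
          rcases le_total 0 t with ht | ht
          · rw [hf.smul t ht]
          · have h1 := hf.smul (-t) (by linarith) x
            have h2 := hf.neg_le (t • x)
            rw [← neg_smul, h1] at h2
            simpa using h2)
      refine ⟨g, ?_, hg2⟩
      exact (hg1 ⟨x, Submodule.mem_span_singleton_self x⟩).trans
        (LinearPMap.mkSpanSingleton_apply ℝ ℝ hx (f x))
  refine ⟨(InnerProductSpace.toDual ℝ V).symm (LinearMap.toContinuousLinearMap g), fun z => ?_, ?_⟩
  · rw [real_inner_comm, InnerProductSpace.toDual_symm_apply]; exact hg2 z
  · rw [real_inner_comm, InnerProductSpace.toDual_symm_apply]; exact hg1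

theorem body_nonempty {f : V → ℝ} (hf : Sublin f) : (body f).Nonempty :=
  let ⟨y, hy, _⟩ := hf.exists_mem_body 0; ⟨y, hy⟩

theorem exists_inner_separation {A : Set V} (hA : CC A) {y : V} (hy : y ∉ A) :
    ∃ (x : V) (u : ℝ), (∀ a ∈ A, inner ℝ x a < u) ∧ u < inner ℝ x y := by
  obtain ⟨f, u, h1, h2⟩ := geometric_hahn_banach_closed_point hA.conv hA.comp.isClosed hy
  refine ⟨(InnerProductSpace.toDual ℝ V).symm f, u, fun a ha => ?_, ?_⟩
  · rw [InnerProductSpace.toDual_symm_apply]; exact h1 a ha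
  · rw [InnerProductSpace.toDual_symm_apply]; exact h2

theorem body_add {f g : V → ℝ} (hf : Sublin f) (hg : Sublin g) :
    body (fun x => f x + g x) = body f + body g := by
  apply Set.Subset.antisymm
  · intro y hy
    by_contra h
    obtain ⟨x, u, h1, h2⟩ := exists_inner_separation ((body_cc hf).add (body_cc hg)) h
    obtain ⟨a, ha, ha'⟩ := hf.exists_mem_body x
    obtain ⟨b, hb, hb'⟩ := hg.exists_mem_body x
    have h3 := h1 _ (Set.add_mem_add ha hb)
    have h4 := hy x
    rw [inner_add_right] at h3
    linarith
  · rintro _ ⟨a, ha, b, hb, rfl⟩ x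
    simp only [inner_add_right]
    exact add_le_add (ha x) (hb x)

theorem body_mul {f : V → ℝ} (hf : Sublin f) {c : ℝ} (hc : 0 ≤ c) :
    body (fun x => c * f x) = c • body f := by
  apply Set.Subset.antisymm
  · intro y hy
    by_contra h
    obtain ⟨x, u, h1, h2⟩ := exists_inner_separation ((body_cc hf).smul c) h
    obtain ⟨a, ha, ha'⟩ := hf.exists_mem_body x
    have h3 := h1 _ (Set.smul_mem_smul_set ha)
    have h4 := hy x
    rw [inner_smul_right, ha'] at h3
    linarith
  · rintro _ ⟨a, ha, rfl⟩ x
    simp only [inner_smul_right]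
    exact mul_le_mul_of_nonneg_left (ha x) hc

theorem body_supp {A : Set V} (hA : CC A) (hne : A.Nonempty) : body (supp A) = A := by
  apply Set.Subset.antisymm
  · intro y hy
    by_contra h
    obtain ⟨x, u, h1, h2⟩ := exists_inner_separation hA h
    obtain ⟨a, ha, ha'⟩ := exists_eq_supp hA hne x
    linarith [h1 a ha, hy x]
  · exact fun y hy x => le_supp hA x hy

theorem body_subset_of_le {f g : V → ℝ} (hg : Sublin g) {δ : ℝ} (hδ : 0 ≤ δ)
    (h : ∀ x, f x ≤ g x + δ * ‖x‖) {y : V} (hy : y ∈ body f) : ∃ z ∈ body g, ‖y - z‖ ≤ δ := by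
  have h1 : y ∈ body g + body (fun x : V => δ * ‖x‖) := by
    rw [← body_add hg (Sublin.norm.mul hδ)]
    exact fun x => (hy x).trans (h x)
  obtain ⟨z, hz, w, hw, rfl⟩ := h1
  refine ⟨z, hz, ?_⟩
  rw [body_norm hδ, mem_closedBall_zero_iff] at hw
  simpa using hw

theorem near_body {f g : V → ℝ} (hf : Sublin f) (hg : Sublin g) {δ : ℝ} (hδ : 0 ≤ δ)
    (h : ∀ x, |f x - g x| ≤ δ * ‖x‖) : Near δ (body f) (body g) := by
  refine ⟨fun y hy => body_subset_of_le hg hδ (fun x => ?_) hy, fun y hy => ?_⟩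
  · linarith [le_abs_self (f x - g x), h x]
  · obtain ⟨z, hz, hz'⟩ := body_subset_of_le hf hδ
      (fun x => by linarith [neg_abs_le (f x - g x), h x]) hy
    exact ⟨z, hz, by rwa [norm_sub_rev]⟩

end sublinear

section integral
variable {V : Type*} [NormedAddCommGroup V] [InnerProductSpace ℝ V] [FiniteDimensional ℝ V]

/-- Support functions on the unit ball together with the values of `T`. -/
def suppGraph (T : Set V → ℂ) : Set (C(Metric.closedBall (0 : V) 1, ℝ) × ℂ) :=
  {p | ∃ f : V → ℝ, Sublin f ∧ (∀ x : Metric.closedBall (0 : V) 1, p.1 x = f x) ∧ p.2 = T (body f)}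

theorem abs_sub_le_of_ball {f g : V → ℝ} (hf : Sublin f) (hg : Sublin g)
    {u v : C(Metric.closedBall (0 : V) 1, ℝ)} (hu : ∀ x : Metric.closedBall (0 : V) 1, u x = f x)
    (hv : ∀ x : Metric.closedBall (0 : V) 1, v x = g x) (x : V) :
    |f x - g x| ≤ ‖u - v‖ * ‖x‖ := by
  have hx : ‖x‖⁻¹ • x ∈ Metric.closedBall (0 : V) 1 := by simpa using norm_unit_le x
  rw [hf.norm_smul_unit x, hg.norm_smul_unit x, ← mul_sub, abs_mul, abs_norm, mul_comm]
  refine mul_le_mul_of_nonneg_right ?_ (norm_nonneg x)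
  have := (u - v).norm_coe_le_norm ⟨_, hx⟩
  rwa [ContinuousMap.sub_apply, hu, hv] at this

theorem Val.suppGraph_convex {T : Set V → ℂ} (hT : Val T)
    (h2 : ∀ A, CC A → T ((2 : ℝ) • A) = 2 * T A) : Convex ℝ (suppGraph T) := by
  rintro ⟨u, a⟩ ⟨f, hf, hu, rfl⟩ ⟨v, b⟩ ⟨g, hg, hv, rfl⟩ s t hs ht -
  refine ⟨fun x => s * f x + t * g x, (hf.mul hs).sum (hg.mul ht), fun x => ?_, ?_⟩
  · simp [← hu, ← hv]
  · rw [body_add (hf.mul hs) (hg.mul ht), body_mul hf hs, body_mul hg ht,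
      hT.minkowski_add h2 ((body_cc hf).smul _) ((body_cc hg).smul _) (body_nonempty hf).smul_set
        (body_nonempty hg).smul_set, hT.smul_of_double h2 (body_cc hf) (body_nonempty hf) hs,
      hT.smul_of_double h2 (body_cc hg) (body_nonempty hg) ht]
    simp

theorem Val.suppGraph_closed {T : Set V → ℂ} (hT : Val T) : IsClosed (suppGraph T) := by
  rw [← isSeqClosed_iff_isClosed]
  rintro p ⟨u, c⟩ hp hlim
  choose f hf hpf hpT using hp
  have hlim1 : Filter.Tendsto (fun k => (p k).1) Filter.atTop (nhds u) :=
    (continuous_fst.tendsto _).comp hlim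
  have hlim2 : Filter.Tendsto (fun k => (p k).2) Filter.atTop (nhds c) :=
    (continuous_snd.tendsto _).comp hlim
  have hmem : ∀ x : V, ‖x‖⁻¹ • x ∈ Metric.closedBall (0 : V) 1 := fun x => by
    simpa using norm_unit_le x
  have hpt : ∀ x : Metric.closedBall (0 : V) 1,
      Filter.Tendsto (fun k => (p k).1 x) Filter.atTop (nhds (u x)) := fun x =>
    ((continuous_eval_const (F := C(Metric.closedBall (0 : V) 1, ℝ)) x).tendsto u).comp hlim1
  set g : V → ℝ := fun x => ‖x‖ * u ⟨_, hmem x⟩ with hg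
  have hfg : ∀ x, Filter.Tendsto (fun k => f k x) Filter.atTop (nhds (g x)) := fun x => by
    have := (hpt ⟨_, hmem x⟩).const_mul ‖x‖
    refine this.congr fun k => ?_
    rw [hpf, (hf k).norm_smul_unit x]
  have hgs : Sublin g := by
    refine ⟨fun x y => ?_, fun t ht x => ?_⟩
    · exact le_of_tendsto_of_tendsto' (hfg _) ((hfg x).add (hfg y)) fun k => (hf k).add x y
    · exact tendsto_nhds_unique (hfg _) (((hfg x).const_mul t).congr fun k =>
        ((hf k).smul t ht x).symm)
  have hug : ∀ x : Metric.closedBall (0 : V) 1, u x = g x := fun x =>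
    tendsto_nhds_unique (hpt x) ((hfg x).congr fun k => (hpf k x).symm)
  refine ⟨g, hgs, hug, ?_⟩
  refine tendsto_nhds_unique hlim2 ?_
  simp only [hpT]
  refine hT.tendsto (body_cc hgs) (body_nonempty hgs) (fun k => body_cc (hf k))
    (δ := fun k => ‖(p k).1 - u‖) ?_ (fun k => near_body (hf k) hgs (norm_nonneg _)
      (abs_sub_le_of_ball (hf k) hgs (hpf k) hug))
  simpa using (hlim1.sub_const u).norm

theorem Val.continuous_body {T : Set V → ℂ} (hT : Val T) {Ω : Type*} [TopologicalSpace Ω]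
    {F : Ω → V → ℝ} (hF : ∀ ω, Sublin (F ω)) (hc : Continuous fun q : Ω × V => F q.1 q.2) :
    Continuous fun ω => T (body (F ω)) := by
  let Φ : C(Ω, C(Metric.closedBall (0 : V) 1, ℝ)) :=
    ContinuousMap.curry ⟨fun q : Ω × Metric.closedBall (0 : V) 1 => F q.1 q.2, by fun_prop⟩
  have hΦ : ∀ ω (x : Metric.closedBall (0 : V) 1), Φ ω x = F ω x := fun _ _ => rfl
  rw [continuous_iff_continuousAt]
  intro ω
  refine hT.tendsto (body_cc (hF ω)) (body_nonempty (hF ω)) (fun η => body_cc (hF η))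
    (δ := fun η => ‖Φ η - Φ ω‖) ?_ (fun η => near_body (hF η) (hF ω) (norm_nonneg _)
      (abs_sub_le_of_ball (hF η) (hF ω) (hΦ η) (hΦ ω)))
  have : Continuous fun η => ‖Φ η - Φ ω‖ := (Φ.continuous.sub continuous_const).norm
  simpa using this.tendsto ω

/-- Integrals of continuous families of support functions. -/
theorem Val.integral_body {T : Set V → ℂ} (hT : Val T)
    (h2 : ∀ A, CC A → T ((2 : ℝ) • A) = 2 * T A) {Ω : Type*} [MetricSpace Ω] [MeasurableSpace Ω]
    [BorelSpace Ω] {ν : Measure Ω} [IsFiniteMeasureOnCompacts ν] {κ : Set Ω} (hκ : IsCompact κ)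
    {F : Ω → V → ℝ} (hF : ∀ ω, Sublin (F ω)) (hc : Continuous fun q : Ω × V => F q.1 q.2) :
    (Sublin fun x => ∫ ω in κ, F ω x ∂ν) ∧
      T (body fun x => ∫ ω in κ, F ω x ∂ν) = ∫ ω in κ, T (body (F ω)) ∂ν := by
  let Φ : C(Ω, C(Metric.closedBall (0 : V) 1, ℝ)) :=
    ContinuousMap.curry ⟨fun q : Ω × Metric.closedBall (0 : V) 1 => F q.1 q.2, by fun_prop⟩
  have hΦ : ∀ ω (x : Metric.closedBall (0 : V) 1), Φ ω x = F ω x := fun _ _ => rfl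
  have hTc := hT.continuous_body hF hc
  have hInt : IntegrableOn (fun ω => (Φ ω, T (body (F ω)))) κ ν :=
    (Φ.continuous.prodMk hTc).continuousOn.integrableOn_compact hκ
  rcases eq_or_ne (ν κ) 0 with h0 | h0
  · have : ν.restrict κ = 0 := Measure.restrict_eq_zero.mpr h0
    simp only [this, integral_zero_measure]
    have hz : Sublin fun _ : V => (0 : ℝ) := ⟨fun _ _ => by simp, fun _ _ _ => by simp⟩
    refine ⟨hz, ?_⟩
    have h3 := hT.smul_of_double h2 (body_cc hz) (body_nonempty hz) le_rfl
    rw [← body_mul hz le_rfl] at h3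
    simpa using h3
  · obtain ⟨f, hf, hf1, hf2⟩ := (hT.suppGraph_convex h2).set_average_mem hT.suppGraph_closed h0
      hκ.measure_lt_top.ne (Filter.Eventually.of_forall fun ω =>
        show (Φ ω, T (body (F ω))) ∈ suppGraph T from ⟨F ω, hF ω, hΦ ω, rfl⟩) hInt
    have hpos : 0 < ν.real κ := ENNReal.toReal_pos h0 hκ.measure_lt_top.ne
    have hav : (⨍ ω in κ, (Φ ω, T (body (F ω))) ∂ν) =
        (ν.real κ)⁻¹ • (∫ ω in κ, Φ ω ∂ν, ∫ ω in κ, T (body (F ω)) ∂ν) := by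
      rw [setAverage_eq, integral_pair hInt.fst hInt.snd]
    rw [hav] at hf1 hf2
    have hfx : ∀ x, ∫ ω in κ, F ω x ∂ν = ν.real κ * f x := by
      intro x
      have hx : ‖x‖⁻¹ • x ∈ Metric.closedBall (0 : V) 1 := by simpa using norm_unit_le x
      have h4 := hf1 ⟨_, hx⟩
      simp only [Prod.smul_fst, ContinuousMap.smul_apply, smul_eq_mul] at h4
      rw [ContinuousMap.integral_apply hInt.fst] at h4
      have h5 : ∀ ω, F ω x = ‖x‖ * F ω (‖x‖⁻¹ • x) := fun ω => (hF ω).norm_smul_unit x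
      simp_rw [h5, integral_const_mul]
      rw [hf.norm_smul_unit x, ← h4]
      simp only [hΦ]
      field_simp
    simp_rw [hfx]
    refine ⟨hf.mul hpos.le, ?_⟩
    rw [body_mul hf hpos.le, hT.smul_of_double h2 (body_cc hf) (body_nonempty hf) hpos.le, ← hf2]
    simp only [Prod.smul_snd, Complex.real_smul]
    push_cast
    rw [← mul_assoc, mul_inv_cancel₀ (by exact_mod_cast hpos.ne'), one_mul]

end integral

section lattice
variable {V : Type*} [NormedAddCommGroup V] [InnerProductSpace ℝ V] [FiniteDimensional ℝ V]

/-- Differences of sublinear functions are dense among positively homogeneous ones. -/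
theorem exists_sublin_approx {φ : V → ℝ} (hc : Continuous φ)
    (hφ : ∀ t : ℝ, 0 ≤ t → ∀ x, φ (t • x) = t * φ x) {ε : ℝ} (hε : 0 < ε) :
    ∃ f g : V → ℝ, Sublin f ∧ Sublin g ∧ ∀ x, |φ x - (f x - g x)| ≤ ε * ‖x‖ := by
  let S := Metric.sphere (0 : V) 1
  let L : Set C(S, ℝ) := {u | ∃ f g : V → ℝ, Sublin f ∧ Sublin g ∧ ∀ x : S, u x = f x - g x}
  have hneg : ∀ u ∈ L, -u ∈ L := by
    rintro u ⟨f, g, hf, hg, hu⟩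
    exact ⟨g, f, hg, hf, fun x => by simp [hu]⟩
  have hsup : ∀ u ∈ L, ∀ v ∈ L, u ⊔ v ∈ L := by
    rintro u ⟨f, g, hf, hg, hu⟩ v ⟨f', g', hf', hg', hv⟩
    refine ⟨_, _, (hf.sum hg').sup (hf'.sum hg), hg.sum hg', fun x => ?_⟩
    rw [ContinuousMap.sup_apply, hu, hv, ← max_sub_sub_right]
    congr 1 <;> ring
  have hinf : ∀ u ∈ L, ∀ v ∈ L, u ⊓ v ∈ L := by
    intro u hu v hv
    have := hneg _ (hsup _ (hneg u hu) _ (hneg v hv))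
    rwa [← neg_inf, neg_neg] at this
  have hlin : ∀ (α β : ℝ) (y : V), ∃ u ∈ L, ∀ x : S, u x = α * inner ℝ (x : V) y + β := by
    intro α β y
    refine ⟨⟨fun x => α * inner ℝ (x : V) y + β, by fun_prop⟩, ?_, fun x => rfl⟩
    refine ⟨fun x => α * inner ℝ x y + max β 0 * ‖x‖, fun x => max (-β) 0 * ‖x‖, ?_, ?_, ?_⟩
    · refine Sublin.sum ?_ (Sublin.norm.mul (le_max_right _ _))
      have := Sublin.linear (α • (innerₛₗ ℝ y : V →ₗ[ℝ] ℝ))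
      simpa [real_inner_comm] using this
    · exact Sublin.norm.mul (le_max_right _ _)
    · intro x
      have hx : ‖(x : V)‖ = 1 := by simp
      simp only [ContinuousMap.coe_mk, hx]
      rcases le_total 0 β with h | h
      · rw [max_eq_left h, max_eq_right (by linarith)]; ring
      · rw [max_eq_right h, max_eq_left (by linarith)]; ring
  have hdense := ContinuousMap.sublattice_closure_eq_top L
    (let ⟨u, hu, _⟩ := hlin 0 0 0; ⟨u, hu⟩) hinf hsup (by
      intro v x y
      rcases eq_or_ne x y with rfl | hxy
      · obtain ⟨u, hu, h⟩ := hlin 0 (v x) 0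
        exact ⟨u, hu, by simp [h], by simp [h]⟩
      · have hx : ‖(x : V)‖ = 1 := by simp
        have hy : ‖(y : V)‖ = 1 := by simp
        have hlt : inner ℝ (y : V) x ≠ 1 := fun h => hxy
          (Subtype.ext ((inner_eq_one_iff_of_norm_eq_one hy hx).mp h).symm)
        set q := inner ℝ (y : V) x with hq
        obtain ⟨u, hu, h⟩ := hlin ((v x - v y) / (1 - q)) (v x - (v x - v y) / (1 - q)) x
        refine ⟨u, hu, ?_, ?_⟩
        · rw [h, real_inner_self_eq_norm_sq, hx]; ring
        · rw [h, ← hq]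
          have : 1 - q ≠ 0 := sub_ne_zero.mpr hlt.symm
          field_simp
          ring)
  let u : C(S, ℝ) := ⟨fun x => φ x, by fun_prop⟩
  have hu : u ∈ closure L := by rw [hdense]; trivial
  obtain ⟨v, ⟨f, g, hf, hg, hv⟩, hd⟩ := Metric.mem_closure_iff.mp hu ε hε
  refine ⟨f, g, hf, hg, fun x => ?_⟩
  rcases eq_or_ne x 0 with rfl | hx
  · have := hφ 0 le_rfl 0
    simp at this
    simp [this, hf.zero, hg.zero]
  have hx' : ‖x‖ ≠ 0 := norm_ne_zero_iff.mpr hx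
  have hmem : ‖x‖⁻¹ • x ∈ S := by
    simp [S, norm_smul, inv_mul_cancel₀ hx']
  have h1 := (u - v).norm_coe_le_norm ⟨_, hmem⟩
  rw [← dist_eq_norm] at h1
  have h2 : φ x = ‖x‖ * φ (‖x‖⁻¹ • x) := by
    rw [← hφ _ (norm_nonneg x), smul_smul, mul_inv_cancel₀ hx', one_smul]
  rw [h2, hf.norm_smul_unit x, hg.norm_smul_unit x, ← mul_sub, ← mul_sub, abs_mul, abs_norm,
    mul_comm]
  refine mul_le_mul_of_nonneg_right ?_ (norm_nonneg x)
  rw [ContinuousMap.sub_apply, hv] at h1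
  exact h1.trans hd.le

end lattice

section density
variable {V : Type*} [NormedAddCommGroup V] [InnerProductSpace ℝ V]

/-- Nonnegative combinations of support functions of planar convex bodies. -/
inductive PlanarSum {V : Type*} [NormedAddCommGroup V] [InnerProductSpace ℝ V] :
    (V → ℝ) → Prop
  | planar (a b : V) (g : EuclideanSpace ℝ (Fin 2) → ℝ) (hg : Sublin g) :
      PlanarSum fun x => g !₂[inner ℝ a x, inner ℝ b x]
  | sum (f g : V → ℝ) (hf : PlanarSum f) (hg : PlanarSum g) : PlanarSum fun x => f x + g x
  | mul (f : V → ℝ) (c : ℝ) (hc : 0 ≤ c) (hf : PlanarSum f) : PlanarSum fun x => c * f x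

/-- The linear map with coordinates `⟪a, ·⟫` and `⟪b, ·⟫`. -/
def planeMap (a b : V) : V →ₗ[ℝ] EuclideanSpace ℝ (Fin 2) where
  toFun x := !₂[inner ℝ a x, inner ℝ b x]
  map_add' x y := by ext i; fin_cases i <;> simp [inner_add_right]
  map_smul' t x := by ext i; fin_cases i <;> simp [inner_smul_right]

theorem planeMap_apply (a b x : V) : planeMap a b x = !₂[inner ℝ a x, inner ℝ b x] := rfl

theorem norm_planeMap_le (a b x : V) : ‖planeMap a b x‖ ≤ (‖a‖ + ‖b‖) * ‖x‖ := by
  rw [planeMap_apply, EuclideanSpace.norm_eq, Fin.sum_univ_two]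
  simp only [Matrix.cons_val_zero, Matrix.cons_val_one, Real.norm_eq_abs, sq_abs]
  refine Real.sqrt_le_iff.mpr ⟨by positivity, ?_⟩
  have h1 := abs_real_inner_le_norm a x
  have h2 := abs_real_inner_le_norm b x
  have h3 := sq_le_sq' (by linarith [neg_abs_le (inner ℝ a x : ℝ)]) ((le_abs_self _).trans h1)
  have h4 := sq_le_sq' (by linarith [neg_abs_le (inner ℝ b x : ℝ)]) ((le_abs_self _).trans h2)
  nlinarith [mul_nonneg (mul_nonneg (norm_nonneg a) (norm_nonneg b)) (sq_nonneg ‖x‖)]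

theorem PlanarSum.sublin {f : V → ℝ} (hf : PlanarSum f) : Sublin f := by
  induction hf with
  | planar a b g hg => exact hg.comp (planeMap a b)
  | sum f g _ _ hf hg => exact hf.sum hg
  | mul f c hc _ hf => exact hf.mul hc

theorem planarSum_zero : PlanarSum fun _ : V => (0 : ℝ) :=
  PlanarSum.planar 0 0 (fun _ => 0) ⟨by simp, by simp⟩

/-- The span of the planar support functions, restricted to the unit sphere. -/
def planarSpan (V : Type*) [NormedAddCommGroup V] [InnerProductSpace ℝ V] :
    Submodule ℝ C(Metric.sphere (0 : V) 1, ℝ) where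
  carrier := {u | ∃ f g, PlanarSum f ∧ PlanarSum g ∧ ∀ x, u x = f (x : V) - g (x : V)}
  zero_mem' := ⟨_, _, planarSum_zero, planarSum_zero, by simp⟩
  add_mem' := by
    rintro u v ⟨f, g, hf, hg, hu⟩ ⟨f', g', hf', hg', hv⟩
    refine ⟨_, _, hf.sum _ _ hf', hg.sum _ _ hg', fun x => ?_⟩
    rw [ContinuousMap.add_apply, hu, hv]; ring
  smul_mem' := by
    rintro c u ⟨f, g, hf, hg, hu⟩
    rcases le_total 0 c with h | h
    · refine ⟨_, _, hf.mul _ _ h, hg.mul _ _ h, fun x => ?_⟩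
      rw [ContinuousMap.smul_apply, hu, smul_eq_mul]; ring
    · refine ⟨_, _, hg.mul _ (-c) (by linarith), hf.mul _ (-c) (by linarith), fun x => ?_⟩
      rw [ContinuousMap.smul_apply, hu, smul_eq_mul]; ring

/-- The positive part of the coordinate `⟪a, ·⟫` on the sphere. -/
def posCoord (a : V) (ha : ‖a‖ ≤ 1) : C(Metric.sphere (0 : V) 1, Set.Icc (0 : ℝ) 1) where
  toFun x := ⟨max (inner ℝ a (x : V)) 0, le_max_right _ _, max_le (by
    have hx : ‖(x : V)‖ = 1 := by simp
    have := real_inner_le_norm a (x : V)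
    rw [hx, mul_one] at this
    linarith) zero_le_one⟩
  continuous_toFun := by
    refine Continuous.subtype_mk ?_ _
    fun_prop

theorem posCoord_coe (a : V) (ha : ‖a‖ ≤ 1) (x : Metric.sphere (0 : V) 1) :
    (posCoord a ha x : ℝ) = max (inner ℝ a (x : V)) 0 := rfl

/-- The function `s ↦ exp(-1/s²)` on the unit interval. -/
def expInvSq : C(Set.Icc (0 : ℝ) 1, ℝ) where
  toFun s := expNegInvGlue ((s : ℝ) ^ 2)
  continuous_toFun := by
    have : Continuous expNegInvGlue := (expNegInvGlue.contDiff (n := 0)).continuous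
    fun_prop

theorem expInvSq_apply (s : Set.Icc (0 : ℝ) 1) (hs : 0 < (s : ℝ)) :
    expInvSq s = Real.exp (-((s : ℝ) ^ 2)⁻¹) := by
  have : 0 < (s : ℝ) ^ 2 := by positivity
  exact if_neg this.not_ge

theorem expInvSq_injective : Function.Injective expInvSq := by
  have h0 : ∀ t : Set.Icc (0 : ℝ) 1, (t : ℝ) = 0 → expInvSq t = 0 := fun t ht => by
    simp [expInvSq, ht]
  have key : ∀ s t : Set.Icc (0 : ℝ) 1, 0 < (s : ℝ) → expInvSq s = expInvSq t → s = t := by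
    intro s t hs h
    rcases t.2.1.eq_or_lt with ht | ht
    · rw [expInvSq_apply s hs, h0 t ht.symm] at h
      exact absurd h (Real.exp_pos _).ne'
    · rw [expInvSq_apply s hs, expInvSq_apply t ht, Real.exp_eq_exp, neg_inj, inv_inj] at h
      exact Subtype.ext ((sq_eq_sq₀ s.2.1 t.2.1).mp h)
  intro s t h
  rcases s.2.1.eq_or_lt with hs | hs
  · rcases t.2.1.eq_or_lt with ht | ht
    · exact Subtype.ext (hs.symm.trans ht)
    · exact (key t s ht h.symm).symm
  · exact key s t hs h

/-- The map `φ ↦ s₊ φ(s₊)`, `s = ⟪a, ·⟫`. -/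
def posMul (a : V) (ha : ‖a‖ ≤ 1) (φ : C(Set.Icc (0 : ℝ) 1, ℝ)) :
    C(Metric.sphere (0 : V) 1, ℝ) :=
  (⟨Subtype.val, continuous_subtype_val⟩ * φ).comp (posCoord a ha)

theorem posMul_apply (a : V) (ha : ‖a‖ ≤ 1) (φ : C(Set.Icc (0 : ℝ) 1, ℝ))
    (x : Metric.sphere (0 : V) 1) :
    posMul a ha φ x = max (inner ℝ a (x : V)) 0 * φ (posCoord a ha x) := rfl

/-- Exponentials of linear functions on the sphere. -/
def expLin (a : V) : C(Metric.sphere (0 : V) 1, ℝ) where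
  toFun x := Real.exp (inner ℝ a (x : V))
  continuous_toFun := by fun_prop

theorem expLin_apply (a : V) (x : Metric.sphere (0 : V) 1) :
    expLin a x = Real.exp (inner ℝ a (x : V)) := rfl

theorem exists_exp_sub_one (R : ℝ) : ∃ φ : C(Set.Icc (0 : ℝ) 1, ℝ),
    ∀ s : Set.Icc (0 : ℝ) 1, (s : ℝ) * φ s = Real.exp (R * s) - 1 := by
  have hc : Continuous (dslope (fun s : ℝ => Real.exp (R * s)) 0) := by
    rw [← continuousOn_univ, continuousOn_dslope Filter.univ_mem]
    exact ⟨by fun_prop, by fun_prop⟩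
  refine ⟨⟨fun s => dslope (fun s : ℝ => Real.exp (R * s)) 0 s, by fun_prop⟩, fun s => ?_⟩
  have := sub_smul_dslope (fun s : ℝ => Real.exp (R * s)) 0 (s : ℝ)
  simpa using this

variable [FiniteDimensional ℝ V]

/-- The closure of `planarSpan`. -/
abbrev planarClosure (V : Type*) [NormedAddCommGroup V] [InnerProductSpace ℝ V]
    [FiniteDimensional ℝ V] : Submodule ℝ C(Metric.sphere (0 : V) 1, ℝ) :=
  (planarSpan V).topologicalClosure

theorem mem_planarClosure_of_homogeneous (a b : V) {φ : EuclideanSpace ℝ (Fin 2) → ℝ}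
    (hc : Continuous φ) (hφ : ∀ t : ℝ, 0 ≤ t → ∀ x, φ (t • x) = t * φ x)
    (u : C(Metric.sphere (0 : V) 1, ℝ)) (hu : ∀ x, u x = φ (planeMap a b x)) :
    u ∈ planarClosure V := by
  rw [← SetLike.mem_coe, Submodule.topologicalClosure_coe, Metric.mem_closure_iff]
  intro ε hε
  have hM : 0 < ‖a‖ + ‖b‖ + 1 := by positivity
  obtain ⟨f, g, hf, hg, h⟩ := exists_sublin_approx hc hφ (ε := ε / 2 / (‖a‖ + ‖b‖ + 1))
    (by positivity)
  have hpf := PlanarSum.planar a b f hf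
  have hpg := PlanarSum.planar a b g hg
  refine ⟨⟨fun x => f (planeMap a b x) - g (planeMap a b x), ?_⟩,
    ⟨_, _, hpf, hpg, fun x => rfl⟩, ?_⟩
  · have h1 : Continuous (planeMap a b) := (planeMap a b).continuous_of_finiteDimensional
    have h2 := hf.continuous
    have h3 := hg.continuous
    fun_prop
  · refine lt_of_le_of_lt ?_ (half_lt_self hε)
    rw [ContinuousMap.dist_le (by positivity)]
    intro x
    have hx : ‖(x : V)‖ = 1 := by simp
    rw [hu, Real.dist_eq]
    refine (h _).trans ?_
    have h1 := norm_planeMap_le a b x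
    rw [hx, mul_one] at h1
    calc _ ≤ ε / 2 / (‖a‖ + ‖b‖ + 1) * (‖a‖ + ‖b‖ + 1) := by gcongr; linarith
      _ = ε / 2 := by field_simp

/-- The positively homogeneous function `s₊ cos(ω t / s)`. -/
def cosHom (ω : ℝ) (y : EuclideanSpace ℝ (Fin 2)) : ℝ := max (y 0) 0 * Real.cos (ω * y 1 / y 0)

theorem cosHom_smul (ω : ℝ) (t : ℝ) (ht : 0 ≤ t) (y : EuclideanSpace ℝ (Fin 2)) :
    cosHom ω (t • y) = t * cosHom ω y := by
  rcases ht.eq_or_lt with rfl | h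
  · simp [cosHom]
  · have h1 : max (t * y 0) 0 = t * max (y 0) 0 := by rw [mul_max_of_nonneg _ _ ht, mul_zero]
    simp only [cosHom, PiLp.smul_apply, smul_eq_mul, h1, mul_left_comm ω t,
      mul_div_mul_left _ _ h.ne']
    ring

theorem cosHom_continuous (ω : ℝ) : Continuous (cosHom ω) := by
  rw [continuous_iff_continuousAt]
  intro y
  rcases lt_or_ge 0 (y 0) with h | h
  · have : ContinuousAt (fun z : EuclideanSpace ℝ (Fin 2) => ω * z 1 / z 0) y :=
      ContinuousAt.div (by fun_prop) (by fun_prop) h.ne'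
    exact ContinuousAt.mul (by fun_prop) (Real.continuous_cos.continuousAt.comp this)
  · have h0 : cosHom ω y = 0 := by rw [cosHom, max_eq_right h, zero_mul]
    rw [ContinuousAt, h0]
    refine squeeze_zero_norm (a := fun z : EuclideanSpace ℝ (Fin 2) => max (z 0) 0) (fun z => ?_) ?_
    · rw [cosHom, norm_mul, Real.norm_of_nonneg (le_max_right _ _)]
      exact mul_le_of_le_one_right (le_max_right _ _) (Real.abs_cos_le_one _)
    · have : ContinuousAt (fun z : EuclideanSpace ℝ (Fin 2) => max (z 0) 0) y := by fun_prop
      rw [ContinuousAt, max_eq_right h] at this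
      exact this

theorem integral_cos_inner [MeasurableSpace V] [BorelSpace V] (c : ℝ) {x : V} (hx : ‖x‖ = 1) :
    ∫ b, Real.cos (c * inner ℝ b x) ∂(ProbabilityTheory.stdGaussian V) =
      Real.exp (-(c ^ 2) / 2) := by
  have h := ProbabilityTheory.charFun_stdGaussian (c • x)
  have h2 := congrArg Complex.re h
  rw [charFun_apply] at h2
  have h3 : (∫ b, Complex.exp (inner ℝ b (c • x) * Complex.I) ∂(ProbabilityTheory.stdGaussian V)).re
      = ∫ b, (Complex.exp (inner ℝ b (c • x) * Complex.I)).re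
        ∂(ProbabilityTheory.stdGaussian V) := by
    refine (integral_re (𝕜 := ℂ) ?_).symm
    refine Integrable.of_bound (C := 1) ?_ ?_
    · refine Continuous.aestronglyMeasurable ?_
      fun_prop
    · filter_upwards with b
      rw [Complex.norm_exp_ofReal_mul_I]
  rw [h3] at h2
  simp only [Complex.exp_ofReal_mul_I_re, inner_smul_right, norm_smul, hx] at h2
  rw [h2]
  have : (-(((‖c‖ * 1 : ℝ)) : ℂ) ^ 2 / 2) = ((-(c ^ 2) / 2 : ℝ) : ℂ) := by
    push_cast
    rw [← Complex.ofReal_pow, mul_one, Real.norm_eq_abs, ← Complex.ofReal_pow, sq_abs]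
  rw [this, ← Complex.ofReal_exp, Complex.ofReal_re]

theorem posMul_pow_mem (a : V) (ha : ‖a‖ ≤ 1) (k : ℕ) :
    posMul a ha (expInvSq ^ k) ∈ planarClosure V := by
  borelize V
  let S := Metric.sphere (0 : V) 1
  have hcont : Continuous fun q : V × S => cosHom (√(2 * k)) (planeMap a q.1 q.2) := by
    refine (cosHom_continuous _).comp ?_
    have : Continuous fun q : V × S => (planeMap a q.1 (q.2 : V) : Fin 2 → ℝ) := by
      refine continuous_pi fun i => ?_
      fin_cases i
      · change Continuous fun q : V × S => (inner ℝ a (q.2 : V) : ℝ)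
        fun_prop
      · change Continuous fun q : V × S => (inner ℝ q.1 (q.2 : V) : ℝ)
        fun_prop
    exact (PiLp.continuous_toLp 2 (fun _ : Fin 2 => ℝ)).comp this
  let Ψ : C(V, C(S, ℝ)) := ContinuousMap.curry ⟨_, hcont⟩
  have hΨ : ∀ b x, Ψ b x = cosHom (√(2 * k)) (planeMap a b x) := fun b x => rfl
  have hbd : ∀ b, ‖Ψ b‖ ≤ 1 := by
    intro b
    rw [ContinuousMap.norm_le _ zero_le_one]
    intro x
    rw [hΨ, cosHom, norm_mul, Real.norm_of_nonneg (le_max_right _ _)]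
    have h1 : max ((planeMap a b (x : V)) 0) 0 ≤ 1 := (posCoord a ha x).2.2
    exact mul_le_one₀ h1 (norm_nonneg _) (Real.abs_cos_le_one _)
  have hInt : Integrable Ψ (ProbabilityTheory.stdGaussian V) :=
    Integrable.of_bound Ψ.continuous.aestronglyMeasurable 1 (Filter.Eventually.of_forall hbd)
  have hmem := Convex.integral_mem (μ := ProbabilityTheory.stdGaussian V)
    (planarClosure V).convex (planarSpan V).isClosed_topologicalClosure
    (f := Ψ) (Filter.Eventually.of_forall fun b =>
      mem_planarClosure_of_homogeneous a b (cosHom_continuous _) (cosHom_smul _) _ (hΨ b)) hInt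
  suffices h : posMul a ha (expInvSq ^ k) = ∫ b, Ψ b ∂(ProbabilityTheory.stdGaussian V) by
    rw [h]; exact hmem
  ext x
  have hev := (ContinuousMap.evalCLM ℝ x).integral_comp_comm hInt
  change ∫ b, Ψ b x ∂_ = (∫ b, Ψ b ∂_) x at hev
  rw [← hev, posMul_apply]
  simp only [hΨ, cosHom]
  have e0 : ∀ b, planeMap a b (x : V) 0 = inner ℝ a (x : V) := fun b => rfl
  have e1 : ∀ b, planeMap a b (x : V) 1 = inner ℝ b (x : V) := fun b => rfl
  simp only [e0, e1, integral_const_mul]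
  rcases le_or_gt (inner ℝ a (x : V)) 0 with h | h
  · rw [max_eq_right h, zero_mul, zero_mul]
  congr 1
  have hx : ‖(x : V)‖ = 1 := by simp
  have := integral_cos_inner (√(2 * k) / inner ℝ a (x : V)) hx
  simp only [div_mul_eq_mul_div] at this
  rw [this, ContinuousMap.pow_apply, expInvSq_apply, ← Real.exp_nat_mul, posCoord_coe,
    max_eq_left h.le]
  · congr 1
    rw [div_pow, Real.sq_sqrt (by positivity)]
    field_simp
  · rw [posCoord_coe]; exact lt_max_of_lt_left h

theorem posMul_mem (a : V) (ha : ‖a‖ ≤ 1) (φ : C(Set.Icc (0 : ℝ) 1, ℝ)) :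
    posMul a ha φ ∈ planarClosure V := by
  let P : Submodule ℝ C(Set.Icc (0 : ℝ) 1, ℝ) :=
    { carrier := {φ | posMul a ha φ ∈ planarClosure V}
      zero_mem' := by
        have : posMul a ha 0 = 0 := by ext x; simp [posMul_apply]
        simp [this]
      add_mem' := fun {u v} hu hv => by
        have : posMul a ha (u + v) = posMul a ha u + posMul a ha v := by
          ext x; simp [posMul_apply, mul_add]
        simpa [this] using add_mem hu hv
      smul_mem' := fun c u hu => by
        have : posMul a ha (c • u) = c • posMul a ha u := by
          ext x; simp [posMul_apply, mul_left_comm]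
        simpa [this] using Submodule.smul_mem _ c hu }
  have hcl : IsClosed (P : Set C(Set.Icc (0 : ℝ) 1, ℝ)) := by
    refine (planarSpan V).isClosed_topologicalClosure.preimage (f := posMul a ha) ?_
    exact (ContinuousMap.continuous_precomp _).comp (continuous_const.mul continuous_id)
  let A := Algebra.adjoin ℝ {expInvSq}
  have hA : (A : Set C(Set.Icc (0 : ℝ) 1, ℝ)) ⊆ P := by
    intro u hu
    have h1 : u ∈ Subalgebra.toSubmodule A := hu
    rw [Algebra.adjoin_eq_span] at h1
    refine Submodule.span_le.mpr ?_ h1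
    rintro _ hv
    obtain ⟨k, rfl⟩ := Submonoid.mem_closure_singleton.mp hv
    exact posMul_pow_mem a ha k
  have hsep : A.SeparatesPoints := fun x y hxy =>
    ⟨expInvSq, ⟨_, Algebra.self_mem_adjoin_singleton ℝ _, rfl⟩, fun h => hxy (expInvSq_injective h)⟩
  have htop := ContinuousMap.subalgebra_topologicalClosure_eq_top_of_separatesPoints A hsep
  have : φ ∈ A.topologicalClosure := by rw [htop]; trivial
  exact closure_minimal hA hcl this

theorem one_mem_planarClosure : (1 : C(Metric.sphere (0 : V) 1, ℝ)) ∈ planarClosure V := by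
  let e := stdOrthonormalBasis ℝ V
  let idI : C(Set.Icc (0 : ℝ) 1, ℝ) := ⟨Subtype.val, continuous_subtype_val⟩
  have hmem : ∑ i, (posMul (e i) (e.norm_eq_one i).le idI +
      posMul (-(e i)) (by simp) idI) ∈ planarClosure V :=
    Submodule.sum_mem _ fun i _ => add_mem (posMul_mem _ _ _) (posMul_mem _ _ _)
  convert hmem using 1
  ext x
  have hx : ‖(x : V)‖ = 1 := by simp
  have h2 := e.sum_sq_norm_inner_right (x : V)
  rw [hx, one_pow] at h2
  rw [ContinuousMap.one_apply, ContinuousMap.sum_apply]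
  refine h2.symm.trans ?_
  refine Finset.sum_congr rfl fun i _ => ?_
  rw [ContinuousMap.add_apply, posMul_apply, posMul_apply]
  change _ = _ * max (inner ℝ (e i) (x : V)) 0 + _ * max (inner ℝ (-(e i)) (x : V)) 0
  rw [inner_neg_left, Real.norm_eq_abs, sq_abs]
  rcases le_total (inner ℝ (e i) (x : V)) 0 with h | h
  · rw [max_eq_right h, max_eq_left (by linarith)]; ring
  · rw [max_eq_left h, max_eq_right (by linarith)]; ring

theorem expLin_mem (a : V) : expLin a ∈ planarClosure V := by
  rcases eq_or_ne a 0 with rfl | ha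
  · convert one_mem_planarClosure (V := V) using 1
    ext x; simp [expLin_apply]
  obtain ⟨φ, hφ⟩ := exists_exp_sub_one ‖a‖
  obtain ⟨ψ, hψ⟩ := exists_exp_sub_one (-‖a‖)
  have h1 := norm_unit_le a
  have hmem := add_mem (add_mem (posMul_mem _ h1 φ)
    (posMul_mem (-(‖a‖⁻¹ • a)) (by rwa [norm_neg]) ψ)) (one_mem_planarClosure (V := V))
  convert hmem using 1
  ext x
  have h2 : ‖-(‖a‖⁻¹ • a)‖ ≤ 1 := by rwa [norm_neg]
  rw [ContinuousMap.add_apply, ContinuousMap.add_apply, posMul_apply, posMul_apply,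
    ← posCoord_coe _ h1, ← posCoord_coe _ h2, hφ, hψ, posCoord_coe, posCoord_coe, expLin_apply,
    ContinuousMap.one_apply]
  have hxa : (inner ℝ a (x : V) : ℝ) = ‖a‖ * inner ℝ (‖a‖⁻¹ • a) (x : V) := by
      rw [real_inner_smul_left, ← mul_assoc, mul_inv_cancel₀ (norm_ne_zero_iff.mpr ha), one_mul]
  rw [hxa, inner_neg_left]
  rcases le_total (inner ℝ (‖a‖⁻¹ • a) (x : V)) 0 with h | h
  · rw [max_eq_right h, max_eq_left (by linarith)]; simp
  · rw [max_eq_left h, max_eq_right (by linarith)]; simp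

theorem planarClosure_eq_top : planarClosure V = ⊤ := by
  let M : Submonoid C(Metric.sphere (0 : V) 1, ℝ) :=
    { carrier := Set.range expLin
      one_mem' := ⟨0, by ext x; simp [expLin_apply]⟩
      mul_mem' := by
        rintro _ _ ⟨a, rfl⟩ ⟨b, rfl⟩
        exact ⟨a + b, by ext x; simp [expLin_apply, inner_add_left, Real.exp_add]⟩ }
  let A := Algebra.adjoin ℝ (M : Set C(Metric.sphere (0 : V) 1, ℝ))
  have hA : Subalgebra.toSubmodule A ≤ planarClosure V := by
    rw [Algebra.adjoin_eq_span, Submonoid.closure_eq]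
    refine Submodule.span_le.mpr ?_
    rintro _ ⟨a, rfl⟩
    exact expLin_mem a
  have hsep : A.SeparatesPoints := by
    intro x y hxy
    refine ⟨expLin ((x : V) - y), ⟨_, Algebra.subset_adjoin ⟨_, rfl⟩, rfl⟩, fun h => hxy ?_⟩
    rw [expLin_apply, expLin_apply, Real.exp_eq_exp, ← sub_eq_zero, ← inner_sub_right,
      inner_self_eq_zero, sub_eq_zero] at h
    exact Subtype.ext h
  have htop := ContinuousMap.subalgebra_topologicalClosure_eq_top_of_separatesPoints A hsep
  rw [eq_top_iff]
  intro u _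
  have hu : u ∈ A.topologicalClosure := by rw [htop]; trivial
  exact closure_minimal (fun v hv => hA hv) (planarSpan V).isClosed_topologicalClosure hu

/-- Differences of planar sums approximate every sublinear function. -/
theorem Sublin.exists_planar_approx {h : V → ℝ} (hh : Sublin h) {ε : ℝ} (hε : 0 < ε) :
    ∃ f g : V → ℝ, PlanarSum f ∧ PlanarSum g ∧ ∀ x, |h x - (f x - g x)| ≤ ε * ‖x‖ := by
  have hc := hh.continuous
  let u : C(Metric.sphere (0 : V) 1, ℝ) := ⟨fun x => h x, by fun_prop⟩
  have hu : u ∈ planarClosure V := by rw [planarClosure_eq_top]; trivial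
  rw [← SetLike.mem_coe, Submodule.topologicalClosure_coe, Metric.mem_closure_iff] at hu
  obtain ⟨v, ⟨f, g, hf, hg, hv⟩, hd⟩ := hu ε hε
  refine ⟨f, g, hf, hg, fun x => ?_⟩
  rcases eq_or_ne x 0 with rfl | hx
  · simp [hh.zero, hf.sublin.zero, hg.sublin.zero]
  have hx' : ‖x‖ ≠ 0 := norm_ne_zero_iff.mpr hx
  have hmem : ‖x‖⁻¹ • x ∈ Metric.sphere (0 : V) 1 := by
    simp [norm_smul, inv_mul_cancel₀ hx']
  have h1 := (u - v).norm_coe_le_norm ⟨_, hmem⟩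
  rw [← dist_eq_norm] at h1
  rw [hh.norm_smul_unit x, hf.sublin.norm_smul_unit x, hg.sublin.norm_smul_unit x, ← mul_sub,
    ← mul_sub, abs_mul, abs_norm, mul_comm]
  refine mul_le_mul_of_nonneg_right ?_ (norm_nonneg x)
  rw [ContinuousMap.sub_apply, hv] at h1
  exact h1.trans hd.le

end density

section planarVanishing
variable {V : Type*} [NormedAddCommGroup V] [InnerProductSpace ℝ V]

/-- The linear map sending the basis vectors `e i` to `g i`. -/
def frameMap {N : ℕ} (e g : Fin N → V) : V →ₗ[ℝ] V :=
  ∑ i, (innerₛₗ ℝ (e i) : V →ₗ[ℝ] ℝ).smulRight (g i)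

theorem frameMap_apply {N : ℕ} (e g : Fin N → V) (x : V) :
    frameMap e g x = ∑ i, (inner ℝ (e i) x : ℝ) • g i := by
  simp [frameMap]

theorem inner_frameMap {N : ℕ} (e g : Fin N → V) (x y : V) :
    (inner ℝ x (frameMap e g y) : ℝ) = inner ℝ (frameMap g e x) y := by
  simp only [frameMap_apply, inner_sum, sum_inner, inner_smul_right, real_inner_smul_left]
  refine Finset.sum_congr rfl fun i _ => ?_
  rw [real_inner_comm x, mul_comm]

theorem frameMap_isometry {N : ℕ} (e g : Fin N → V) (k : V ≃ₗᵢ[ℝ] V) (x : V) :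
    frameMap (fun i => k (g i)) e (k x) = frameMap g e x := by
  simp [frameMap_apply, LinearIsometryEquiv.inner_map_map]

theorem continuous_frameMap {N : ℕ} (e : Fin N → V) :
    Continuous fun q : (Fin N → V) × V => frameMap q.1 e q.2 := by
  simp only [frameMap_apply]
  fun_prop

theorem exists_isometry_apply_eq {x y : V} (h : ‖x‖ = ‖y‖) : ∃ k : V ≃ₗᵢ[ℝ] V, k x = y :=
  ⟨_, Submodule.reflection_sub h⟩

variable [FiniteDimensional ℝ V]

theorem body_comp_adjoint {f : V → ℝ} (hf : Sublin f) {L L' : V →ₗ[ℝ] V}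
    (hL : ∀ x y, (inner ℝ x (L y) : ℝ) = inner ℝ (L' x) y) :
    body (fun x => f (L' x)) = L '' body f := by
  refine Set.Subset.antisymm (fun z hz => ?_) ?_
  · by_contra h
    obtain ⟨x, u, h1, h2⟩ := exists_inner_separation ((body_cc hf).image L) h
    obtain ⟨y, hy, hy'⟩ := hf.exists_mem_body (L' x)
    have h3 := h1 _ (Set.mem_image_of_mem L hy)
    rw [hL, hy'] at h3
    linarith [hz x]
  · rintro _ ⟨y, hy, rfl⟩ x
    rw [hL]
    exact hy _

/-- Continuous functions of `N` vectors whose orbit under the orthogonal group spans a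
finite-dimensional space. -/
def orbitAlg (V : Type*) [NormedAddCommGroup V] [InnerProductSpace ℝ V] (N : ℕ) :
    Subalgebra ℝ C(Fin N → V, ℝ) where
  carrier := {p | ∃ (J : Type) (_ : Fintype J) (m : J → (V ≃ₗᵢ[ℝ] V) → ℝ)
    (q : J → C(Fin N → V, ℝ)), ∀ k g, p (fun i => k (g i)) = ∑ j, m j k * q j g}
  mul_mem' := by
    rintro u v ⟨J, _, m, q, h⟩ ⟨J', _, m', q', h'⟩
    refine ⟨J × J', inferInstance, fun j k => m j.1 k * m' j.2 k, fun j => q j.1 * q' j.2,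
      fun k g => ?_⟩
    rw [ContinuousMap.mul_apply, h, h', Finset.sum_mul_sum, Fintype.sum_prod_type]
    refine Finset.sum_congr rfl fun i _ => Finset.sum_congr rfl fun j _ => ?_
    rw [ContinuousMap.mul_apply]; ring
  add_mem' := by
    rintro u v ⟨J, _, m, q, h⟩ ⟨J', _, m', q', h'⟩
    refine ⟨J ⊕ J', inferInstance, Sum.elim m m', Sum.elim q q', fun k g => ?_⟩
    rw [ContinuousMap.add_apply, h, h', Fintype.sum_sum_type]
    rfl
  algebraMap_mem' c := ⟨Unit, inferInstance, fun _ _ => c, fun _ => 1, by simp⟩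

theorem orbitAlg_separatesPoints (N : ℕ) : (orbitAlg V N).SeparatesPoints := by
  intro g g' hg
  obtain ⟨i, hi⟩ := Function.ne_iff.mp hg
  let e := stdOrthonormalBasis ℝ V
  obtain ⟨j, hj⟩ : ∃ j, (inner ℝ (e j) (g i) : ℝ) ≠ inner ℝ (e j) (g' i) := by
    by_contra! h
    exact hi (InnerProductSpace.ext_inner_left_basis e.toBasis fun j => by simpa using h j)
  refine ⟨fun g => inner ℝ (e j) (g i), ⟨⟨fun g => inner ℝ (e j) (g i), by fun_prop⟩, ?_, rfl⟩, hj⟩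
  refine ⟨_, inferInstance, fun l k => inner ℝ (e j) (k (e l)),
    fun l => ⟨fun g => inner ℝ (e l) (g i), by fun_prop⟩, fun k g => ?_⟩
  change (inner ℝ (e j) (k (g i)) : ℝ) = ∑ l, inner ℝ (e j) (k (e l)) * inner ℝ (e l) (g i)
  conv_lhs => rw [← e.sum_repr (g i)]
  simp only [map_sum, map_smul, inner_sum, inner_smul_right, e.repr_apply_apply]
  exact Finset.sum_congr rfl fun l _ => mul_comm _ _

/-- A planar body lies in the plane of its defining vectors. -/
theorem body_planar_subset (a b : V) (g : EuclideanSpace ℝ (Fin 2) → ℝ) (hg : Sublin g) :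
    body (fun x => g !₂[inner ℝ a x, inner ℝ b x]) ⊆ Submodule.span ℝ {a, b} := by
  intro y hy
  rw [SetLike.mem_coe, ← Submodule.orthogonal_orthogonal (Submodule.span ℝ {a, b}),
    Submodule.mem_orthogonal]
  intro x hx
  have h1 : ∀ t : ℝ, (inner ℝ (t • x) y : ℝ) ≤ 0 := by
    intro t
    have ha : (inner ℝ a x : ℝ) = 0 :=
      Submodule.inner_right_of_mem_orthogonal (Submodule.subset_span (by simp)) hx
    have hb : (inner ℝ b x : ℝ) = 0 :=
      Submodule.inner_right_of_mem_orthogonal (Submodule.subset_span (by simp)) hx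
    refine (hy (t • x)).trans_eq ?_
    have : (!₂[inner ℝ a (t • x), inner ℝ b (t • x)] : EuclideanSpace ℝ (Fin 2)) = 0 := by
      ext i; fin_cases i <;> simp [inner_smul_right, ha, hb]
    exact (congrArg g this).trans hg.zero
  have h2 := h1 1
  have h3 := h1 (-1)
  rw [real_inner_smul_left] at h2 h3
  linarith

theorem Val.planarSum_eq_zero {T : Set V → ℂ} (hT : Val T)
    (h2 : ∀ A, CC A → T ((2 : ℝ) • A) = 2 * T A)
    (hpl : ∀ a b : V, ∀ A, CC A → A ⊆ Submodule.span ℝ {a, b} → T A = 0) {f : V → ℝ}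
    (hf : PlanarSum f) (L : V →ₗ[ℝ] V) : T (L '' body f) = 0 := by
  induction hf with
  | planar a b g hg =>
    refine hpl (L a) (L b) _ ((body_cc (hg.comp (planeMap a b))).image L) ?_
    have := Set.image_mono (f := L) (body_planar_subset a b g hg)
    rwa [← Submodule.map_coe, Submodule.map_span, Set.image_pair] at this
  | sum f g hf hg ihf ihg =>
    rw [body_add hf.sublin hg.sublin, Set.image_add,
      hT.minkowski_add h2 ((body_cc hf.sublin).image L) ((body_cc hg.sublin).image L)
        ((body_nonempty hf.sublin).image L) ((body_nonempty hg.sublin).image L), ihf, ihg, add_zero]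
  | mul f c hc hf ih =>
    rw [body_mul hf.sublin hc, image_smul_set,
      hT.smul_of_double h2 ((body_cc hf.sublin).image L) ((body_nonempty hf.sublin).image L) hc,
      ih, mul_zero]

variable {N : ℕ} [MeasurableSpace V] [BorelSpace V]

/-- Averages of a function over linear images. -/
def frameAvg (e : Fin N → V) (p : (Fin N → V) → ℝ) (h : V → ℝ) (x : V) : ℝ :=
  letI := measureSpaceOfInnerProductSpace (E := V)
  ∫ g in Metric.closedBall (0 : Fin N → V) 2, p g * h (frameMap g e x)

theorem frameAvg_isometry (e : Fin N → V) (p : (Fin N → V) → ℝ) (h : V → ℝ) (k : V ≃ₗᵢ[ℝ] V)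
    (x : V) : frameAvg e p h (k x) = frameAvg e (fun g => p fun i => k (g i)) h x := by
  let := measureSpaceOfInnerProductSpace (E := V)
  let κ : (Fin N → V) ≃ᵐ (Fin N → V) := MeasurableEquiv.piCongrRight fun _ =>
    k.toHomeomorph.toMeasurableEquiv
  have hκ : MeasurePreserving κ (volume : Measure (Fin N → V)) volume :=
    measurePreserving_pi _ _ fun _ => k.measurePreserving
  have := hκ.setIntegral_preimage_emb κ.measurableEmbedding
    (fun g => p g * h (frameMap g e (k x))) (Metric.closedBall (0 : Fin N → V) 2)
  have hpre : κ ⁻¹' Metric.closedBall (0 : Fin N → V) 2 = Metric.closedBall 0 2 := by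
    ext g
    rw [Set.mem_preimage, mem_closedBall_zero_iff, mem_closedBall_zero_iff,
      pi_norm_le_iff_of_nonneg zero_le_two, pi_norm_le_iff_of_nonneg zero_le_two]
    exact forall_congr' fun i => by rw [← k.norm_map (g i)]; rfl
  rw [hpre] at this
  rw [frameAvg, ← this, frameAvg]
  refine integral_congr_ae (Filter.Eventually.of_forall fun g => ?_)
  change p (fun i => k (g i)) * h (frameMap (fun i => k (g i)) e (k x)) = _
  rw [frameMap_isometry]

theorem Val.frameAvg {T : Set V → ℂ} (hT : Val T) (h2 : ∀ A, CC A → T ((2 : ℝ) • A) = 2 * T A)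
    (e : Fin N → V) {p : (Fin N → V) → ℝ} (hp : Continuous p) (hp0 : ∀ g, 0 ≤ p g) {h : V → ℝ}
    (hh : Sublin h) :
    letI := measureSpaceOfInnerProductSpace (E := V)
    Sublin (frameAvg e p h) ∧ T (body (frameAvg e p h)) =
      ∫ g in Metric.closedBall (0 : Fin N → V) 2, p g * T (frameMap e g '' body h) := by
  let := measureSpaceOfInnerProductSpace (E := V)
  have hs : ∀ g : Fin N → V, Sublin fun x => h (frameMap g e x) := fun g => hh.comp _
  have hcont : Continuous fun q : (Fin N → V) × V => p q.1 * h (frameMap q.1 e q.2) :=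
    (hp.comp continuous_fst).mul (hh.continuous.comp (continuous_frameMap e))
  obtain ⟨h3, h4⟩ := hT.integral_body h2 (ν := (volume : Measure (Fin N → V)))
    (isCompact_closedBall 0 2)
    (F := fun g x => p g * h (frameMap g e x)) (fun g => (hs g).mul (hp0 g)) hcont
  refine ⟨h3, h4.trans ?_⟩
  congr 1
  ext g
  rw [body_mul (hs g) (hp0 g), hT.smul_of_double h2 (body_cc (hs g)) (body_nonempty (hs g)) (hp0 g),
    body_comp_adjoint hh fun x y => inner_frameMap e g x y]

theorem frameAvg_integrable (e : Fin N → V) (p : C(Fin N → V, ℝ)) {h : V → ℝ} (hh : Continuous h)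
    (x : V) :
    letI := measureSpaceOfInnerProductSpace (E := V)
    IntegrableOn (fun g => p g * h (frameMap g e x)) (Metric.closedBall (0 : Fin N → V) 2) := by
  let := measureSpaceOfInnerProductSpace (E := V)
  refine ContinuousOn.integrableOn_compact (isCompact_closedBall 0 2) (Continuous.continuousOn ?_)
  have h1 : Continuous fun g : Fin N → V => frameMap g e x :=
    (continuous_frameMap e).comp (continuous_id.prodMk continuous_const)
  exact p.continuous.mul (hh.comp h1)

/-- The value of `frameAvg` at a point, as a linear functional. -/
def frameAvgLinear (e : Fin N → V) (p : C(Fin N → V, ℝ)) (x : V) : C(V, ℝ) →ₗ[ℝ] ℝ where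
  toFun u := frameAvg e p u x
  map_add' u v := by
    simp only [frameAvg, ContinuousMap.add_apply, mul_add]
    exact integral_add (frameAvg_integrable e p u.continuous x)
      (frameAvg_integrable e p v.continuous x)
  map_smul' c u := by
    simp only [frameAvg, ContinuousMap.smul_apply, smul_eq_mul, mul_left_comm _ c]
    exact integral_const_mul _ _

theorem frameAvg_sum {J : Type} [Fintype J] (e : Fin N → V) (c : J → ℝ)
    (q : J → C(Fin N → V, ℝ)) {h : V → ℝ} (hh : Continuous h) (x : V) :
    frameAvg e (fun g => ∑ j, c j * q j g) h x = ∑ j, c j * frameAvg e (q j) h x := by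
  simp only [frameAvg, Finset.sum_mul, mul_assoc]
  rw [integral_finsetSum _ fun j _ => (frameAvg_integrable e (q j) hh x).const_mul (c j)]
  simp only [integral_const_mul]

theorem frameAvg_smul (e : Fin N → V) (p : (Fin N → V) → ℝ) {h : V → ℝ} (hh : Sublin h) {r : ℝ}
    (hr : 0 ≤ r) (x : V) : frameAvg e p h (r • x) = r * frameAvg e p h x := by
  simp only [frameAvg, map_smul, hh.smul r hr, mul_left_comm _ r]
  exact integral_const_mul _ _

theorem frameAvg_bound (e : Fin N → V) (p : C(Fin N → V, ℝ)) (x : V) : ∃ C : ℝ, ∀ (u : V → ℝ)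
    (δ : ℝ), 0 ≤ δ → (∀ y, |u y| ≤ δ * ‖y‖) → |frameAvg e p u x| ≤ δ * C := by
  let := measureSpaceOfInnerProductSpace (E := V)
  refine ⟨∫ g in Metric.closedBall (0 : Fin N → V) 2, |p g| * ‖frameMap g e x‖,
    fun u δ hδ hu => ?_⟩
  have hInt := frameAvg_integrable e ⟨fun g => |p g|, by fun_prop⟩ continuous_norm x
  rw [← integral_const_mul, ← Real.norm_eq_abs, frameAvg]
  refine norm_integral_le_of_norm_le (hInt.const_mul δ) (Filter.Eventually.of_forall fun g => ?_)
  rw [norm_mul, Real.norm_eq_abs, Real.norm_eq_abs]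
  have := mul_le_mul_of_nonneg_left (hu (frameMap g e x)) (abs_nonneg (p g))
  change _ ≤ δ * (|p g| * _)
  linarith

/-- Averages of sublinear functions are averages of differences of planar sums. -/
theorem Sublin.exists_frameAvg_eq [Nontrivial V] (e : Fin N → V) {p : C(Fin N → V, ℝ)}
    (hp : p ∈ orbitAlg V N) {h : V → ℝ} (hh : Sublin h) :
    ∃ f g, PlanarSum f ∧ PlanarSum g ∧
      ∀ x, frameAvg e p h x + frameAvg e p g x = frameAvg e p f x := by
  obtain ⟨J, _, m, q, hmq⟩ := hp
  obtain ⟨e0, he0⟩ := exists_norm_eq V zero_le_one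
  let Λ : C(V, ℝ) →ₗ[ℝ] (J → ℝ) := LinearMap.pi fun j => frameAvgLinear e (q j) e0
  let P : Submodule ℝ C(V, ℝ) :=
    { carrier := {u | ∃ f g, PlanarSum f ∧ PlanarSum g ∧ ∀ x, u x = f x - g x}
      zero_mem' := ⟨_, _, planarSum_zero, planarSum_zero, by simp⟩
      add_mem' := by
        rintro u v ⟨f, g, hf, hg, hu⟩ ⟨f', g', hf', hg', hv⟩
        refine ⟨_, _, hf.sum _ _ hf', hg.sum _ _ hg', fun x => ?_⟩
        rw [ContinuousMap.add_apply, hu, hv]; ring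
      smul_mem' := by
        rintro c u ⟨f, g, hf, hg, hu⟩
        rcases le_total 0 c with h | h
        · refine ⟨_, _, hf.mul _ _ h, hg.mul _ _ h, fun x => ?_⟩
          rw [ContinuousMap.smul_apply, hu, smul_eq_mul]; ring
        · refine ⟨_, _, hg.mul _ (-c) (by linarith), hf.mul _ (-c) (by linarith), fun x => ?_⟩
          rw [ContinuousMap.smul_apply, hu, smul_eq_mul]; ring }
  let u : C(V, ℝ) := ⟨h, hh.continuous⟩
  have hmem : Λ u ∈ closure (P.map Λ : Set (J → ℝ)) := by
    choose C hC using fun j => frameAvg_bound e (q j) e0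
    let D := ∑ j, |C j|
    have hCD : ∀ j, C j ≤ D := fun j => (le_abs_self _).trans
      (Finset.single_le_sum (f := fun j => |C j|) (fun _ _ => abs_nonneg _) (Finset.mem_univ j))
    have hD : 0 ≤ D := Finset.sum_nonneg fun _ _ => abs_nonneg _
    rw [Metric.mem_closure_iff]
    intro ε hε
    obtain ⟨f, g, hf, hg, hfg⟩ := hh.exists_planar_approx (ε := ε / 2 / (D + 1)) (by positivity)
    let v : C(V, ℝ) := ⟨fun x => f x - g x, hf.sublin.continuous.sub hg.sublin.continuous⟩
    refine ⟨Λ v, ⟨v, ⟨f, g, hf, hg, fun x => rfl⟩, rfl⟩, ?_⟩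
    refine lt_of_le_of_lt ?_ (half_lt_self hε)
    rw [dist_eq_norm, ← map_sub, pi_norm_le_iff_of_nonneg (by positivity)]
    intro j
    refine (hC j (u - v : C(V, ℝ)) (ε / 2 / (D + 1)) (by positivity) hfg).trans ?_
    calc ε / 2 / (D + 1) * C j ≤ ε / 2 / (D + 1) * (D + 1) := by
          gcongr; linarith [hCD j]
      _ = ε / 2 := by field_simp
  rw [(Submodule.closed_of_finiteDimensional (P.map Λ)).closure_eq] at hmem
  obtain ⟨v, ⟨f, g, hf, hg, hv⟩, hΛ⟩ := hmem
  have hfc := hf.sublin.continuous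
  have hgc := hg.sublin.continuous
  have hsum : ∀ j, frameAvg e (q j) h e0 + frameAvg e (q j) g e0 = frameAvg e (q j) f e0 := by
    intro j
    have hv' : v = (⟨f, hfc⟩ : C(V, ℝ)) - ⟨g, hgc⟩ := by ext x; exact hv x
    have h1 := congrFun hΛ j
    rw [hv', map_sub] at h1
    change frameAvg e (q j) f e0 - frameAvg e (q j) g e0 = frameAvg e (q j) h e0 at h1
    linarith
  refine ⟨f, g, hf, hg, fun x => ?_⟩
  have key : ∀ w : V → ℝ, Sublin w → ∀ k : V ≃ₗᵢ[ℝ] V, ‖x‖ • k e0 = x →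
      frameAvg e p w x = ‖x‖ * ∑ j, m j k * frameAvg e (q j) w e0 := by
    intro w hw k hk
    rw [← frameAvg_sum e _ _ hw.continuous]
    conv_lhs => rw [← hk]
    rw [frameAvg_smul e _ hw (norm_nonneg x), frameAvg_isometry]
    simp only [hmq]
  obtain ⟨k, hk⟩ : ∃ k : V ≃ₗᵢ[ℝ] V, ‖x‖ • k e0 = x := by
    rcases eq_or_ne x 0 with rfl | hx
    · exact ⟨LinearIsometryEquiv.refl ℝ V, by simp⟩
    · have hx' := norm_ne_zero_iff.mpr hx
      obtain ⟨k, hk⟩ := exists_isometry_apply_eq (x := e0) (y := ‖x‖⁻¹ • x) (by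
        rw [he0, norm_smul, norm_inv, norm_norm, inv_mul_cancel₀ hx'])
      exact ⟨k, by rw [hk, smul_smul, mul_inv_cancel₀ hx', one_smul]⟩
  rw [key h hh k hk, key f hf.sublin k hk, key g hg.sublin k hk, ← mul_add,
    ← Finset.sum_add_distrib]
  simp only [← mul_add, hsum]

theorem Val.integral_frameMap_eq_zero [Nontrivial V] {T : Set V → ℂ} (hT : Val T)
    (h2 : ∀ A, CC A → T ((2 : ℝ) • A) = 2 * T A)
    (hpl : ∀ a b : V, ∀ A, CC A → A ⊆ Submodule.span ℝ {a, b} → T A = 0) (e : Fin N → V)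
    {p : C(Fin N → V, ℝ)} (hp : p ∈ orbitAlg V N) (hp0 : ∀ g, 0 ≤ p g) {h : V → ℝ}
    (hh : Sublin h) :
    letI := measureSpaceOfInnerProductSpace (E := V)
    ∫ g in Metric.closedBall (0 : Fin N → V) 2, p g * T (frameMap e g '' body h) = 0 := by
  obtain ⟨f, g, hf, hg, hfg⟩ := hh.exists_frameAvg_eq e hp
  obtain ⟨sf, tf⟩ := hT.frameAvg h2 e p.continuous hp0 hf.sublin
  obtain ⟨sg, tg⟩ := hT.frameAvg h2 e p.continuous hp0 hg.sublin
  obtain ⟨sh, th⟩ := hT.frameAvg h2 e p.continuous hp0 hh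
  simp only [hT.planarSum_eq_zero h2 hpl hf, mul_zero, integral_zero] at tf
  simp only [hT.planarSum_eq_zero h2 hpl hg, mul_zero, integral_zero] at tg
  have hadd := body_add sh sg
  rw [funext hfg] at hadd
  rw [hadd, hT.minkowski_add h2 (body_cc sh) (body_cc sg) (body_nonempty sh) (body_nonempty sg),
    tg, add_zero, th] at tf
  exact tf

end planarVanishing

section minkowskiVanishing
variable {V : Type*} [NormedAddCommGroup V] [InnerProductSpace ℝ V] [FiniteDimensional ℝ V]

/-- A Minkowski additive continuous valuation vanishing on planar bodies is zero. -/
theorem Val.eq_zero_of_planar {T : Set V → ℂ} (hT : Val T)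
    (h2 : ∀ A, CC A → T ((2 : ℝ) • A) = 2 * T A)
    (hpl : ∀ a b : V, ∀ A, CC A → A ⊆ Submodule.span ℝ {a, b} → T A = 0) {K : Set V}
    (hK : CC K) : T K = 0 := by
  rcases K.eq_empty_or_nonempty with rfl | hne
  · exact hT.empty
  rcases subsingleton_or_nontrivial V with _ | _
  · exact hpl 0 0 K hK fun x _ => by simp [Subsingleton.elim x 0]
  borelize V
  let := measureSpaceOfInnerProductSpace (E := V)
  let e := stdOrthonormalBasis ℝ V
  let N := Module.finrank ℝ V
  let B := Metric.closedBall (0 : Fin N → V) 2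
  have hh := supp_sublin hK hne
  let τ : (Fin N → V) → ℂ := fun g => T (frameMap e g '' K)
  have hτ : Continuous τ := by
    have := hT.continuous_body (F := fun (g : Fin N → V) x => supp K (frameMap g e x))
      (fun g => hh.comp _) (hh.continuous.comp (continuous_frameMap e))
    simpa only [body_comp_adjoint hh fun x y => inner_frameMap e _ x y, body_supp hK hne] using this
  have hInt : ∀ p : C(Fin N → V, ℝ), IntegrableOn (fun g => (p g : ℂ) * τ g) B := fun p =>
    ContinuousOn.integrableOn_compact (isCompact_closedBall 0 2)
      (((Complex.continuous_ofReal.comp p.continuous).mul hτ).continuousOn)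
  have hsq : ∀ p ∈ orbitAlg V N, ∫ g in B, ((p * p) g : ℂ) * τ g = 0 := by
    intro p hp
    have := hT.integral_frameMap_eq_zero h2 hpl e (mul_mem hp hp)
      (fun g => mul_self_nonneg (p g)) hh
    rwa [body_supp hK hne] at this
  have hall : ∀ p ∈ orbitAlg V N, ∫ g in B, (p g : ℂ) * τ g = 0 := by
    intro p hp
    have h1 := hsq _ (add_mem hp (one_mem _))
    have h3 := hsq _ (sub_mem hp (one_mem _))
    have h4 : ∫ g in B, (4 : ℂ) * ((p g : ℂ) * τ g) = 0 := by
      refine Eq.trans ?_ ((congrArg₂ (· - ·) h1 h3).trans (sub_zero (0 : ℂ)))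
      refine Eq.trans ?_ (integral_sub (hInt _) (hInt _))
      congr 1
      ext g
      simp only [ContinuousMap.mul_apply, ContinuousMap.add_apply, ContinuousMap.sub_apply,
        ContinuousMap.one_apply]
      push_cast
      ring
    rw [integral_const_mul] at h4
    simpa using h4
  have hreal : ∀ ρ : C(Fin N → V, ℝ), (∀ p ∈ orbitAlg V N, ∫ g in B, p g * ρ g = 0) →
      ∀ g ∈ Metric.ball (0 : Fin N → V) 2, ρ g = 0 := by
    intro ρ hρ
    have hii : ∀ u v : C(Fin N → V, ℝ), IntegrableOn (fun g => u g * v g) B := fun u v =>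
      ContinuousOn.integrableOn_compact (isCompact_closedBall 0 2)
        ((u.continuous.mul v.continuous).continuousOn)
    have habs : IntegrableOn (fun g => |ρ g|) B :=
      ContinuousOn.integrableOn_compact (isCompact_closedBall 0 2) (by fun_prop)
    have hz : ∫ g in B, ρ g * ρ g = 0 := by
      by_contra hne
      have hpos : 0 < ∫ g in B, ρ g * ρ g :=
        lt_of_le_of_ne (integral_nonneg fun g => mul_self_nonneg _) (Ne.symm hne)
      have hI : 0 ≤ ∫ g in B, |ρ g| := integral_nonneg fun g => abs_nonneg _
      set I := ∫ g in B, |ρ g|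
      set Q := ∫ g in B, ρ g * ρ g
      obtain ⟨p, hp, hpε⟩ :=
        ContinuousMap.exists_mem_subalgebra_near_continuous_of_isCompact_of_separatesPoints
          (orbitAlg_separatesPoints (V := V) N) ρ (isCompact_closedBall (0 : Fin N → V) 2)
          (ε := Q / (I + 1)) (by positivity)
      have h5 : Q = ∫ g in B, (ρ g - p g) * ρ g := by
        simp only [sub_mul]
        rw [integral_sub (hii ρ ρ) (hii p ρ), hρ p hp, sub_zero]
      have h6 : Q ≤ Q / (I + 1) * I := by
        rw [← integral_const_mul]
        conv_lhs => rw [h5]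
        refine setIntegral_mono_on (by simpa using hii (ρ - p) ρ) (habs.const_mul _)
          measurableSet_closedBall fun g hg => ?_
        refine (le_abs_self _).trans ?_
        rw [abs_mul, abs_sub_comm]
        exact mul_le_mul_of_nonneg_right (hpε g hg).le (abs_nonneg _)
      have h7 : Q / (I + 1) * I < Q := by
        rw [div_mul_eq_mul_div, div_lt_iff₀ (by positivity)]
        nlinarith
      linarith
    rw [integral_eq_zero_iff_of_nonneg (fun g => mul_self_nonneg _) (hii ρ ρ)] at hz
    have hz' := ae_restrict_of_ae_restrict_of_subset
      (Metric.ball_subset_closedBall (x := (0 : Fin N → V)) (ε := 2)) hz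
    have := Measure.eqOn_open_of_ae_eq hz' Metric.isOpen_ball
      (ρ.continuous.mul ρ.continuous).continuousOn continuousOn_const
    exact fun g hg => mul_self_eq_zero.mp (this hg)
  have he : (e : Fin N → V) ∈ Metric.ball (0 : Fin N → V) 2 := by
    rw [mem_ball_zero_iff]
    refine lt_of_le_of_lt ?_ one_lt_two
    rw [pi_norm_le_iff_of_nonneg zero_le_one]
    exact fun i => (e.norm_eq_one i).le
  have hτe : τ e = 0 := by
    refine Complex.ext ?_ ?_
    · refine hreal ⟨fun g => (τ g).re, Complex.continuous_re.comp hτ⟩ (fun p hp => ?_) e he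
      have := congrArg Complex.re (hall p hp)
      rw [Complex.zero_re] at this
      rw [← this]
      refine Eq.trans ?_ (integral_re (𝕜 := ℂ) (hInt p))
      congr 1
      ext g
      simp
    · refine hreal ⟨fun g => (τ g).im, Complex.continuous_im.comp hτ⟩ (fun p hp => ?_) e he
      have := congrArg Complex.im (hall p hp)
      rw [Complex.zero_im] at this
      rw [← this]
      refine Eq.trans ?_ (integral_im (𝕜 := ℂ) (hInt p))
      congr 1
      ext g
      simp
  have hid : frameMap e e = LinearMap.id := by
    ext x
    rw [frameMap_apply]
    exact e.sum_repr' x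
  change T (frameMap e e '' K) = 0 at hτe
  rwa [hid, LinearMap.id_coe, Set.image_id] at hτe

end minkowskiVanishing

section quad
variable {E : Type*} [NormedAddCommGroup E] [NormedSpace ℝ E]

/-- Combinations of four vectors with coefficients constrained by a predicate. -/
def quad (P : ℝ → ℝ → ℝ → ℝ → Prop) (a b c d : E) : Set E :=
  {z | ∃ s t u w, P s t u w ∧ z = s • a + t • b + u • c + w • d}

/-- Coefficients of a simplex. -/
def chain4 (s t u w : ℝ) : Prop := 0 ≤ w ∧ w ≤ u ∧ u ≤ t ∧ t ≤ s ∧ s ≤ 1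

/-- Coefficients of a sum of two triangles. -/
def chain22 (s t u w : ℝ) : Prop := 0 ≤ t ∧ t ≤ s ∧ s ≤ 1 ∧ 0 ≤ w ∧ w ≤ u ∧ u ≤ 1

theorem quad_eq_image (P : ℝ → ℝ → ℝ → ℝ → Prop) (a b c d : E) :
    quad P a b c d = Fintype.linearCombination ℝ ![a, b, c, d] ''
      {x : Fin 4 → ℝ | P (x 0) (x 1) (x 2) (x 3)} := by
  ext z
  constructor
  · rintro ⟨s, t, u, w, h, rfl⟩
    exact ⟨![s, t, u, w], h, by simp [Fintype.linearCombination_apply, Fin.sum_univ_four]⟩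
  · rintro ⟨x, h, rfl⟩
    exact ⟨_, _, _, _, h, by simp [Fintype.linearCombination_apply, Fin.sum_univ_four]⟩

theorem tet_four (v : Fin 4 → E) : tet v = quad chain4 (v 0) (v 1) (v 2) (v 3) := by
  have e : v = ![v 0, v 1, v 2, v 3] := by
    funext i; fin_cases i <;> rfl
  rw [quad_eq_image, tet, ← e]
  congr 1
  ext x
  constructor
  · rintro ⟨h, h'⟩
    exact ⟨(h' 3).1, h (by decide), h (by decide), h (by decide), (h' 0).2⟩
  · rintro ⟨h0, h1, h2, h3, h4⟩
    refine ⟨?_, ?_⟩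
    · intro i j hij
      fin_cases i <;> fin_cases j <;> first | exact absurd hij (by decide) | (simp; try linarith)
    · intro i
      fin_cases i <;> constructor <;> simp <;> linarith

theorem mem_tet_two {a b z : E} :
    z ∈ tet ![a, b] ↔ ∃ s t : ℝ, 0 ≤ t ∧ t ≤ s ∧ s ≤ 1 ∧ z = s • a + t • b := by
  constructor
  · rintro ⟨x, ⟨h, h'⟩, rfl⟩
    exact ⟨x 0, x 1, (h' 1).1, h (by decide), (h' 0).2,
      by simp [Fintype.linearCombination_apply, Fin.sum_univ_two]⟩
  · rintro ⟨s, t, h0, h1, h2, rfl⟩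
    refine ⟨![s, t], ⟨?_, ?_⟩, by simp [Fintype.linearCombination_apply, Fin.sum_univ_two]⟩
    · intro i j hij
      fin_cases i <;> fin_cases j <;> first | exact absurd hij (by decide) | (simp; try linarith)
    · intro i
      fin_cases i <;> constructor <;> simp <;> linarith

theorem tet_two_add (a b c d : E) : tet ![a, b] + tet ![c, d] = quad chain22 a b c d := by
  ext z
  constructor
  · rintro ⟨x, hx, y, hy, rfl⟩
    obtain ⟨s, t, h0, h1, h2, rfl⟩ := mem_tet_two.mp hx
    obtain ⟨u, w, h3, h4, h5, rfl⟩ := mem_tet_two.mp hy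
    exact ⟨s, t, u, w, ⟨h0, h1, h2, h3, h4, h5⟩, by simp only; module⟩
  · rintro ⟨s, t, u, w, ⟨h0, h1, h2, h3, h4, h5⟩, rfl⟩
    exact ⟨_, mem_tet_two.mpr ⟨s, t, h0, h1, h2, rfl⟩, _, mem_tet_two.mpr ⟨u, w, h3, h4, h5, rfl⟩,
      by simp only; module⟩

theorem Simple.comp_linear [FiniteDimensional ℝ E] {F : Type*} [NormedAddCommGroup F]
    [NormedSpace ℝ F] [FiniteDimensional ℝ F] {m : Set E → ℂ} (hs : Simple m)
    (φ : F →ₗ[ℝ] E) (hd : Module.finrank ℝ F = Module.finrank ℝ E) :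
    Simple fun A => m (φ '' A) := by
  intro S hS l hl c hlc
  by_cases hφ : Function.Injective φ
  · let e := LinearEquiv.ofInjectiveOfFinrankEq φ hφ hd
    refine hs _ (hS.image φ) (l ∘ₗ e.symm.toLinearMap) (fun h => hl ?_) c ?_
    · ext x
      have := LinearMap.congr_fun h (e x)
      simpa using this
    · rintro _ ⟨x, hx, rfl⟩
      have : e.symm (φ x) = x := e.symm_apply_apply x
      simp [this, hlc x hx]
  · have hlt : LinearMap.range φ < ⊤ := by
      rw [lt_top_iff_ne_top]
      intro h
      exact hφ ((LinearMap.injective_iff_surjective_of_finrank_eq_finrank hd).mpr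
        (LinearMap.range_eq_top.mp h))
    obtain ⟨f, hf, hf'⟩ := Submodule.exists_le_ker_of_lt_top _ hlt
    refine hs _ (hS.image φ) f hf 0 ?_
    rintro _ ⟨x, -, rfl⟩
    exact hf' ⟨x, rfl⟩

/-- A constraint on four coefficients cutting out a convex body. -/
def Quad (P : ℝ → ℝ → ℝ → ℝ → Prop) : Prop := CC {x : Fin 4 → ℝ | P (x 0) (x 1) (x 2) (x 3)}

theorem Quad.cc {P : ℝ → ℝ → ℝ → ℝ → Prop} (hP : Quad P) (a b c d : E) : CC (quad P a b c d) := by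
  rw [quad_eq_image]
  exact CC.image hP _

theorem Val.quad_cut [FiniteDimensional ℝ E] {m : Set E → ℂ} (hm : Val m) (hs : Simple m)
    (hd : Module.finrank ℝ E = 4) {P : ℝ → ℝ → ℝ → ℝ → Prop} (hP : Quad P)
    (l : Fin 4 → ℝ) (hl : ∃ i, l i ≠ 0) (r : ℝ) (a b c d : E) :
    m (quad P a b c d) =
      m (quad (fun s t u w => P s t u w ∧ l 0 * s + l 1 * t + l 2 * u + l 3 * w ≤ r) a b c d) +
      m (quad (fun s t u w => P s t u w ∧ r ≤ l 0 * s + l 1 * t + l 2 * u + l 3 * w) a b c d) := by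
  simp only [quad_eq_image]
  have hs' := hs.comp_linear (Fintype.linearCombination ℝ ![a, b, c, d]) (by simp [hd])
  have hm' := hm.comp_linear (Fintype.linearCombination ℝ ![a, b, c, d])
  let f : (Fin 4 → ℝ) →ₗ[ℝ] ℝ := Fintype.linearCombination ℝ l
  have hf : ∀ x, f x = l 0 * x 0 + l 1 * x 1 + l 2 * x 2 + l 3 * x 3 := fun x => by
    simp [f, Fintype.linearCombination_apply, Fin.sum_univ_four, mul_comm]
  have hf0 : f ≠ 0 := by
    obtain ⟨i, hi⟩ := hl
    intro h
    apply hi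
    have := LinearMap.congr_fun h (Pi.single i 1)
    simpa [f] using this
  have := hm'.cut hP f r
  have h0 := hs' _ (hP.inter_closed (convex_hyperplane f.isLinear r)
    (isClosed_eq f.continuous_of_finiteDimensional continuous_const)) f hf0 r fun x hx => hx.2
  dsimp only at h0
  rw [h0, add_zero] at this
  simp only [hf] at this
  exact this

theorem Quad.and_le {P : ℝ → ℝ → ℝ → ℝ → Prop} (hP : Quad P) (l : Fin 4 → ℝ) (r : ℝ) :
    Quad (fun s t u w => P s t u w ∧ r ≤ l 0 * s + l 1 * t + l 2 * u + l 3 * w) := by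
  let f : (Fin 4 → ℝ) →ₗ[ℝ] ℝ := Fintype.linearCombination ℝ l
  have hf : ∀ x, f x = l 0 * x 0 + l 1 * x 1 + l 2 * x 2 + l 3 * x 3 := fun x => by
    simp [f, Fintype.linearCombination_apply, Fin.sum_univ_four, mul_comm]
  have := hP.inter_closed (convex_halfSpace_ge f.isLinear r)
    (isClosed_le continuous_const f.continuous_of_finiteDimensional)
  simp only [hf] at this
  exact this

theorem Quad.of_box {P : ℝ → ℝ → ℝ → ℝ → Prop} {R : ℝ}
    (hb : ∀ s t u w, P s t u w → |s| ≤ R ∧ |t| ≤ R ∧ |u| ≤ R ∧ |w| ≤ R)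
    (hconv : Convex ℝ {x : Fin 4 → ℝ | P (x 0) (x 1) (x 2) (x 3)})
    (hc : IsClosed {x : Fin 4 → ℝ | P (x 0) (x 1) (x 2) (x 3)}) : Quad P := by
  refine ⟨hconv, Metric.isCompact_of_isClosed_isBounded hc ?_⟩
  refine Metric.isBounded_closedBall (x := (0 : Fin 4 → ℝ)) (r := |R|) |>.subset fun x hx => ?_
  rw [mem_closedBall_zero_iff, pi_norm_le_iff_of_nonneg (abs_nonneg R)]
  obtain ⟨h0, h1, h2, h3⟩ := hb _ _ _ _ hx
  have := le_abs_self R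
  intro i
  rw [Real.norm_eq_abs]
  fin_cases i
  · exact h0.trans this
  · exact h1.trans this
  · exact h2.trans this
  · exact h3.trans this

theorem isClosed_and {X : Type*} [TopologicalSpace X] {p q : X → Prop} (hp : IsClosed {x | p x})
    (hq : IsClosed {x | q x}) : IsClosed {x | p x ∧ q x} := hp.inter hq

theorem quad_chain4 : Quad chain4 := by
  refine Quad.of_box (R := 1) ?_ ?_ ?_
  · rintro s t u w ⟨h0, h1, h2, h3, h4⟩
    refine ⟨?_, ?_, ?_, ?_⟩ <;> rw [abs_le] <;> constructor <;> linarith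
  · rintro x ⟨h0, h1, h2, h3, h4⟩ y ⟨k0, k1, k2, k3, k4⟩ s t hs ht hst
    simp only [chain4, Set.mem_ofPred_eq, Pi.add_apply, Pi.smul_apply, smul_eq_mul]
    refine ⟨?_, ?_, ?_, ?_, ?_⟩ <;> nlinarith
  · unfold chain4
    refine isClosed_and (isClosed_le ?_ ?_) (isClosed_and (isClosed_le ?_ ?_) (isClosed_and
      (isClosed_le ?_ ?_) (isClosed_and (isClosed_le ?_ ?_) (isClosed_le ?_ ?_)))) <;> fun_prop

theorem quad_chain22_scaled (R : ℝ) (hR : 1 ≤ R) :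
    Quad fun s t u w => 0 ≤ t ∧ t ≤ s ∧ s ≤ R ∧ 0 ≤ w ∧ w ≤ u ∧ u ≤ 1 := by
  refine Quad.of_box (R := R) ?_ ?_ ?_
  · rintro s t u w ⟨h0, h1, h2, h3, h4, h5⟩
    refine ⟨?_, ?_, ?_, ?_⟩ <;> rw [abs_le] <;> constructor <;> linarith
  · rintro x ⟨h0, h1, h2, h3, h4, h5⟩ y ⟨k0, k1, k2, k3, k4, k5⟩ s t hs ht hst
    simp only [Set.mem_ofPred_eq, Pi.add_apply, Pi.smul_apply, smul_eq_mul]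
    have : R = s * R + t * R := by rw [← add_mul, hst, one_mul]
    refine ⟨?_, ?_, ?_, ?_, ?_, ?_⟩ <;> nlinarith
  · refine isClosed_and (isClosed_le ?_ ?_) (isClosed_and (isClosed_le ?_ ?_) (isClosed_and
      (isClosed_le ?_ ?_) (isClosed_and (isClosed_le ?_ ?_) (isClosed_and (isClosed_le ?_ ?_)
      (isClosed_le ?_ ?_))))) <;> fun_prop

theorem quad_chain22 : Quad chain22 := quad_chain22_scaled 1 le_rfl

theorem quad_square : Quad fun s t u w => (0 ≤ t ∧ t ≤ 1 ∧ 0 ≤ s ∧ s ≤ 1) ∧ 0 ≤ w ∧ w ≤ u ∧ u ≤ 1 := by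
  refine Quad.of_box (R := 1) ?_ ?_ ?_
  · rintro s t u w ⟨⟨h0, h1, h2, h6⟩, h3, h4, h5⟩
    refine ⟨?_, ?_, ?_, ?_⟩ <;> rw [abs_le] <;> constructor <;> linarith
  · rintro x ⟨⟨h0, h1, h2, h6⟩, h3, h4, h5⟩ y ⟨⟨k0, k1, k2, k6⟩, k3, k4, k5⟩ s t hs ht hst
    simp only [Set.mem_ofPred_eq, Pi.add_apply, Pi.smul_apply, smul_eq_mul]
    refine ⟨⟨?_, ?_, ?_, ?_⟩, ?_, ?_, ?_⟩ <;> nlinarith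
  · refine isClosed_and (isClosed_and (isClosed_le ?_ ?_) (isClosed_and (isClosed_le ?_ ?_)
      (isClosed_and (isClosed_le ?_ ?_) (isClosed_le ?_ ?_)))) (isClosed_and (isClosed_le ?_ ?_)
      (isClosed_and (isClosed_le ?_ ?_) (isClosed_le ?_ ?_))) <;> fun_prop

theorem quad_congr {P Q : ℝ → ℝ → ℝ → ℝ → Prop} {a b c d a' b' c' d' : E}
    (f g : ℝ → ℝ → ℝ → ℝ → ℝ × ℝ × ℝ × ℝ)
    (hf : ∀ s t u w, P s t u w → Q (f s t u w).1 (f s t u w).2.1 (f s t u w).2.2.1 (f s t u w).2.2.2)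
    (hg : ∀ s t u w, Q s t u w → P (g s t u w).1 (g s t u w).2.1 (g s t u w).2.2.1 (g s t u w).2.2.2)
    (hf' : ∀ s t u w, s • a + t • b + u • c + w • d = (f s t u w).1 • a' + (f s t u w).2.1 • b' +
      (f s t u w).2.2.1 • c' + (f s t u w).2.2.2 • d')
    (hg' : ∀ s t u w, s • a' + t • b' + u • c' + w • d' = (g s t u w).1 • a + (g s t u w).2.1 • b +
      (g s t u w).2.2.1 • c + (g s t u w).2.2.2 • d) :
    quad P a b c d = quad Q a' b' c' d' := by
  ext z
  constructor
  · rintro ⟨s, t, u, w, h, rfl⟩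
    exact ⟨_, _, _, _, hf s t u w h, hf' s t u w⟩
  · rintro ⟨s, t, u, w, h, rfl⟩
    exact ⟨_, _, _, _, hg s t u w h, hg' s t u w⟩

theorem quad_square_eq (a b c d : E) :
    quad (fun s t u w => (0 ≤ t ∧ t ≤ 1 ∧ 0 ≤ s ∧ s ≤ 1) ∧ 0 ≤ w ∧ w ≤ u ∧ u ≤ 1) a b c d =
      quad chain22 0 0 c d + segment ℝ 0 a + segment ℝ 0 b := by
  ext z
  have ha := segment_zero_smul a zero_le_one
  have hb := segment_zero_smul b zero_le_one
  rw [one_smul] at ha hb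
  rw [ha, hb]
  constructor
  · rintro ⟨s, t, u, w, ⟨⟨h0, h1, h2, h3⟩, h4, h5, h6⟩, rfl⟩
    exact ⟨_, ⟨_, ⟨0, 0, u, w, ⟨le_rfl, le_rfl, zero_le_one, h4, h5, h6⟩, rfl⟩, _,
      ⟨s, h2, h3, rfl⟩, rfl⟩, _, ⟨t, h0, h1, rfl⟩, by simp only; module⟩
  · rintro ⟨_, ⟨_, ⟨s', t', u, w, ⟨-, -, -, h4, h5, h6⟩, rfl⟩, _,
      ⟨s, h2, h3, rfl⟩, rfl⟩, _, ⟨t, h0, h1, rfl⟩, rfl⟩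
    exact ⟨s, t, u, w, ⟨⟨h0, h1, h2, h3⟩, h4, h5, h6⟩, by simp only; module⟩

theorem Simple.quad_eq_zero {m : Set E → ℂ} (hs : Simple m) (hd : Module.finrank ℝ E = 4)
    {P : ℝ → ℝ → ℝ → ℝ → Prop} (hP : Quad P) {a b c d : E}
    (h : ¬ LinearIndependent ℝ ![a, b, c, d]) : m (quad P a b c d) = 0 := by
  have hlt : Submodule.span ℝ (Set.range ![a, b, c, d]) < ⊤ := by
    rw [lt_top_iff_ne_top]
    intro h'
    exact h (linearIndependent_of_top_le_span_of_card_eq_finrank h'.ge (by simp [hd]))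
  obtain ⟨f, hf, hf'⟩ := Submodule.exists_le_ker_of_lt_top _ hlt
  refine hs _ (hP.cc a b c d) f hf 0 ?_
  rw [quad_eq_image]
  rintro _ ⟨x, -, rfl⟩
  refine hf' ?_
  rw [← range_linearCombination]
  exact ⟨x, rfl⟩

theorem not_linearIndependent_zero_zero (c d : E) : ¬ LinearIndependent ℝ ![0, 0, c, d] :=
  fun h => h.ne_zero 0 rfl

theorem quad_chain22_swap (a b c d : E) : quad chain22 a b c d = quad chain22 c d a b := by
  refine quad_congr (fun s t u w => (u, w, s, t)) (fun s t u w => (u, w, s, t)) ?_ ?_ ?_ ?_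
  · rintro s t u w ⟨h0, h1, h2, h3, h4, h6⟩
    exact ⟨h3, h4, h6, h0, h1, h2⟩
  · rintro s t u w ⟨h0, h1, h2, h3, h4, h6⟩
    exact ⟨h3, h4, h6, h0, h1, h2⟩
  · intro s t u w; simp only; module
  · intro s t u w; simp only; module

theorem Val.quad_square_eq_zero {m : Set E → ℂ} (hs : Simple m) (hd : Module.finrank ℝ E = 4)
    (hseg : ∀ (v : E) (A : Set E), CC A → m (A + segment ℝ 0 v) = m A) (a b c d : E) :
    m (quad (fun s t u w => (0 ≤ t ∧ t ≤ 1 ∧ 0 ≤ s ∧ s ≤ 1) ∧ 0 ≤ w ∧ w ≤ u ∧ u ≤ 1) a b c d)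
      = 0 := by
  rw [quad_square_eq, hseg _ _ ((quad_chain22.cc _ _ _ _).add (CC.segment _ _)),
    hseg _ _ (quad_chain22.cc _ _ _ _),
    hs.quad_eq_zero hd quad_chain22 (not_linearIndependent_zero_zero c d)]

end quad

section block
variable {E : Type*} [NormedAddCommGroup E] [NormedSpace ℝ E] [FiniteDimensional ℝ E]
  {m : Set E → ℂ}

theorem Val.chain4_cut (hm : Val m) (hs : Simple m) (hd : Module.finrank ℝ E = 4) (a h c d : E) :
    m (quad chain4 a ((2 : ℝ) • h) c d) =
      m (quad chain4 (a + h) h c d) + m (quad chain4 a h (h + c) d) := by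
  rw [hm.quad_cut hs hd quad_chain4 ![1, -2, 1, 0] ⟨0, by simp⟩ 0]
  congr 2
  · refine quad_congr (fun s t u w => (s, 2 * t - s, u, w)) (fun s t u w => (s, (s + t) / 2, u, w))
      ?_ ?_ ?_ ?_
    · rintro s t u w ⟨⟨h0, h1, h2, h3, h4⟩, h5⟩
      simp at h5
      refine ⟨?_, ?_, ?_, ?_, ?_⟩ <;> simp only <;> linarith
    · rintro s t u w ⟨h0, h1, h2, h3, h4⟩
      refine ⟨⟨?_, ?_, ?_, ?_, ?_⟩, ?_⟩ <;> simp <;> linarith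
    · intro s t u w; simp only; module
    · intro s t u w; simp only; module
  · refine quad_congr (fun s t u w => (s, 2 * t - u, u, w)) (fun s t u w => (s, (t + u) / 2, u, w))
      ?_ ?_ ?_ ?_
    · rintro s t u w ⟨⟨h0, h1, h2, h3, h4⟩, h5⟩
      simp at h5
      refine ⟨?_, ?_, ?_, ?_, ?_⟩ <;> simp only <;> linarith
    · rintro s t u w ⟨h0, h1, h2, h3, h4⟩
      refine ⟨⟨?_, ?_, ?_, ?_, ?_⟩, ?_⟩ <;> simp <;> linarith
    · intro s t u w; simp only; module
    · intro s t u w; simp only; module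

theorem Val.chain22_cut (hm : Val m) (hs : Simple m) (hd : Module.finrank ℝ E = 4) (a h c d : E) :
    m (quad chain22 a ((2 : ℝ) • h) c d) =
      m (quad chain22 (a + h) h c d) + m (quad chain22 a h c d) := by
  rw [hm.quad_cut hs hd quad_chain22 ![1, -2, 0, 0] ⟨0, by simp⟩ 0]
  congr 2
  · refine quad_congr (fun s t u w => (s, 2 * t - s, u, w)) (fun s t u w => (s, (s + t) / 2, u, w))
      ?_ ?_ ?_ ?_
    · rintro s t u w ⟨⟨h0, h1, h2, h3, h4, h6⟩, h5⟩
      simp at h5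
      refine ⟨?_, ?_, ?_, ?_, ?_, ?_⟩ <;> simp only <;> linarith
    · rintro s t u w ⟨h0, h1, h2, h3, h4, h6⟩
      refine ⟨⟨?_, ?_, ?_, ?_, ?_, ?_⟩, ?_⟩ <;> simp <;> linarith
    · intro s t u w; simp only; module
    · intro s t u w; simp only; module
  · refine quad_congr (fun s t u w => (s, 2 * t, u, w)) (fun s t u w => (s, t / 2, u, w))
      ?_ ?_ ?_ ?_
    · rintro s t u w ⟨⟨h0, h1, h2, h3, h4, h6⟩, h5⟩
      simp at h5
      refine ⟨?_, ?_, ?_, ?_, ?_, ?_⟩ <;> simp only <;> linarith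
    · rintro s t u w ⟨h0, h1, h2, h3, h4, h6⟩
      refine ⟨⟨?_, ?_, ?_, ?_, ?_, ?_⟩, ?_⟩ <;> simp <;> linarith
    · intro s t u w; simp only; module
    · intro s t u w; simp only; module

theorem Val.chain22_antisymm (hm : Val m) (hs : Simple m) (hd : Module.finrank ℝ E = 4)
    (hseg : ∀ (v : E) (A : Set E), CC A → m (A + segment ℝ 0 v) = m A) (a b c d : E) :
    m (quad chain22 b a c d) = - m (quad chain22 a b c d) := by
  have h := hm.quad_cut hs hd quad_square ![1, -1, 0, 0] ⟨0, by simp⟩ 0 a b c d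
  rw [Val.quad_square_eq_zero hs hd hseg] at h
  have e1 : quad chain22 b a c d = quad (fun s t u w => ((0 ≤ t ∧ t ≤ 1 ∧ 0 ≤ s ∧ s ≤ 1) ∧
      0 ≤ w ∧ w ≤ u ∧ u ≤ 1) ∧ (![1, -1, 0, 0] : Fin 4 → ℝ) 0 * s + (![1, -1, 0, 0] : Fin 4 → ℝ) 1 * t +
      (![1, -1, 0, 0] : Fin 4 → ℝ) 2 * u + (![1, -1, 0, 0] : Fin 4 → ℝ) 3 * w ≤ 0) a b c d := by
    refine quad_congr (fun s t u w => (t, s, u, w)) (fun s t u w => (t, s, u, w)) ?_ ?_ ?_ ?_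
    · rintro s t u w ⟨h0, h1, h2, h3, h4, h6⟩
      refine ⟨⟨⟨?_, ?_, ?_, ?_⟩, ?_, ?_, ?_⟩, ?_⟩ <;> simp <;> linarith
    · rintro s t u w ⟨⟨⟨h0, h1, h2, h3⟩, h4, h5, h6⟩, h7⟩
      simp at h7
      refine ⟨?_, ?_, ?_, ?_, ?_, ?_⟩ <;> simp only <;> linarith
    · intro s t u w; simp only; module
    · intro s t u w; simp only; module
  have e2 : quad chain22 a b c d = quad (fun s t u w => ((0 ≤ t ∧ t ≤ 1 ∧ 0 ≤ s ∧ s ≤ 1) ∧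
      0 ≤ w ∧ w ≤ u ∧ u ≤ 1) ∧ 0 ≤ (![1, -1, 0, 0] : Fin 4 → ℝ) 0 * s + (![1, -1, 0, 0] : Fin 4 → ℝ) 1 * t +
      (![1, -1, 0, 0] : Fin 4 → ℝ) 2 * u + (![1, -1, 0, 0] : Fin 4 → ℝ) 3 * w) a b c d := by
    refine quad_congr (fun s t u w => (s, t, u, w)) (fun s t u w => (s, t, u, w)) ?_ ?_ ?_ ?_
    · rintro s t u w ⟨h0, h1, h2, h3, h4, h6⟩
      refine ⟨⟨⟨?_, ?_, ?_, ?_⟩, ?_, ?_, ?_⟩, ?_⟩ <;> simp <;> linarith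
    · rintro s t u w ⟨⟨⟨h0, h1, h2, h3⟩, h4, h5, h6⟩, h7⟩
      simp at h7
      refine ⟨?_, ?_, ?_, ?_, ?_, ?_⟩ <;> simp only <;> linarith
    · intro s t u w; rfl
    · intro s t u w; rfl
  rw [← e1, ← e2] at h
  linear_combination -h

theorem Val.chain22_double (hm : Val m) (hs : Simple m) (hd : Module.finrank ℝ E = 4)
    (hseg : ∀ (v : E) (A : Set E), CC A → m (A + segment ℝ 0 v) = m A) (a b c d : E) :
    m (quad chain22 ((2 : ℝ) • a) ((2 : ℝ) • b) c d) = 2 * m (quad chain22 a b c d) := by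
  have e : quad chain22 ((2 : ℝ) • a) ((2 : ℝ) • b) c d =
      quad (fun s t u w => 0 ≤ t ∧ t ≤ s ∧ s ≤ 2 ∧ 0 ≤ w ∧ w ≤ u ∧ u ≤ 1) a b c d := by
    refine quad_congr (fun s t u w => (2 * s, 2 * t, u, w)) (fun s t u w => (s / 2, t / 2, u, w))
      ?_ ?_ ?_ ?_
    · rintro s t u w ⟨h0, h1, h2, h3, h4, h6⟩
      refine ⟨?_, ?_, ?_, ?_, ?_, ?_⟩ <;> simp only <;> linarith
    · rintro s t u w ⟨h0, h1, h2, h3, h4, h6⟩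
      refine ⟨?_, ?_, ?_, ?_, ?_, ?_⟩ <;> simp only <;> linarith
    · intro s t u w; simp only; module
    · intro s t u w; simp only; module
  rw [e, hm.quad_cut hs hd (quad_chain22_scaled 2 one_le_two) ![1, 0, 0, 0] ⟨0, by simp⟩ 1,
    hm.quad_cut hs hd ((quad_chain22_scaled 2 one_le_two).and_le _ _) ![0, 1, 0, 0] ⟨1, by simp⟩ 1]
  have e1 : quad (fun s t u w => (0 ≤ t ∧ t ≤ s ∧ s ≤ 2 ∧ 0 ≤ w ∧ w ≤ u ∧ u ≤ 1) ∧
      (![1, 0, 0, 0] : Fin 4 → ℝ) 0 * s + (![1, 0, 0, 0] : Fin 4 → ℝ) 1 * t +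
      (![1, 0, 0, 0] : Fin 4 → ℝ) 2 * u + (![1, 0, 0, 0] : Fin 4 → ℝ) 3 * w ≤ 1) a b c d =
      quad chain22 a b c d := by
    refine quad_congr (fun s t u w => (s, t, u, w)) (fun s t u w => (s, t, u, w)) ?_ ?_ ?_ ?_
    · rintro s t u w ⟨⟨h0, h1, h2, h3, h4, h6⟩, h7⟩
      simp at h7
      refine ⟨?_, ?_, ?_, ?_, ?_, ?_⟩ <;> simp only <;> linarith
    · rintro s t u w ⟨h0, h1, h2, h3, h4, h6⟩
      refine ⟨⟨?_, ?_, ?_, ?_, ?_, ?_⟩, ?_⟩ <;> simp <;> linarith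
    · intro s t u w; rfl
    · intro s t u w; rfl
  have e2 : quad (fun s t u w => ((0 ≤ t ∧ t ≤ s ∧ s ≤ 2 ∧ 0 ≤ w ∧ w ≤ u ∧ u ≤ 1) ∧
      1 ≤ (![1, 0, 0, 0] : Fin 4 → ℝ) 0 * s + (![1, 0, 0, 0] : Fin 4 → ℝ) 1 * t +
      (![1, 0, 0, 0] : Fin 4 → ℝ) 2 * u + (![1, 0, 0, 0] : Fin 4 → ℝ) 3 * w) ∧
      (![0, 1, 0, 0] : Fin 4 → ℝ) 0 * s + (![0, 1, 0, 0] : Fin 4 → ℝ) 1 * t +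
      (![0, 1, 0, 0] : Fin 4 → ℝ) 2 * u + (![0, 1, 0, 0] : Fin 4 → ℝ) 3 * w ≤ 1) a b c d =
      {a} + quad (fun s t u w => (0 ≤ t ∧ t ≤ 1 ∧ 0 ≤ s ∧ s ≤ 1) ∧ 0 ≤ w ∧ w ≤ u ∧ u ≤ 1) a b c d := by
    ext z
    constructor
    · rintro ⟨s, t, u, w, ⟨⟨⟨h0, h1, h2, h3, h4, h6⟩, h7⟩, h8⟩, rfl⟩
      simp at h7 h8
      refine ⟨a, rfl, _, ⟨s - 1, t, u, w, ⟨⟨?_, ?_, ?_, ?_⟩, ?_, ?_, ?_⟩, rfl⟩, by simp only; module⟩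
        <;> linarith
    · rintro ⟨_, rfl, _, ⟨s, t, u, w, ⟨⟨h0, h1, h2, h3⟩, h4, h5, h6⟩, rfl⟩, rfl⟩
      refine ⟨s + 1, t, u, w, ⟨⟨⟨?_, ?_, ?_, ?_, ?_, ?_⟩, ?_⟩, ?_⟩, by simp only; module⟩ <;>
        (try simp) <;> linarith
  have e3 : quad (fun s t u w => ((0 ≤ t ∧ t ≤ s ∧ s ≤ 2 ∧ 0 ≤ w ∧ w ≤ u ∧ u ≤ 1) ∧
      1 ≤ (![1, 0, 0, 0] : Fin 4 → ℝ) 0 * s + (![1, 0, 0, 0] : Fin 4 → ℝ) 1 * t +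
      (![1, 0, 0, 0] : Fin 4 → ℝ) 2 * u + (![1, 0, 0, 0] : Fin 4 → ℝ) 3 * w) ∧
      1 ≤ (![0, 1, 0, 0] : Fin 4 → ℝ) 0 * s + (![0, 1, 0, 0] : Fin 4 → ℝ) 1 * t +
      (![0, 1, 0, 0] : Fin 4 → ℝ) 2 * u + (![0, 1, 0, 0] : Fin 4 → ℝ) 3 * w) a b c d =
      {a + b} + quad chain22 a b c d := by
    ext z
    constructor
    · rintro ⟨s, t, u, w, ⟨⟨⟨h0, h1, h2, h3, h4, h6⟩, h7⟩, h8⟩, rfl⟩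
      simp at h7 h8
      refine ⟨_, rfl, _, ⟨s - 1, t - 1, u, w, ⟨?_, ?_, ?_, ?_, ?_, ?_⟩, rfl⟩, by simp only; module⟩
        <;> linarith
    · rintro ⟨_, rfl, _, ⟨s, t, u, w, ⟨h0, h1, h2, h4, h5, h6⟩, rfl⟩, rfl⟩
      refine ⟨s + 1, t + 1, u, w, ⟨⟨⟨?_, ?_, ?_, ?_, ?_, ?_⟩, ?_⟩, ?_⟩, by simp only; module⟩ <;>
        (try simp) <;> linarith
  rw [e1, e2, e3, hm.trans _ _ (quad_square.cc _ _ _ _), hm.trans _ _ (quad_chain22.cc _ _ _ _),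
    Val.quad_square_eq_zero hs hd hseg]
  ring

end block

section parts
variable {E : Type*} [NormedAddCommGroup E] [NormedSpace ℝ E]

theorem tet_lowPart {d j k : ℕ} (hd : j + k = d) (v : Fin d → E) :
    tet (lowPart v j) = tet fun i : Fin j => v ⟨i, by omega⟩ := by
  subst hd
  have key : ∀ x : Fin (j + k) → ℝ, Fintype.linearCombination ℝ (lowPart v j) x =
      Fintype.linearCombination ℝ (fun i : Fin j => v ⟨i, by omega⟩)
        (fun i : Fin j => x ⟨i, by omega⟩) := fun x => by
    rw [Fintype.linearCombination_apply, Fintype.linearCombination_apply, Fin.sum_univ_add]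
    rw [Finset.sum_eq_zero (s := Finset.univ (α := Fin k)), add_zero]
    · refine Finset.sum_congr rfl fun i _ => ?_
      simp only [lowPart, Fin.val_castAdd, i.2, if_true]
      rfl
    · intro i _
      simp [lowPart]
  ext z
  constructor
  · rintro ⟨x, ⟨h, h'⟩, rfl⟩
    exact ⟨_, ⟨fun a b hab => h (show (⟨a, _⟩ : Fin (j + k)) ≤ ⟨b, _⟩ from hab), fun i => h' _⟩,
      (key x).symm⟩
  · rintro ⟨y, ⟨h, h'⟩, rfl⟩
    refine ⟨fun i => if hi : (i : ℕ) < j then y ⟨i, hi⟩ else 0, ⟨fun a b hab => ?_, fun i => ?_⟩, ?_⟩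
    · dsimp only
      split_ifs with h1 h2 h2
      · exact h (show (⟨a, _⟩ : Fin j) ≤ ⟨b, _⟩ from hab)
      · exact absurd (lt_of_le_of_lt (show (a : ℕ) ≤ b from hab) h1) h2
      · exact (h' _).1
      · exact le_rfl
    · dsimp only
      split_ifs with h1
      · exact h' _
      · exact ⟨le_rfl, zero_le_one⟩
    · rw [key]
      congr 1
      funext i
      simp

theorem tet_highPart {d j k : ℕ} (hd : j + k = d) (v : Fin d → E) :
    tet (highPart v j) = tet fun i : Fin k => v ⟨j + i, by omega⟩ := by
  subst hd
  have key : ∀ x : Fin (j + k) → ℝ, Fintype.linearCombination ℝ (highPart v j) x =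
      Fintype.linearCombination ℝ (fun i : Fin k => v ⟨j + i, by omega⟩)
        (fun i : Fin k => x ⟨j + i, by omega⟩) := fun x => by
    rw [Fintype.linearCombination_apply, Fintype.linearCombination_apply, Fin.sum_univ_add]
    rw [Finset.sum_eq_zero (s := Finset.univ (α := Fin j)), zero_add]
    · refine Finset.sum_congr rfl fun i _ => ?_
      simp only [highPart, Fin.val_natAdd]
      rw [if_neg (by omega)]
      rfl
    · intro i _
      simp [highPart]
  ext z
  constructor
  · rintro ⟨x, ⟨h, h'⟩, rfl⟩
    exact ⟨_, ⟨fun a b hab => h (show (⟨j + a, _⟩ : Fin (j + k)) ≤ ⟨j + b, _⟩ from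
      Nat.add_le_add_left hab _), fun i => h' _⟩, (key x).symm⟩
  · rintro ⟨y, ⟨h, h'⟩, rfl⟩
    refine ⟨fun i => if hi : (i : ℕ) < j then 1 else y ⟨i - j, by omega⟩,
      ⟨fun a b hab => ?_, fun i => ?_⟩, ?_⟩
    · have hab' : (a : ℕ) ≤ b := hab
      dsimp only
      split_ifs with h1 h2 h2
      · exact le_rfl
      · omega
      · exact (h' _).2
      · exact h (show (⟨a - j, _⟩ : Fin k) ≤ ⟨b - j, _⟩ from Nat.sub_le_sub_right hab' _)
    · dsimp only
      split_ifs with h1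
      · exact ⟨zero_le_one, le_rfl⟩
      · exact h' _
    · rw [key]
      congr 1
      funext i
      simp

theorem tet_one (v : Fin 1 → E) : tet v = segment ℝ 0 (v 0) := by
  have ha := segment_zero_smul (v 0) zero_le_one
  rw [one_smul] at ha
  rw [ha]
  ext z
  constructor
  · rintro ⟨x, ⟨-, h⟩, rfl⟩
    exact ⟨x 0, (h 0).1, (h 0).2, by simp [Fintype.linearCombination_apply]⟩
  · rintro ⟨s, h0, h1, rfl⟩
    exact ⟨fun _ => s, ⟨fun _ _ _ => le_rfl, fun _ => ⟨h0, h1⟩⟩,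
      by simp [Fintype.linearCombination_apply]⟩

theorem tet_zero_fin (v : Fin 0 → E) : tet v = {0} := tet_zero_part fun i => i.elim0

variable [FiniteDimensional ℝ E] {m : Set E → ℂ}

theorem Val.double_chain4 (hm : Val m) (hs : Simple m) (hd : Module.finrank ℝ E = 4) (a b c d : E) :
    m ((2 : ℝ) • quad chain4 a b c d) = 2 * m (quad chain4 a b c d) + Nv a m (tet ![b, c, d]) +
      m (quad chain22 a b c d) + Nv d m (tet ![a, b, c]) := by
  have h := hm.double_tet ![a, b, c, d]
    (hs.comp_linear (Fintype.linearCombination ℝ ![a, b, c, d]) (by simp [hd]))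
  rw [Fin.sum_univ_four] at h
  have h4 : tet ![a, b, c, d] = quad chain4 a b c d := tet_four _
  have e0 : lowPart ![a, b, c, d] ((0 : Fin 4) : ℕ) = 0 := by
    funext i; simp [lowPart]
  have e0' : highPart ![a, b, c, d] ((0 : Fin 4) : ℕ) = ![a, b, c, d] := by
    funext i; simp [highPart]
  rw [e0, e0', tet_zero_part (v := (0 : Fin 4 → E)) (fun _ => rfl), hm.trans _ _ (tet_cc _), h4] at h
  have l1 : tet (lowPart ![a, b, c, d] ((1 : Fin 4) : ℕ)) = segment ℝ 0 a :=
    (tet_lowPart (show 1 + 3 = 4 from rfl) _).trans (tet_one _)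
  have l2 : tet (lowPart ![a, b, c, d] ((2 : Fin 4) : ℕ)) = tet ![a, b] :=
    (tet_lowPart (show 2 + 2 = 4 from rfl) _).trans (by congr 1; funext i; fin_cases i <;> rfl)
  have l3 : tet (lowPart ![a, b, c, d] ((3 : Fin 4) : ℕ)) = tet ![a, b, c] :=
    (tet_lowPart (show 3 + 1 = 4 from rfl) _).trans (by congr 1; funext i; fin_cases i <;> rfl)
  have r1 : tet (highPart ![a, b, c, d] ((1 : Fin 4) : ℕ)) = tet ![b, c, d] :=
    (tet_highPart (show 1 + 3 = 4 from rfl) _).trans (by congr 1; funext i; fin_cases i <;> rfl)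
  have r2 : tet (highPart ![a, b, c, d] ((2 : Fin 4) : ℕ)) = tet ![c, d] :=
    (tet_highPart (show 2 + 2 = 4 from rfl) _).trans (by congr 1; funext i; fin_cases i <;> rfl)
  have r3 : tet (highPart ![a, b, c, d] ((3 : Fin 4) : ℕ)) = segment ℝ 0 d :=
    (tet_highPart (show 3 + 1 = 4 from rfl) _).trans (tet_one _)
  rw [l1, l2, l3, r1, r2, r3, tet_two_add, add_comm (segment ℝ 0 a)] at h
  have z : ∀ x y z : E, m (tet ![x, y, z]) = 0 := fun x y z => by
    have e1 : tet ![x, y, z] = tet (lowPart ![x, y, z, 0] 3) :=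
      ((tet_lowPart (show 3 + 1 = 4 from rfl) _).trans
        (by congr 1; funext i; fin_cases i <;> rfl)).symm
    rw [e1]
    exact hs.tet_eq_zero hd _ fun h => h.ne_zero 3 (by simp [lowPart])
  simp only [Nv, z]
  rw [h]
  ring

end parts

section segInvariant
variable {E : Type*} [NormedAddCommGroup E] [NormedSpace ℝ E]

theorem Simple.eq_zero_of_subset {m : Set E → ℂ} (hs : Simple m) {W : Submodule ℝ E} (hW : W < ⊤)
    (a : E) {A : Set E} (hA : CC A) (h : ∀ x ∈ A, x - a ∈ W) : m A = 0 := by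
  obtain ⟨f, hf, hf'⟩ := Submodule.exists_le_ker_of_lt_top _ hW
  refine hs _ hA f hf (f a) fun x hx => ?_
  have := hf' (h x hx)
  rwa [LinearMap.mem_ker, map_sub, sub_eq_zero] at this

theorem smul_quad_chain4 (a b c d : E) (r : ℝ) :
    r • quad chain4 a b c d = quad chain4 (r • a) (r • b) (r • c) (r • d) := by
  have h := smul_tet_eq ![a, b, c, d] r
  rw [tet_four, tet_four] at h
  exact h

variable [FiniteDimensional ℝ E] {m : Set E → ℂ}

theorem Val.chain22_eq_zero (hm : Val m) (hs : Simple m) (hd : Module.finrank ℝ E = 4)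
    (hseg : ∀ (v : E) (A : Set E), CC A → m (A + segment ℝ 0 v) = m A) (a b c d : E) :
    m (quad chain22 a b c d) = 0 := by
  have hN : ∀ (v : E) {k : ℕ} (w : Fin k → E), Nv v m (tet w) = 0 := fun v k w => by
    rw [Nv, hseg v _ (tet_cc _), sub_self]
  have hB : ∀ a b c d : E, m (quad chain22 a b c d) =
      m (quad chain4 ((2 : ℝ) • a) ((2 : ℝ) • b) ((2 : ℝ) • c) ((2 : ℝ) • d)) -
        2 * m (quad chain4 a b c d) := fun a b c d => by
    have h := hm.double_chain4 hs hd a b c d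
    rw [hN, hN, smul_quad_chain4] at h
    linear_combination -h
  have h12 : ∀ a h c d : E, m (quad chain22 a h c d) = m (quad chain22 a h (c + h) d) := by
    intro a h c d
    have e1 := hm.chain22_cut hs hd a h c d
    have e2 := hm.chain4_cut hs hd a h c d
    have e3 := hm.chain4_cut hs hd ((2 : ℝ) • a) ((2 : ℝ) • h) ((2 : ℝ) • c) ((2 : ℝ) • d)
    have b1 := hB a ((2 : ℝ) • h) c d
    have b2 := hB (a + h) h c d
    have b3 := hB a h (h + c) d
    rw [smul_add] at b2 b3
    rw [add_comm c h]
    linear_combination -e1 + b1 - b2 - b3 + e3 - 2 * e2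
  have anti := hm.chain22_antisymm hs hd hseg
  have h02 : ∀ a b c d : E, m (quad chain22 a b c d) = m (quad chain22 a b (c + a) d) := by
    intro a b c d
    linear_combination anti b a c d - h12 b a c d - anti b a (c + a) d
  have h20 : ∀ a b c d : E, m (quad chain22 a b c d) = m (quad chain22 (a + c) b c d) := by
    intro a b c d
    rw [quad_chain22_swap a, h02, quad_chain22_swap]
  have h01 : ∀ a b c d : E, m (quad chain22 a b c d) = m (quad chain22 (a + b) b c d) := by
    intro a b c d
    have e1 := h20 (a + b) b (c - b) d
    have e2 := h12 (a + c) b (c - b) d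
    have e3 := h20 a b c d
    have e4 := h12 (a + b) b (c - b) d
    rw [show a + b + (c - b) = a + c by abel] at e1
    rw [show c - b + b = c by abel] at e2 e4
    linear_combination e3 - e2 - e1 + e4
  have k1 : ∀ a h c d : E, m (quad chain22 a ((2 : ℝ) • h) c d) = 2 * m (quad chain22 a h c d) := by
    intro a h c d
    rw [hm.chain22_cut hs hd, ← h01]
    ring
  have k2 := k1 ((2 : ℝ) • a) b c d
  have k3 := k1 b a c d
  have k4 := hm.chain22_double hs hd hseg a b c d
  have k5 := anti ((2 : ℝ) • a) b c d
  linear_combination 2 * anti a b c d + k3 - k5 - (1 / 2 : ℂ) * k2 + (1 / 2 : ℂ) * k4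

theorem Simple.comp_add_span (hm : Val m) (hs : Simple m) {a b : ℕ} (hab : a + b = Module.finrank ℝ E)
    {p : Fin a → E} (q : Fin b → E) :
    Simple fun A : Set (Submodule.span ℝ (Set.range p)) =>
      m ((Submodule.span ℝ (Set.range p)).subtype '' A + tet q) := by
  set W := Submodule.span ℝ (Set.range p)
  intro A hA l hl c hc
  dsimp only
  rcases A.eq_empty_or_nonempty with rfl | ⟨x₀, hx₀⟩
  · rw [Set.image_empty, Set.empty_add, hm.empty]
  have hlt : (LinearMap.ker l).map W.subtype ⊔ Submodule.span ℝ (Set.range q) < ⊤ := by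
    refine Submodule.lt_top_of_finrank_lt_finrank ?_
    refine (Submodule.finrank_add_le_finrank_add_finrank _ _).trans_lt ?_
    have h1 : Module.finrank ℝ (LinearMap.ker l) < Module.finrank ℝ W := by
      refine Submodule.finrank_lt ?_
      rwa [Ne, LinearMap.ker_eq_top]
    have h2 : Module.finrank ℝ W ≤ a := (finrank_range_le_card p).trans (by simp)
    have h3 : Module.finrank ℝ (Submodule.span ℝ (Set.range q)) ≤ b :=
      (finrank_range_le_card q).trans (by simp)
    rw [Submodule.finrank_map_subtype_eq] at *
    omega
  refine hs.eq_zero_of_subset hlt (x₀ : E) ((hA.image _).add (tet_cc q)) ?_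
  rintro _ ⟨_, ⟨x, hx, rfl⟩, y, hy, rfl⟩
  have : (x : E) + y - x₀ = ((x - x₀ : W) : E) + y := by push_cast; abel
  simp only [Submodule.subtype_apply]
  rw [this]
  refine Submodule.add_mem_sup ⟨x - x₀, ?_, rfl⟩ (tet_subset_span q hy)
  rw [SetLike.mem_coe, LinearMap.mem_ker, map_sub, hc x hx, hc x₀ hx₀, sub_self]

end segInvariant

section segInvariant'
universe u

theorem Val.eq_zero_of_seg (d : ℕ) (hd3 : 3 ≤ d) : ∀ (V : Type u) [NormedAddCommGroup V]
    [InnerProductSpace ℝ V] [FiniteDimensional ℝ V] (m : Set V → ℂ), Val m → Simple m →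
    Module.finrank ℝ V = d → (∀ (v : V) (A : Set V), CC A → m (A + segment ℝ 0 v) = m A) →
    ∀ A : Set V, CC A → m A = 0 := by
  induction d using Nat.strong_induction_on with
  | _ d ih =>
  intro V _ _ _ m hm hs hd hseg
  have block : ∀ (a b : ℕ), a + b = d → 3 ≤ a → 0 < b → ∀ (p : Fin a → V) (q : Fin b → V),
      LinearIndependent ℝ p → m (tet p + tet q) = 0 := by
    intro a b hab ha hb p q hp
    have h := ih a (by omega) ha (Submodule.span ℝ (Set.range p)) _
      ((hm.comp_add (tet_cc q)).comp_linear (Submodule.span ℝ (Set.range p)).subtype)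
      (hs.comp_add_span hm (hab.trans hd.symm) q) (by simpa using finrank_span_eq_card hp) ?_
      (tet fun i => ⟨p i, Submodule.subset_span ⟨i, rfl⟩⟩) (tet_cc _)
    · rwa [image_tet] at h
    · intro v A hA
      rw [Set.image_add]
      have : (Submodule.span ℝ (Set.range p)).subtype '' segment ℝ 0 v = segment ℝ 0 (v : V) := by
        have := image_segment ℝ (Submodule.span ℝ (Set.range p)).subtype.toAffineMap 0 v
        simpa using this
      rw [this, add_right_comm, hseg]
      exact (hA.image _).add (tet_cc q)
  have h2 : ∀ v : Fin d → V, LinearIndependent ℝ v → m ((2 : ℝ) • tet v) = 2 * m (tet v) := by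
    intro v hv
    have hspan : Submodule.span ℝ (Set.range v) ≤ ⊤ := le_top
    rw [hm.double_tet v (hs.comp_linear _ (by simp [hd])),
      Finset.sum_eq_single (⟨0, by omega⟩ : Fin d)]
    · have e0 : lowPart v 0 = 0 := by funext i; simp [lowPart]
      have e0' : highPart v 0 = v := by funext i; simp [highPart]
      rw [e0, e0', tet_zero_part (v := (0 : Fin d → V)) (fun _ => rfl), hm.trans _ _ (tet_cc _)]
      ring
    · intro j _ hj
      have hj0 : 0 < (j : ℕ) := Nat.pos_of_ne_zero fun h => hj (Fin.ext h)
      obtain ⟨k, hk⟩ : ∃ k, (j : ℕ) + k = d := ⟨d - j, by omega⟩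
      have hl := tet_lowPart hk v
      have hh := tet_highPart hk v
      have hlv : LinearIndependent ℝ fun i : Fin j => v ⟨i, by omega⟩ :=
        hv.comp _ fun a b h => by simpa [Fin.ext_iff] using h
      have hhv : LinearIndependent ℝ fun i : Fin k => v ⟨j + i, by omega⟩ :=
        hv.comp _ fun a b h => by simpa [Fin.ext_iff] using h
      by_cases h3 : 3 ≤ (j : ℕ)
      · rw [hl, hh]
        exact block _ _ hk h3 (by omega) _ _ hlv
      by_cases k3 : 3 ≤ k
      · rw [hl, hh, add_comm]
        exact block _ _ (by omega) k3 hj0 _ _ hhv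
      by_cases j1 : (j : ℕ) = 1
      · have : tet (lowPart v j) = segment ℝ 0 (v ⟨0, by omega⟩) := by
          rw [j1]
          exact (tet_lowPart (show 1 + (d - 1) = d by omega) v).trans (tet_one _)
        rw [this, add_comm, hseg _ _ (tet_cc _)]
        exact hs.eq_zero_of_subset ((span_highPart_lt hv j hj0).trans_le hspan) 0 (tet_cc _)
          fun x hx => by simpa using tet_subset_span _ hx
      by_cases k1 : k = 1
      · subst k1
        rw [hh, tet_one, hseg _ _ (tet_cc _)]
        exact hs.eq_zero_of_subset ((span_lowPart_lt hv j).trans_le hspan) 0 (tet_cc _)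
          fun x hx => by simpa using tet_subset_span _ hx
      have hj2 : (j : ℕ) = 2 := by omega
      have hk2 : k = 2 := by omega
      subst hk2
      rw [hj2, tet_lowPart (show 2 + 2 = d by omega), tet_highPart (show 2 + 2 = d by omega)]
      have := hm.chain22_eq_zero hs (by omega) hseg (v ⟨0, by omega⟩) (v ⟨1, by omega⟩)
        (v ⟨2 + 0, by omega⟩) (v ⟨2 + 1, by omega⟩)
      rw [← tet_two_add] at this
      convert this using 3
      · congr 1; funext i; fin_cases i <;> rfl
      · congr 1; funext i; fin_cases i <;> rfl
    · simp
  have hsm : ∀ A : Set V, ((2 : ℝ) • (LinearMap.id : V →ₗ[ℝ] V)) '' A = (2 : ℝ) • A := fun A => rfl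
  have hdouble : ∀ A, CC A → m ((2 : ℝ) • A) = 2 * m A := by
    intro A hA
    rw [← sub_eq_zero]
    refine Val.eq_zero_of_tet (m := fun A => m ((2 : ℝ) • A) - 2 * m A) ?_ ?_ hd ?_ hA
    · exact (hm.comp_linear ((2 : ℝ) • (LinearMap.id : V →ₗ[ℝ] V))).sub (hm.smul 2)
    · intro S hS l hl c hc
      have h1 := hs S hS l hl c hc
      have h2 := hs.comp_linear ((2 : ℝ) • (LinearMap.id : V →ₗ[ℝ] V)) rfl S hS l hl c hc
      dsimp only at h2 ⊢
      rw [hsm] at h2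
      rw [h1, h2]
      simp
    · intro v hv
      rw [h2 v hv, sub_self]
  intro A hA
  refine hm.eq_zero_of_planar hdouble ?_ hA
  intro a b A hA hAs
  refine hs.eq_zero_of_subset (W := Submodule.span ℝ {a, b}) ?_ 0 hA fun x hx => by
    simpa using hAs hx
  refine Submodule.lt_top_of_finrank_lt_finrank ?_
  have : Module.finrank ℝ (Submodule.span ℝ (Set.range ![a, b])) ≤ 2 :=
    (finrank_range_le_card ![a, b]).trans (by simp)
  rw [Matrix.range_cons, Matrix.range_cons, Matrix.range_empty, Set.union_empty,
    Set.singleton_union] at this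
  omega

end segInvariant'

section descent

theorem Val.simple_subtype {E : Type*} [NormedAddCommGroup E] [NormedSpace ℝ E]
    [FiniteDimensional ℝ E] {m : Set E → ℂ} (hm : Val m) (W : Submodule ℝ E)
    (h : ∀ W' : Submodule ℝ E, W' < W → ∀ K : Set E, CC K → K ⊆ W' → m K = 0) :
    Simple fun A : Set W => m (W.subtype '' A) := by
  intro A hA l hl c hc
  dsimp only
  rcases A.eq_empty_or_nonempty with rfl | ⟨x₀, hx₀⟩
  · rw [Set.image_empty, hm.empty]
  have hlt : (LinearMap.ker l).map W.subtype < W := by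
    have h1 : LinearMap.ker l < ⊤ := lt_top_iff_ne_top.mpr fun h => hl (LinearMap.ker_eq_top.mp h)
    have h2 := Submodule.map_strictMono_of_injective W.injective_subtype h1
    simpa using h2
  have hcc := (CC.singleton (-x₀)).add hA
  rw [← hm.trans (-(x₀ : E)) _ (hA.image _)]
  refine h _ hlt _ ((CC.singleton _).add (hA.image _)) ?_
  rintro _ ⟨_, rfl, _, ⟨x, hx, rfl⟩, rfl⟩
  refine ⟨-x₀ + x, ?_, rfl⟩
  rw [SetLike.mem_coe, LinearMap.mem_ker, map_add, map_neg, hc x hx, hc x₀ hx₀, neg_add_cancel]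

theorem image_subtype_segment {E : Type*} [NormedAddCommGroup E] [NormedSpace ℝ E]
    (W : Submodule ℝ E) (v : W) : W.subtype '' segment ℝ 0 v = segment ℝ 0 (v : E) := by
  have := image_segment ℝ W.subtype.toAffineMap 0 v
  simpa using this

theorem CC.exists_subtype_image {E : Type*} [NormedAddCommGroup E] [NormedSpace ℝ E]
    [FiniteDimensional ℝ E] {K : Set E} (hK : CC K) {W : Submodule ℝ E} (h : K ⊆ W) :
    ∃ A : Set W, CC A ∧ W.subtype '' A = K :=
  ⟨_, hK.preimage W.subtype W.injective_subtype, by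
    rw [Set.image_preimage_eq_iff]; simpa using h⟩

theorem Val.eq_zero_of_nv {V : Type*} [NormedAddCommGroup V] [InnerProductSpace ℝ V]
    [FiniteDimensional ℝ V] {m : Set V → ℂ} (hm : Val m) {k : ℕ} (hk : 2 ≤ k)
    (hh : ∀ A, CC A → m ((2 : ℝ) • A) = 2 ^ k * m A)
    (hn : ∀ (v : V) (A : Set V), CC A → Nv v m A = 0) {K : Set V} (hK : CC K) : m K = 0 := by
  have hseg : ∀ (v : V) (A : Set V), CC A → m (A + segment ℝ 0 v) = m A := fun v A hA =>
    sub_eq_zero.mp (hn v A hA)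
  have hpow : (4 : ℝ) ≤ 2 ^ k := by
    calc (4 : ℝ) = 2 ^ 2 := by norm_num
      _ ≤ 2 ^ k := pow_le_pow_right₀ one_le_two hk
  have cancel : ∀ (c : ℝ) (z : ℂ), c < 4 → (2 : ℂ) ^ k * z = c * z → z = 0 := by
    intro c z hc h
    have h1 : ((2 : ℂ) ^ k - c) * z = 0 := by linear_combination h
    refine (mul_eq_zero.mp h1).resolve_left fun h0 => ?_
    have : ((2 ^ k - c : ℝ) : ℂ) = 0 := by push_cast; exact h0
    rw [Complex.ofReal_eq_zero] at this
    linarith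
  have h0 : ∀ x : V, m {x} = 0 := by
    have hz : m {0} = 0 := by
      refine cancel 1 _ (by norm_num) ?_
      rw [← hh _ (CC.singleton 0)]
      simp
    intro x
    have := hm.trans x {0} (CC.singleton 0)
    rw [hz] at this
    simpa using this
  refine vanish_induction (fun _ : Unit => m) (fun _ => hm) ?_ () hK
  intro d v hv hlow _
  have hlow' := hlow ()
  by_cases hd : 3 ≤ d
  · set W := Submodule.span ℝ (Set.range v)
    obtain ⟨A, hA, hAv⟩ := (tet_cc v).exists_subtype_image (tet_subset_span v)
    rw [← hAv]
    refine Val.eq_zero_of_seg d hd W _ (hm.comp_linear W.subtype) (hm.simple_subtype W hlow')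
      (by simpa using finrank_span_eq_card hv) (fun w A hA => ?_) A hA
    rw [Set.image_add, image_subtype_segment, hseg _ _ (hA.image _)]
  have hdt := hm.double_tet v (hm.simple_of_lower hv hlow')
  have hseg0 : ∀ v : V, m (segment ℝ 0 v) = 0 := fun v => by
    have := hseg v {0} (CC.singleton 0)
    rwa [h0, Set.singleton_add, show (fun x : V => 0 + x) = id by funext x; simp, Set.image_id]
      at this
  interval_cases d
  · rw [tet_zero_fin, h0]
  · rw [tet_one, hseg0]
  · refine cancel 2 _ (by norm_num) ?_
    have e0 : lowPart v ((0 : Fin 2) : ℕ) = 0 := by funext i; simp [lowPart]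
    have e0' : highPart v ((0 : Fin 2) : ℕ) = v := by funext i; simp [highPart]
    have l1 : tet (lowPart v ((1 : Fin 2) : ℕ)) = segment ℝ 0 (v 0) :=
      (tet_lowPart (show 1 + 1 = 2 from rfl) _).trans (tet_one _)
    have r1 : tet (highPart v ((1 : Fin 2) : ℕ)) = segment ℝ 0 (v 1) :=
      (tet_highPart (show 1 + 1 = 2 from rfl) _).trans (tet_one _)
    rw [hh _ (tet_cc v), Fin.sum_univ_two, e0, e0', l1, r1,
      tet_zero_part (v := (0 : Fin 2 → V)) (fun _ => rfl), hm.trans _ _ (tet_cc _),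
      hseg _ _ (CC.segment _ _), hseg0] at hdt
    rw [hdt]
    push_cast
    ring

end descent

section iterated
variable {E : Type*} [NormedAddCommGroup E] [NormedSpace ℝ E]

instance : LeftCommutative (Nv : E → (Set E → ℂ) → Set E → ℂ) := ⟨nv_comm⟩

/-- Iterated differences in the directions of a multiset of vectors. -/
def NN (l : Multiset E) (m : Set E → ℂ) : Set E → ℂ := l.foldr Nv m

/-- The span of a multiset of vectors. -/
def mspan (l : Multiset E) : Submodule ℝ E := Submodule.span ℝ {x | x ∈ l}

theorem mspan_cons (v : E) (l : Multiset E) : mspan (v ::ₘ l) = Submodule.span ℝ {v} ⊔ mspan l := by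
  rw [mspan, mspan, ← Submodule.span_union]
  congr 1
  ext x
  simp

theorem mspan_add (k l : Multiset E) : mspan (k + l) = mspan k ⊔ mspan l := by
  rw [mspan, mspan, mspan, ← Submodule.span_union]
  congr 1
  ext x
  simp

theorem mem_mspan {v : E} {l : Multiset E} (h : v ∈ l) : v ∈ mspan l := Submodule.subset_span h

theorem mspan_zero : mspan (0 : Multiset E) = ⊥ := by simp [mspan]

theorem mem_mspan_cons {v x : E} {l : Multiset E} :
    x ∈ mspan (v ::ₘ l) ↔ ∃ t : ℝ, ∃ w ∈ mspan l, x = t • v + w := by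
  rw [mspan_cons, Submodule.mem_sup]
  constructor
  · rintro ⟨y, hy, w, hw, rfl⟩
    obtain ⟨t, rfl⟩ := Submodule.mem_span_singleton.mp hy
    exact ⟨t, w, hw, rfl⟩
  · rintro ⟨t, w, hw, rfl⟩
    exact ⟨_, Submodule.mem_span_singleton.mpr ⟨t, rfl⟩, w, hw, rfl⟩

theorem finrank_mspan_le [FiniteDimensional ℝ E] (l : Multiset E) :
    Module.finrank ℝ (mspan l) ≤ Multiset.card l := by
  classical
  have h : {x | x ∈ l} = ((l.toFinset : Finset E) : Set E) := by ext; simp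
  rw [mspan, h]
  exact (finrank_span_finset_le_card _).trans (Multiset.toFinset_card_le l)

theorem exists_mspan_eq [FiniteDimensional ℝ E] (W : Submodule ℝ E) :
    ∃ l : Multiset E, Multiset.card l = Module.finrank ℝ W ∧ mspan l = W := by
  let b := Module.finBasis ℝ W
  refine ⟨Finset.univ.val.map fun i => (b i : E), by simp, ?_⟩
  have h : {x : E | x ∈ Finset.univ.val.map fun i => (b i : E)} = W.subtype '' Set.range b := by
    ext x; simp
  rw [mspan, h, ← Submodule.map_span, b.span_eq]
  simp

theorem nn_cons (v : E) (l : Multiset E) (m : Set E → ℂ) : NN (v ::ₘ l) m = Nv v (NN l m) :=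
  Multiset.foldr_cons _ _ _ _

theorem nn_zero (m : Set E → ℂ) : NN 0 m = m := Multiset.foldr_zero _ _

theorem nn_cons' (v : E) (l : Multiset E) (m : Set E → ℂ) : NN (v ::ₘ l) m = NN l (Nv v m) := by
  induction l using Multiset.induction_on with
  | empty => rw [nn_cons, nn_zero, nn_zero]
  | cons w l ih => rw [nn_cons w, ← ih, Multiset.cons_swap, nn_cons]

theorem Val.nn {m : Set E → ℂ} (hm : Val m) (l : Multiset E) : Val (NN l m) := by
  induction l using Multiset.induction_on with
  | empty => rwa [nn_zero]
  | cons w l ih => rw [nn_cons]; exact ih.nv w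

theorem nn_eq_zero_of_subset {m : Set E → ℂ} {W : Submodule ℝ E}
    (h : ∀ A, CC A → A ⊆ W → m A = 0) {l : Multiset E} (hl : mspan l ≤ W) {A : Set E} (hA : CC A)
    (hAW : A ⊆ W) : NN l m A = 0 := by
  induction l using Multiset.induction_on generalizing A with
  | empty => rw [nn_zero]; exact h A hA hAW
  | cons w l ih =>
    rw [mspan_cons, sup_le_iff, Submodule.span_singleton_le_iff_mem] at hl
    rw [nn_cons, Nv, ih hl.2 hA hAW, ih hl.2 (hA.add (CC.segment _ _)), sub_zero]
    rintro _ ⟨a, ha, _, ⟨s, t, -, -, -, rfl⟩, rfl⟩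
    exact W.add_mem (hAW ha) (W.add_mem (W.smul_mem _ W.zero_mem) (W.smul_mem _ hl.1))

theorem nv_double {m : Set E → ℂ} (hm : Val m) {c : ℂ} (h : ∀ A, CC A → m ((2 : ℝ) • A) = 2 * c * m A)
    (v : E) {A : Set E} (hA : CC A) : Nv v m ((2 : ℝ) • A) = c * Nv v m A := by
  have e : (2 : ℝ) • A + segment ℝ 0 v = (2 : ℝ) • (A + segment ℝ 0 ((1 / 2 : ℝ) • v)) := by
    rw [smul_add]
    congr 1
    have := image_segment ℝ ((2 : ℝ) • (LinearMap.id : E →ₗ[ℝ] E)).toAffineMap 0 ((1 / 2 : ℝ) • v)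
    have h2 : (2 : ℝ) • segment ℝ 0 ((1 / 2 : ℝ) • v) = segment ℝ 0 v := by
      refine Eq.trans this ?_
      simp [smul_smul]
    exact h2.symm
  have h3 := hm.nv_smul v (1 / 2) hA
  rw [abs_of_pos (by norm_num)] at h3
  simp only [Nv] at h3 ⊢
  rw [e, h _ (hA.add (CC.segment _ _)), h _ hA]
  push_cast at h3
  linear_combination 2 * c * h3

theorem nn_double {m : Set E → ℂ} (hm : Val m) {k j : ℕ} {l : Multiset E} (hl : Multiset.card l + j = k)
    (h : ∀ A, CC A → m ((2 : ℝ) • A) = 2 ^ k * m A) {A : Set E} (hA : CC A) :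
    NN l m ((2 : ℝ) • A) = 2 ^ j * NN l m A := by
  induction l using Multiset.induction_on generalizing j A with
  | empty =>
    rw [nn_zero, h A hA]
    simp only [Multiset.card_zero, zero_add] at hl
    rw [hl]
  | cons w l ih =>
    rw [nn_cons]
    rw [Multiset.card_cons] at hl
    refine nv_double (hm.nn l) (fun A hA => ?_) w hA
    rw [ih (j := j + 1) (by omega) hA, pow_succ']

/-- Iterated differences only depend on the body modulo the span of the directions. -/
theorem Val.nn_congr [FiniteDimensional ℝ E] {F : Type*} [NormedAddCommGroup F] [NormedSpace ℝ F]
    [FiniteDimensional ℝ F] {m : Set E → ℂ} (hm : Val m) {l : Multiset E} {φ ψ : F →ₗ[ℝ] E}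
    (h : ∀ x, φ x - ψ x ∈ mspan l) {C : Set F} (hC : CC C) :
    NN l m (φ '' C) = NN l m (ψ '' C) := by
  induction l using Multiset.induction_on generalizing m φ ψ with
  | empty =>
    have : φ = ψ := by
      ext x
      have := h x
      rwa [mspan_zero, Submodule.mem_bot, sub_eq_zero] at this
    rw [this]
  | cons v l ih =>
    by_cases hv : v ∈ mspan l
    · have hle : mspan (v ::ₘ l) = mspan l := by
        rw [mspan_cons, sup_eq_right, Submodule.span_singleton_le_iff_mem]; exact hv
      rw [nn_cons']
      exact ih (hm.nv v) fun x => hle ▸ h x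
    · obtain ⟨g, hg, hgl⟩ := Submodule.exists_le_ker_of_notMem hv
      let f : F →ₗ[ℝ] ℝ := (g v)⁻¹ • (g ∘ₗ (φ - ψ))
      have hf : ∀ x, φ x - ψ x - f x • v ∈ mspan l := by
        intro x
        obtain ⟨t, w, hw, hx⟩ := mem_mspan_cons.mp (h x)
        have hgw : g w = 0 := hgl hw
        have : f x = t := by
          simp [f, hx, hgw]
          field_simp
        rw [this, hx, add_sub_cancel_left]
        exact hw
      have h1 : NN (v ::ₘ l) m (φ '' C) = NN (v ::ₘ l) m ((ψ + f.smulRight v) '' C) := by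
        rw [nn_cons']
        refine ih (hm.nv v) fun x => ?_
        have := hf x
        rwa [sub_sub] at this
      rw [h1, nn_cons]
      have hgv : ((g v)⁻¹ • g) v = 1 := by simp [inv_mul_cancel₀ hg]
      refine (hm.nn l).nv_congr hgv (hC.image _) (hC.image _) ?_
      rw [← Set.image_comp, ← Set.image_comp]
      refine Set.image_congr fun x _ => ?_
      simp only [Function.comp, projAlong_apply, LinearMap.add_apply, LinearMap.smulRight_apply,
        map_add, map_smul, hgv]
      module

theorem Val.nn_shear [FiniteDimensional ℝ E] {m : Set E → ℂ} (hm : Val m) {l : Multiset E} {w : E}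
    (hw : w ∈ mspan l) (v : E) {A : Set E} (hA : CC A) :
    NN ((v + w) ::ₘ l) m A = NN (v ::ₘ l) m A := by
  have key : ∀ u : E, A + segment ℝ 0 u =
      ((LinearMap.fst ℝ E ℝ) + (LinearMap.snd ℝ E ℝ).smulRight u) '' (A ×ˢ Set.Icc 0 1) := by
    intro u
    have hu := segment_zero_smul u zero_le_one
    rw [one_smul] at hu
    rw [hu]
    ext z
    constructor
    · rintro ⟨a, ha, _, ⟨s, h0, h1, rfl⟩, rfl⟩
      exact ⟨(a, s), ⟨ha, h0, h1⟩, by simp⟩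
    · rintro ⟨⟨a, s⟩, ⟨ha, h0, h1⟩, rfl⟩
      exact ⟨a, ha, _, ⟨s, h0, h1, rfl⟩, by simp⟩
  have hcc : CC (A ×ˢ Set.Icc (0 : ℝ) 1) :=
    ⟨hA.conv.prod (convex_Icc 0 1), hA.comp.prod isCompact_Icc⟩
  rw [nn_cons, nn_cons, Nv, Nv, key, key]
  congr 1
  refine hm.nn_congr (fun x => ?_) hcc
  simpa [smul_add] using (mspan l).smul_mem x.2 hw

theorem Val.nn_smul {m : Set E → ℂ} (hm : Val m) (l : Multiset E) (v : E) (t : ℝ) {A : Set E}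
    (hA : CC A) : NN ((t • v) ::ₘ l) m A = |t| * NN (v ::ₘ l) m A := by
  rw [nn_cons, nn_cons, (hm.nn l).nv_smul v t hA]

theorem Val.nn_dependent [FiniteDimensional ℝ E] {m : Set E → ℂ} (hm : Val m) {l : Multiset E} {w : E}
    (hw : w ∈ mspan l) {A : Set E} (hA : CC A) : NN (w ::ₘ l) m A = 0 := by
  have := hm.nn_shear hw 0 hA
  rw [zero_add] at this
  rw [this, nn_cons, nv_zero]

theorem exists_exchange {k c : Multiset E} {v : E} (hv : v ∈ mspan (k + c)) (hk : v ∉ mspan k) :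
    ∃ x c', c = x ::ₘ c' ∧ ∃ t : ℝ, t ≠ 0 ∧ ∃ w ∈ mspan (k + c'), v = t • x + w := by
  induction c using Multiset.induction_on with
  | empty => rw [add_zero] at hv; exact absurd hv hk
  | cons x c ih =>
    rw [Multiset.add_cons] at hv
    obtain ⟨t, w, hw, rfl⟩ := mem_mspan_cons.mp hv
    by_cases ht : t = 0
    · subst ht
      rw [zero_smul, zero_add] at ih hk ⊢
      obtain ⟨y, c', rfl, s, hs, u, hu, rfl⟩ := ih hw
      refine ⟨y, x ::ₘ c', Multiset.cons_swap _ _ _, s, hs, u, ?_, rfl⟩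
      rw [Multiset.add_cons, mspan_cons]
      exact Submodule.mem_sup_right hu
    · exact ⟨x, c, rfl, t, ht, w, hw, rfl⟩

theorem Val.nn_exchange [FiniteDimensional ℝ E] {m : Set E → ℂ} (hm : Val m) {A : Set E} (hA : CC A)
    (k c l : Multiset E) (hcl : Multiset.card c = Multiset.card l) (hl : mspan l ≤ mspan (k + c))
    (h : NN (k + c) m A = 0) : NN (k + l) m A = 0 := by
  induction l using Multiset.induction_on generalizing k c with
  | empty =>
    rw [Multiset.card_zero, Multiset.card_eq_zero] at hcl
    rwa [← hcl]
  | cons v l ih =>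
    rw [mspan_cons, sup_le_iff, Submodule.span_singleton_le_iff_mem] at hl
    by_cases hk : v ∈ mspan k
    · rw [Multiset.add_cons]
      refine hm.nn_dependent ?_ hA
      rw [mspan_add]
      exact Submodule.mem_sup_left hk
    obtain ⟨x, c', rfl, t, ht, w, hw, rfl⟩ := exists_exchange hl.1 hk
    rw [Multiset.add_cons, ← Multiset.cons_add]
    refine ih _ c' (by simpa using hcl) (hl.2.trans ?_) ?_
    · rw [Multiset.add_cons, Multiset.cons_add, mspan_cons, sup_le_iff,
        Submodule.span_singleton_le_iff_mem]
      refine ⟨mem_mspan_cons.mpr ⟨t⁻¹, -(t⁻¹ • w), ?_, ?_⟩, ?_⟩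
      · exact Submodule.neg_mem _ (Submodule.smul_mem _ _ hw)
      · rw [smul_add, smul_smul, inv_mul_cancel₀ ht]; module
      · rw [mspan_cons]; exact le_sup_right
    · rw [Multiset.cons_add, hm.nn_shear hw _ hA, hm.nn_smul _ _ _ hA]
      rw [Multiset.add_cons] at h
      rw [h, mul_zero]

end iterated

section planarReduction
variable {E : Type*} [NormedAddCommGroup E] [NormedSpace ℝ E]

theorem tet_two_union (a b : E) :
    tet ![a, b] ∪ tet ![b, a] = segment ℝ 0 a + segment ℝ 0 b := by
  have ha := segment_zero_smul a zero_le_one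
  have hb := segment_zero_smul b zero_le_one
  rw [one_smul] at ha hb
  rw [ha, hb]
  ext z
  simp only [Set.mem_union, mem_tet_two, Set.mem_add, Set.mem_ofPred_eq]
  constructor
  · rintro (⟨s, t, h0, h1, h2, rfl⟩ | ⟨s, t, h0, h1, h2, rfl⟩)
    · exact ⟨_, ⟨s, by linarith, h2, rfl⟩, _, ⟨t, h0, by linarith, rfl⟩, rfl⟩
    · exact ⟨_, ⟨t, h0, by linarith, rfl⟩, _, ⟨s, by linarith, h2, rfl⟩, add_comm _ _⟩
  · rintro ⟨_, ⟨s, h0, h1, rfl⟩, _, ⟨t, h2, h3, rfl⟩, rfl⟩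
    rcases le_total t s with h | h
    · exact Or.inl ⟨s, t, h2, h, h1, rfl⟩
    · exact Or.inr ⟨t, s, h0, h, h3, add_comm _ _⟩

theorem tet_two_inter {a b : E} (hab : LinearIndependent ℝ ![a, b]) :
    tet ![a, b] ∩ tet ![b, a] = segment ℝ 0 (a + b) := by
  have hs := segment_zero_smul (a + b) zero_le_one
  rw [one_smul] at hs
  rw [hs]
  ext z
  simp only [Set.mem_inter_iff, mem_tet_two, Set.mem_ofPred_eq]
  constructor
  · rintro ⟨⟨s, t, h0, h1, h2, rfl⟩, ⟨s', t', h0', h1', h2', h⟩⟩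
    obtain ⟨e1, e2⟩ := LinearIndependent.eq_of_pair hab (h.trans (add_comm _ _))
    have : t = s := by linarith
    subst this
    exact ⟨t, h0, h2, by rw [smul_add]⟩
  · rintro ⟨s, h0, h1, rfl⟩
    exact ⟨⟨s, s, h0, le_rfl, h1, smul_add _ _ _⟩, ⟨s, s, h0, le_rfl, h1, by rw [smul_add, add_comm]⟩⟩

theorem tet_two_swap (a b : E) : tet ![b, a] = {a + b} + (-1 : ℝ) • tet ![a, b] := by
  ext z
  rw [mem_singleton_add_iff, Set.mem_smul_set]
  simp only [mem_tet_two]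
  constructor
  · rintro ⟨s, t, h0, h1, h2, rfl⟩
    exact ⟨_, ⟨1 - t, 1 - s, by linarith, by linarith, by linarith, rfl⟩, by module⟩
  · rintro ⟨_, ⟨s, t, h0, h1, h2, rfl⟩, h⟩
    refine ⟨1 - t, 1 - s, by linarith, by linarith, by linarith, ?_⟩
    rw [eq_sub_iff_add_eq] at h
    rw [← h]
    module

theorem Val.tet_two_neg [FiniteDimensional ℝ E] {T : Set E → ℂ} (hT : Val T)
    (h2 : ∀ A, CC A → T ((2 : ℝ) • A) = 2 * T A) (hs : ∀ v, T (segment ℝ 0 v) = 0) {a b : E}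
    (hab : LinearIndependent ℝ ![a, b]) :
    T ((-1 : ℝ) • tet ![a, b]) = - T (tet ![a, b]) := by
  have h := hT.union (tet ![a, b]) (tet ![b, a]) (tet_cc _) (tet_cc _)
    (by rw [tet_two_union]; exact ((CC.segment _ _).add (CC.segment _ _)).conv)
  rw [tet_two_union, tet_two_inter hab, hs, hT.minkowski_add h2 (CC.segment _ _) (CC.segment _ _)
    ⟨0, left_mem_segment _ _ _⟩ ⟨0, left_mem_segment _ _ _⟩, hs, hs, tet_two_swap a b,
    hT.trans _ _ ((tet_cc _).smul _)] at h
  linear_combination -h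

theorem neg_one_smul_segment (v : E) : (-1 : ℝ) • segment ℝ 0 v = segment ℝ 0 (-v) := by
  have := image_segment ℝ ((-1 : ℝ) • (LinearMap.id : E →ₗ[ℝ] E)).toAffineMap 0 v
  refine Eq.trans this ?_
  simp

theorem nn_neg {m : Set E → ℂ} (hm : Val m) {c : ℂ}
    (h : ∀ A, CC A → m ((-1 : ℝ) • A) = c * m A) (l : Multiset E) {A : Set E} (hA : CC A) :
    NN l m ((-1 : ℝ) • A) = c * NN l m A := by
  induction l using Multiset.induction_on generalizing A with
  | empty => rw [nn_zero, h A hA]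
  | cons w l ih =>
    rw [nn_cons, ← (hm.nn l).nv_neg w hA, Nv, Nv, ih hA, mul_sub, ← ih (hA.add (CC.segment _ _)),
      smul_add, neg_one_smul_segment, neg_neg]

theorem nn_map {F : Type*} [NormedAddCommGroup F] [NormedSpace ℝ F] (g : E →ₗ[ℝ] F)
    (m : Set F → ℂ) (l : Multiset E) (A : Set E) :
    NN (l.map g) m (g '' A) = NN l (fun B => m (g '' B)) A := by
  induction l using Multiset.induction_on generalizing A with
  | empty => rw [Multiset.map_zero, nn_zero, nn_zero]
  | cons w l ih =>
    have := image_segment ℝ g.toAffineMap 0 w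
    have hs : g '' segment ℝ 0 w = segment ℝ 0 (g w) := by simpa using this
    rw [Multiset.map_cons, nn_cons, nn_cons, Nv, Nv, ← ih, ← ih, Set.image_add, hs]

theorem nn_segment_eq_zero [FiniteDimensional ℝ E] {m : Set E → ℂ} {k : ℕ}
    (hlow : ∀ W : Submodule ℝ E, Module.finrank ℝ W ≤ k → ∀ A, CC A → A ⊆ W → m A = 0)
    {l : Multiset E} (hl : Multiset.card l + 1 ≤ k) (v : E) : NN l m (segment ℝ 0 v) = 0 := by
  refine nn_eq_zero_of_subset (W := mspan (v ::ₘ l)) (hlow _ ?_) ?_ (CC.segment _ _) ?_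
  · exact (finrank_mspan_le _).trans (by simpa using hl)
  · rw [mspan_cons]; exact le_sup_right
  · exact (mspan _).convex.segment_subset (Submodule.zero_mem _)
      (mem_mspan (Multiset.mem_cons_self v l))

end planarReduction

section planarReduction
variable {V : Type*} [NormedAddCommGroup V] [InnerProductSpace ℝ V] [FiniteDimensional ℝ V]

theorem Val.nn_eq_zero_of_tet {m : Set V → ℂ} (hm : Val m) {k : ℕ}
    (hh : ∀ A, CC A → m ((2 : ℝ) • A) = 2 ^ k * m A)
    (hlow : ∀ W : Submodule ℝ V, Module.finrank ℝ W ≤ k → ∀ A, CC A → A ⊆ W → m A = 0)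
    {l : Multiset V} (hl : Multiset.card l + 1 = k)
    (ht : ∀ a b : V, LinearIndependent ℝ ![a, b] → NN l m (tet ![a, b]) = 0) {A : Set V}
    (hA : CC A) : NN l m A = 0 := by
  have h2 : ∀ A, CC A → NN l m ((2 : ℝ) • A) = 2 * NN l m A := fun A hA => by
    rw [nn_double hm hl hh hA, pow_one]
  have h1 : ∀ W : Submodule ℝ V, Module.finrank ℝ W ≤ 1 → ∀ A, CC A → A ⊆ W → NN l m A = 0 := by
    intro W hW A hA hAW
    refine nn_eq_zero_of_subset (W := mspan l ⊔ W) (hlow _ ?_) le_sup_left hA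
      (hAW.trans (SetLike.coe_subset_coe.mpr le_sup_right))
    have := Submodule.finrank_add_le_finrank_add_finrank (mspan l) W
    have := finrank_mspan_le l
    omega
  refine (hm.nn l).eq_zero_of_planar h2 (fun a b A hA hAW => ?_) hA
  set W := Submodule.span ℝ {a, b}
  by_cases hW : Module.finrank ℝ W ≤ 1
  · exact h1 W hW A hA hAW
  have hW2 : Module.finrank ℝ W = 2 := by
    have : Module.finrank ℝ W ≤ 2 := by
      have := finrank_range_le_card (R := ℝ) ![a, b]
      simp only [Matrix.range_cons, Matrix.range_empty, Set.union_empty] at this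
      simp only [Set.finrank, Set.singleton_union, Fintype.card_fin] at this
      exact this
    omega
  obtain ⟨B, hB, rfl⟩ := hA.exists_subtype_image hAW
  refine ((hm.nn l).comp_linear W.subtype).eq_zero_of_tet ?_ hW2 (fun v hv => ?_) hB
  · refine (hm.nn l).simple_subtype W fun W' hW' => h1 W' ?_
    have := Submodule.finrank_lt_finrank_of_lt hW'
    omega
  · rw [image_tet]
    have : (W.subtype ∘ v) = ![(v 0 : V), (v 1 : V)] := by
      funext i; fin_cases i <;> rfl
    rw [this]
    refine ht _ _ ?_
    rw [← this]
    exact hv.map' _ (Submodule.ker_subtype _)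

theorem Val.eq_zero_of_nn {m : Set V → ℂ} (hm : Val m) {k : ℕ} (hk : 1 ≤ k)
    (hh : ∀ A, CC A → m ((2 : ℝ) • A) = 2 ^ k * m A)
    (h : ∀ l : Multiset V, Multiset.card l + 1 = k → ∀ A, CC A → NN l m A = 0) {A : Set V}
    (hA : CC A) : m A = 0 := by
  have key : ∀ j : ℕ, 1 ≤ j → ∀ l : Multiset V, Multiset.card l + j = k → ∀ A, CC A →
      NN l m A = 0 := by
    intro j hj
    induction j, hj using Nat.le_induction with
    | base => exact h
    | succ j hj ih =>
      intro l hl A hA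
      refine (hm.nn l).eq_zero_of_nv (k := j + 1) (by omega) (fun A hA => nn_double hm hl hh hA)
        (fun v A hA => ?_) hA
      rw [← nn_cons]
      exact ih _ (by rw [Multiset.card_cons]; omega) A hA
  have := key k hk 0 (by simp) A hA
  rwa [nn_zero] at this

/-- Even valuations are determined by their restrictions to subspaces of dimension `k`. -/
theorem Val.eq_zero_of_even {m : Set V → ℂ} (hm : Val m) {k : ℕ} (hk : 1 ≤ k)
    (hh : ∀ A, CC A → m ((2 : ℝ) • A) = 2 ^ k * m A)
    (hlow : ∀ W : Submodule ℝ V, Module.finrank ℝ W ≤ k → ∀ A, CC A → A ⊆ W → m A = 0)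
    (he : ∀ A, CC A → m ((-1 : ℝ) • A) = m A) {A : Set V} (hA : CC A) : m A = 0 := by
  refine hm.eq_zero_of_nn hk hh (fun l hl A hA => ?_) hA
  refine hm.nn_eq_zero_of_tet hh hlow hl (fun a b hab => ?_) hA
  have h2 : ∀ A, CC A → NN l m ((2 : ℝ) • A) = 2 * NN l m A := fun A hA => by
    rw [nn_double hm hl hh hA, pow_one]
  have h1 := (hm.nn l).tet_two_neg h2 (nn_segment_eq_zero hlow hl.le) hab
  rw [nn_neg hm (c := 1) (fun A hA => by rw [one_mul, he A hA]) l (tet_cc _)] at h1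
  linear_combination h1 / 2

end planarReduction

section planeRotation
variable {n : ℕ}

theorem real_inner_cn (x y : Cn n) : inner ℝ x y = (inner ℂ x y).re := by
  simp only [PiLp.inner_apply, Complex.re_sum]
  exact Finset.sum_congr rfl fun i _ => rfl

/-- The matrix acting as `R` on the span of the columns `v 0, v 1` and trivially on the complement. -/
def planeMat (v : Fin 2 → Cn n) (R : Matrix (Fin 2) (Fin 2) ℂ) : Matrix (Fin n) (Fin n) ℂ :=
  1 + (Matrix.of fun i j => v j i) * ((R - 1) * (Matrix.of fun i j => v j i).conjTranspose)

theorem conjTranspose_mul_self_of_orthonormal {v : Fin 2 → Cn n} (hv : Orthonormal ℂ v) :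
    (Matrix.of fun i j => v j i).conjTranspose * (Matrix.of fun i j => v j i) = 1 := by
  ext i j
  rw [orthonormal_iff_ite] at hv
  have := hv i j
  rw [PiLp.inner_apply] at this
  rw [Matrix.mul_apply, Matrix.one_apply, ← this]
  refine Finset.sum_congr rfl fun k _ => ?_
  simp [mul_comm]

theorem det_planeMat {v : Fin 2 → Cn n} (hv : Orthonormal ℂ v) (R : Matrix (Fin 2) (Fin 2) ℂ) :
    (planeMat v R).det = R.det := by
  rw [planeMat, Matrix.det_one_add_mul_comm, Matrix.mul_assoc,
    conjTranspose_mul_self_of_orthonormal hv, mul_one, add_sub_cancel]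

theorem planeMat_mem {v : Fin 2 → Cn n} (hv : Orthonormal ℂ v) {R : Matrix (Fin 2) (Fin 2) ℂ}
    (hR : R ∈ Matrix.unitaryGroup (Fin 2) ℂ) : planeMat v R ∈ Matrix.unitaryGroup (Fin n) ℂ := by
  have hR' := Matrix.mem_unitaryGroup_iff.mp hR
  have hU := conjTranspose_mul_self_of_orthonormal hv
  rw [Matrix.mem_unitaryGroup_iff]
  rw [Matrix.star_eq_conjTranspose] at hR' ⊢
  rw [planeMat]
  set U : Matrix (Fin n) (Fin 2) ℂ := Matrix.of fun i j => v j i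
  rw [Matrix.conjTranspose_add, Matrix.conjTranspose_mul, Matrix.conjTranspose_mul,
    Matrix.conjTranspose_conjTranspose, Matrix.conjTranspose_one, Matrix.conjTranspose_sub,
    Matrix.conjTranspose_one]
  have e : U * ((R - 1) * U.conjTranspose) * (U * (R.conjTranspose - 1) * U.conjTranspose) =
      U * ((R - 1) * (R.conjTranspose - 1) * U.conjTranspose) := by
    calc _ = U * ((R - 1) * (U.conjTranspose * U) * (R.conjTranspose - 1) * U.conjTranspose) := by
          simp only [Matrix.mul_assoc]
      _ = _ := by rw [hU, mul_one]
  rw [add_mul, mul_add, mul_add, e, one_mul, one_mul, mul_one, Matrix.mul_assoc U]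
  have : (R - 1) * (R.conjTranspose - 1) = 1 - R - R.conjTranspose + 1 := by
    rw [sub_mul, mul_sub, hR', mul_one, one_mul]; abel
  rw [this, add_assoc, ← Matrix.mul_add, ← Matrix.mul_add, ← Matrix.add_mul, ← Matrix.add_mul]
  have : R.conjTranspose - 1 + (R - 1 + (1 - R - R.conjTranspose + 1)) = 0 := by abel
  rw [this, Matrix.zero_mul, Matrix.mul_zero, add_zero]

/-- The action of `planeMat v !![p, q; r, s]`. -/
def planeLin (v : Fin 2 → Cn n) (p q r s : ℝ) : Cn n →ₗ[ℝ] Cn n where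
  toFun x := x + (((p - 1 : ℝ) : ℂ) * inner ℂ (v 0) x + (q : ℂ) * inner ℂ (v 1) x) • v 0 +
    ((r : ℂ) * inner ℂ (v 0) x + ((s - 1 : ℝ) : ℂ) * inner ℂ (v 1) x) • v 1
  map_add' x y := by
    simp only [inner_add_right]
    module
  map_smul' c x := by
    have : ∀ w : Cn n, inner ℂ w (c • x) = (c : ℂ) * inner ℂ w x := fun w => by
      rw [show c • x = (c : ℂ) • x from rfl, inner_smul_right]
    simp only [this, RingHom.id_apply]
    rw [show ∀ z : Cn n, c • z = (c : ℂ) • z from fun _ => rfl]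
    module

theorem planeLin_apply (v : Fin 2 → Cn n) (p q r s : ℝ) (x : Cn n) :
    planeLin v p q r s x =
      x + (((p - 1 : ℝ) : ℂ) * inner ℂ (v 0) x + (q : ℂ) * inner ℂ (v 1) x) • v 0 +
      ((r : ℂ) * inner ℂ (v 0) x + ((s - 1 : ℝ) : ℂ) * inner ℂ (v 1) x) • v 1 := rfl

theorem toEuclideanLin_planeMat (v : Fin 2 → Cn n) (p q r s : ℝ) (x : Cn n) :
    Matrix.toEuclideanLin (planeMat v !![(p : ℂ), q; r, s]) x = planeLin v p q r s x := by
  have hi : ∀ k, inner ℂ (v k) x = ∑ i, star (v k i) * x i := fun k => by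
    rw [PiLp.inner_apply]
    exact Finset.sum_congr rfl fun i _ => by simp [mul_comm]
  have hc : (Matrix.of fun i j => v j i).conjTranspose.mulVec x.ofLp = fun k => inner ℂ (v k) x := by
    funext k
    rw [hi]
    rfl
  ext i
  rw [Matrix.toLpLin_apply, planeLin_apply, planeMat]
  simp only [Matrix.add_mulVec, Matrix.one_mulVec, ← Matrix.mulVec_mulVec, hc]
  simp [Matrix.vecHead, Matrix.vecTail]
  ring

theorem planeLin_adjoint (v : Fin 2 → Cn n) (p q r s : ℝ) (x y : Cn n) :
    inner ℝ x (planeLin v p q r s y) = inner ℝ (planeLin v p r q s x) y := by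
  rw [real_inner_cn, real_inner_cn, planeLin_apply, planeLin_apply]
  simp only [inner_add_left, inner_add_right, inner_smul_left, inner_smul_right, map_add, map_mul,
    Complex.conj_ofReal, inner_conj_symm]
  congr 1
  ring

theorem planeLin_zero {v : Fin 2 → Cn n} (hv : Orthonormal ℂ v) (p q r s : ℝ) :
    planeLin v p q r s (v 0) = p • v 0 + r • v 1 := by
  have h := orthonormal_iff_ite.mp hv
  rw [planeLin_apply, h, h]
  rw [show ∀ (t : ℝ) (z : Cn n), t • z = (t : ℂ) • z from fun _ _ => rfl,
    show ∀ (t : ℝ) (z : Cn n), t • z = (t : ℂ) • z from fun _ _ => rfl]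
  simp
  module

theorem planeLin_one {v : Fin 2 → Cn n} (hv : Orthonormal ℂ v) (p q r s : ℝ) :
    planeLin v p q r s (v 1) = q • v 0 + s • v 1 := by
  have h := orthonormal_iff_ite.mp hv
  rw [planeLin_apply, h, h]
  rw [show ∀ (t : ℝ) (z : Cn n), t • z = (t : ℂ) • z from fun _ _ => rfl,
    show ∀ (t : ℝ) (z : Cn n), t • z = (t : ℂ) • z from fun _ _ => rfl]
  simp
  module

theorem planeLin_of_orthogonal {v : Fin 2 → Cn n} {x : Cn n} (h0 : inner ℂ (v 0) x = 0)
    (h1 : inner ℂ (v 1) x = 0) (p q r s : ℝ) : planeLin v p q r s x = x := by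
  rw [planeLin_apply, h0, h1]
  simp

theorem inner_planeLin {v : Fin 2 → Cn n} (hv : Orthonormal ℂ v) (p q r s : ℝ) (x : Cn n) :
    inner ℂ (v 0) (planeLin v p q r s x) = p * inner ℂ (v 0) x + q * inner ℂ (v 1) x ∧
    inner ℂ (v 1) (planeLin v p q r s x) = r * inner ℂ (v 0) x + s * inner ℂ (v 1) x := by
  have h := orthonormal_iff_ite.mp hv
  rw [planeLin_apply]
  simp only [inner_add_right, inner_smul_right, h]
  constructor <;> (simp; ring)

/-- The orthogonal projection along the real plane spanned by `v 0, v 1`. -/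
def offPlane (v : Fin 2 → Cn n) : Cn n →ₗ[ℝ] Cn n where
  toFun x := x - (inner ℝ (v 0) x : ℝ) • v 0 - (inner ℝ (v 1) x : ℝ) • v 1
  map_add' x y := by simp only [inner_add_right]; module
  map_smul' c x := by
    simp only [real_inner_smul_right, RingHom.id_apply]; module

theorem offPlane_apply (v : Fin 2 → Cn n) (x : Cn n) :
    offPlane v x = x - (inner ℝ (v 0) x : ℝ) • v 0 - (inner ℝ (v 1) x : ℝ) • v 1 := rfl

theorem offPlane_adjoint (v : Fin 2 → Cn n) (x y : Cn n) :
    inner ℝ x (offPlane v y) = inner ℝ (offPlane v x) y := by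
  rw [offPlane_apply, offPlane_apply]
  simp only [inner_sub_left, inner_sub_right, real_inner_smul_left, real_inner_smul_right,
    real_inner_comm x]
  ring

theorem planeLin_offPlane {v : Fin 2 → Cn n} (hv : Orthonormal ℂ v) (p q r s : ℝ) (x : Cn n) :
    planeLin v p q r s (offPlane v x) =
      (x - inner ℂ (v 0) x • v 0 - inner ℂ (v 1) x • v 1) +
      (Complex.I * ((p * (inner ℂ (v 0) x).im + q * (inner ℂ (v 1) x).im : ℝ) : ℂ)) • v 0 +
      (Complex.I * ((r * (inner ℂ (v 0) x).im + s * (inner ℂ (v 1) x).im : ℝ) : ℂ)) • v 1 := by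
  have h := orthonormal_iff_ite.mp hv
  have e : offPlane v x = x - ((inner ℂ (v 0) x).re : ℂ) • v 0 - ((inner ℂ (v 1) x).re : ℂ) • v 1 := by
    rw [offPlane_apply, real_inner_cn, real_inner_cn]
    rfl
  have d0 := Complex.re_add_im (inner ℂ (v 0) x)
  have d1 := Complex.re_add_im (inner ℂ (v 1) x)
  set z0 := inner ℂ (v 0) x
  set z1 := inner ℂ (v 1) x
  have i0 : inner ℂ (v 0) (offPlane v x) = z0.im * Complex.I := by
    rw [e]
    simp only [inner_sub_right, inner_smul_right, h]
    simp
    linear_combination -d0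
  have i1 : inner ℂ (v 1) (offPlane v x) = z1.im * Complex.I := by
    rw [e]
    simp only [inner_sub_right, inner_smul_right, h]
    simp
    linear_combination -d1
  rw [planeLin_apply, i0, i1, e]
  nth_rewrite 4 [← d0]
  nth_rewrite 4 [← d1]
  push_cast
  module

end planeRotation

section oddPart
variable {n : ℕ}

/-- The properties of the odd part of the difference of two solutions, as a function on sets. -/
structure OddSU (δ : Set (Cn n) → ℂ) : Prop where
  val : Val δ
  double : ∀ A, CC A → δ ((2 : ℝ) • A) = 2 ^ n * δ A
  low : ∀ W : Submodule ℝ (Cn n), Module.finrank ℝ W ≤ n → ∀ A, CC A → A ⊆ W → δ A = 0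
  odd : ∀ A, CC A → δ ((-1 : ℝ) • A) = -δ A
  su : ∀ g ∈ Matrix.specialUnitaryGroup (Fin n) ℂ, ∀ A, CC A →
    δ (Matrix.toEuclideanLin g '' A) = δ A

theorem nn_const_mul {E : Type*} [NormedAddCommGroup E] [NormedSpace ℝ E] {m m' : Set E → ℂ} {c : ℂ}
    (h : ∀ A, CC A → m A = c * m' A) (l : Multiset E) {A : Set E} (hA : CC A) :
    NN l m A = c * NN l m' A := by
  induction l using Multiset.induction_on generalizing A with
  | empty => rw [nn_zero, nn_zero, h A hA]
  | cons w l ih =>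
    rw [nn_cons, nn_cons, Nv, Nv, ih hA, ih (hA.add (CC.segment _ _)), mul_sub]

theorem Val.nn_gl_two {E : Type*} [NormedAddCommGroup E] [NormedSpace ℝ E] [FiniteDimensional ℝ E]
    {m : Set E → ℂ} (hm : Val m) (l : Multiset E) (v w : E) (p q r s : ℝ) {A : Set E} (hA : CC A)
    (hd : |p * s - q * r| = 1) :
    NN ((p • v + r • w) ::ₘ (q • v + s • w) ::ₘ l) m A = NN (v ::ₘ w ::ₘ l) m A := by
  by_cases hp : p = 0
  · subst hp
    have e : (0 : ℝ) • v + r • w = r • w := by simp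
    rw [e, Multiset.cons_swap,
      hm.nn_shear (by
        refine (mspan _).smul_mem s ?_
        have hr : r ≠ 0 := by rintro rfl; norm_num at hd
        have : w = r⁻¹ • (r • w) := by rw [smul_smul, inv_mul_cancel₀ hr, one_smul]
        have hm := (mspan ((r • w) ::ₘ l)).smul_mem r⁻¹ (mem_mspan (Multiset.mem_cons_self _ _))
        rwa [← this] at hm) _ hA,
      hm.nn_smul _ _ _ hA, Multiset.cons_swap, hm.nn_smul _ _ _ hA, Multiset.cons_swap w, ← mul_assoc]
    have : |q| * |r| = 1 := by
      rw [← abs_mul, ← hd]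
      simp
    rw [← Complex.ofReal_mul, this, Complex.ofReal_one, one_mul]
  · have e : q • v + s • w = ((p * s - q * r) / p) • w + (q / p) • (p • v + r • w) := by
      have h1 : q = q / p * p := by field_simp
      have h2 : s = (p * s - q * r) / p + q / p * r := by field_simp; ring
      nth_rewrite 1 [h1]
      nth_rewrite 1 [h2]
      module
    rw [e, Multiset.cons_swap, hm.nn_shear ((mspan _).smul_mem _
      (mem_mspan (Multiset.mem_cons_self _ _))) _ hA, hm.nn_smul _ _ _ hA, Multiset.cons_swap,
      hm.nn_shear ((mspan _).smul_mem _ (mem_mspan (Multiset.mem_cons_self _ _))) _ hA,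
      hm.nn_smul _ _ _ hA, ← mul_assoc, ← Complex.ofReal_mul, abs_div, hd,
      one_div, inv_mul_cancel₀ (abs_ne_zero.mpr hp), Complex.ofReal_one, one_mul]

theorem OddSU.unitary (hn : Odd n) {δ : Set (Cn n) → ℂ} (hδ : OddSU δ)
    {g : Matrix (Fin n) (Fin n) ℂ} (hg : g ∈ Matrix.unitaryGroup (Fin n) ℂ) {ε : ℂ}
    (hdet : g.det = ε) (hε : ε = 1 ∨ ε = -1) {A : Set (Cn n)} (hA : CC A) :
    δ (Matrix.toEuclideanLin g '' A) = ε * δ A := by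
  rcases hε with rfl | rfl
  · rw [hδ.su g (Matrix.mem_specialUnitaryGroup_iff.mpr ⟨hg, hdet⟩) A hA, one_mul]
  · have hg' : -g ∈ Matrix.specialUnitaryGroup (Fin n) ℂ := by
      refine Matrix.mem_specialUnitaryGroup_iff.mpr ⟨?_, ?_⟩
      · rw [Matrix.mem_unitaryGroup_iff] at hg ⊢
        rw [star_neg, neg_mul_neg, hg]
      · rw [Matrix.det_neg, hdet, Fintype.card_fin, hn.neg_one_pow]; norm_num
    have ho := hδ.odd _ (hA.image ((Matrix.toEuclideanLin (-g)).restrictScalars ℝ))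
    have he : Matrix.toEuclideanLin g '' A =
        (-1 : ℝ) • ((Matrix.toEuclideanLin (-g)).restrictScalars ℝ '' A) := by
      rw [← Set.image_smul, ← Set.image_comp]
      refine Set.image_congr fun x _ => ?_
      simp
    rw [he, ho, neg_one_mul, ← hδ.su _ hg' A hA]
    rfl

theorem OddSU.nn_planeLin (hn : Odd n) {δ : Set (Cn n) → ℂ} (hδ : OddSU δ) {v : Fin 2 → Cn n}
    (hv : Orthonormal ℂ v) {l : Multiset (Cn n)} (hl : ∀ x ∈ l, ∀ i, inner ℂ (v i) x = 0)
    {p q r s ε : ℝ} (hR : !![(p : ℂ), q; r, s] ∈ Matrix.unitaryGroup (Fin 2) ℂ)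
    (hdet : p * s - q * r = ε) (hε : ε = 1 ∨ ε = -1) {A : Set (Cn n)} (hA : CC A) :
    NN (v 0 ::ₘ v 1 ::ₘ l) δ (planeLin v p q r s '' A) = ε * NN (v 0 ::ₘ v 1 ::ₘ l) δ A := by
  have hA' := hA.image (planeLin v p q r s)
  have hmap : (v 0 ::ₘ v 1 ::ₘ l).map (planeLin v p q r s) =
      (p • v 0 + r • v 1) ::ₘ (q • v 0 + s • v 1) ::ₘ l := by
    rw [Multiset.map_cons, Multiset.map_cons, planeLin_zero hv, planeLin_one hv]
    congr 2
    conv_rhs => rw [← Multiset.map_id l]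
    exact Multiset.map_congr rfl fun x hx => planeLin_of_orthogonal (hl x hx 0) (hl x hx 1) _ _ _ _
  have habs : |p * s - q * r| = 1 := by rw [hdet]; rcases hε with rfl | rfl <;> simp
  rw [← hδ.val.nn_gl_two l (v 0) (v 1) p q r s hA' habs, ← hmap, nn_map]
  refine nn_const_mul (fun B hB => ?_) _ hA
  have : planeLin v p q r s '' B = Matrix.toEuclideanLin (planeMat v !![(p : ℂ), q; r, s]) '' B :=
    Set.image_congr fun x _ => (toEuclideanLin_planeMat v p q r s x).symm
  rw [this]
  refine hδ.unitary hn (planeMat_mem hv hR) ?_ ?_ hB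
  · rw [det_planeMat hv, Matrix.det_fin_two_of, ← hdet]; push_cast; ring
  · rcases hε with rfl | rfl <;> simp

theorem integral_rotate {G : ℝ → ℝ} (hG : Function.Periodic G (2 * Real.pi)) (φ : ℝ) :
    ∫ θ in (0 : ℝ)..(2 * Real.pi), G (φ - θ) = ∫ θ in (0 : ℝ)..(2 * Real.pi), G θ := by
  rw [intervalIntegral.integral_comp_sub_left (fun x => G x) φ, sub_zero]
  have := hG.intervalIntegral_add_eq (φ - 2 * Real.pi) 0
  rwa [sub_add_cancel, zero_add] at this

/-- The average of a function over a rotating frame depends only on the norm of the vector. -/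
theorem integral_rotate_norm (H : ℝ → ℝ → ℝ) (a b : ℝ) :
    ∫ θ in (0 : ℝ)..(2 * Real.pi), H (Real.cos θ * a + Real.sin θ * b)
      (-Real.sin θ * a + Real.cos θ * b) =
    ∫ θ in (0 : ℝ)..(2 * Real.pi), H (√(a ^ 2 + b ^ 2) * Real.cos θ)
      (√(a ^ 2 + b ^ 2) * Real.sin θ) := by
  have h1 : a = √(a ^ 2 + b ^ 2) * Real.cos (Complex.arg ⟨a, b⟩) := by
    have := Complex.norm_mul_cos_arg ⟨a, b⟩
    rw [Complex.norm_eq_sqrt_sq_add_sq] at this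
    exact this.symm
  have h2 : b = √(a ^ 2 + b ^ 2) * Real.sin (Complex.arg ⟨a, b⟩) := by
    have := Complex.norm_mul_sin_arg ⟨a, b⟩
    rw [Complex.norm_eq_sqrt_sq_add_sq] at this
    exact this.symm
  set ρ := √(a ^ 2 + b ^ 2)
  set φ := Complex.arg ⟨a, b⟩
  rw [← integral_rotate (G := fun t => H (ρ * Real.cos t) (ρ * Real.sin t)) ?_ φ]
  · congr 1
    funext θ
    rw [Real.cos_sub, Real.sin_sub]
    congr 1
    · rw [h1, h2]; ring
    · rw [h1, h2]; ring
  · intro t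
    simp only [Real.cos_add_two_pi, Real.sin_add_two_pi]

theorem rotation_mem {c s : ℝ} (h : c ^ 2 + s ^ 2 = 1) :
    !![(c : ℂ), ((-s : ℝ) : ℂ); (s : ℂ), (c : ℂ)] ∈ Matrix.unitaryGroup (Fin 2) ℂ := by
  have h' : (c : ℂ) * c + (s : ℂ) * s = 1 := by
    rw [← Complex.ofReal_mul, ← Complex.ofReal_mul, ← Complex.ofReal_add, ← sq, ← sq, h,
      Complex.ofReal_one]
  rw [Matrix.mem_unitaryGroup_iff]
  ext i j
  fin_cases i <;> fin_cases j <;> simp [Matrix.mul_apply, Fin.sum_univ_two]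
  · exact h'
  · ring
  · ring
  · rw [add_comm]; exact h'

theorem OddSU.nn_eq_zero_of_orthonormal (hn : Odd n) {δ : Set (Cn n) → ℂ} (hδ : OddSU δ)
    {v : Fin 2 → Cn n} (hv : Orthonormal ℂ v) {l : Multiset (Cn n)}
    (hl : ∀ x ∈ l, ∀ i, inner ℂ (v i) x = 0) (hc : Multiset.card l + 3 = n) {A : Set (Cn n)}
    (hA : CC A) : NN (v 0 ::ₘ v 1 ::ₘ l) δ A = 0 := by
  have hT := hδ.val.nn (v 0 ::ₘ v 1 ::ₘ l)
  have h2 : ∀ A, CC A → NN (v 0 ::ₘ v 1 ::ₘ l) δ ((2 : ℝ) • A) =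
      2 * NN (v 0 ::ₘ v 1 ::ₘ l) δ A := fun A hA => by
    rw [nn_double hδ.val (j := 1) (by simpa using hc) hδ.double hA, pow_one]
  have hrot : ∀ θ {A : Set (Cn n)}, CC A → NN (v 0 ::ₘ v 1 ::ₘ l) δ
      (planeLin v (Real.cos θ) (-Real.sin θ) (Real.sin θ) (Real.cos θ) '' A) =
      NN (v 0 ::ₘ v 1 ::ₘ l) δ A := fun θ A hA => by
    have := hδ.nn_planeLin hn hv hl (ε := 1) (rotation_mem (Real.cos_sq_add_sin_sq θ))
      (by linarith [Real.cos_sq_add_sin_sq θ]) (Or.inl rfl) hA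
    rwa [Complex.ofReal_one, one_mul] at this
  have hrefl : ∀ {A : Set (Cn n)}, CC A → NN (v 0 ::ₘ v 1 ::ₘ l) δ (planeLin v 1 0 0 (-1) '' A) =
      -NN (v 0 ::ₘ v 1 ::ₘ l) δ A := fun {A} hA => by
    have := hδ.nn_planeLin hn hv hl (p := 1) (q := 0) (r := 0) (s := -1) (ε := -1) (by
      rw [Matrix.mem_unitaryGroup_iff]
      ext i j
      fin_cases i <;> fin_cases j <;> simp [Matrix.mul_apply, Fin.sum_univ_two])
      (by norm_num) (Or.inr rfl) hA
    rw [this]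
    push_cast
    ring
  rcases A.eq_empty_or_nonempty with rfl | hne
  · exact hT.empty
  set T := NN (v 0 ::ₘ v 1 ::ₘ l) δ with hTdef
  let L : ℝ → Cn n →ₗ[ℝ] Cn n := fun θ =>
    offPlane v ∘ₗ planeLin v (Real.cos θ) (-Real.sin θ) (Real.sin θ) (Real.cos θ)
  let L' : ℝ → Cn n →ₗ[ℝ] Cn n := fun θ =>
    planeLin v (Real.cos θ) (Real.sin θ) (-Real.sin θ) (Real.cos θ) ∘ₗ offPlane v
  have hadj : ∀ θ x y, inner ℝ x (L θ y) = inner ℝ (L' θ x) y := fun θ x y => by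
    simp only [L, L', LinearMap.comp_apply]
    rw [offPlane_adjoint, planeLin_adjoint]
  have hTL : ∀ θ, T (L θ '' A) = T A := fun θ => by
    rw [← hrot θ hA, hTdef]
    refine hδ.val.nn_congr (fun x => ?_) hA
    simp only [L, LinearMap.comp_apply]
    rw [offPlane_apply, ← neg_mem_iff, neg_sub, sub_sub, sub_sub_cancel]
    refine Submodule.add_mem _ (Submodule.smul_mem _ _ ?_) (Submodule.smul_mem _ _ ?_) <;>
      exact mem_mspan (by simp)
  let h := supp A
  have hh : Sublin h := supp_sublin hA hne
  let F : ℝ → Cn n → ℝ := fun θ x => h (L' θ x)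
  have hF : ∀ θ, Sublin (F θ) := fun θ => hh.comp (L' θ)
  have hcont : Continuous fun q : ℝ × Cn n => F q.1 q.2 := by
    refine hh.continuous.comp ?_
    simp only [L', LinearMap.comp_apply, planeLin_offPlane hv]
    fun_prop
  obtain ⟨hsub, hInt⟩ := hT.integral_body h2 (ν := volume)
    (isCompact_Icc (a := (0 : ℝ)) (b := 2 * Real.pi)) hF hcont
  have hTF : ∀ θ, T (body (F θ)) = T A := fun θ => by
    rw [body_comp_adjoint hh (hadj θ), body_supp hA hne, hTL]
  simp only [hTF] at hInt
  have hconv : ∀ x, ∫ θ in Set.Icc (0 : ℝ) (2 * Real.pi), F θ x =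
      ∫ θ in (0 : ℝ)..(2 * Real.pi), F θ x := fun x => by
    rw [integral_Icc_eq_integral_Ioc, intervalIntegral.integral_of_le (by positivity)]
  have hval : ∀ x, ∫ θ in Set.Icc (0 : ℝ) (2 * Real.pi), F θ x =
      ∫ θ in (0 : ℝ)..(2 * Real.pi), h ((x - inner ℂ (v 0) x • v 0 - inner ℂ (v 1) x • v 1) +
        (Complex.I * ((√((inner ℂ (v 0) x).im ^ 2 + (inner ℂ (v 1) x).im ^ 2) *
          Real.cos θ : ℝ) : ℂ)) • v 0 +
        (Complex.I * ((√((inner ℂ (v 0) x).im ^ 2 + (inner ℂ (v 1) x).im ^ 2) *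
          Real.sin θ : ℝ) : ℂ)) • v 1) := fun x => by
    rw [hconv, ← integral_rotate_norm fun a b =>
      h ((x - inner ℂ (v 0) x • v 0 - inner ℂ (v 1) x • v 1) + (Complex.I * (a : ℂ)) • v 0 +
        (Complex.I * (b : ℂ)) • v 1)]
    simp only [F, L', LinearMap.comp_apply, planeLin_offPlane hv]
  have hinv : ∀ x, ∫ θ in Set.Icc (0 : ℝ) (2 * Real.pi), F θ (planeLin v 1 0 0 (-1) x) =
      ∫ θ in Set.Icc (0 : ℝ) (2 * Real.pi), F θ x := fun x => by
    obtain ⟨e0, e1⟩ := inner_planeLin hv 1 0 0 (-1) x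
    have e0' : inner ℂ (v 0) (planeLin v 1 0 0 (-1) x) = inner ℂ (v 0) x := by rw [e0]; simp
    have e1' : inner ℂ (v 1) (planeLin v 1 0 0 (-1) x) = -inner ℂ (v 1) x := by rw [e1]; simp
    have e2 : planeLin v 1 0 0 (-1) x - inner ℂ (v 0) x • v 0 - -inner ℂ (v 1) x • v 1 =
        x - inner ℂ (v 0) x • v 0 - inner ℂ (v 1) x • v 1 := by
      rw [planeLin_apply]
      push_cast
      module
    rw [hval, hval, e0', e1', e2, Complex.neg_im, neg_sq]
  have hbody := body_comp_adjoint hsub (L := planeLin v 1 0 0 (-1)) (L' := planeLin v 1 0 0 (-1))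
    (planeLin_adjoint v 1 0 0 (-1))
  simp only [hinv] at hbody
  have h3 := hrefl (body_cc hsub)
  rw [← hbody, hInt] at h3
  rw [setIntegral_const] at h3
  have h4 : volume.real (Set.Icc (0 : ℝ) (2 * Real.pi)) ≠ 0 := by
    rw [Real.volume_real_Icc_of_le (by positivity)]
    have := Real.pi_pos
    linarith
  have h5 : volume.real (Set.Icc (0 : ℝ) (2 * Real.pi)) • T A = 0 := by
    have : (2 : ℂ) * (volume.real (Set.Icc (0 : ℝ) (2 * Real.pi)) • T A) = 0 := by
      linear_combination h3
    simpa using this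
  exact (smul_eq_zero.mp h5).resolve_left h4

end oddPart

section radical

theorem exists_radical_of_odd {E : Type*} [AddCommGroup E] [Module ℝ E] [FiniteDimensional ℝ E]
    (B : E →ₗ[ℝ] E →ₗ[ℝ] ℝ) (hB : ∀ x y, B x y = -B y x) (ho : Odd (Module.finrank ℝ E)) :
    ∃ y, y ≠ 0 ∧ ∀ z, B y z = 0 := by
  let b := Module.finBasis ℝ E
  let M : Matrix (Fin (Module.finrank ℝ E)) (Fin (Module.finrank ℝ E)) ℝ :=
    Matrix.of fun i j => B (b i) (b j)
  have hM : M.transpose = -M := by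
    ext i j
    exact hB _ _
  have hdet : M.det = 0 := by
    have := Matrix.det_transpose M
    rw [hM, Matrix.det_neg, Fintype.card_fin, ho.neg_one_pow] at this
    linarith
  obtain ⟨u, hu, hMu⟩ := Matrix.exists_mulVec_eq_zero_iff.mpr hdet
  refine ⟨∑ j, u j • b j, fun h => hu ?_, ?_⟩
  · funext j
    exact Fintype.linearIndependent_iff.mp b.linearIndependent u h j
  · have : B (∑ j, u j • b j) = 0 := by
      refine b.ext fun i => ?_
      rw [hB, map_sum, LinearMap.zero_apply, neg_eq_zero]
      have := congrFun hMu i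
      simp only [Matrix.mulVec, dotProduct, M, Matrix.of_apply, Pi.zero_apply] at this
      rw [← this]
      exact Finset.sum_congr rfl fun j _ => by rw [map_smul, smul_eq_mul, mul_comm]
    intro z
    rw [this, LinearMap.zero_apply]

theorem exists_radical_of_odd_submodule {E : Type*} [AddCommGroup E] [Module ℝ E]
    (W : Submodule ℝ E) [FiniteDimensional ℝ W]
    (B : E →ₗ[ℝ] E →ₗ[ℝ] ℝ) (hB : ∀ x y, B x y = -B y x) (ho : Odd (Module.finrank ℝ W)) :
    ∃ y ∈ W, y ≠ 0 ∧ ∀ z ∈ W, B y z = 0 := by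
  obtain ⟨y, hy, h⟩ := exists_radical_of_odd (B.domRestrict₁₂ W W) (fun x y => hB x y) ho
  exact ⟨y, y.2, fun h0 => hy (Subtype.ext h0), fun z hz => h ⟨z, hz⟩⟩

end radical

section oddPart
variable {n : ℕ}

/-- The symplectic form of `ℂⁿ`. -/
def omega (n : ℕ) : Cn n →ₗ[ℝ] Cn n →ₗ[ℝ] ℝ :=
  LinearMap.mk₂ ℝ (fun x y => (inner ℂ x y).im)
    (fun x y z => by rw [inner_add_left, Complex.add_im])
    (fun c x y => by
      rw [show c • x = (c : ℂ) • x from rfl, inner_smul_left, Complex.conj_ofReal,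
        Complex.im_ofReal_mul, smul_eq_mul])
    (fun x y z => by rw [inner_add_right, Complex.add_im])
    (fun c x y => by
      rw [show c • y = (c : ℂ) • y from rfl, inner_smul_right,
        Complex.im_ofReal_mul, smul_eq_mul])

theorem omega_apply (x y : Cn n) : omega n x y = (inner ℂ x y).im := rfl

theorem omega_swap (x y : Cn n) : omega n x y = -omega n y x := by
  rw [omega_apply, omega_apply, ← inner_conj_symm, Complex.conj_im]

theorem omega_self (x : Cn n) : omega n x x = 0 := by
  have := omega_swap x x
  linarith

theorem inner_eq_zero_of_real_omega {x y : Cn n} (h : inner ℝ x y = 0) (h' : omega n x y = 0) :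
    inner ℂ x y = 0 := by
  rw [real_inner_cn] at h
  exact Complex.ext h h'

theorem OddSU.nn_eq_zero_of_radical (hn : Odd n) {δ : Set (Cn n) → ℂ} (hδ : OddSU δ)
    {W : Submodule ℝ (Cn n)} (hW : Module.finrank ℝ W + 1 = n) {x : Cn n} (hxW : x ∈ W)
    (hx : x ≠ 0) (hr : ∀ y ∈ W, omega n x y = 0) {l : Multiset (Cn n)}
    (hlW : mspan l ≤ W) (hl : Multiset.card l + 1 = n) {A : Set (Cn n)} (hA : CC A) :
    NN l δ A = 0 := by
  have hxs : Submodule.span ℝ {x} ≤ W := (Submodule.span_singleton_le_iff_mem _ _).mpr hxW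
  set C := (Submodule.span ℝ {x})ᗮ ⊓ W with hC
  have hCd := Submodule.finrank_add_inf_finrank_orthogonal hxs
  have hCs := Submodule.sup_orthogonal_inf_of_hasOrthogonalProjection hxs
  rw [finrank_span_singleton hx, ← hC] at hCd
  rw [← hC] at hCs
  have hCo : Odd (Module.finrank ℝ C) := by
    obtain ⟨j, rfl⟩ := hn
    exact ⟨j - 1, by omega⟩
  obtain ⟨y, hyC, hy, hyr⟩ := exists_radical_of_odd_submodule C (omega n) omega_swap hCo
  have hys : Submodule.span ℝ {y} ≤ C := (Submodule.span_singleton_le_iff_mem _ _).mpr hyC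
  set D := (Submodule.span ℝ {y})ᗮ ⊓ C with hD
  have hDd := Submodule.finrank_add_inf_finrank_orthogonal hys
  have hDs := Submodule.sup_orthogonal_inf_of_hasOrthogonalProjection hys
  rw [finrank_span_singleton hy, ← hD] at hDd
  rw [← hD] at hDs
  obtain ⟨l', hl'c, hl's⟩ := exists_mspan_eq D
  have hxC : ∀ z ∈ C, inner ℂ x z = 0 := fun z hz =>
    inner_eq_zero_of_real_omega (Submodule.mem_orthogonal_singleton_iff_inner_right.mp hz.1)
      (hr z hz.2)
  have hyD : ∀ z ∈ D, inner ℂ y z = 0 := fun z hz =>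
    inner_eq_zero_of_real_omega (Submodule.mem_orthogonal_singleton_iff_inner_right.mp hz.1)
      (hyr z hz.2)
  have hx' : ‖x‖ ≠ 0 := norm_ne_zero_iff.mpr hx
  have hy' : ‖y‖ ≠ 0 := norm_ne_zero_iff.mpr hy
  let v : Fin 2 → Cn n := ![(‖x‖⁻¹ : ℂ) • x, (‖y‖⁻¹ : ℂ) • y]
  have hv : Orthonormal ℂ v := by
    constructor
    · intro i
      fin_cases i
      · simp [v, norm_smul, hx']
      · simp [v, norm_smul, hy']
    · intro i j hij
      fin_cases i <;> fin_cases j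
      · exact absurd rfl hij
      · simp [v, inner_smul_left, inner_smul_right, hxC y hyC]
      · have : inner ℂ y x = 0 := by rw [← inner_conj_symm, hxC y hyC, map_zero]
        simp [v, inner_smul_left, inner_smul_right, this]
      · exact absurd rfl hij
  have key := hδ.nn_eq_zero_of_orthonormal hn hv (l := l') (fun z hz i => by
    have hzD : z ∈ D := hl's ▸ mem_mspan hz
    fin_cases i
    · simp [v, hxC z hzD.2]
    · simp [v, hyD z hzD]) (by omega) hA
  have := hδ.val.nn_exchange hA 0 (v 0 ::ₘ v 1 ::ₘ l') l (by simp; omega) ?_ (by rwa [zero_add])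
  · rwa [zero_add] at this
  refine hlW.trans ?_
  rw [zero_add, ← hCs, ← hDs, mspan_cons, mspan_cons, hl's]
  refine sup_le_sup ?_ (sup_le_sup ?_ le_rfl) <;>
    rw [Submodule.span_singleton_le_iff_mem, Submodule.mem_span_singleton]
  · refine ⟨‖x‖, ?_⟩
    rw [show ∀ z : Cn n, ‖x‖ • z = (‖x‖ : ℂ) • z from fun _ => rfl]
    simp [v, smul_smul, hx']
  · refine ⟨‖y‖, ?_⟩
    rw [show ∀ z : Cn n, ‖y‖ • z = (‖y‖ : ℂ) • z from fun _ => rfl]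
    simp [v, smul_smul, hy']

end oddPart

section spans
variable {E : Type*} [NormedAddCommGroup E] [InnerProductSpace ℝ E]

theorem finrank_span_pair_le (a b : E) : Module.finrank ℝ (Submodule.span ℝ (Set.range ![a, b])) ≤ 2 :=
  (finrank_range_le_card ![a, b]).trans (by simp)

theorem finrank_span_singleton_le (x : E) : Module.finrank ℝ (Submodule.span ℝ {x}) ≤ 1 := by
  have := finrank_range_le_card (R := ℝ) ![x]
  rwa [Set.finrank, Matrix.range_cons, Matrix.range_empty, Set.union_empty] at this

theorem Simple.eq_zero_of_finrank_lt {m : Set E → ℂ} (hs : Simple m) {U : Submodule ℝ E}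
    (hU : Module.finrank ℝ U < Module.finrank ℝ E) {A : Set E} (hA : CC A) (h : A ⊆ U) :
    m A = 0 :=
  hs.eq_zero_of_subset (Submodule.lt_top_of_finrank_lt_finrank hU) 0 hA fun x hx => by
    rw [sub_zero]; exact h hx

end spans

section fourDim
variable {E : Type*} [NormedAddCommGroup E] [InnerProductSpace ℝ E] [FiniteDimensional ℝ E]
  {m : Set E → ℂ}

theorem Simple.add_linearCombination (hm : Val m) (hs : Simple m) {d : ℕ} (v : Fin d → E)
    {U : Submodule ℝ E} (hU : d + Module.finrank ℝ U ≤ Module.finrank ℝ E) {M : Set E}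
    (hM : CC M) (hMU : M ⊆ U) :
    Simple fun A : Set (Fin d → ℝ) => m (Fintype.linearCombination ℝ v '' A + M) := by
  intro A hA l hl c hc
  dsimp only
  rcases A.eq_empty_or_nonempty with rfl | ⟨x₀, hx₀⟩
  · rw [Set.image_empty, Set.empty_add, hm.empty]
  set φ := Fintype.linearCombination ℝ v
  have hlt : (LinearMap.ker l).map φ ⊔ U < ⊤ := by
    refine Submodule.lt_top_of_finrank_lt_finrank ?_
    refine (Submodule.finrank_add_le_finrank_add_finrank _ _).trans_lt ?_
    have h1 : Module.finrank ℝ (LinearMap.ker l) < Module.finrank ℝ (Fin d → ℝ) := by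
      refine Submodule.finrank_lt ?_
      rwa [Ne, LinearMap.ker_eq_top]
    rw [Module.finrank_fin_fun] at h1
    have h2 := Submodule.finrank_map_le φ (LinearMap.ker l)
    omega
  refine hs.eq_zero_of_subset hlt (φ x₀) ((hA.image _).add hM) ?_
  rintro _ ⟨_, ⟨x, hx, rfl⟩, y, hy, rfl⟩
  have : φ x + y - φ x₀ = φ (x - x₀) + y := by rw [map_sub]; abel
  dsimp only
  rw [this]
  refine Submodule.add_mem_sup ⟨x - x₀, ?_, rfl⟩ (hMU hy)
  rw [SetLike.mem_coe, LinearMap.mem_ker, map_sub, hc x hx, hc x₀ hx₀, sub_self]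

theorem Val.double_triangle_add (hm : Val m) (hs : Simple m) (a b : E) {U : Submodule ℝ E}
    (hU : 2 + Module.finrank ℝ U ≤ Module.finrank ℝ E) {M : Set E} (hM : CC M) (hMU : M ⊆ U) :
    m ((2 : ℝ) • tet ![a, b] + M) = 2 * m (tet ![a, b] + M) + Nv a (Nv b m) M := by
  have h := (hm.comp_add hM).double_tet ![a, b] (hs.add_linearCombination hm _ hU hM hMU)
  rw [Fin.sum_univ_two] at h
  have e0 : lowPart ![a, b] ((0 : Fin 2) : ℕ) = 0 := by
    funext i; simp [lowPart]
  have e0' : highPart ![a, b] ((0 : Fin 2) : ℕ) = ![a, b] := by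
    funext i; simp [highPart]
  have l1 : tet (lowPart ![a, b] ((1 : Fin 2) : ℕ)) = segment ℝ 0 a :=
    (tet_lowPart (show 1 + 1 = 2 from rfl) _).trans (tet_one _)
  have r1 : tet (highPart ![a, b] ((1 : Fin 2) : ℕ)) = segment ℝ 0 b :=
    (tet_highPart (show 1 + 1 = 2 from rfl) _).trans (tet_one _)
  rw [e0, e0', tet_zero_part (v := (0 : Fin 2 → E)) (fun _ => rfl),
    (hm.comp_add hM).trans _ _ (tet_cc _), l1, r1] at h
  have z : ∀ x, m (M + segment ℝ 0 x) = 0 := fun x => by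
    have hx2 := Submodule.finrank_add_le_finrank_add_finrank U (Submodule.span ℝ {x})
    have hx1 : Module.finrank ℝ (Submodule.span ℝ {x}) ≤ 1 := finrank_span_singleton_le x
    refine hs.eq_zero_of_finrank_lt (U := U ⊔ Submodule.span ℝ {x}) (by omega)
      (hM.add (CC.segment _ _)) ?_
    rintro _ ⟨y, hy, z, hz, rfl⟩
    refine Submodule.add_mem_sup (hMU hy) ?_
    exact (Submodule.span ℝ {x}).toConvexCone.convex.segment_subset (Submodule.zero_mem _)
      (Submodule.mem_span_singleton_self x) hz
  have z0 : m M = 0 := hs.eq_zero_of_finrank_lt (by omega) hM hMU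
  rw [h]
  simp only [Nv, z, z0]
  rw [show segment ℝ 0 a + segment ℝ 0 b + M = M + segment ℝ 0 a + segment ℝ 0 b by abel]
  ring

theorem Val.six_chain4 (hm : Val m) (hs : Simple m) (hd : Module.finrank ℝ E = 4)
    (h2 : ∀ A, CC A → m ((2 : ℝ) • A) = 8 * m A) (a b c d : E) :
    6 * m (quad chain4 a b c d) = Nv a (Nv b m) (tet ![c, d]) + Nv a (Nv d m) (tet ![b, c]) +
      Nv c (Nv d m) (tet ![a, b]) := by
  have hB : 4 * m (quad chain22 a b c d) =
      2 * (Nv c (Nv d m) (tet ![a, b]) + Nv a (Nv b m) (tet ![c, d])) := by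
    have h := h2 _ (quad_chain22.cc a b c d)
    have hab := finrank_span_pair_le a b
    have hcd := finrank_span_pair_le c d
    have hNN : Nv a (Nv b m) ((2 : ℝ) • tet ![c, d]) = 2 * Nv a (Nv b m) (tet ![c, d]) := by
      rw [nv_double (hm.nv b) (c := 2) (fun A hA => ?_) a (tet_cc _)]
      rw [nv_double hm (c := 4) (fun A hA => by rw [h2 A hA]; norm_num) b hA]
      norm_num
    rw [← tet_two_add, smul_add, hm.double_triangle_add hs a b (U := Submodule.span ℝ (Set.range ![c, d]))
      (by omega) ((tet_cc _).smul 2) ?_, add_comm (tet ![a, b]),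
      hm.double_triangle_add hs c d (U := Submodule.span ℝ (Set.range ![a, b])) (by omega)
        (tet_cc _) (tet_subset_span _), add_comm (tet ![c, d]), hNN] at h
    · rw [← tet_two_add]
      linear_combination -h
    · rintro _ ⟨x, hx, rfl⟩
      exact Submodule.smul_mem _ _ (tet_subset_span _ hx)
  have hN : ∀ x p q r : E, 2 * Nv x m (tet ![p, q, r]) =
      Nv p (Nv x m) (tet ![q, r]) + Nv x (Nv r m) (tet ![p, q]) := by
    intro x p q r
    have hx1 : Module.finrank ℝ (Submodule.span ℝ {x}) ≤ 1 := finrank_span_singleton_le x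
    have hxs : segment ℝ 0 x ⊆ Submodule.span ℝ {x} :=
      (Submodule.span ℝ {x}).toConvexCone.convex.segment_subset (Submodule.zero_mem _)
      (Submodule.mem_span_singleton_self x)
    have hsx : Simple fun A : Set (Fin 3 → ℝ) =>
        Nv x m (Fintype.linearCombination ℝ ![p, q, r] '' A) := by
      intro A hA l hl c hc
      have e1 := hs.add_linearCombination hm ![p, q, r] (U := Submodule.span ℝ {x}) (by omega)
        (CC.segment 0 x) hxs A hA l hl c hc
      have e2 := hs.add_linearCombination hm ![p, q, r] (U := ⊥) (by simp [hd])
        (CC.singleton 0) (by simp) A hA l hl c hc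
      simp only [Set.add_singleton, add_zero, Set.image_id'] at e2
      simp only [Nv]
      rw [e2, sub_zero]
      exact e1
    have h := (hm.nv x).double_tet ![p, q, r] hsx
    rw [Fin.sum_univ_three] at h
    have e0 : lowPart ![p, q, r] ((0 : Fin 3) : ℕ) = 0 := by
      funext i; simp [lowPart]
    have e0' : highPart ![p, q, r] ((0 : Fin 3) : ℕ) = ![p, q, r] := by
      funext i; simp [highPart]
    have l1 : tet (lowPart ![p, q, r] ((1 : Fin 3) : ℕ)) = segment ℝ 0 p :=
      (tet_lowPart (show 1 + 2 = 3 from rfl) _).trans (tet_one _)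
    have l2 : tet (lowPart ![p, q, r] ((2 : Fin 3) : ℕ)) = tet ![p, q] :=
      (tet_lowPart (show 2 + 1 = 3 from rfl) _).trans (by congr 1; funext i; fin_cases i <;> rfl)
    have r1 : tet (highPart ![p, q, r] ((1 : Fin 3) : ℕ)) = tet ![q, r] :=
      (tet_highPart (show 1 + 2 = 3 from rfl) _).trans (by congr 1; funext i; fin_cases i <;> rfl)
    have r2 : tet (highPart ![p, q, r] ((2 : Fin 3) : ℕ)) = segment ℝ 0 r :=
      (tet_highPart (show 2 + 1 = 3 from rfl) _).trans (tet_one _)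
    rw [e0, e0', tet_zero_part (v := (0 : Fin 3 → E)) (fun _ => rfl),
      (hm.nv x).trans _ _ (tet_cc _), l1, l2, r1, r2,
      nv_double hm (c := 4) (fun A hA => by rw [h2 A hA]; norm_num) x (tet_cc _)] at h
    have z : ∀ y z : E, Nv x m (tet ![y, z]) = 0 := fun y z => by
      have hyz := finrank_span_pair_le y z
      have hx2 := Submodule.finrank_add_le_finrank_add_finrank
        (Submodule.span ℝ (Set.range ![y, z])) (Submodule.span ℝ {x})
      rw [Nv, hs.eq_zero_of_finrank_lt (by omega) (tet_cc _) (tet_subset_span _),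
        hs.eq_zero_of_finrank_lt (U := Submodule.span ℝ (Set.range ![y, z]) ⊔ Submodule.span ℝ {x})
          (by omega) ((tet_cc _).add (CC.segment _ _)), sub_zero]
      rintro _ ⟨u, hu, w, hw, rfl⟩
      exact Submodule.add_mem_sup (tet_subset_span _ hu) (hxs hw)
    rw [nv_comm x r]
    have e1 : Nv p (Nv x m) (tet ![q, r]) = Nv x m (segment ℝ 0 p + tet ![q, r]) := by
      rw [Nv, z, sub_zero, add_comm]
    have e2 : Nv r (Nv x m) (tet ![p, q]) = Nv x m (tet ![p, q] + segment ℝ 0 r) := by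
      rw [Nv, z, sub_zero]
    rw [e1, e2]
    linear_combination h
  have h := hm.double_chain4 hs hd a b c d
  rw [h2 _ (quad_chain4.cc a b c d)] at h
  have h1 := hN a b c d
  have h3 := hN d a b c
  rw [nv_comm b a] at h1
  rw [nv_comm d c] at h3
  linear_combination h + h1 / 2 + h3 / 2 + hB / 4

/-- Triangulating a symplectic four-space in two ways. -/
theorem Val.symplectic_eq_zero (hm : Val m) (hs : Simple m) (hd : Module.finrank ℝ E = 4)
    (h2 : ∀ A, CC A → m ((2 : ℝ) • A) = 8 * m A)
    (β : E →ₗ[ℝ] E →ₗ[ℝ] ℝ)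
    (hβ : ∀ x y, β x y = -β y x)
    (hN : ∀ x y, β x y = 0 → ∀ A, CC A → Nv x (Nv y m) A = 0) {p q r s : E}
    (hpq : β p q = β r s) (hpr : β p r = 0) (hps : β p s = 0) (hqr : β q r = 0) (hqs : β q s = 0)
    (hli : LinearIndependent ℝ ![p, q]) :
    Nv r (Nv s m) (tet ![p, q]) = 0 := by
  have hd4 : ∀ x y A, CC A → Nv x (Nv y m) ((2 : ℝ) • A) = 2 * Nv x (Nv y m) A := fun x y A hA => by
    rw [nv_double (hm.nv y) (c := 2) (fun A hA => ?_) x hA]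
    rw [nv_double hm (c := 4) (fun A hA => by rw [h2 A hA]; norm_num) y hA]
    norm_num
  have hβ0 : ∀ x, β x x = 0 := fun x => by linarith [hβ x x]
  have key : ∀ p q r s : E, β p q = β r s → β p r = 0 → β p s = 0 → β q r = 0 → β q s = 0 →
      Nv p (Nv q m) (tet ![r, s]) + Nv r (Nv s m) (tet ![p, q]) = 0 := by
    intro p q r s hpq hpr hps hqr hqs
    have hrp := hβ r p; have hsp := hβ s p; have hrq := hβ r q; have hsq := hβ s q
    have hqp := hβ q p; have hsr := hβ s r
    have e : quad chain4 p q r s = quad chain4 (p + q + r + s) (-(r + s)) (-q) (q + r) := by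
      refine quad_congr (fun a b c d => (a, a - d, a + c - d - b, c - d))
        (fun a b c d => (a, a - c + d, a - b + d, a - b)) ?_ ?_ ?_ ?_
      · rintro a b c d ⟨h1, h2, h3, h4, h5⟩
        refine ⟨?_, ?_, ?_, ?_, ?_⟩ <;> dsimp only <;> linarith
      · rintro a b c d ⟨h1, h2, h3, h4, h5⟩
        refine ⟨?_, ?_, ?_, ?_, ?_⟩ <;> dsimp only <;> linarith
      · intro a b c d
        module
      · intro a b c d
        module
    have f1 := hm.six_chain4 hs hd h2 p q r s
    have f2 := hm.six_chain4 hs hd h2 (p + q + r + s) (-(r + s)) (-q) (q + r)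
    rw [← e, hN (p + q + r + s) (-(r + s)) (by simp; linarith [hβ0 r, hβ0 s]) _ (tet_cc _),
      hN (p + q + r + s) (q + r) (by simp; linarith [hβ0 r, hβ0 q]) _ (tet_cc _),
      hN (-q) (q + r) (by simp; linarith [hβ0 q]) _ (tet_cc _)] at f2
    rw [hN p s hps _ (tet_cc _)] at f1
    linear_combination f2 - f1
  have h1 := key p q r s hpq hpr hps hqr hqs
  have h3 := key (-p) (-q) r s (by simpa using hpq) (by simpa using hpr) (by simpa using hps)
    (by simpa using hqr) (by simpa using hqs)
  have hneg' : tet ![-p, -q] = (-1 : ℝ) • tet ![p, q] := by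
    rw [smul_tet_eq]
    congr 1; funext i; fin_cases i <;> simp
  have hz : ∀ v, Nv r (Nv s m) (segment ℝ 0 v) = 0 := by
    intro v
    have := nn_segment_eq_zero (m := m) (k := 3) (fun W hW A hA hAW =>
      hs.eq_zero_of_finrank_lt (by omega) hA hAW) (l := r ::ₘ s ::ₘ 0) (by simp) v
    simpa only [nn_cons, nn_zero] using this
  rw [hneg', (hm.nv s).nv r |>.tet_two_neg (hd4 r s) hz hli, (hm.nv (-q)).nv_neg p (tet_cc _),
    nv_comm, hm.nv p |>.nv_neg q (tet_cc _), nv_comm] at h3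
  linear_combination (h1 - h3) / 2

end fourDim

section dependent
variable {E : Type*} [NormedAddCommGroup E] [NormedSpace ℝ E] [FiniteDimensional ℝ E]

theorem Val.nn_eq_zero_of_finrank_lt {m : Set E → ℂ} (hm : Val m) {l : Multiset E}
    (h : Module.finrank ℝ (mspan l) < Multiset.card l) {A : Set E} (hA : CC A) : NN l m A = 0 := by
  induction l using Multiset.induction_on generalizing A with
  | empty => simp at h
  | cons v l ih =>
    by_cases hv : v ∈ mspan l
    · exact hm.nn_dependent hv hA
    have hlt : Module.finrank ℝ (mspan l) < Module.finrank ℝ (mspan (v ::ₘ l)) := by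
      refine Submodule.finrank_lt_finrank_of_lt (lt_of_le_of_ne ?_ fun he => hv ?_)
      · rw [mspan_cons]; exact le_sup_right
      · rw [he]; exact mem_mspan (Multiset.mem_cons_self _ _)
    rw [Multiset.card_cons] at h
    have h' : Module.finrank ℝ (mspan l) < Multiset.card l := by omega
    rw [nn_cons, Nv, ih h' hA, ih h' (hA.add (CC.segment _ _)), sub_zero]

end dependent

section oddMain
variable {n : ℕ}

theorem linearIndependent_pair_of_omega {p q : Cn n} (h : omega n p q ≠ 0) :
    LinearIndependent ℝ ![p, q] := by
  rw [LinearIndependent.pair_iff]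
  intro s t hst
  have h1 := congrArg (omega n p) hst
  have h2 := congrArg (omega n q) hst
  simp only [map_add, map_smul, smul_eq_mul, map_zero, omega_self, omega_swap q p] at h1 h2
  constructor
  · have : s * omega n p q = 0 := by linarith
    exact (mul_eq_zero.mp this).resolve_right h
  · have : t * omega n p q = 0 := by linarith
    exact (mul_eq_zero.mp this).resolve_right h

theorem linearIndependent_of_omega {p q r s : Cn n} (hpq : omega n p q ≠ 0)
    (hrs : omega n r s ≠ 0) (hpr : omega n p r = 0) (hps : omega n p s = 0)
    (hqr : omega n q r = 0) (hqs : omega n q s = 0) : LinearIndependent ℝ ![p, q, r, s] := by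
  rw [Fintype.linearIndependent_iff]
  intro g hg
  rw [Fin.sum_univ_four] at hg
  simp only [Matrix.cons_val] at hg
  have h1 := congrArg (omega n p) hg
  have h2 := congrArg (omega n q) hg
  have h3 := congrArg (omega n r) hg
  have h4 := congrArg (omega n s) hg
  simp only [map_add, map_smul, smul_eq_mul, map_zero, omega_self, omega_swap q p, omega_swap s r,
    omega_swap r p, omega_swap r q, omega_swap s p, omega_swap s q, hpr, hps, hqr, hqs] at h1 h2 h3 h4
  have e1 : g 1 * omega n p q = 0 := by linarith
  have e0 : g 0 * omega n p q = 0 := by linarith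
  have e3 : g 3 * omega n r s = 0 := by linarith
  have e2 : g 2 * omega n r s = 0 := by linarith
  intro i
  fin_cases i
  · exact (mul_eq_zero.mp e0).resolve_right hpq
  · exact (mul_eq_zero.mp e1).resolve_right hpq
  · exact (mul_eq_zero.mp e2).resolve_right hrs
  · exact (mul_eq_zero.mp e3).resolve_right hrs

theorem OddSU.nn_eq_zero_of_symplectic (hn : Odd n) {δ : Set (Cn n) → ℂ} (hδ : OddSU δ)
    {p q r s : Cn n} {l : Multiset (Cn n)} (hl : Multiset.card l + 3 = n)
    (hpq : omega n p q ≠ 0) (hrs : omega n p q = omega n r s) (hpr : omega n p r = 0)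
    (hps : omega n p s = 0) (hqr : omega n q r = 0) (hqs : omega n q s = 0)
    (hQ : ∀ x ∈ ({p, q, r, s} : Set (Cn n)), ∀ y ∈ mspan l, omega n x y = 0) :
    NN (r ::ₘ s ::ₘ l) δ (tet ![p, q]) = 0 := by
  have hli := linearIndependent_of_omega hpq (hrs ▸ hpq) hpr hps hqr hqs
  set Q := Submodule.span ℝ (Set.range ![p, q, r, s]) with hQdef
  have hQd : Module.finrank ℝ Q = 4 := by
    rw [finrank_span_eq_card hli, Fintype.card_fin]
  have hQr : Set.range ![p, q, r, s] = {p, q, r, s} := by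
    ext x
    simp [eq_comm]
    tauto
  have hQl : ∀ x ∈ Q, ∀ y ∈ mspan l, omega n x y = 0 := by
    intro x hx y hy
    have : Q ≤ LinearMap.ker ((omega n).flip y) := by
      rw [hQdef, Submodule.span_le, hQr]
      intro x hx
      exact hQ x hx y hy
    exact this hx
  have mem : ∀ x ∈ ({p, q, r, s} : Set (Cn n)), x ∈ Q := fun x hx =>
    Submodule.subset_span (hQr ▸ hx)
  have hp : p ∈ Q := mem p (by simp)
  have hq : q ∈ Q := mem q (by simp)
  have hr : r ∈ Q := mem r (by simp)
  have hs : s ∈ Q := mem s (by simp)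
  have hv := (hδ.val.nn l).comp_linear Q.subtype
  have hlc := finrank_mspan_le l
  have hNv : ∀ (x : Q) (m : Set (Cn n) → ℂ), Nv x (fun A : Set Q => m (Q.subtype '' A)) =
      fun A : Set Q => Nv (x : Cn n) m (Q.subtype '' A) := by
    intro x m
    funext A
    simp only [Nv]
    rw [Set.image_add, image_subtype_segment]
  have key := Val.symplectic_eq_zero (E := Q) (m := fun A : Set Q => NN l δ (Q.subtype '' A)) hv (β := (omega n).domRestrict₁₂ Q Q) (p := ⟨p, hp⟩) (q := ⟨q, hq⟩)
    (r := ⟨r, hr⟩) (s := ⟨s, hs⟩)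
    ((hδ.val.nn l).simple_subtype Q fun W' hW' K hK hKW => by
      have h1 := Submodule.finrank_lt_finrank_of_lt hW'
      have h2 := Submodule.finrank_add_le_finrank_add_finrank (mspan l) W'
      exact nn_eq_zero_of_subset (W := mspan l ⊔ W') (hδ.low _ (by omega)) le_sup_left hK
        (hKW.trans (SetLike.coe_subset_coe.mpr le_sup_right))) hQd
    (fun A hA => by
      rw [show Q.subtype '' ((2 : ℝ) • A) = (2 : ℝ) • (Q.subtype '' A) from
        Set.image_smul_comm _ _ _ fun _ => by rw [map_smul],
        nn_double hδ.val hl hδ.double (hA.image _)]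
      norm_num)
    (fun x y => omega_swap (x : Cn n) y)
    (fun x y hxy A hA => by
      rw [hNv, hNv]
      dsimp only
      rw [← nn_cons, ← nn_cons]
      by_cases hc : Module.finrank ℝ (mspan ((x : Cn n) ::ₘ (y : Cn n) ::ₘ l)) <
        Multiset.card ((x : Cn n) ::ₘ (y : Cn n) ::ₘ l)
      · exact hδ.val.nn_eq_zero_of_finrank_lt hc (hA.image _)
      by_cases hx0 : (x : Cn n) = 0
      · exact hδ.val.nn_dependent (hx0 ▸ Submodule.zero_mem _) (hA.image _)
      have hc' := finrank_mspan_le ((x : Cn n) ::ₘ (y : Cn n) ::ₘ l)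
      simp only [Multiset.card_cons] at hc hc'
      refine hδ.nn_eq_zero_of_radical hn (W := mspan ((x : Cn n) ::ₘ (y : Cn n) ::ₘ l)) (by omega)
        (mem_mspan (Multiset.mem_cons_self _ _)) hx0 (fun z hz => ?_) le_rfl
        (by simp only [Multiset.card_cons]; omega) (hA.image _)
      obtain ⟨t, w, hw, rfl⟩ := mem_mspan_cons.mp hz
      obtain ⟨u, w', hw', rfl⟩ := mem_mspan_cons.mp hw
      have hxy' : omega n (x : Cn n) y = 0 := hxy
      simp [omega_self, hxy', hQl x x.2 w' hw'])
    hrs hpr hps hqr hqs ?_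
  · rw [hNv, hNv] at key
    dsimp only at key
    rw [image_tet] at key
    have e : Q.subtype ∘ ![⟨p, hp⟩, ⟨q, hq⟩] = ![p, q] := by
      funext i
      fin_cases i <;> rfl
    rw [e] at key
    rwa [nn_cons, nn_cons]
  · have := linearIndependent_pair_of_omega hpq
    refine LinearIndependent.of_comp Q.subtype ?_
    convert this using 1
    funext i
    fin_cases i <;> rfl

theorem OddSU.nn_tet_of_omega (hn : Odd n) {δ : Set (Cn n) → ℂ} (hδ : OddSU δ)
    {l : Multiset (Cn n)} (hl : Multiset.card l + 1 = n) {r : Cn n} (hr : r ∈ mspan l)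
    {s : Cn n} (hs : s ∈ mspan l) (hrs : omega n r s ≠ 0)
    (hld : Module.finrank ℝ (mspan l) = Multiset.card l) {p q : Cn n}
    (hp : ∀ y ∈ mspan l, omega n p y = 0) (hq : ∀ y ∈ mspan l, omega n q y = 0)
    (hpq : omega n p q ≠ 0) : NN l δ (tet ![p, q]) = 0 := by
  set W := mspan l with hW
  obtain ⟨s', hs', hrs', hr0⟩ : ∃ s' ∈ W, omega n p q = omega n r s' ∧ omega n r s' ≠ 0 := by
    refine ⟨(omega n p q / omega n r s) • s, W.smul_mem _ hs, ?_, ?_⟩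
    · rw [map_smul, smul_eq_mul, div_mul_cancel₀ _ hrs]
    · rw [map_smul, smul_eq_mul, div_mul_cancel₀ _ hrs]
      exact hpq
  clear hrs hs s
  set C : Submodule ℝ (Cn n) := W ⊓ (LinearMap.ker (omega n r) ⊓ LinearMap.ker (omega n s')) with hC
  set P := Submodule.span ℝ (Set.range ![r, s'])
  have hP2 : Module.finrank ℝ P = 2 := by
    rw [finrank_span_eq_card (linearIndependent_pair_of_omega hr0), Fintype.card_fin]
  have hPr : Set.range ![r, s'] = {r, s'} := by
    ext x
    simp [eq_comm]
    tauto
  have hPW : P ≤ W := by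
    rw [Submodule.span_le, hPr]
    rintro x (rfl | rfl)
    exacts [hr, hs']
  have hsr := omega_swap s' r
  have hsup : P ⊔ C = W := by
    refine le_antisymm (sup_le hPW inf_le_left) fun w hw => ?_
    set c := (omega n w s' / omega n r s') • r + (omega n r w / omega n r s') • s' with hc
    have hcP : c ∈ P := P.add_mem (P.smul_mem _ (Submodule.subset_span (by simp)))
      (P.smul_mem _ (Submodule.subset_span (by simp)))
    rw [show w = c + (w - c) by abel]
    refine Submodule.add_mem_sup hcP ⟨W.sub_mem hw (hPW hcP), ?_, ?_⟩
    · simp [LinearMap.mem_ker, hc, omega_self, hr0]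
    · simp [LinearMap.mem_ker, hc, omega_self, hsr, hr0, omega_swap s' w]
  have hinf : P ⊓ C = ⊥ := by
    rw [eq_bot_iff]
    rintro x ⟨hxP, -, hxr, hxs⟩
    rw [SetLike.mem_coe, show P = Submodule.span ℝ {r, s'} from by rw [← hPr],
      Submodule.mem_span_pair] at hxP
    obtain ⟨a, b, rfl⟩ := hxP
    rw [SetLike.mem_coe, LinearMap.mem_ker] at hxr hxs
    simp only [map_add, map_smul, omega_self, smul_eq_mul, hsr] at hxr hxs
    have hb : b = 0 := (mul_eq_zero.mp (show b * omega n r s' = 0 by linarith)).resolve_right hr0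
    have ha : a = 0 := (mul_eq_zero.mp (show a * omega n r s' = 0 by linarith)).resolve_right hr0
    simp [ha, hb]
  have hdim := Submodule.finrank_sup_add_finrank_inf_eq P C
  rw [hsup, hinf, finrank_bot] at hdim
  obtain ⟨l', hl'c, hl's⟩ := exists_mspan_eq C
  have key := hδ.nn_eq_zero_of_symplectic hn (l := l') (by omega) hpq hrs' (hp r hr) (hp s' hs')
    (hq r hr) (hq s' hs') (by
      rw [hl's]
      rintro x (rfl | rfl | rfl | rfl) y hy
      exacts [hp y hy.1, hq y hy.1, hy.2.1, hy.2.2])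
  have := hδ.val.nn_exchange (tet_cc ![p, q]) 0 (r ::ₘ s' ::ₘ l') l (by simp; omega) ?_
    (by rwa [zero_add])
  · rwa [zero_add] at this
  · rw [zero_add, mspan_cons, mspan_cons, hl's, ← hW, ← hsup, ← sup_assoc]
    refine sup_le_sup ?_ le_rfl
    rw [Submodule.span_le, hPr]
    rintro x (rfl | rfl)
    · exact le_sup_left (a := Submodule.span ℝ {x}) (Submodule.mem_span_singleton_self x)
    · exact le_sup_right (b := Submodule.span ℝ {x}) (Submodule.mem_span_singleton_self x)

theorem near_tet (a b c : Cn n) {ε : ℝ} (hε : 0 ≤ ε) :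
    Near (ε * ‖c‖) (tet ![a, b + ε • c]) (tet ![a, b]) := by
  have key : ∀ t : ℝ, 0 ≤ t → t ≤ 1 → ‖t • (ε • c)‖ ≤ ε * ‖c‖ := fun t h0 h1 => by
    rw [norm_smul, norm_smul, Real.norm_of_nonneg h0, Real.norm_of_nonneg hε]
    exact mul_le_of_le_one_left (by positivity) h1
  constructor
  · intro x hx
    obtain ⟨s, t, h0, h1, h2, rfl⟩ := mem_tet_two.mp hx
    refine ⟨_, mem_tet_two.mpr ⟨s, t, h0, h1, h2, rfl⟩, ?_⟩
    rw [show s • a + t • (b + ε • c) - (s • a + t • b) = t • (ε • c) by module]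
    exact key t h0 (h1.trans h2)
  · intro x hx
    obtain ⟨s, t, h0, h1, h2, rfl⟩ := mem_tet_two.mp hx
    refine ⟨_, mem_tet_two.mpr ⟨s, t, h0, h1, h2, rfl⟩, ?_⟩
    rw [show s • a + t • (b + ε • c) - (s • a + t • b) = t • (ε • c) by module]
    exact key t h0 (h1.trans h2)

theorem OddSU.nn_eq_zero (hn : Odd n) (hn2 : 2 ≤ n) {δ : Set (Cn n) → ℂ} (hδ : OddSU δ)
    {l : Multiset (Cn n)} (hl : Multiset.card l + 1 = n) {A : Set (Cn n)} (hA : CC A) :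
    NN l δ A = 0 := by
  set W := mspan l with hW
  have hlc : Module.finrank ℝ W ≤ Multiset.card l := finrank_mspan_le l
  by_cases hld : Module.finrank ℝ W < Multiset.card l
  · exact hδ.val.nn_eq_zero_of_finrank_lt hld hA
  have hld' : Module.finrank ℝ W = Multiset.card l := by omega
  by_cases hrad : ∃ x ∈ W, x ≠ 0 ∧ ∀ y ∈ W, omega n x y = 0
  · obtain ⟨x, hxW, hx, hr⟩ := hrad
    exact hδ.nn_eq_zero_of_radical hn (W := W) (by omega) hxW hx hr le_rfl hl hA
  push Not at hrad
  have hproj : ∀ z : Cn n, ∃ w ∈ W, ∀ y ∈ W, omega n (z - w) y = 0 := by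
    intro z
    have hinj : Function.Injective ((omega n).domRestrict₁₂ W W) := by
      rw [← LinearMap.ker_eq_bot, eq_bot_iff]
      intro x hx
      rw [LinearMap.mem_ker] at hx
      by_contra hx0
      obtain ⟨y, hy, hxy⟩ := hrad x x.2 fun h => hx0 (by simpa using h)
      exact hxy (LinearMap.congr_fun hx ⟨y, hy⟩)
    have hsurj := (LinearMap.injective_iff_surjective_of_finrank_eq_finrank
      (Subspace.dual_finrank_eq (K := ℝ) (V := W)).symm).mp hinj
    obtain ⟨w, hw⟩ := hsurj ((omega n z).domRestrict W)
    refine ⟨w, w.2, fun y hy => ?_⟩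
    have := LinearMap.congr_fun hw ⟨y, hy⟩
    rw [map_sub, LinearMap.sub_apply, sub_eq_zero]
    exact this.symm
  obtain ⟨r, hr, s, hs, hrs⟩ : ∃ r ∈ W, ∃ s ∈ W, omega n r s ≠ 0 := by
    have : W ≠ ⊥ := by
      intro h
      rw [h, finrank_bot] at hld
      omega
    obtain ⟨r, hr, hr0⟩ := Submodule.exists_mem_ne_zero_of_ne_bot this
    obtain ⟨s, hs, h⟩ := hrad r hr hr0
    exact ⟨r, hr, s, hs, h⟩
  refine hδ.val.nn_eq_zero_of_tet hδ.double hδ.low hl (fun a b _ => ?_) hA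
  obtain ⟨wa, hwa, ha⟩ := hproj a
  obtain ⟨wb, hwb, hb⟩ := hproj b
  have hcongr : NN l δ (tet ![a, b]) = NN l δ (tet ![a - wa, b - wb]) := by
    refine hδ.val.nn_congr (fun x => ?_) (orth_cc 2 1)
    simp only [Fintype.linearCombination_apply, Fin.sum_univ_two, Matrix.cons_val_zero,
      Matrix.cons_val_one]
    rw [show x 0 • a + x 1 • b - (x 0 • (a - wa) + x 1 • (b - wb)) = x 0 • wa + x 1 • wb by module]
    exact W.add_mem (W.smul_mem _ hwa) (W.smul_mem _ hwb)
  rw [hcongr]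
  set p := a - wa
  set q := b - wb
  have hmain : ∀ q : Cn n, (∀ y ∈ W, omega n q y = 0) → omega n p q ≠ 0 →
      NN l δ (tet ![p, q]) = 0 := fun q hq hpq =>
    hδ.nn_tet_of_omega hn hl hr hs hrs hld' ha hq hpq
  by_cases hpq : omega n p q = 0
  swap
  · exact hmain q hb hpq
  by_cases hp0 : p = 0
  · rw [hp0]
    have h1 := Submodule.finrank_add_le_finrank_add_finrank W (Submodule.span ℝ {q})
    have h2 := finrank_span_singleton_le q
    refine nn_eq_zero_of_subset (W := W ⊔ Submodule.span ℝ {q}) (hδ.low _ (by omega)) le_sup_left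
      (tet_cc _) ?_
    intro x hx
    obtain ⟨u, t, -, -, -, rfl⟩ := mem_tet_two.mp hx
    rw [smul_zero, zero_add]
    exact le_sup_right (a := W) (Submodule.smul_mem _ _ (Submodule.mem_span_singleton_self q))
  obtain ⟨w, hw, hc⟩ := hproj (Complex.I • p)
  set c := Complex.I • p - w with hcdef
  have hpc : omega n p c ≠ 0 := by
    rw [hcdef, map_sub, ha w hw, sub_zero, omega_apply, inner_smul_right, inner_self_eq_norm_sq_to_K]
    simpa [← Complex.ofReal_pow] using hp0
  have hlim := (hδ.val.nn l).tendsto (tet_cc ![p, q]) (tet_nonempty _)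
    (B := fun i : ℕ => tet ![p, q + (1 / ((i : ℝ) + 1)) • c])
    (δ := fun i : ℕ => (1 / ((i : ℝ) + 1)) * ‖c‖) (l := Filter.atTop) (fun i => tet_cc _)
    (by simpa using tendsto_one_div_add_atTop_nhds_zero_nat.mul_const ‖c‖)
    (fun i => near_tet p q c (by positivity))
  refine tendsto_nhds_unique hlim ?_
  refine tendsto_const_nhds.congr fun i => (hmain _ (fun y hy => ?_) ?_).symm
  · simp [hb y hy, hc y hy]
  · rw [map_add, hpq, zero_add, map_smul, smul_eq_mul]
    exact mul_ne_zero (by positivity) hpc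

theorem OddSU.eq_zero (hn : Odd n) (hn2 : 2 ≤ n) {δ : Set (Cn n) → ℂ} (hδ : OddSU δ)
    {A : Set (Cn n)} (hA : CC A) : δ A = 0 :=
  hδ.val.eq_zero_of_nn (by omega) hδ.double (fun _ hl _ hA => hδ.nn_eq_zero hn hn2 hl hA) hA

end oddMain

section extend
variable {E : Type*} [NormedAddCommGroup E] [NormedSpace ℝ E]

open Classical in
/-- A function of convex bodies as a function on all sets. -/
def extendBody (δ : ConvexBody E → ℂ) (A : Set E) : ℂ :=
  if h : CC A ∧ A.Nonempty then δ ⟨A, h.1.conv, h.1.comp, h.2⟩ else 0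

theorem extendBody_of {δ : ConvexBody E → ℂ} {A : Set E} (hA : CC A) (hne : A.Nonempty) :
    extendBody δ A = δ ⟨A, hA.conv, hA.comp, hne⟩ := dif_pos ⟨hA, hne⟩

theorem extendBody_coe (δ : ConvexBody E → ℂ) (K : ConvexBody E) : extendBody δ K = δ K :=
  extendBody_of ⟨K.convex, K.isCompact⟩ K.nonempty

theorem extendBody_empty (δ : ConvexBody E → ℂ) : extendBody δ ∅ = 0 :=
  dif_neg fun h => Set.not_nonempty_empty h.2

theorem ConvexBody.dist_le_of_near {K L : ConvexBody E} {r : ℝ} (hr : 0 ≤ r)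
    (h : Near r (K : Set E) L) : dist K L ≤ r := by
  rw [← ConvexBody.hausdorffDist_coe]
  refine Metric.hausdorffDist_le_of_mem_dist hr (fun x hx => ?_) fun x hx => ?_
  · obtain ⟨y, hy, h⟩ := h.1 x hx
    exact ⟨y, hy, by rwa [dist_eq_norm]⟩
  · obtain ⟨y, hy, h⟩ := h.2 x hx
    exact ⟨y, hy, by rwa [dist_comm, dist_eq_norm]⟩

theorem exists_submodule_finrank [FiniteDimensional ℝ E] (W : Submodule ℝ E) (k : ℕ)
    (hk : Module.finrank ℝ W + k ≤ Module.finrank ℝ E) :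
    ∃ W' : Submodule ℝ E, W ≤ W' ∧ Module.finrank ℝ W' = Module.finrank ℝ W + k := by
  induction k with
  | zero => exact ⟨W, le_rfl, rfl⟩
  | succ k ih =>
    obtain ⟨W', hW, h⟩ := ih (by omega)
    have : W' ≠ ⊤ := by
      rintro rfl
      rw [finrank_top] at h
      omega
    obtain ⟨x, -, hx⟩ := SetLike.exists_of_lt (lt_top_iff_ne_top.mpr this)
    have hx0 : x ≠ 0 := fun h0 => hx (h0 ▸ Submodule.zero_mem _)
    refine ⟨W' ⊔ Submodule.span ℝ {x}, hW.trans le_sup_left, ?_⟩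
    have h1 := Submodule.finrank_add_le_finrank_add_finrank W' (Submodule.span ℝ {x})
    have h2 : Module.finrank ℝ W' < Module.finrank ℝ ↥(W' ⊔ Submodule.span ℝ {x}) :=
      Submodule.finrank_lt_finrank_of_lt (lt_of_le_of_ne le_sup_left fun he => hx (by
        rw [he]
        exact le_sup_right (a := W') (Submodule.mem_span_singleton_self x)))
    rw [finrank_span_singleton hx0] at h1
    omega

end extend

section uniqueness
variable {n : ℕ}

theorem val_extendBody {δ : ConvexBody (Cn n) → ℂ} (hv : IsValuation δ) (hc : Continuous δ)
    (ht : TranslationInvariant δ) : Val (extendBody δ) where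
  empty := extendBody_empty δ
  union A B hA hB hU := by
    rcases A.eq_empty_or_nonempty with rfl | hAn
    · rw [Set.empty_union, Set.empty_inter, add_comm]
    rcases B.eq_empty_or_nonempty with rfl | hBn
    · rw [Set.union_empty, Set.inter_empty]
    obtain ⟨a, ha⟩ := hAn
    obtain ⟨b, hb⟩ := hBn
    obtain ⟨s, t, -, -, -, hst⟩ := CC.crossing hA hB hU ha hb
    rw [extendBody_of ⟨hU, hA.comp.union hB.comp⟩ ⟨a, Or.inl ha⟩, extendBody_of (hA.inter hB) ⟨_, hst⟩,
      extendBody_of hA ⟨a, ha⟩, extendBody_of hB ⟨b, hb⟩]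
    exact hv _ _ _ _ rfl rfl
  trans x A hA := by
    rcases A.eq_empty_or_nonempty with rfl | hAn
    · rw [Set.add_empty]
    rw [extendBody_of ((CC.singleton x).add hA) ((Set.singleton_nonempty x).add hAn),
      extendBody_of hA hAn]
    exact ht x _ _ Set.singleton_add
  cont A hA hAn ε hε := by
    obtain ⟨d, hd, h⟩ := Metric.continuous_iff.mp hc ⟨A, hA.conv, hA.comp, hAn⟩ ε hε
    refine ⟨d / 2, by positivity, fun B hB hBn hBA => ?_⟩
    rw [extendBody_of hB hBn, extendBody_of hA hAn, ← dist_eq_norm]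
    refine (h _ ?_).le
    exact (ConvexBody.dist_le_of_near (by positivity) hBA).trans_lt (by linarith)

theorem eq_zero_of_low {δ : Set (Cn n) → ℂ} (hn : 2 ≤ n) (hm : Val δ)
    (hh : ∀ A, CC A → δ ((2 : ℝ) • A) = 2 ^ n * δ A)
    (hlow : ∀ W : Submodule ℝ (Cn n), Module.finrank ℝ W ≤ n → ∀ A, CC A → A ⊆ W → δ A = 0)
    (su : ∀ g ∈ Matrix.specialUnitaryGroup (Fin n) ℂ, ∀ A, CC A →
      δ (Matrix.toEuclideanLin g '' A) = δ A) {A : Set (Cn n)} (hA : CC A) : δ A = 0 := by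
  rcases Nat.even_or_odd n with he | ho
  · refine hm.eq_zero_of_even (by omega) hh hlow (fun A hA => ?_) hA
    rw [← su (-1) ?_ A hA]
    · congr 1
      ext x
      simp
    · rw [Matrix.mem_specialUnitaryGroup_iff]
      exact ⟨by simp [Matrix.mem_unitaryGroup_iff], by rw [Matrix.det_neg]; simp [he.neg_one_pow]⟩
  · have himg : ∀ A : Set (Cn n), (-1 : ℝ) • A = (-LinearMap.id : Cn n →ₗ[ℝ] Cn n) '' A := by
      intro A
      ext x
      simp
    have hneg : Val fun A => δ ((-1 : ℝ) • A) := by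
      simp only [himg]
      exact hm.comp_linear _
    have hnn : ∀ A : Set (Cn n), (-1 : ℝ) • (-1 : ℝ) • A = A := fun A => by
      rw [smul_smul]; norm_num
    have hdn : ∀ A : Set (Cn n), (-1 : ℝ) • (2 : ℝ) • A = (2 : ℝ) • (-1 : ℝ) • A := fun A =>
      smul_comm _ _ _
    have hnlow : ∀ W : Submodule ℝ (Cn n), Module.finrank ℝ W ≤ n → ∀ A, CC A → A ⊆ W →
        δ ((-1 : ℝ) • A) = 0 := fun W hW A hA hAW => by
      refine hlow W hW _ (hA.smul _) ?_
      rintro _ ⟨x, hx, rfl⟩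
      exact W.smul_mem _ (hAW hx)
    have h1 : δ A + δ ((-1 : ℝ) • A) = 0 := by
      refine (hm.add hneg).eq_zero_of_even (k := n) (by omega) (fun A hA => ?_)
        (fun W hW A hA hAW => ?_) (fun A hA => ?_) hA
      · rw [hdn, hh A hA, hh _ (hA.smul _), mul_add]
      · rw [hlow W hW A hA hAW, hnlow W hW A hA hAW, add_zero]
      · rw [hnn, add_comm]
    have h2 : δ A - δ ((-1 : ℝ) • A) = 0 := by
      refine OddSU.eq_zero (δ := fun A => δ A - δ ((-1 : ℝ) • A)) ho hn
        ⟨hm.sub hneg, fun A hA => ?_, fun W hW A hA hAW => ?_, fun A hA => ?_, fun g hg A hA => ?_⟩ hA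
      · rw [hdn, hh A hA, hh _ (hA.smul _), mul_sub]
      · rw [hlow W hW A hA hAW, hnlow W hW A hA hAW, sub_zero]
      · rw [hnn, neg_sub]
      · rw [su g hg A hA, ← su g hg _ (hA.smul _)]
        congr 2
        exact (Set.image_smul_comm _ _ _ fun x => by
          rw [show ∀ z : Cn n, (-1 : ℝ) • z = (-1 : ℂ) • z from fun z => by simp, map_smul]; simp).symm
    linear_combination (h1 + h2) / 2

theorem eq_of_klain (hn : 2 ≤ n) {μ ν : ConvexBody (Cn n) → ℂ}
    (hμ : IsValuation μ ∧ Continuous μ ∧ TranslationInvariant μ ∧ SUInvariant μ ∧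
      Homogeneous n μ ∧ KlainTheta2 μ)
    (hν : IsValuation ν ∧ Continuous ν ∧ TranslationInvariant ν ∧ SUInvariant ν ∧
      Homogeneous n ν ∧ KlainTheta2 ν) : μ = ν := by
  obtain ⟨v, c, t, s, h, k⟩ := hμ
  obtain ⟨v', c', t', s', h', k'⟩ := hν
  set δ : ConvexBody (Cn n) → ℂ := fun K => μ K - ν K with hδ
  have hval : Val (extendBody δ) := by
    refine val_extendBody (fun K L U I hU hI => ?_) (c.sub c') fun x K L hKL => ?_
    · have h1 := v K L U I hU hI
      have h2 := v' K L U I hU hI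
      simp only [hδ]
      linear_combination h1 - h2
    · simp only [hδ, t x K L hKL, t' x K L hKL]
  funext K
  have : extendBody δ K = 0 := by
    refine eq_zero_of_low hn hval (fun A hA => ?_) (fun W hW A hA hAW => ?_) (fun g hg A hA => ?_)
      ⟨K.convex, K.isCompact⟩
    · rcases A.eq_empty_or_nonempty with rfl | hne
      · rw [Set.smul_set_empty, extendBody_empty, mul_zero]
      rw [extendBody_of (hA.smul 2) (hne.smul_set), extendBody_of hA hne]
      have h1 := h 2 two_pos ⟨A, hA.conv, hA.comp, hne⟩ ⟨_, (hA.smul 2).conv, (hA.smul 2).comp, hne.smul_set⟩ rfl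
      have h2 := h' 2 two_pos ⟨A, hA.conv, hA.comp, hne⟩ ⟨_, (hA.smul 2).conv, (hA.smul 2).comp, hne.smul_set⟩ rfl
      simp only [hδ]
      rw [h1, h2]
      push_cast
      ring
    · rcases A.eq_empty_or_nonempty with rfl | hne
      · rw [extendBody_empty]
      have hd : Module.finrank ℝ (Cn n) = 2 * n := by
        rw [← Module.finrank_mul_finrank ℝ ℂ (Cn n)]
        simp [Complex.finrank_real_complex]
      obtain ⟨W', hWW', hW'⟩ := exists_submodule_finrank W (n - Module.finrank ℝ W) (by omega)
      have hW'n : Module.finrank ℝ W' = n := by omega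
      let b := (stdOrthonormalBasis ℝ W').reindex (finCongr hW'n)
      have hb : IsONBasisOf (fun i => (b i : Cn n)) W' := by
        refine ⟨fun i => (b i).2, ?_, ?_⟩
        · have h1 := b.toBasis.span_eq
          have h2 := congrArg (Submodule.map W'.subtype) h1
          rw [Submodule.map_span, Submodule.map_top, Submodule.range_subtype, ← Set.range_comp] at h2
          exact Eq.trans (by congr 2) h2
        · exact b.orthonormal.comp_linearIsometry W'.subtypeₗᵢ
      rw [extendBody_of hA hne]
      simp only [hδ]
      rw [k W' hW'n _ hb _ (hAW.trans hWW'), k' W' hW'n _ hb _ (hAW.trans hWW'), sub_self]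
    · rcases A.eq_empty_or_nonempty with rfl | hne
      · rw [Set.image_empty]
      have hgA : CC (Matrix.toEuclideanLin g '' A) :=
        hA.image ((Matrix.toEuclideanLin g).restrictScalars ℝ)
      rw [extendBody_of hgA (hne.image _), extendBody_of hA hne]
      simp only [hδ]
      rw [s g hg ⟨A, hA.conv, hA.comp, hne⟩ _ rfl, s' g hg ⟨A, hA.conv, hA.comp, hne⟩ _ rfl]
  rw [extendBody_coe] at this
  exact sub_eq_zero.mp this

end uniqueness

section volume
open Filter Topology
variable {E : Type*} [NormedAddCommGroup E] [NormedSpace ℝ E]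
variable {F : Type*} [NormedAddCommGroup F] [NormedSpace ℝ F]

theorem ConvexBody.exists_dist_lt {K L : ConvexBody E} {r : ℝ} (h : dist K L < r) {x : E}
    (hx : x ∈ (K : Set E)) : ∃ y ∈ (L : Set E), dist x y < r := by
  rw [← ConvexBody.hausdorffDist_coe] at h
  exact Metric.exists_dist_lt_of_hausdorffDist_lt hx h ConvexBody.hausdorffEDist_ne_top

/-- The image of a convex body under a continuous linear map. -/
def ConvexBody.img (T : E →L[ℝ] F) (K : ConvexBody E) : ConvexBody F :=
  ⟨T '' K, K.convex.linear_image T.toLinearMap, K.isCompact.image T.continuous, K.nonempty.image _⟩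

theorem ConvexBody.continuous_img (T : E →L[ℝ] F) : Continuous (ConvexBody.img T) := by
  refine (LipschitzWith.of_dist_le_mul (K := ‖T‖₊) fun K L => ?_).continuous
  refine le_of_forall_pos_lt_add fun ε hε => ?_
  have key : ∀ {K L : ConvexBody E} {r : ℝ}, dist K L < r → ∀ x ∈ (K.img T : Set F),
      ∃ y ∈ (L.img T : Set F), ‖x - y‖ ≤ ‖T‖ * r := by
    rintro K L r h _ ⟨x, hx, rfl⟩
    obtain ⟨y, hy, hxy⟩ := ConvexBody.exists_dist_lt h hx
    refine ⟨T y, ⟨y, hy, rfl⟩, ?_⟩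
    rw [← map_sub]
    rw [dist_eq_norm] at hxy
    exact (T.le_opNorm _).trans (by gcongr)
  set r := dist K L + ε / (‖T‖ + 1) with hr
  have hr1 : dist K L < r := by rw [hr]; linarith [show 0 < ε / (‖T‖ + 1) by positivity]
  have h1 : dist (K.img T) (L.img T) ≤ ‖T‖ * r := by
    refine ConvexBody.dist_le_of_near (by positivity) ⟨key hr1, fun y hy => ?_⟩
    obtain ⟨x, hx, h⟩ := key (by rwa [dist_comm] at hr1) y hy
    exact ⟨x, hx, by rwa [norm_sub_rev]⟩
  refine h1.trans_lt ?_
  rw [hr, mul_add, coe_nnnorm]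
  gcongr
  rw [← mul_div_assoc, div_lt_iff₀ (by positivity)]
  nlinarith [norm_nonneg T]

theorem ConvexBody.continuous_img_left (K : ConvexBody E) :
    Continuous fun T : E →L[ℝ] F => K.img T := by
  obtain ⟨R, hR⟩ := K.isCompact.isBounded.exists_norm_le
  have hR0 : 0 ≤ R := by
    obtain ⟨x, hx⟩ := K.nonempty
    exact (norm_nonneg x).trans (hR x hx)
  refine (LipschitzWith.of_dist_le_mul (K := ⟨R, hR0⟩) fun S T => ?_).continuous
  have key : ∀ x ∈ (K : Set E), ‖S x - T x‖ ≤ R * dist S T := fun x hx => by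
    rw [← sub_apply, mul_comm, dist_eq_norm]
    exact ((S - T).le_opNorm x).trans (by gcongr; exact hR x hx)
  refine ConvexBody.dist_le_of_near (mul_nonneg hR0 dist_nonneg) ⟨?_, ?_⟩
  · rintro _ ⟨x, hx, rfl⟩
    exact ⟨T x, ⟨x, hx, rfl⟩, key x hx⟩
  · rintro _ ⟨x, hx, rfl⟩
    exact ⟨S x, ⟨x, hx, rfl⟩, key x hx⟩

/-- A point at distance `δ` inside a convex body stays inside under small perturbations. -/
theorem ConvexBody.mem_of_ball_subset {K L : ConvexBody E} {x : E} {δ : ℝ}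
    (hδ : 0 < δ) (hx : Metric.ball x δ ⊆ (K : Set E)) (h : dist K L < δ / 4) :
    x ∈ (L : Set E) := by
  by_contra hxL
  obtain ⟨f, u, hf, hu⟩ := geometric_hahn_banach_closed_point L.convex L.isCompact.isClosed hxL
  obtain ⟨l, hl⟩ := L.nonempty
  have hf0 : 0 < ‖f‖ := by
    rw [norm_pos_iff]
    rintro rfl
    have := hf l hl
    simp only [zero_apply] at this hu
    linarith
  obtain ⟨v, hv1, hv⟩ := f.exists_lt_apply_of_lt_opNorm (r := ‖f‖ / 2) (by linarith)
  have hv' : ∃ v : E, ‖v‖ < 1 ∧ ‖f‖ / 2 < f v := by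
    rcases le_total 0 (f v) with h0 | h0
    · exact ⟨v, hv1, by rwa [Real.norm_of_nonneg h0] at hv⟩
    · exact ⟨-v, by rwa [norm_neg], by rwa [Real.norm_of_nonpos h0, ← map_neg] at hv⟩
  obtain ⟨v, hv1, hv⟩ := hv'
  have hy : x + (δ / 2) • v ∈ (K : Set E) := hx (by
    rw [mem_ball_iff_norm, add_sub_cancel_left, norm_smul, Real.norm_of_nonneg (by positivity)]
    nlinarith [norm_nonneg v])
  obtain ⟨a, ha, hya⟩ := ConvexBody.exists_dist_lt h hy
  have h1 := f.le_opNorm (x + (δ / 2) • v - a)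
  rw [dist_eq_norm] at hya
  have h2 := le_trans (le_abs_self _) h1
  rw [map_sub, map_add, map_smul, smul_eq_mul] at h2
  have h3 := hf a ha
  have h4 : ‖f‖ * ‖x + (δ / 2) • v - a‖ ≤ ‖f‖ * (δ / 4) := by gcongr
  nlinarith

theorem ConvexBody.continuous_volume [FiniteDimensional ℝ F] [MeasurableSpace F] [BorelSpace F]
    (μ : Measure F) [μ.IsAddHaarMeasure] :
    Continuous fun K : ConvexBody F => (μ (K : Set F)).toReal := by
  rw [continuous_iff_continuousAt]
  intro K
  have h1 : (fun K : ConvexBody F => (μ (K : Set F)).toReal) =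
      fun K : ConvexBody F => ∫ x, (K : Set F).indicator (1 : F → ℝ) x ∂μ := by
    funext K
    rw [integral_indicator_one K.isCompact.measurableSet]
    rfl
  rw [h1]
  have hc : IsCompact (Metric.cthickening 1 (K : Set F)) := K.isCompact.cthickening
  refine continuousAt_of_dominated (bound := (Metric.cthickening 1 (K : Set F)).indicator 1)
    (Eventually.of_forall fun L => ?_) ?_ ?_ ?_
  · exact (measurable_one.indicator L.isCompact.measurableSet).aestronglyMeasurable
  · filter_upwards [Metric.ball_mem_nhds K one_pos] with L hL
    refine Eventually.of_forall fun x => ?_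
    by_cases hx : x ∈ (L : Set F)
    · rw [Set.indicator_of_mem hx]
      obtain ⟨y, hy, hxy⟩ := ConvexBody.exists_dist_lt hL hx
      rw [Set.indicator_of_mem (Metric.mem_cthickening_of_dist_le x y 1 _ hy hxy.le)]
      simp
    · rw [Set.indicator_of_notMem hx, norm_zero]
      exact Set.indicator_nonneg (fun _ _ => zero_le_one) _
  · exact (integrable_indicator_iff hc.measurableSet).mpr
      (integrableOn_const hc.measure_lt_top.ne)
  · have h0 : ∀ᵐ x ∂μ, x ∉ frontier (K : Set F) :=
      measure_eq_zero_iff_ae_notMem.mp (K.convex.addHaar_frontier μ)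
    filter_upwards [h0] with x hx
    by_cases hxK : x ∈ (K : Set F)
    · have hxi : x ∈ interior (K : Set F) := by
        by_contra h
        exact hx ⟨subset_closure hxK, h⟩
      obtain ⟨δ, hδ, hb⟩ := Metric.isOpen_iff.mp isOpen_interior x hxi
      refine ContinuousAt.congr (f := fun _ => (1 : ℝ)) continuousAt_const ?_
      filter_upwards [Metric.ball_mem_nhds K (show 0 < δ / 4 by positivity)] with L hL
      rw [Metric.mem_ball, dist_comm] at hL
      rw [Set.indicator_of_mem (ConvexBody.mem_of_ball_subset hδ (hb.trans interior_subset) hL),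
        Pi.one_apply]
    · obtain ⟨δ, hδ, hb⟩ := Metric.isOpen_iff.mp K.isCompact.isClosed.isOpen_compl x hxK
      refine ContinuousAt.congr (f := fun _ => (0 : ℝ)) continuousAt_const ?_
      filter_upwards [Metric.ball_mem_nhds K hδ] with L hL
      rw [Set.indicator_of_notMem]
      intro hxL
      obtain ⟨y, hy, hxy⟩ := ConvexBody.exists_dist_lt hL hxL
      exact hb (by rwa [Metric.mem_ball, dist_comm]) hy

end volume

section gauss
open ProbabilityTheory
variable {n : ℕ}

/-- The map `z ↦ (Re⟨g₁,z⟩, …, Re⟨gₙ,z⟩)`. -/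
def reMap (g : Fin n → Cn n) : Cn n →L[ℝ] (Fin n → ℝ) :=
  ContinuousLinearMap.pi fun j => innerSL ℝ (g j)

theorem reMap_apply (g : Fin n → Cn n) (z : Cn n) (j : Fin n) : reMap g z j = inner ℝ (g j) z := rfl

theorem continuous_reMap : Continuous (reMap : (Fin n → Cn n) → _) := by
  let L : (Fin n → Cn n) →ₗ[ℝ] (Cn n →L[ℝ] (Fin n → ℝ)) :=
    { toFun := reMap
      map_add' := fun g h => by ext z j; simp [reMap_apply, inner_add_left]
      map_smul' := fun c g => by ext z j; simp [reMap_apply, real_inner_smul_left] }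
  exact L.continuous_of_finiteDimensional

/-- `n` independent standard Gaussian vectors of `ℂⁿ`. -/
abbrev gaussFrame (n : ℕ) : Measure (Fin n → Cn n) := Measure.pi fun _ => stdGaussian (Cn n)

theorem norm_detC_le (w : Fin n → Cn n) : ‖detC w‖ ≤ n.factorial * ∏ j, ‖w j‖ := by
  rw [detC, Matrix.det_apply]
  refine (norm_sum_le _ _).trans ?_
  refine (Finset.sum_le_card_nsmul _ _ (∏ j, ‖w j‖) fun σ _ => ?_).trans_eq ?_
  · rw [Units.smul_def, zsmul_eq_mul, norm_mul, norm_prod]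
    have h1 : ‖((Equiv.Perm.sign σ : ℤ) : ℂ)‖ = 1 := by
      rcases Int.units_eq_one_or (Equiv.Perm.sign σ) with h | h <;> simp [h]
    rw [h1, one_mul]
    exact Finset.prod_le_prod (fun _ _ => norm_nonneg _) fun j _ => PiLp.norm_apply_le (w j) _
  · rw [Finset.card_univ, Fintype.card_perm, Fintype.card_fin, nsmul_eq_mul]

theorem continuous_detC : Continuous (detC : (Fin n → Cn n) → ℂ) := by
  unfold detC
  refine Continuous.matrix_det ?_
  refine continuous_matrix fun i j => ?_
  simp only [Matrix.of_apply]
  fun_prop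

theorem volume_reMap_le (g : Fin n → Cn n) {K : Set (Cn n)} {R : ℝ}
    (hK : ∀ z ∈ K, ‖z‖ ≤ R) (hR : 0 ≤ R) :
    (volume (reMap g '' K)).toReal ≤ (2 * R) ^ n * ∏ j, ‖g j‖ := by
  have hsub : reMap g '' K ⊆ Set.Icc (fun j => -(‖g j‖ * R)) (fun j => ‖g j‖ * R) := by
    rintro _ ⟨z, hz, rfl⟩
    have h : ∀ j, |inner ℝ (g j) z| ≤ ‖g j‖ * R := fun j =>
      (abs_real_inner_le_norm _ _).trans (by gcongr; exact hK z hz)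
    exact ⟨fun j => (abs_le.mp (h j)).1, fun j => (abs_le.mp (h j)).2⟩
  refine (ENNReal.toReal_mono (isCompact_Icc.measure_lt_top.ne) (measure_mono hsub)).trans ?_
  rw [Real.volume_Icc_pi_toReal fun j => by
    have : 0 ≤ ‖g j‖ * R := by positivity
    linarith]
  rw [Finset.prod_congr rfl fun j _ => show ‖g j‖ * R - -(‖g j‖ * R) = (2 * R) * ‖g j‖ by ring,
    Finset.prod_mul_distrib]
  simp

theorem integrable_prod_norm (n k : ℕ) :
    Integrable (fun g : Fin n → Cn n => ∏ j, ‖g j‖ ^ (k + 1)) (gaussFrame n) :=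
  Integrable.fintype_prod (f := fun _ (x : Cn n) => ‖x‖ ^ (k + 1)) fun _ =>
    (IsGaussian.memLp_id (stdGaussian (Cn n)) ((k + 1 : ℕ) : ℝ≥0∞)
      (ENNReal.natCast_ne_top _)).integrable_norm_pow (by omega)

/-- The integrand defining `φ₂`. -/
def phiInt (K : ConvexBody (Cn n)) (g : Fin n → Cn n) : ℂ :=
  detC g ^ 2 * ((volume (reMap g '' K)).toReal : ℂ)

/-- A multiple of `φ₂`. -/
def phiRaw (K : ConvexBody (Cn n)) : ℂ := ∫ g, phiInt K g ∂gaussFrame n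

theorem continuous_phiInt (K : ConvexBody (Cn n)) : Continuous (phiInt K) := by
  refine (continuous_detC.pow 2).mul (Complex.continuous_ofReal.comp ?_)
  exact (ConvexBody.continuous_volume volume).comp
    ((ConvexBody.continuous_img_left K).comp continuous_reMap)

theorem norm_phiInt_le (K : ConvexBody (Cn n)) {R : ℝ} (hK : ∀ z ∈ (K : Set (Cn n)), ‖z‖ ≤ R)
    (hR : 0 ≤ R) (g : Fin n → Cn n) :
    ‖phiInt K g‖ ≤ n.factorial ^ 2 * (2 * R) ^ n * ∏ j, ‖g j‖ ^ 3 := by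
  rw [phiInt, norm_mul, norm_pow, Complex.norm_real, Real.norm_of_nonneg ENNReal.toReal_nonneg]
  calc ‖detC g‖ ^ 2 * (volume (reMap g '' K)).toReal
      ≤ (n.factorial * ∏ j, ‖g j‖) ^ 2 * ((2 * R) ^ n * ∏ j, ‖g j‖) := by
        gcongr
        · exact norm_detC_le g
        · exact volume_reMap_le g hK hR
    _ = _ := by rw [Finset.prod_pow]; ring

theorem integrable_phiInt (K : ConvexBody (Cn n)) : Integrable (phiInt K) (gaussFrame n) := by
  obtain ⟨R, hR⟩ := K.isCompact.isBounded.exists_norm_le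
  have hR0 : 0 ≤ R := by
    obtain ⟨x, hx⟩ := K.nonempty
    exact (norm_nonneg x).trans (hR x hx)
  exact ((integrable_prod_norm n 2).const_mul _).mono' (continuous_phiInt K).aestronglyMeasurable
    (Filter.Eventually.of_forall (norm_phiInt_le K hR hR0))

theorem continuous_phiRaw : Continuous (phiRaw : ConvexBody (Cn n) → ℂ) := by
  rw [continuous_iff_continuousAt]
  intro K
  obtain ⟨R, hR⟩ := K.isCompact.isBounded.exists_norm_le
  have hR0 : 0 ≤ R := by
    obtain ⟨x, hx⟩ := K.nonempty
    exact (norm_nonneg x).trans (hR x hx)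
  refine continuousAt_of_dominated (Filter.Eventually.of_forall fun L =>
    (continuous_phiInt L).aestronglyMeasurable) ?_
    ((integrable_prod_norm n 2).const_mul (n.factorial ^ 2 * (2 * (R + 1)) ^ n : ℝ))
    (Filter.Eventually.of_forall fun g => Continuous.continuousAt ?_)
  · filter_upwards [Metric.ball_mem_nhds K one_pos] with L hL
    refine Filter.Eventually.of_forall (norm_phiInt_le L (fun z hz => ?_) (by positivity))
    obtain ⟨y, hy, hzy⟩ := ConvexBody.exists_dist_lt hL hz
    rw [dist_eq_norm] at hzy
    linarith [norm_le_norm_add_norm_sub' z y, hR y hy]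
  · exact continuous_const.mul (Complex.continuous_ofReal.comp
      ((ConvexBody.continuous_volume volume).comp (ConvexBody.continuous_img _)))

theorem isValuation_phiRaw : IsValuation (phiRaw : ConvexBody (Cn n) → ℂ) := by
  intro K L U I hU hI
  unfold phiRaw
  rw [← integral_add (integrable_phiInt U) (integrable_phiInt I),
    ← integral_add (integrable_phiInt K) (integrable_phiInt L)]
  congr 1
  funext g
  have hc : Convex ℝ ((K : Set (Cn n)) ∪ L) := hU ▸ U.convex
  have h1 := CC.image_inter ⟨K.convex, K.isCompact⟩ ⟨L.convex, L.isCompact⟩ hc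
    (reMap g).toLinearMap
  have hm : ∀ A : ConvexBody (Cn n), volume (reMap g '' A) ≠ ∞ := fun A =>
    (A.isCompact.image (reMap g).continuous).measure_lt_top.ne
  have h2 := measure_union_add_inter (μ := volume) (reMap g '' K)
    (L.isCompact.image (reMap g).continuous).measurableSet
  rw [← Set.image_union, ← hU] at h2
  rw [← hI] at h1
  have h3 := congrArg ENNReal.toReal h2
  have h1' : reMap g '' K ∩ reMap g '' L = reMap g '' I := h1.symm
  rw [h1', ENNReal.toReal_add (hm _) (hm _), ENNReal.toReal_add (hm _) (hm _)] at h3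
  unfold phiInt
  rw [← mul_add, ← mul_add]
  congr 1
  exact_mod_cast h3

theorem translationInvariant_phiRaw : TranslationInvariant (phiRaw : ConvexBody (Cn n) → ℂ) := by
  intro x K L hL
  unfold phiRaw phiInt
  congr 1
  funext g
  have : reMap g '' (L : Set (Cn n)) = (fun y => reMap g x + y) '' (reMap g '' K) := by
    rw [hL, Set.image_image, Set.image_image]
    simp only [map_add]
  rw [this, Set.image_add_left, measure_preimage_add]

theorem homogeneous_phiRaw : Homogeneous n (phiRaw : ConvexBody (Cn n) → ℂ) := by
  intro t ht K L hL
  unfold phiRaw phiInt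
  rw [← integral_const_mul]
  congr 1
  funext g
  have : reMap g '' (L : Set (Cn n)) = t • (reMap g '' K) := by
    rw [hL, Set.image_image, ← Set.image_smul, Set.image_image]
    simp only [map_smul]
  rw [this, Measure.addHaar_smul, ENNReal.toReal_mul, Module.finrank_fin_fun,
    ENNReal.toReal_ofReal (abs_nonneg _), abs_of_nonneg (by positivity)]
  push_cast
  ring

theorem integral_gaussFrame_isometry (e : Cn n ≃ₗᵢ[ℝ] Cn n) (f : (Fin n → Cn n) → ℂ) :
    ∫ g, f (fun j => e (g j)) ∂gaussFrame n = ∫ g, f g ∂gaussFrame n := by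
  have hp : MeasurePreserving (MeasurableEquiv.piCongrRight fun _ : Fin n =>
      e.toHomeomorph.toMeasurableEquiv) (gaussFrame n) (gaussFrame n) :=
    measurePreserving_pi _ _ fun _ => ⟨e.continuous.measurable, stdGaussian_map e⟩
  exact hp.integral_comp' f

theorem inner_unitary {g : Matrix (Fin n) (Fin n) ℂ} (hg : g ∈ Matrix.unitaryGroup (Fin n) ℂ)
    (x y : Cn n) :
    inner ℂ (Matrix.toEuclideanLin g x) (Matrix.toEuclideanLin g y) = inner ℂ x y := by
  rw [← LinearMap.adjoint_inner_right, ← Matrix.toEuclideanLin_conjTranspose_eq_adjoint,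
    ← LinearMap.comp_apply, ← Matrix.toLpLin_mul_same]
  rw [show g.conjTranspose * g = 1 from Matrix.mem_unitaryGroup_iff'.mp hg]
  simp

/-- A unitary matrix as a real linear isometry. -/
def unitaryIso {g : Matrix (Fin n) (Fin n) ℂ} (hg : g ∈ Matrix.unitaryGroup (Fin n) ℂ) :
    Cn n ≃ₗᵢ[ℝ] Cn n :=
  LinearIsometry.toLinearIsometryEquiv
    (((Matrix.toEuclideanLin g).restrictScalars ℝ).isometryOfInner fun x y => by
      rw [real_inner_cn, real_inner_cn]
      exact congrArg Complex.re (inner_unitary hg x y)) rfl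

theorem unitaryIso_apply {g : Matrix (Fin n) (Fin n) ℂ} (hg : g ∈ Matrix.unitaryGroup (Fin n) ℂ)
    (x : Cn n) : unitaryIso hg x = Matrix.toEuclideanLin g x := rfl

theorem detC_toEuclideanLin (g : Matrix (Fin n) (Fin n) ℂ) (w : Fin n → Cn n) :
    detC (fun j => Matrix.toEuclideanLin g (w j)) = g.det * detC w := by
  rw [detC, detC, ← Matrix.det_mul]
  congr 1

theorem hasWeight_phiRaw : HasWeight 2 (phiRaw : ConvexBody (Cn n) → ℂ) := by
  intro u hu K L hL
  unfold phiRaw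
  rw [← integral_gaussFrame_isometry (unitaryIso hu), ← integral_const_mul]
  congr 1
  funext g
  have h1 : reMap (fun j => unitaryIso hu (g j)) '' (L : Set (Cn n)) = reMap g '' K := by
    rw [hL, Set.image_image]
    refine Set.image_congr fun z _ => ?_
    funext j
    rw [reMap_apply, reMap_apply, ← unitaryIso_apply hu, LinearIsometryEquiv.inner_map_map]
  rw [phiInt, h1, phiInt]
  simp only [unitaryIso_apply, detC_toEuclideanLin]
  rw [zpow_ofNat]
  ring

end gauss

section moments
open ProbabilityTheory
variable {n m : ℕ}

/-- Real Euclidean space. -/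
abbrev Rn (n : ℕ) := EuclideanSpace ℝ (Fin n)

theorem measurePreserving_ofLp_stdGaussian :
    MeasurePreserving (WithLp.ofLp : Rn n → Fin n → ℝ) (stdGaussian (Rn n))
      (Measure.pi fun _ => gaussianReal 0 1) :=
  MeasurePreserving.symm (MeasurableEquiv.toLp 2 (Fin n → ℝ))
    ⟨(MeasurableEquiv.toLp 2 (Fin n → ℝ)).measurable, map_pi_eq_stdGaussian⟩

/-- The vector with coordinates `x` and `y` in a basis indexed by two copies of `Fin n`. -/
def pairSum (b : Fin n ⊕ Fin n → Cn n) (x y : Rn n) : Cn n :=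
  (∑ k, x k • b (Sum.inl k)) + ∑ k, y k • b (Sum.inr k)

theorem measurePreserving_pairSum (b : OrthonormalBasis (Fin n ⊕ Fin n) ℝ (Cn n)) :
    MeasurePreserving (fun p : Rn n × Rn n => pairSum b p.1 p.2)
      ((stdGaussian (Rn n)).prod (stdGaussian (Rn n))) (stdGaussian (Cn n)) := by
  have h1 := (measurePreserving_ofLp_stdGaussian (n := n)).prod
    (measurePreserving_ofLp_stdGaussian (n := n))
  have h2 := measurePreserving_sumPiEquivProdPi_symm
    (fun _ : Fin n ⊕ Fin n => gaussianReal 0 1)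
  have h3 : MeasurePreserving (fun x : Fin n ⊕ Fin n → ℝ => ∑ i, x i • b i)
      (Measure.pi fun _ => gaussianReal 0 1) (stdGaussian (Cn n)) :=
    ⟨(Continuous.measurable (by fun_prop)), (stdGaussian_eq_map_pi_orthonormalBasis b).symm⟩
  have h4 := h3.comp (h2.comp h1)
  convert h4 using 1
  funext p
  simp only [Function.comp_apply, Fintype.sum_sum_type, pairSum]
  rfl

theorem measurePreserving_pairSum_pi (b : OrthonormalBasis (Fin n ⊕ Fin n) ℝ (Cn n)) :
    MeasurePreserving (fun (p : (Fin n → Rn n) × (Fin n → Rn n)) j => pairSum b (p.1 j) (p.2 j))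
      ((Measure.pi fun _ => stdGaussian (Rn n)).prod (Measure.pi fun _ => stdGaussian (Rn n)))
      (gaussFrame n) := by
  have h1 := (measurePreserving_arrowProdEquivProdArrow (Rn n) (Rn n) (Fin n)
    (fun _ => stdGaussian (Rn n)) (fun _ => stdGaussian (Rn n))).symm
  have h2 : MeasurePreserving (fun (p : Fin n → Rn n × Rn n) j => pairSum b (p j).1 (p j).2)
      (Measure.pi fun _ => (stdGaussian (Rn n)).prod (stdGaussian (Rn n))) (gaussFrame n) :=
    measurePreserving_pi _ _ fun _ => measurePreserving_pairSum b
  have h3 := h2.comp h1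
  exact h3

theorem integrable_coord (k : Fin m) : Integrable (fun y : Rn m => y k) (stdGaussian (Rn m)) :=
  ((EuclideanSpace.proj k : Rn m →L[ℝ] ℝ).integrable_comp IsGaussian.integrable_id)

theorem integral_coord (k : Fin m) : ∫ y : Rn m, y k ∂stdGaussian (Rn m) = 0 :=
  integral_strongDual_stdGaussian (EuclideanSpace.proj k : Rn m →L[ℝ] ℝ)

theorem integrable_coord_mul (k l : Fin m) :
    Integrable (fun y : Rn m => y k * y l) (stdGaussian (Rn m)) :=
  MemLp.integrable_mul (IsGaussian.memLp_dual _ (EuclideanSpace.proj k : Rn m →L[ℝ] ℝ) 2 (by simp))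
    (IsGaussian.memLp_dual _ (EuclideanSpace.proj l : Rn m →L[ℝ] ℝ) 2 (by simp))

theorem integral_coord_mul (k l : Fin m) :
    ∫ y : Rn m, y k * y l ∂stdGaussian (Rn m) = if k = l then 1 else 0 := by
  have h := covarianceBilin_apply (μ := stdGaussian (Rn m)) IsGaussian.memLp_two_id
    (EuclideanSpace.single k (1 : ℝ)) (EuclideanSpace.single l (1 : ℝ))
  rw [covarianceBilin_stdGaussian, show innerSL ℝ (EuclideanSpace.single k (1 : ℝ) : Rn m)
    (EuclideanSpace.single l (1 : ℝ)) = inner ℝ (EuclideanSpace.single k (1 : ℝ) : Rn m)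
      (EuclideanSpace.single l (1 : ℝ)) from rfl] at h
  simp only [id_eq, integral_id_stdGaussian, sub_zero, EuclideanSpace.inner_single_left,
    map_one, one_mul] at h
  rw [← h, EuclideanSpace.single, PiLp.single_apply]

theorem integrable_ofReal_coord_mul (k l : Fin m) :
    Integrable (fun y : Rn m => ((y k : ℂ) * (y l : ℂ))) (stdGaussian (Rn m)) := by
  have := (integrable_coord_mul k l).ofReal (𝕜 := ℂ)
  simpa using this

theorem quad_expand (α β : ℂ) (a b : Fin m → ℂ) (y : Rn m) :
    (α + ∑ k, (y k : ℂ) * a k) * (β + ∑ k, (y k : ℂ) * b k) =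
      (α * β + ∑ k, (y k : ℂ) * (α * b k + a k * β)) +
        ∑ k, ∑ l, ((y k : ℂ) * (y l : ℂ)) * (a k * b l) := by
  have h1 : (∑ k, (y k : ℂ) * a k) * ∑ k, (y k : ℂ) * b k =
      ∑ k, ∑ l, ((y k : ℂ) * (y l : ℂ)) * (a k * b l) := by
    rw [Finset.sum_mul_sum]
    exact Finset.sum_congr rfl fun k _ => Finset.sum_congr rfl fun l _ => by ring
  have h2 : ∑ k, (y k : ℂ) * (α * b k + a k * β) =
      α * ∑ k, (y k : ℂ) * b k + (∑ k, (y k : ℂ) * a k) * β := by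
    rw [Finset.mul_sum, Finset.sum_mul, ← Finset.sum_add_distrib]
    exact Finset.sum_congr rfl fun k _ => by ring
  rw [← h1, h2]
  ring

theorem integrable_quad_lin (α : ℂ) (c : Fin m → ℂ) :
    Integrable (fun y : Rn m => α + ∑ k, (y k : ℂ) * c k) (stdGaussian (Rn m)) :=
  (integrable_const _).add (integrable_finsetSum _ fun k _ =>
    ((integrable_coord k).ofReal (𝕜 := ℂ)).mul_const _)

theorem integrable_quad_sq (c : Fin m → Fin m → ℂ) :
    Integrable (fun y : Rn m => ∑ k, ∑ l, ((y k : ℂ) * (y l : ℂ)) * c k l)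
      (stdGaussian (Rn m)) :=
  integrable_finsetSum _ fun k _ => integrable_finsetSum _ fun l _ =>
    (integrable_ofReal_coord_mul k l).mul_const _

theorem integrable_quad (α β : ℂ) (a b : Fin m → ℂ) :
    Integrable (fun y : Rn m => (α + ∑ k, (y k : ℂ) * a k) * (β + ∑ k, (y k : ℂ) * b k))
      (stdGaussian (Rn m)) := by
  simp only [quad_expand]
  exact (integrable_quad_lin _ _).add (integrable_quad_sq fun k l => a k * b l)

theorem integral_quad_lin (α : ℂ) (c : Fin m → ℂ) :
    ∫ y : Rn m, α + ∑ k, (y k : ℂ) * c k ∂stdGaussian (Rn m) = α := by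
  have hi : ∀ k, Integrable (fun y : Rn m => (y k : ℂ) * c k) (stdGaussian (Rn m)) := fun k =>
    ((integrable_coord k).ofReal (𝕜 := ℂ)).mul_const _
  have h1 : ∫ y : Rn m, ∑ k, (y k : ℂ) * c k ∂stdGaussian (Rn m) = 0 := by
    rw [integral_finsetSum _ fun k _ => hi k]
    refine Finset.sum_eq_zero fun k _ => ?_
    rw [integral_mul_const, integral_complex_ofReal, integral_coord, Complex.ofReal_zero, zero_mul]
  rw [integral_add (f := fun _ : Rn m => α) (g := fun y : Rn m => ∑ k, (y k : ℂ) * c k)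
    (integrable_const _) (integrable_finsetSum _ fun k _ => hi k), h1, integral_const,
    probReal_univ, one_smul, add_zero]

theorem integral_quad_sq (c : Fin m → Fin m → ℂ) :
    ∫ y : Rn m, ∑ k, ∑ l, ((y k : ℂ) * (y l : ℂ)) * c k l ∂stdGaussian (Rn m) =
      ∑ k, c k k := by
  have hi : ∀ k l, Integrable (fun y : Rn m => ((y k : ℂ) * (y l : ℂ)) * c k l)
      (stdGaussian (Rn m)) := fun k l => (integrable_ofReal_coord_mul k l).mul_const _
  have h2 : ∀ k l : Fin m, ∫ y : Rn m, (y k : ℂ) * (y l : ℂ) ∂stdGaussian (Rn m) =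
      if k = l then 1 else 0 := fun k l => by
    simp only [← Complex.ofReal_mul]
    rw [integral_complex_ofReal, integral_coord_mul]
    split_ifs <;> simp
  rw [integral_finsetSum _ fun k _ => integrable_finsetSum _ fun l _ => hi k l]
  refine Finset.sum_congr rfl fun k _ => ?_
  rw [integral_finsetSum _ fun l _ => hi k l]
  simp only [integral_mul_const, h2, ite_mul, one_mul, zero_mul, Finset.sum_ite_eq,
    Finset.mem_univ, if_true]

theorem integral_quad (α β : ℂ) (a b : Fin m → ℂ) :
    ∫ y : Rn m, (α + ∑ k, (y k : ℂ) * a k) * (β + ∑ k, (y k : ℂ) * b k) ∂stdGaussian (Rn m) =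
      α * β + ∑ k, a k * b k := by
  simp only [quad_expand]
  rw [integral_add (integrable_quad_lin _ _) (integrable_quad_sq fun k l => a k * b l),
    integral_quad_lin, integral_quad_sq fun k l => a k * b l]

theorem detC_sq (w : Fin n → Cn n) :
    detC w ^ 2 = ∑ σ : Equiv.Perm (Fin n), ∑ τ : Equiv.Perm (Fin n),
      (((Equiv.Perm.sign σ : ℤ) : ℂ) * ((Equiv.Perm.sign τ : ℤ) : ℂ)) *
        ∏ j, (w j (σ j) * w j (τ j)) := by
  rw [detC, Matrix.det_apply', sq, Finset.sum_mul_sum]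
  refine Finset.sum_congr rfl fun σ _ => Finset.sum_congr rfl fun τ _ => ?_
  rw [Finset.prod_mul_distrib]
  simp only [Matrix.of_apply]
  ring

/-- The Gaussian average of a squared determinant in terms of second moments. -/
theorem integral_detC_sq (a v : Fin n → Cn n) :
    ∫ y : Fin n → Rn n, detC (fun j => a j + ∑ k, y j k • v k) ^ 2
        ∂Measure.pi (fun _ => stdGaussian (Rn n)) =
      ∑ σ : Equiv.Perm (Fin n), ∑ τ : Equiv.Perm (Fin n),
        (((Equiv.Perm.sign σ : ℤ) : ℂ) * ((Equiv.Perm.sign τ : ℤ) : ℂ)) *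
          ∏ j, (a j (σ j) * a j (τ j) + ∑ k, v k (σ j) * v k (τ j)) := by
  have hc : ∀ (y : Fin n → Rn n) (j i : Fin n), (a j + ∑ k, y j k • v k) i =
      a j i + ∑ k, ((y j k : ℝ) : ℂ) * v k i := fun y j i => by
    rw [PiLp.add_apply, WithLp.ofLp_sum, Finset.sum_apply]
    simp
  simp only [detC_sq, hc]
  have hInt : ∀ σ τ : Equiv.Perm (Fin n), Integrable (fun y : Fin n → Rn n =>
      ∏ j, ((a j (σ j) + ∑ k, ((y j k : ℝ) : ℂ) * v k (σ j)) *
        (a j (τ j) + ∑ k, ((y j k : ℝ) : ℂ) * v k (τ j))))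
      (Measure.pi fun _ => stdGaussian (Rn n)) := fun σ τ =>
    Integrable.fintype_prod (f := fun j (x : Rn n) =>
      (a j (σ j) + ∑ k, ((x k : ℝ) : ℂ) * v k (σ j)) *
        (a j (τ j) + ∑ k, ((x k : ℝ) : ℂ) * v k (τ j))) fun j => integrable_quad _ _ _ _
  rw [integral_finsetSum _ fun σ _ => integrable_finsetSum _ fun τ _ => (hInt σ τ).const_mul _]
  refine Finset.sum_congr rfl fun σ _ => ?_
  rw [integral_finsetSum _ fun τ _ => (hInt σ τ).const_mul _]
  refine Finset.sum_congr rfl fun τ _ => ?_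
  rw [integral_const_mul]
  congr 1
  rw [integral_fintype_prod_eq_prod (fun j (x : Rn n) =>
      (a j (σ j) + ∑ k, ((x k : ℝ) : ℂ) * v k (σ j)) *
        (a j (τ j) + ∑ k, ((x k : ℝ) : ℂ) * v k (τ j)))]
  exact Finset.prod_congr rfl fun j _ => integral_quad _ _ _ _

theorem integral_detC_sq_congr (a : Fin n → Cn n) {v v' : Fin n → Cn n}
    (h : ∀ i l, ∑ k, v k i * v k l = ∑ k, v' k i * v' k l) :
    ∫ y : Fin n → Rn n, detC (fun j => a j + ∑ k, y j k • v k) ^ 2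
        ∂Measure.pi (fun _ => stdGaussian (Rn n)) =
      ∫ y : Fin n → Rn n, detC (fun j => a j + ∑ k, y j k • v' k) ^ 2
        ∂Measure.pi (fun _ => stdGaussian (Rn n)) := by
  rw [integral_detC_sq, integral_detC_sq]
  simp only [h]

end moments

section klainRed
open ProbabilityTheory
variable {n : ℕ}

theorem abs_det_le (M : Matrix (Fin n) (Fin n) ℝ) {c : Fin n → ℝ} (h : ∀ i j, |M i j| ≤ c j) :
    |M.det| ≤ n.factorial * ∏ j, c j := by
  rw [Matrix.det_apply, ← Real.norm_eq_abs]
  refine (norm_sum_le _ _).trans ?_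
  refine (Finset.sum_le_card_nsmul _ _ (∏ j, c j) fun σ _ => ?_).trans_eq ?_
  · rw [Units.smul_def, zsmul_eq_mul, norm_mul, norm_prod]
    have h1 : ‖((Equiv.Perm.sign σ : ℤ) : ℝ)‖ = 1 := by
      rcases Int.units_eq_one_or (Equiv.Perm.sign σ) with h | h <;> simp [h]
    rw [h1, one_mul]
    exact Finset.prod_le_prod (fun _ _ => norm_nonneg _) fun j _ => h _ j
  · rw [Finset.card_univ, Fintype.card_perm, Fintype.card_fin, nsmul_eq_mul]

/-- The real matrix of inner products of two families of vectors. -/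
def innerMat (w g : Fin n → Cn n) : Matrix (Fin n) (Fin n) ℝ :=
  Matrix.of fun i j => inner ℝ (w i) (g j)

/-- The integrand of the Klain function of `φ₂`. -/
def klainInt (w g : Fin n → Cn n) : ℂ := detC g ^ 2 * (|(innerMat w g).det| : ℝ)

/-- The standard basis of `ℂⁿ` as a complex space. -/
def stdFrame (n : ℕ) : Fin n → Cn n := fun k => EuclideanSpace.single k 1

/-- The normalizing constant of `φ₂`. -/
def cG (n : ℕ) : ℂ := ∫ g, klainInt (stdFrame n) g ∂gaussFrame n

theorem continuous_klainInt (w : Fin n → Cn n) : Continuous (klainInt w) := by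
  refine (continuous_detC.pow 2).mul (Complex.continuous_ofReal.comp (Continuous.abs ?_))
  refine Continuous.matrix_det (continuous_matrix fun i j => ?_)
  simp only [innerMat, Matrix.of_apply]
  fun_prop

theorem integrable_klainInt (w : Fin n → Cn n) (hw : ∀ k, ‖w k‖ ≤ 1) :
    Integrable (klainInt w) (gaussFrame n) := by
  refine ((integrable_prod_norm n 2).const_mul ((n.factorial : ℝ) ^ 3)).mono'
    (continuous_klainInt w).aestronglyMeasurable (Filter.Eventually.of_forall fun g => ?_)
  have h1 : |(innerMat w g).det| ≤ n.factorial * ∏ j, ‖g j‖ := abs_det_le _ fun i j => by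
    refine (abs_real_inner_le_norm (w i) (g j)).trans ?_
    exact mul_le_of_le_one_left (norm_nonneg _) (hw i)
  rw [klainInt, norm_mul, norm_pow, Complex.norm_real, Real.norm_eq_abs, abs_abs]
  calc ‖detC g‖ ^ 2 * |(innerMat w g).det|
      ≤ (n.factorial * ∏ j, ‖g j‖) ^ 2 * (n.factorial * ∏ j, ‖g j‖) := by
        gcongr
        exact norm_detC_le g
    _ = _ := by rw [Finset.prod_pow]; ring

theorem OrthonormalBasis.sum_coord_mul {ι : Type*} [Fintype ι]
    (b : OrthonormalBasis ι ℝ (Cn n)) (i l : Fin n) : ∑ s, b s i * b s l = 0 := by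
  have hc : ∀ (z : Cn n) (i : Fin n), z i =
      (inner ℝ (EuclideanSpace.single i (1 : ℂ) : Cn n) z : ℝ) +
        (inner ℝ (EuclideanSpace.single i Complex.I : Cn n) z : ℝ) * Complex.I := fun z i => by
    rw [real_inner_cn, real_inner_cn, EuclideanSpace.inner_single_left,
      EuclideanSpace.inner_single_left]
    apply Complex.ext <;> simp
  have hs : ∀ x y : Cn n, ∑ s, (inner ℝ x (b s) : ℝ) * (inner ℝ y (b s) : ℝ) = (inner ℝ x y : ℝ) := fun x y => by
    rw [← b.sum_inner_mul_inner x y]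
    exact Finset.sum_congr rfl fun s _ => by rw [real_inner_comm y]
  have he : ∀ s, b s i * b s l =
      ((inner ℝ (EuclideanSpace.single i (1 : ℂ) : Cn n) (b s) *
        inner ℝ (EuclideanSpace.single l (1 : ℂ) : Cn n) (b s) -
      inner ℝ (EuclideanSpace.single i Complex.I : Cn n) (b s) *
        inner ℝ (EuclideanSpace.single l Complex.I : Cn n) (b s) : ℝ) : ℂ) +
      ((inner ℝ (EuclideanSpace.single i (1 : ℂ) : Cn n) (b s) *
        inner ℝ (EuclideanSpace.single l Complex.I : Cn n) (b s) +
      inner ℝ (EuclideanSpace.single i Complex.I : Cn n) (b s) *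
        inner ℝ (EuclideanSpace.single l (1 : ℂ) : Cn n) (b s) : ℝ) : ℂ) * Complex.I := fun s => by
    rw [hc (b s) i, hc (b s) l]
    push_cast
    ring_nf
    rw [Complex.I_sq]
    ring
  simp only [he]
  rw [Finset.sum_add_distrib, ← Finset.sum_mul, ← Complex.ofReal_sum, ← Complex.ofReal_sum,
    Finset.sum_sub_distrib, Finset.sum_add_distrib, hs, hs, hs, hs]
  simp only [real_inner_cn, EuclideanSpace.inner_single_left, PiLp.single_apply,
    EuclideanSpace.single]
  by_cases h : i = l <;> simp [h]

theorem innerMat_pairSum (b : OrthonormalBasis (Fin n ⊕ Fin n) ℝ (Cn n))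
    (x y : Fin n → Rn n) :
    innerMat (fun k => b (Sum.inl k)) (fun j => pairSum b (x j) (y j)) =
      Matrix.of fun i j => x j i := by
  ext i j
  simp only [innerMat, Matrix.of_apply, pairSum, inner_add_right, inner_sum, inner_smul_right,
    b.inner_eq_ite]
  simp

theorem detC_comb (w : Fin n → Cn n) (x y : Fin n → Rn n) :
    detC (fun j => (∑ k, x j k • w k) + ∑ k, y j k • (Complex.I • w k)) =
      detC w * (Matrix.of fun i j => ((x j i : ℝ) : ℂ) + (y j i : ℝ) * Complex.I).det := by
  rw [detC, detC, ← Matrix.det_mul]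
  congr 1
  ext i j
  rw [Matrix.mul_apply, Matrix.of_apply, PiLp.add_apply, WithLp.ofLp_sum, WithLp.ofLp_sum,
    Finset.sum_apply, Finset.sum_apply, ← Finset.sum_add_distrib]
  refine Finset.sum_congr rfl fun k _ => ?_
  simp
  ring

theorem integral_klainInt_pair (b : OrthonormalBasis (Fin n ⊕ Fin n) ℝ (Cn n)) :
    ∫ g, klainInt (fun k => b (Sum.inl k)) g ∂gaussFrame n =
      detC (fun k => b (Sum.inl k)) ^ 2 *
        ∫ x : Fin n → Rn n, ((|(Matrix.of fun i j => x j i).det| : ℝ) : ℂ) *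
          ∫ y : Fin n → Rn n,
            (Matrix.of fun i j => ((x j i : ℝ) : ℂ) + (y j i : ℝ) * Complex.I).det ^ 2
          ∂Measure.pi (fun _ => stdGaussian (Rn n)) ∂Measure.pi (fun _ => stdGaussian (Rn n)) := by
  have hmp := measurePreserving_pairSum_pi b
  have hInt := integrable_klainInt (fun k => b (Sum.inl k)) fun k => by simp
  have h1 : Integrable (fun p : (Fin n → Rn n) × (Fin n → Rn n) =>
      klainInt (fun k => b (Sum.inl k)) fun j => pairSum b (p.1 j) (p.2 j)) _ :=
    hmp.integrable_comp_of_integrable hInt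
  rw [← hmp.map_eq, integral_map hmp.measurable.aemeasurable
    (continuous_klainInt _).aestronglyMeasurable, integral_prod _ h1, ← integral_const_mul]
  refine integral_congr_ae (Filter.Eventually.of_forall fun x => ?_)
  simp only [klainInt, innerMat_pairSum]
  rw [integral_mul_const, mul_left_comm, mul_comm]
  congr 1
  rw [← integral_const_mul]
  simp only [← mul_pow, ← detC_comb, pairSum]
  refine integral_detC_sq_congr (fun j => ∑ k, x j k • b (Sum.inl k)) fun i l => ?_
  have h := b.sum_coord_mul i l
  rw [Fintype.sum_sum_type] at h
  rw [← add_left_cancel_iff (a := ∑ k, b (Sum.inl k) i * b (Sum.inl k) l), h,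
    ← Finset.sum_add_distrib, eq_comm]
  refine Finset.sum_eq_zero fun k _ => ?_
  simp only [PiLp.smul_apply, smul_eq_mul]
  linear_combination (b (Sum.inl k) i * b (Sum.inl k) l) * Complex.I_mul_I

/-- An orthonormal family of `n` vectors extends to an orthonormal basis. -/
theorem exists_basis_inl {w : Fin n → Cn n} (hw : Orthonormal ℝ w) :
    ∃ b : OrthonormalBasis (Fin n ⊕ Fin n) ℝ (Cn n), ∀ k, b (Sum.inl k) = w k := by
  have hcard : Module.finrank ℝ (Cn n) = Fintype.card (Fin n ⊕ Fin n) := by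
    rw [← Module.finrank_mul_finrank ℝ ℂ (Cn n), Complex.finrank_real_complex,
      finrank_euclideanSpace_fin, Fintype.card_sum, Fintype.card_fin]
    ring
  let v : Fin n ⊕ Fin n → Cn n := Sum.elim w 0
  have hv : Orthonormal ℝ ((Set.range (Sum.inl : Fin n → Fin n ⊕ Fin n)).domRestrict v) := by
    have h := hw.comp (fun s : Set.range (Sum.inl : Fin n → Fin n ⊕ Fin n) => s.2.choose)
      fun s t hst => Subtype.ext (by
        rw [← s.2.choose_spec, ← t.2.choose_spec]; exact congrArg Sum.inl hst)
    convert h using 1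
    funext s
    rw [Set.domRestrict_apply, ← s.2.choose_spec]
    rfl
  obtain ⟨b, hb⟩ := hv.exists_orthonormalBasis_extension_of_card_eq hcard
  exact ⟨b, fun k => hb _ ⟨k, rfl⟩⟩

theorem orthonormal_stdFrame : Orthonormal ℝ (stdFrame n) := by
  rw [orthonormal_iff_ite]
  intro i j
  rw [real_inner_cn, stdFrame, stdFrame, EuclideanSpace.inner_single_left, EuclideanSpace.single,
    PiLp.single_apply]
  by_cases h : i = j <;> simp [h]

theorem detC_stdFrame : detC (stdFrame n) = 1 := by
  rw [detC, ← Matrix.det_one (n := Fin n)]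
  congr 1
  ext i j
  rw [Matrix.of_apply, stdFrame, EuclideanSpace.single, PiLp.single_apply, Matrix.one_apply]

theorem integral_klainInt {w : Fin n → Cn n} (hw : Orthonormal ℝ w) :
    ∫ g, klainInt w g ∂gaussFrame n = detC w ^ 2 * cG n := by
  obtain ⟨b, hb⟩ := exists_basis_inl hw
  obtain ⟨b', hb'⟩ := exists_basis_inl (orthonormal_stdFrame (n := n))
  have h1 := integral_klainInt_pair b
  have h2 := integral_klainInt_pair b'
  simp only [hb] at h1
  simp only [hb'] at h2
  rw [h1, cG, h2, show (fun k => stdFrame n k) = stdFrame n from rfl, detC_stdFrame]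
  ring

end klainRed

section klainPhi
open ProbabilityTheory
variable {n : ℕ}

/-- The isometric embedding `t ↦ ∑ tₖ wₖ` given by an orthonormal family. -/
def frameIso {w : Fin n → Cn n} (hw : Orthonormal ℝ w) : Rn n →ₗᵢ[ℝ] Cn n :=
  LinearMap.isometryOfInner
    { toFun := fun t : Rn n => ∑ k, t k • w k
      map_add' := fun s t => by simp [add_smul, Finset.sum_add_distrib]
      map_smul' := fun c t => by simp [mul_smul, Finset.smul_sum] } fun s t => by
    simp only [LinearMap.coe_mk, AddHom.coe_mk]
    rw [hw.inner_sum, PiLp.inner_apply]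
    exact Finset.sum_congr rfl fun k _ => mul_comm _ _

theorem frameIso_apply {w : Fin n → Cn n} (hw : Orthonormal ℝ w) (t : Rn n) :
    frameIso hw t = ∑ k, t k • w k := rfl

/-- The ratio of Lebesgue and Hausdorff measure. -/
def hausdorffRatio (n : ℕ) : NNReal :=
  Measure.addHaarScalarFactor (volume : Measure (Rn n)) μH[n]

theorem volume_rn (s : Set (Rn n)) : (volume s).toReal = hausdorffRatio n * (μH[n] s).toReal := by
  conv_lhs => rw [Measure.isAddLeftInvariant_eq_smul (volume : Measure (Rn n)) μH[n]]
  rw [Measure.smul_apply, ENNReal.smul_def, smul_eq_mul, ENNReal.toReal_mul]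
  rfl

theorem reMap_frameIso {w : Fin n → Cn n} (hw : Orthonormal ℝ w) (g : Fin n → Cn n) (t : Rn n) :
    reMap g (frameIso hw t) = Matrix.toLin' (innerMat w g).transpose t.ofLp := by
  funext j
  rw [reMap_apply, frameIso_apply, inner_sum, Matrix.toLin'_apply]
  simp only [Matrix.mulVec, dotProduct, Matrix.transpose_apply, innerMat, Matrix.of_apply]
  refine Finset.sum_congr rfl fun k _ => ?_
  rw [inner_smul_right, real_inner_comm, mul_comm]

theorem phiInt_eq {w : Fin n → Cn n} (hw : Orthonormal ℝ w) {K : ConvexBody (Cn n)}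
    (hK : (K : Set (Cn n)) ⊆ Submodule.span ℝ (Set.range w)) (g : Fin n → Cn n) :
    phiInt K g = klainInt w g * (hausdorffRatio n * (μH[n] (K : Set (Cn n))).toReal : ℝ) := by
  have himg : frameIso hw '' (frameIso hw ⁻¹' K) = K := by
    rw [Set.image_preimage_eq_iff]
    intro z hz
    obtain ⟨c, hc⟩ := (Submodule.mem_span_range_iff_exists_fun ℝ).mp (hK hz)
    exact ⟨WithLp.toLp 2 c, hc⟩
  have hcl : MeasurableSet (frameIso hw ⁻¹' (K : Set (Cn n))) :=
    (K.isClosed.preimage (frameIso hw).continuous).measurableSet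
  have h1 : μH[n] (K : Set (Cn n)) = μH[n] (frameIso hw ⁻¹' (K : Set (Cn n))) := by
    conv_lhs => rw [← himg]
    exact (frameIso hw).isometry.hausdorffMeasure_image (Or.inl (Nat.cast_nonneg n)) _
  have h2 : reMap g '' (K : Set (Cn n)) = Matrix.toLin' (innerMat w g).transpose ''
      (WithLp.toLp 2 ⁻¹' (frameIso hw ⁻¹' (K : Set (Cn n)))) := by
    conv_lhs => rw [← himg]
    ext v
    constructor
    · rintro ⟨_, ⟨t, ht, rfl⟩, rfl⟩
      exact ⟨t.ofLp, ht, (reMap_frameIso hw g t).symm⟩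
    · rintro ⟨t, ht, rfl⟩
      exact ⟨_, ⟨WithLp.toLp 2 t, ht, rfl⟩, reMap_frameIso hw g _⟩
  rw [phiInt, klainInt, h1, ← volume_rn, h2, Measure.addHaar_image_linearMap,
    LinearMap.det_toLin', Matrix.det_transpose,
    (PiLp.volume_preserving_toLp (Fin n)).measure_preimage hcl.nullMeasurableSet,
    ENNReal.toReal_mul, ENNReal.toReal_ofReal (abs_nonneg _)]
  push_cast
  ring

theorem phiRaw_klain {w : Fin n → Cn n} (hw : Orthonormal ℝ w) {K : ConvexBody (Cn n)}
    (hK : (K : Set (Cn n)) ⊆ Submodule.span ℝ (Set.range w)) :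
    phiRaw K = cG n * hausdorffRatio n *
      (detC w ^ 2 * ((μH[n] (K : Set (Cn n))).toReal : ℂ)) := by
  rw [phiRaw]
  simp only [phiInt_eq hw hK]
  rw [integral_mul_const, integral_klainInt hw]
  push_cast
  ring

end klainPhi

section recursion
open ProbabilityTheory
variable {n m : ℕ}

/-- The vector with real part `x` and imaginary part `y`. -/
def cplx (x y : Rn m) : Cn m := WithLp.toLp 2 fun i => (x i : ℂ) + (y i : ℂ) * Complex.I

theorem cplx_apply (x y : Rn m) (i : Fin m) : cplx x y i = (x i : ℂ) + (y i : ℂ) * Complex.I := rfl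

theorem measurePreserving_cplx :
    MeasurePreserving (fun p : Rn m × Rn m => cplx p.1 p.2)
      ((stdGaussian (Rn m)).prod (stdGaussian (Rn m))) (stdGaussian (Cn m)) := by
  have hcard : Module.finrank ℝ (Cn m) = Fintype.card (Fin m ⊕ Fin m) := by
    rw [← Module.finrank_mul_finrank ℝ ℂ (Cn m), Complex.finrank_real_complex,
      finrank_euclideanSpace_fin, Fintype.card_sum, Fintype.card_fin]
    ring
  let v : Fin m ⊕ Fin m → Cn m := Sum.elim (stdFrame m) fun k => Complex.I • stdFrame m k
  have hv : Orthonormal ℝ v := by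
    rw [orthonormal_iff_ite]
    rintro (i | i) (j | j) <;> by_cases h : i = j <;>
      simp [v, real_inner_cn, stdFrame, EuclideanSpace.inner_single_left, EuclideanSpace.single,
        norm_smul, h]
  have hv' : Orthonormal ℝ (Set.univ.domRestrict v) := hv.comp _ Subtype.val_injective
  obtain ⟨b, hb⟩ := hv'.exists_orthonormalBasis_extension_of_card_eq hcard
  have h := measurePreserving_pairSum b
  convert h using 1
  funext p
  refine PiLp.ext fun i => ?_
  rw [cplx_apply, pairSum, PiLp.add_apply, WithLp.ofLp_sum, WithLp.ofLp_sum, Finset.sum_apply,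
    Finset.sum_apply]
  simp only [hb _ (Set.mem_univ _), v, Sum.elim_inl, Sum.elim_inr]
  simp [stdFrame, EuclideanSpace.single, PiLp.single_apply]

/-- Forgetting the first coordinate. -/
def dropZero : Cn (n + 1) →L[ℝ] Cn n :=
  LinearMap.toContinuousLinearMap
    { toFun := fun z : Cn (n + 1) => WithLp.toLp 2 fun i => z i.succ
      map_add' := fun _ _ => rfl
      map_smul' := fun _ _ => rfl }

theorem dropZero_apply (z : Cn (n + 1)) (i : Fin n) : dropZero z i = z i.succ := rfl

theorem measurePreserving_dropZero :
    MeasurePreserving (dropZero : Cn (n + 1) → Cn n) (stdGaussian _) (stdGaussian _) := by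
  refine ⟨dropZero.continuous.measurable, ?_⟩
  have hp : IsProbabilityMeasure ((stdGaussian (Cn (n + 1))).map (dropZero : _ → Cn n)) :=
    Measure.isProbabilityMeasure_map dropZero.continuous.measurable.aemeasurable
  refine Measure.ext_of_charFun (funext fun t => ?_)
  let s : Cn (n + 1) := WithLp.toLp 2 (Fin.cons 0 t.ofLp)
  have hin : ∀ z : Cn (n + 1), inner ℝ (dropZero z) t = inner ℝ z s := fun z => by
    rw [real_inner_cn, real_inner_cn, PiLp.inner_apply, PiLp.inner_apply, Fin.sum_univ_succ]
    simp [s, dropZero_apply]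
  have hs : ‖s‖ = ‖t‖ := by
    rw [EuclideanSpace.norm_eq, EuclideanSpace.norm_eq, Fin.sum_univ_succ]
    simp [s]
  rw [charFun_stdGaussian, ← hs, ← charFun_stdGaussian, charFun_apply, charFun_apply,
    integral_map dropZero.continuous.measurable.aemeasurable
      (Continuous.aestronglyMeasurable (by fun_prop))]
  simp only [hin]

/-- A rotation matrix of a real isometry. -/
def isoMat (e : Rn m ≃ₗᵢ[ℝ] Rn m) : Matrix (Fin m) (Fin m) ℝ :=
  Matrix.of fun i j => e (EuclideanSpace.single j 1) i

theorem isoMat_mem (e : Rn m ≃ₗᵢ[ℝ] Rn m) : isoMat e ∈ Matrix.orthogonalGroup (Fin m) ℝ := by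
  have h := (EuclideanSpace.basisFun (Fin m) ℝ).toMatrix_orthonormalBasis_mem_unitary
    ((EuclideanSpace.basisFun (Fin m) ℝ).map e)
  convert h using 1
  ext i j
  simp [isoMat, Module.Basis.toMatrix_apply]

theorem isoMat_mulVec (e : Rn m ≃ₗᵢ[ℝ] Rn m) (x : Rn m) (i : Fin m) :
    e x i = ∑ j, isoMat e i j * x j := by
  have hx : x = ∑ j, x j • (EuclideanSpace.single j 1 : Rn m) := by
    have h := (EuclideanSpace.basisFun (Fin m) ℝ).sum_repr x
    simpa using h.symm
  conv_lhs => rw [hx]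
  rw [map_sum, WithLp.ofLp_sum, Finset.sum_apply]
  refine Finset.sum_congr rfl fun j _ => ?_
  rw [map_smul, PiLp.smul_apply, isoMat, Matrix.of_apply, smul_eq_mul, mul_comm]

theorem complexify_mem {Q : Matrix (Fin m) (Fin m) ℝ} (hQ : Q ∈ Matrix.orthogonalGroup (Fin m) ℝ) :
    Q.map (Complex.ofRealHom) ∈ Matrix.unitaryGroup (Fin m) ℂ := by
  rw [Matrix.mem_unitaryGroup_iff]
  have h1 : star (Q.map Complex.ofRealHom) = Q.transpose.map Complex.ofRealHom := by
    ext i j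
    simp [Matrix.star_apply]
  rw [h1, ← Matrix.map_mul, (Matrix.mem_orthogonalGroup_iff _ _).mp hQ]
  simp

theorem toEuclideanLin_cplx (e : Rn m ≃ₗᵢ[ℝ] Rn m) (x y : Rn m) :
    Matrix.toEuclideanLin ((isoMat e).map Complex.ofRealHom) (cplx x y) = cplx (e x) (e y) := by
  refine PiLp.ext fun i => ?_
  rw [cplx_apply, isoMat_mulVec, isoMat_mulVec, Matrix.toLpLin_apply]
  simp only [Matrix.mulVec, dotProduct, Matrix.map_apply, Complex.ofRealHom_eq_coe, cplx_apply]
  push_cast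
  rw [Finset.sum_mul, ← Finset.sum_add_distrib]
  exact Finset.sum_congr rfl fun j _ => by ring

theorem innerMat_stdFrame (g : Fin n → Cn n) :
    innerMat (stdFrame n) g = Matrix.of fun i j => (g j i).re := by
  ext i j
  rw [innerMat, Matrix.of_apply, Matrix.of_apply, stdFrame, real_inner_cn,
    EuclideanSpace.inner_single_left]
  simp

theorem klainInt_rotate {Q : Matrix (Fin n) (Fin n) ℝ} (hQ : Q ∈ Matrix.orthogonalGroup (Fin n) ℝ)
    (g : Fin n → Cn n) :
    klainInt (stdFrame n) (fun j => Matrix.toEuclideanLin (Q.map Complex.ofRealHom) (g j)) =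
      klainInt (stdFrame n) g := by
  have hdet : Q.det * Q.det = 1 := by
    have h := congrArg Matrix.det ((Matrix.mem_orthogonalGroup_iff _ _).mp hQ)
    rwa [Matrix.det_mul, Matrix.det_transpose, Matrix.det_one] at h
  have habs : |Q.det| = 1 := by
    have h := abs_mul Q.det Q.det
    rw [hdet, abs_one] at h
    nlinarith [abs_nonneg Q.det]
  have hmat : innerMat (stdFrame n)
      (fun j => Matrix.toEuclideanLin (Q.map Complex.ofRealHom) (g j)) =
      Q * innerMat (stdFrame n) g := by
    rw [innerMat_stdFrame, innerMat_stdFrame]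
    ext i j
    rw [Matrix.of_apply, Matrix.toLpLin_apply, Matrix.mul_apply]
    simp [Matrix.mulVec, dotProduct]
  have hd : (Q.map Complex.ofRealHom).det = (Q.det : ℂ) :=
    (RingHom.map_det Complex.ofRealHom Q).symm
  have hdet' : (Q.det : ℂ) * Q.det = 1 := by exact_mod_cast hdet
  rw [klainInt, klainInt, detC_toEuclideanLin, hmat, Matrix.det_mul, abs_mul, habs, one_mul,
    mul_pow, hd, sq (Q.det : ℂ), hdet', one_mul]

end recursion

section splitting
open ProbabilityTheory
variable {n : ℕ}

/-- `n` independent standard Gaussian vectors of `ℂⁿ⁺¹`. -/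
abbrev gaussRest (n : ℕ) : Measure (Fin n → Cn (n + 1)) :=
  Measure.pi fun _ => stdGaussian (Cn (n + 1))

theorem measurePreserving_consFrame :
    MeasurePreserving
      (fun p : Cn (n + 1) × (Fin n → Cn (n + 1)) => (Fin.cons p.1 p.2 : Fin (n + 1) → Cn (n + 1)))
      ((stdGaussian (Cn (n + 1))).prod (gaussRest n)) (gaussFrame (n + 1)) := by
  have h := (measurePreserving_piFinSuccAbove (α := fun _ => Cn (n + 1))
    (fun _ : Fin (n + 1) => stdGaussian (Cn (n + 1))) 0).symm
  convert h using 1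
  funext p
  exact (Fin.insertNth_zero' p.1 p.2).symm

theorem integral_gaussRest_isometry (e : Cn (n + 1) ≃ₗᵢ[ℝ] Cn (n + 1))
    (f : (Fin n → Cn (n + 1)) → ℂ) :
    ∫ g, f (fun j => e (g j)) ∂gaussRest n = ∫ g, f g ∂gaussRest n := by
  have hp : MeasurePreserving (MeasurableEquiv.piCongrRight fun _ : Fin n =>
      e.toHomeomorph.toMeasurableEquiv) (gaussRest n) (gaussRest n) :=
    measurePreserving_pi _ _ fun _ => ⟨e.continuous.measurable, stdGaussian_map e⟩
  exact hp.integral_comp' f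

theorem norm_klainInt_le (g : Fin n → Cn n) :
    ‖klainInt (stdFrame n) g‖ ≤ n.factorial ^ 3 * ∏ j, ‖g j‖ ^ 3 := by
  have h1 : |(innerMat (stdFrame n) g).det| ≤ n.factorial * ∏ j, ‖g j‖ := abs_det_le _ fun i j => by
    refine (abs_real_inner_le_norm (stdFrame n i) (g j)).trans ?_
    rw [orthonormal_stdFrame.1 i, one_mul]
  rw [klainInt, norm_mul, norm_pow, Complex.norm_real, Real.norm_eq_abs, abs_abs]
  calc ‖detC g‖ ^ 2 * |(innerMat (stdFrame n) g).det|
      ≤ (n.factorial * ∏ j, ‖g j‖) ^ 2 * (n.factorial * ∏ j, ‖g j‖) := by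
        gcongr
        exact norm_detC_le g
    _ = _ := by rw [Finset.prod_pow]; ring

theorem continuous_consFrame (z : Cn (n + 1)) :
    Continuous fun g : Fin n → Cn (n + 1) => (Fin.cons z g : Fin (n + 1) → Cn (n + 1)) := by
  refine continuous_pi fun j => ?_
  refine Fin.cases ?_ (fun j => ?_) j
  · simp only [Fin.cons_zero]
    fun_prop
  · simp only [Fin.cons_succ]
    fun_prop

theorem integrable_klainInt_cons (z : Cn (n + 1)) :
    Integrable (fun g => klainInt (stdFrame (n + 1)) (Fin.cons z g)) (gaussRest n) := by
  have h : Integrable (fun g : Fin n → Cn (n + 1) => ∏ j, ‖g j‖ ^ 3) (gaussRest n) :=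
    Integrable.fintype_prod (f := fun _ (x : Cn (n + 1)) => ‖x‖ ^ 3) fun _ =>
      (IsGaussian.memLp_id (stdGaussian (Cn (n + 1))) ((3 : ℕ) : ℝ≥0∞)
        (ENNReal.natCast_ne_top _)).integrable_norm_pow (by omega)
  refine (h.const_mul ((n + 1).factorial ^ 3 * ‖z‖ ^ 3)).mono'
    ((continuous_klainInt _).comp (continuous_consFrame z)).aestronglyMeasurable
    (Filter.Eventually.of_forall fun g => (norm_klainInt_le _).trans_eq ?_)
  rw [Fin.prod_univ_succ]
  simp only [Fin.cons_zero, Fin.cons_succ]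
  ring

/-- The part of the Laplace expansion along the first column which omits the first entry. -/
def laplaceRest (z : Cn (n + 1)) (g : Fin n → Cn (n + 1)) : ℂ :=
  ∑ i : Fin n, (-1) ^ ((i : ℕ) + 1) * z i.succ *
    (Matrix.of fun a b => g b (i.succ.succAbove a)).det

theorem detC_cons (z : Cn (n + 1)) (g : Fin n → Cn (n + 1)) :
    detC (Fin.cons z g) = z 0 * detC (fun j => dropZero (g j)) + laplaceRest z g := by
  rw [detC, Matrix.det_succ_column_zero, Fin.sum_univ_succ, laplaceRest]
  simp only [Matrix.of_apply, Fin.cons_zero, Fin.val_zero, pow_zero, one_mul, Fin.val_succ]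
  rfl

theorem det_innerMat_cons {z : Cn (n + 1)} (hz : ∀ i : Fin n, (z i.succ).re = 0)
    (g : Fin n → Cn (n + 1)) :
    (innerMat (stdFrame (n + 1)) (Fin.cons z g)).det =
      (z 0).re * (innerMat (stdFrame n) (fun j => dropZero (g j))).det := by
  rw [innerMat_stdFrame, innerMat_stdFrame, Matrix.det_succ_column_zero, Fin.sum_univ_succ]
  simp only [Matrix.of_apply, Fin.cons_zero, Fin.val_zero, pow_zero, one_mul, hz, mul_zero,
    zero_mul, Finset.sum_const_zero, add_zero]
  rfl

/-- The matrix multiplying the first coordinate by `c`. -/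
def diagFirst (n : ℕ) (c : ℂ) : Matrix (Fin (n + 1)) (Fin (n + 1)) ℂ :=
  Matrix.diagonal (Fin.cons c fun _ => 1)

theorem diagFirst_mem {c : ℂ} (hc : c * star c = 1) :
    diagFirst n c ∈ Matrix.unitaryGroup (Fin (n + 1)) ℂ := by
  rw [Matrix.mem_unitaryGroup_iff, Matrix.star_eq_conjTranspose, diagFirst,
    Matrix.diagonal_conjTranspose, Matrix.diagonal_mul_diagonal, ← Matrix.diagonal_one]
  congr 1
  funext i
  refine Fin.cases ?_ (fun i => ?_) i
  · simpa using hc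
  · simp

theorem diagFirst_apply (c : ℂ) (z : Cn (n + 1)) (i : Fin (n + 1)) :
    Matrix.toEuclideanLin (diagFirst n c) z i =
      (Fin.cons c (fun _ => 1) : Fin (n + 1) → ℂ) i * z i := by
  rw [Matrix.toLpLin_apply, diagFirst]
  exact Matrix.mulVec_diagonal (Fin.cons c fun _ => 1) z.ofLp i

theorem dropZero_diagFirst (c : ℂ) (z : Cn (n + 1)) :
    dropZero (Matrix.toEuclideanLin (diagFirst n c) z) = dropZero z := by
  refine PiLp.ext fun i => ?_
  rw [dropZero_apply, diagFirst_apply, dropZero_apply, Fin.cons_succ, one_mul]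

theorem laplaceRest_diagFirst (c : ℂ) (z : Cn (n + 1)) (g : Fin n → Cn (n + 1)) :
    laplaceRest z (fun j => Matrix.toEuclideanLin (diagFirst n c) (g j)) =
      c * laplaceRest z g := by
  rw [laplaceRest, laplaceRest, Finset.mul_sum]
  refine Finset.sum_congr rfl fun i _ => ?_
  simp only [diagFirst_apply]
  have h := Fin.prod_univ_succAbove (Fin.cons c (fun _ => 1) : Fin (n + 1) → ℂ) i.succ
  rw [Fin.prod_univ_succ] at h
  simp only [Fin.cons_zero, Fin.cons_succ, Finset.prod_const_one, mul_one, one_mul] at h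
  have h2 := Matrix.det_mul_column
    (fun a => (Fin.cons c (fun _ => 1) : Fin (n + 1) → ℂ) (i.succ.succAbove a))
    (Matrix.of fun a b => g b (i.succ.succAbove a))
  simp only [Matrix.of_apply] at h2
  rw [h2, ← h]
  ring

theorem integral_klainInt_dropZero :
    ∫ g, klainInt (stdFrame n) (fun j => dropZero (g j)) ∂gaussRest n = cG n := by
  have hp : MeasurePreserving (fun (g : Fin n → Cn (n + 1)) j => dropZero (g j))
      (gaussRest n) (gaussFrame n) := measurePreserving_pi _ _ fun _ => measurePreserving_dropZero
  rw [cG, ← hp.map_eq, integral_map hp.measurable.aemeasurable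
    (continuous_klainInt _).aestronglyMeasurable]

theorem integral_klainInt_cons {z : Cn (n + 1)} (hz : ∀ i : Fin n, (z i.succ).re = 0) :
    ∫ g, klainInt (stdFrame (n + 1)) (Fin.cons z g) ∂gaussRest n =
      z 0 ^ 2 * (|(z 0).re| : ℝ) * cG n := by
  have hf : ∀ c : ℂ, ∀ g : Fin n → Cn (n + 1), klainInt (stdFrame (n + 1))
      (Fin.cons z fun j => Matrix.toEuclideanLin (diagFirst n c) (g j)) =
      (z 0 * detC (fun j => dropZero (g j)) + c * laplaceRest z g) ^ 2 *
        (|(z 0).re * (innerMat (stdFrame n) (fun j => dropZero (g j))).det| : ℝ) := fun c g => by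
    rw [klainInt, detC_cons, det_innerMat_cons hz, laplaceRest_diagFirst]
    simp only [dropZero_diagFirst]
  have hi : ∀ c : ℂ, c * star c = 1 → (Integrable (fun g => klainInt (stdFrame (n + 1))
      (Fin.cons z fun j => Matrix.toEuclideanLin (diagFirst n c) (g j))) (gaussRest n) ∧
      ∫ g, klainInt (stdFrame (n + 1))
        (Fin.cons z fun j => Matrix.toEuclideanLin (diagFirst n c) (g j)) ∂gaussRest n =
      ∫ g, klainInt (stdFrame (n + 1)) (Fin.cons z g) ∂gaussRest n) := fun c hc => by
    have hp : MeasurePreserving (fun (g : Fin n → Cn (n + 1)) j => unitaryIso (diagFirst_mem hc) (g j))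
        (gaussRest n) (gaussRest n) :=
      measurePreserving_pi _ _ fun _ =>
        ⟨(unitaryIso (diagFirst_mem hc)).continuous.measurable, stdGaussian_map _⟩
    exact ⟨hp.integrable_comp_of_integrable (integrable_klainInt_cons z),
      integral_gaussRest_isometry (unitaryIso (diagFirst_mem hc))
        fun g => klainInt (stdFrame (n + 1)) (Fin.cons z g)⟩
  obtain ⟨i1, e1⟩ := hi 1 (by simp)
  obtain ⟨i2, e2⟩ := hi (-1) (by simp)
  obtain ⟨i3, e3⟩ := hi Complex.I (by simp)
  obtain ⟨i4, e4⟩ := hi (-Complex.I) (by simp)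
  have hs := integral_add (i1.add i2) (i3.add i4)
  have hs1 := integral_add i1 i2
  have hs2 := integral_add i3 i4
  simp only [Pi.add_apply] at hs
  rw [hs1, hs2, e1, e2, e3, e4] at hs
  have hsum : ∀ g : Fin n → Cn (n + 1),
      klainInt (stdFrame (n + 1))
        (Fin.cons z fun j => Matrix.toEuclideanLin (diagFirst n 1) (g j)) +
      klainInt (stdFrame (n + 1))
        (Fin.cons z fun j => Matrix.toEuclideanLin (diagFirst n (-1)) (g j)) +
      (klainInt (stdFrame (n + 1))
        (Fin.cons z fun j => Matrix.toEuclideanLin (diagFirst n Complex.I) (g j)) +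
      klainInt (stdFrame (n + 1))
        (Fin.cons z fun j => Matrix.toEuclideanLin (diagFirst n (-Complex.I)) (g j))) =
      4 * (z 0 ^ 2 * (|(z 0).re| : ℝ)) *
        klainInt (stdFrame n) (fun j => dropZero (g j)) := fun g => by
    simp only [hf, abs_mul]
    rw [klainInt]
    push_cast
    linear_combination (2 * laplaceRest z g ^ 2 * ((|(z 0).re| : ℝ) : ℂ) *
      ((|(innerMat (stdFrame n) (fun j => dropZero (g j))).det| : ℝ) : ℂ)) * Complex.I_sq
  simp only [hsum] at hs
  rw [integral_const_mul, integral_klainInt_dropZero] at hs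
  linear_combination -hs / 4

end splitting

section nonvanishing
open ProbabilityTheory
variable {n : ℕ}

theorem cons_unitaryIso (e : Rn (n + 1) ≃ₗᵢ[ℝ] Rn (n + 1)) (x y : Rn (n + 1))
    (g : Fin n → Cn (n + 1)) :
    (Fin.cons (cplx (e x) (e y))
        (fun j => unitaryIso (complexify_mem (isoMat_mem e)) (g j)) : Fin (n + 1) → Cn (n + 1)) =
      fun j => Matrix.toEuclideanLin ((isoMat e).map Complex.ofRealHom)
        ((Fin.cons (cplx x y) g : Fin (n + 1) → Cn (n + 1)) j) := by
  funext j
  refine Fin.cases ?_ (fun j => ?_) j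
  · simp only [Fin.cons_zero, toEuclideanLin_cplx]
  · simp only [Fin.cons_succ, unitaryIso_apply]

theorem integral_klainInt_cons_rotate (e : Rn (n + 1) ≃ₗᵢ[ℝ] Rn (n + 1)) (x y : Rn (n + 1)) :
    ∫ g, klainInt (stdFrame (n + 1)) (Fin.cons (cplx (e x) (e y)) g) ∂gaussRest n =
      ∫ g, klainInt (stdFrame (n + 1)) (Fin.cons (cplx x y) g) ∂gaussRest n := by
  have h := integral_gaussRest_isometry (unitaryIso (complexify_mem (isoMat_mem e)))
    fun g => klainInt (stdFrame (n + 1)) (Fin.cons (cplx (e x) (e y)) g)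
  simp only [cons_unitaryIso, klainInt_rotate (isoMat_mem e)] at h
  exact h.symm

theorem integral_cplx_single {r : ℝ} (hr : 0 ≤ r) :
    ∫ y, ∫ g, klainInt (stdFrame (n + 1)) (Fin.cons (cplx (EuclideanSpace.single 0 r) y) g)
      ∂gaussRest n ∂stdGaussian (Rn (n + 1)) = ((r ^ 3 - r : ℝ) : ℂ) * cG n := by
  have h0 : ∀ y : Rn (n + 1), cplx (EuclideanSpace.single 0 r) y 0 =
      (r : ℂ) + (y 0 : ℂ) * Complex.I := fun y => by
    rw [cplx_apply]; simp
  have h1 : ∀ y : Rn (n + 1), ∫ g, klainInt (stdFrame (n + 1))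
      (Fin.cons (cplx (EuclideanSpace.single 0 r) y) g) ∂gaussRest n =
      ((r : ℂ) + ∑ k, (y k : ℂ) * (Pi.single 0 Complex.I : Fin (n + 1) → ℂ) k) *
        ((r : ℂ) + ∑ k, (y k : ℂ) * (Pi.single 0 Complex.I : Fin (n + 1) → ℂ) k) *
          ((r : ℂ) * cG n) := fun y => by
    rw [integral_klainInt_cons fun i => by rw [cplx_apply]; simp, h0]
    have h2 : ∑ k, (y k : ℂ) * (Pi.single 0 Complex.I : Fin (n + 1) → ℂ) k =
        (y 0 : ℂ) * Complex.I := by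
      rw [Finset.sum_eq_single 0 (fun k _ hk => by simp [hk]) (by simp)]
      simp
    have h3 : ((r : ℂ) + (y 0 : ℂ) * Complex.I).re = r := by simp
    rw [h2, h3, abs_of_nonneg hr]
    ring
  simp only [h1]
  rw [integral_mul_const, integral_quad, Finset.sum_eq_single 0 (fun k _ hk => by simp [hk])
    (by simp), Pi.single_eq_same, Complex.I_mul_I]
  push_cast
  ring

theorem integral_cplx (x : Rn (n + 1)) :
    ∫ y, ∫ g, klainInt (stdFrame (n + 1)) (Fin.cons (cplx x y) g)
      ∂gaussRest n ∂stdGaussian (Rn (n + 1)) = ((‖x‖ ^ 3 - ‖x‖ : ℝ) : ℂ) * cG n := by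
  rw [← integral_cplx_single (norm_nonneg x)]
  have hn : ‖x‖ = ‖(EuclideanSpace.single 0 ‖x‖ : Rn (n + 1))‖ := by simp
  let e : Rn (n + 1) ≃ₗᵢ[ℝ] Rn (n + 1) :=
    (ℝ ∙ (x - EuclideanSpace.single 0 ‖x‖))ᗮ.reflection
  have he : e x = EuclideanSpace.single 0 ‖x‖ := Submodule.reflection_sub hn
  have hp : MeasurePreserving e.toHomeomorph.toMeasurableEquiv (stdGaussian (Rn (n + 1)))
      (stdGaussian (Rn (n + 1))) := ⟨e.continuous.measurable, stdGaussian_map e⟩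
  rw [← he]
  refine Eq.trans ?_ (hp.integral_comp' fun y =>
    ∫ g, klainInt (stdFrame (n + 1)) (Fin.cons (cplx (e x) y) g) ∂gaussRest n)
  refine integral_congr_ae (Filter.Eventually.of_forall fun y => ?_)
  exact (integral_klainInt_cons_rotate e x y).symm

theorem cG_succ : cG (n + 1) =
    ((∫ x : Rn (n + 1), (‖x‖ ^ 3 - ‖x‖) ∂stdGaussian (Rn (n + 1)) : ℝ) : ℂ) * cG n := by
  have hc := measurePreserving_consFrame (n := n)
  have hInt := integrable_klainInt (stdFrame (n + 1)) fun k => (orthonormal_stdFrame.1 k).le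
  have h1 : Integrable (fun p : Cn (n + 1) × (Fin n → Cn (n + 1)) =>
      klainInt (stdFrame (n + 1)) (Fin.cons p.1 p.2)) _ := hc.integrable_comp_of_integrable hInt
  have h2 : Integrable (fun z : Cn (n + 1) =>
      ∫ g, klainInt (stdFrame (n + 1)) (Fin.cons z g) ∂gaussRest n) (stdGaussian (Cn (n + 1))) :=
    h1.integral_prod_left
  have hm := measurePreserving_cplx (m := n + 1)
  have h3 : Integrable (fun p : Rn (n + 1) × Rn (n + 1) =>
      ∫ g, klainInt (stdFrame (n + 1)) (Fin.cons (cplx p.1 p.2) g) ∂gaussRest n) _ :=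
    hm.integrable_comp_of_integrable h2
  have e1 : cG (n + 1) = ∫ z, ∫ g, klainInt (stdFrame (n + 1)) (Fin.cons z g) ∂gaussRest n
      ∂stdGaussian (Cn (n + 1)) := by
    rw [cG, ← hc.map_eq, integral_map hc.measurable.aemeasurable
      (continuous_klainInt _).aestronglyMeasurable, integral_prod _ h1]
  have hs : AEStronglyMeasurable (fun z : Cn (n + 1) =>
      ∫ g, klainInt (stdFrame (n + 1)) (Fin.cons z g) ∂gaussRest n)
      (((stdGaussian (Rn (n + 1))).prod (stdGaussian (Rn (n + 1)))).map
        fun p => cplx p.1 p.2) := by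
    rw [hm.map_eq]
    exact h2.aestronglyMeasurable
  rw [e1, ← hm.map_eq, integral_map hm.measurable.aemeasurable hs, integral_prod _ h3]
  simp only [integral_cplx]
  rw [integral_mul_const, integral_complex_ofReal]

theorem cG_zero : cG 0 = 1 := by
  have h : ∀ g : Fin 0 → Cn 0, klainInt (stdFrame 0) g = 1 := fun g => by
    simp [klainInt, detC]
  rw [cG]
  simp only [h, integral_const, probReal_univ, one_smul]

theorem integrable_norm_pow_stdGaussian (m k : ℕ) :
    Integrable (fun x : Rn m => ‖x‖ ^ (k + 1)) (stdGaussian (Rn m)) :=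
  (IsGaussian.memLp_id (stdGaussian (Rn m)) ((k + 1 : ℕ) : ℝ≥0∞)
      (ENNReal.natCast_ne_top _)).integrable_norm_pow (by omega)

theorem integral_norm_sq_stdGaussian (m : ℕ) :
    ∫ x : Rn m, ‖x‖ ^ 2 ∂stdGaussian (Rn m) = m := by
  simp only [EuclideanSpace.real_norm_sq_eq]
  simp only [sq]
  rw [integral_finsetSum _ fun k _ => integrable_coord_mul k k]
  simp only [integral_coord_mul, if_true, Finset.sum_const, Finset.card_univ, Fintype.card_fin,
    nsmul_eq_mul, mul_one]

theorem not_ae_norm_le_one : ¬ ∀ᵐ x ∂stdGaussian (Rn (n + 1)), ‖x‖ ≤ 1 := by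
  intro h
  have h1 : stdGaussian (Rn (n + 1)) ((fun x : Rn (n + 1) => x 0) ⁻¹' Set.Ioi 1) = 0 := by
    refine measure_mono_null (t := {x | ¬ ‖x‖ ≤ 1}) (fun x hx => ?_) (ae_iff.mp h)
    refine fun hle => absurd ((le_abs_self _).trans ((PiLp.norm_apply_le x 0).trans hle)) (not_le.mpr hx)
  have hp : MeasurePreserving (fun x : Rn (n + 1) => x 0) (stdGaussian (Rn (n + 1)))
      (gaussianReal 0 1) :=
    (measurePreserving_eval (fun _ : Fin (n + 1) => gaussianReal 0 1) 0).comp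
      measurePreserving_ofLp_stdGaussian
  rw [hp.measure_preimage measurableSet_Ioi.nullMeasurableSet] at h1
  have h2 := gaussianReal_absolutelyContinuous' 0 one_ne_zero h1
  simp at h2

theorem integral_norm_cube_sub_pos :
    0 < ∫ x : Rn (n + 1), (‖x‖ ^ 3 - ‖x‖) ∂stdGaussian (Rn (n + 1)) := by
  have i1 : Integrable (fun x : Rn (n + 1) => ‖x‖) (stdGaussian _) := by
    simpa using integrable_norm_pow_stdGaussian (n + 1) 0
  have i2 : Integrable (fun x : Rn (n + 1) => ‖x‖ ^ 2) (stdGaussian _) :=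
    integrable_norm_pow_stdGaussian (n + 1) 1
  have i3 : Integrable (fun x : Rn (n + 1) => ‖x‖ ^ 3) (stdGaussian _) :=
    integrable_norm_pow_stdGaussian (n + 1) 2
  have hf : ∀ x : Rn (n + 1), ‖x‖ ^ 3 - ‖x‖ =
      (‖x‖ - 1) ^ 2 * (‖x‖ + 1) + (‖x‖ ^ 2 - 1) := fun x => by ring
  have hn : ∀ x : Rn (n + 1), 0 ≤ (‖x‖ - 1) ^ 2 * (‖x‖ + 1) := fun x => by positivity
  have i4 : Integrable (fun x : Rn (n + 1) => (‖x‖ - 1) ^ 2 * (‖x‖ + 1)) (stdGaussian _) := by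
    have h := (i3.sub i1).sub (i2.sub (integrable_const 1))
    refine h.congr (Filter.Eventually.of_forall fun x => ?_)
    simp only [Pi.sub_apply]
    ring
  simp only [hf]
  rw [integral_add (f := fun x : Rn (n + 1) => (‖x‖ - 1) ^ 2 * (‖x‖ + 1))
    (g := fun x : Rn (n + 1) => ‖x‖ ^ 2 - 1) i4 (i2.sub (integrable_const 1)),
    integral_sub i2 (integrable_const 1), integral_norm_sq_stdGaussian, integral_const,
    probReal_univ, one_smul]
  have hpos : 0 < ∫ x : Rn (n + 1), (‖x‖ - 1) ^ 2 * (‖x‖ + 1) ∂stdGaussian (Rn (n + 1)) := by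
    refine (integral_nonneg hn).lt_of_ne fun h0 => not_ae_norm_le_one (n := n) ?_
    filter_upwards [(integral_eq_zero_iff_of_nonneg hn i4).mp h0.symm] with x hx
    have h := mul_eq_zero.mp hx
    rcases h with h | h
    · linarith [pow_eq_zero_iff (two_ne_zero) |>.mp h]
    · linarith [norm_nonneg x]
  push_cast
  have : (0 : ℝ) ≤ n := Nat.cast_nonneg n
  linarith

theorem cG_ne_zero (n : ℕ) : cG n ≠ 0 := by
  induction n with
  | zero => rw [cG_zero]; exact one_ne_zero
  | succ n ih =>
    rw [cG_succ]
    exact mul_ne_zero (Complex.ofReal_ne_zero.mpr integral_norm_cube_sub_pos.ne') ih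

end nonvanishing

section normalization
variable {n : ℕ}

/-- The multiple of `phiRaw` whose Klain function is exactly `Θ²`. -/
def phiTwo (K : ConvexBody (Cn n)) : ℂ := (cG n * hausdorffRatio n)⁻¹ * phiRaw K

theorem hasWeight_phiTwo : HasWeight 2 (phiTwo (n := n)) := fun g hg K L h => by
  rw [phiTwo, phiTwo, hasWeight_phiRaw g hg K L h, mul_left_comm]

theorem suInvariant_phiTwo : SUInvariant (phiTwo (n := n)) := fun g hg K L h => by
  obtain ⟨hu, hd⟩ := Matrix.mem_specialUnitaryGroup_iff.mp hg
  rw [hasWeight_phiTwo g hu K L h, hd, one_zpow, one_mul]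

theorem klainTheta2_phiTwo : KlainTheta2 (phiTwo (n := n)) := by
  intro W _ w hw K hK
  have hc : cG n * hausdorffRatio n ≠ 0 := by
    refine mul_ne_zero (cG_ne_zero n) ?_
    exact_mod_cast Measure.addHaarScalarFactor_volume_hausdorffMeasure_ne_zero n
  rw [phiTwo, phiRaw_klain hw.2.2 (by rwa [hw.2.1]), inv_mul_cancel_left₀ hc]

theorem phiTwo_spec : (IsValuation (phiTwo (n := n)) ∧ Continuous (phiTwo (n := n)) ∧
    TranslationInvariant (phiTwo (n := n)) ∧ SUInvariant (phiTwo (n := n)) ∧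
    Homogeneous n (phiTwo (n := n)) ∧ KlainTheta2 (phiTwo (n := n))) := by
  refine ⟨fun K L U I hU hI => ?_, continuous_const.mul continuous_phiRaw, fun x K L h => ?_,
    suInvariant_phiTwo, fun t ht K L h => ?_, klainTheta2_phiTwo⟩
  · simp only [phiTwo, ← mul_add, isValuation_phiRaw K L U I hU hI]
  · rw [phiTwo, phiTwo, translationInvariant_phiRaw x K L h]
  · rw [phiTwo, phiTwo, homogeneous_phiRaw t ht K L h, mul_left_comm]

end normalization

end development

/-- There is a unique continuous, translation invariant, `SU(n)`-invariant valuation `φ₂`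
on `ℂⁿ`, homogeneous of degree `n`, whose Klain function is `Θ²`; moreover `φ₂` has
weight `2`, i.e. `φ₂ (g K) = (det g)² φ₂ K` for all `g ∈ U(n)`. -/
theorem exists_unique_phi2 (n : ℕ) (hn : 2 ≤ n) :
    ∃ φ₂ : ConvexBody (Cn n) → ℂ,
      ((IsValuation φ₂ ∧ Continuous φ₂ ∧ TranslationInvariant φ₂ ∧ SUInvariant φ₂ ∧
          Homogeneous n φ₂ ∧ KlainTheta2 φ₂) ∧
        HasWeight 2 φ₂) ∧
      ∀ ψ : ConvexBody (Cn n) → ℂ,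
        (IsValuation ψ ∧ Continuous ψ ∧ TranslationInvariant ψ ∧ SUInvariant ψ ∧
          Homogeneous n ψ ∧ KlainTheta2 ψ) → ψ = φ₂ :=
  ⟨phiTwo, ⟨phiTwo_spec, hasWeight_phiTwo⟩, fun _ hψ => eq_of_klain hn hψ phiTwo_spec⟩

end
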